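/- Let n ∈ {5, 6}. For x = (x₀, …, x_{n−1}) ∈ (ℝ²)ⁿ let Ω(x) denote the interior of the convex hull of {x₀, …, x_{n−1}}, and when Ω(x) is nonempty set F(x) = λ₁(Ω(x)) · vol(Ω(x)), where vol is two-dimensional Lebesgue measure. Let a* ∈ (ℝ²)ⁿ be the vertex vector of the regular n-gon inscribed in the unit circle, a*_k = (cos(2πk/n), sin(2πk/n)) for k = 0, …, n−1. Then a* is a local minimizer of F: there exists ε > 0 such that every x ∈ (ℝ²)ⁿ with ‖x − a*‖ < ε (so that Ω(x) is a nonempty bounded open set) satisfies F(a*) ≤ F(x). -/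

import Mathlib

open MeasureTheory

/-- The first Dirichlet eigenvalue of an open set `Ω ⊆ ℝ²`, defined as the infimum of the
Rayleigh quotients of nonzero smooth compactly supported test functions supported in `Ω`. -/
noncomputable def firstDirichletEigenvalue (Ω : Set (EuclideanSpace ℝ (Fin 2))) : ℝ :=
  sInf { R : ℝ | ∃ u : EuclideanSpace ℝ (Fin 2) → ℝ,
    ContDiff ℝ (⊤ : ℕ∞) u ∧ HasCompactSupport u ∧ tsupport u ⊆ Ω ∧ u ≠ 0 ∧
    R = (∫ x in Ω, ‖fderiv ℝ u x‖ ^ 2) / (∫ x in Ω, u x ^ 2) }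

/-- The scale invariant Pólya–Szegő functional `F(x) = λ₁(Ω(x)) · |Ω(x)|`, where `Ω(x)` is
the interior of the convex hull of the points `x₀, …, x_{n−1}`. -/
noncomputable def polyaFunctional {n : ℕ} (x : Fin n → EuclideanSpace ℝ (Fin 2)) : ℝ :=
  firstDirichletEigenvalue (interior (convexHull ℝ (Set.range x))) *
    (volume (interior (convexHull ℝ (Set.range x)))).toReal

/-- The reference triangle. -/
def refTri : Set (ℝ × ℝ) := {p | |p.2| ≤ p.1 ∧ p.1 ≤ 1}

lemma isCompact_refTri : IsCompact refTri := by
  have hc : IsClosed refTri := by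
    have h1 : IsClosed {p : ℝ × ℝ | |p.2| ≤ p.1} := isClosed_le (by fun_prop) (by fun_prop)
    have h2 : IsClosed {p : ℝ × ℝ | p.1 ≤ 1} := isClosed_le (by fun_prop) (by fun_prop)
    exact h1.inter h2
  refine (isCompact_Icc (a := ((0:ℝ), (-1:ℝ))) (b := (1, 1))).of_isClosed_subset hc ?_
  rintro ⟨x, y⟩ ⟨h1, h2⟩
  simp only at h1 h2
  have := abs_le.1 h1
  have h0 := abs_nonneg y
  constructor <;> constructor <;> simp only <;> linarith

lemma measurableSet_refTri : MeasurableSet refTri := isCompact_refTri.measurableSet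

/-- Integral over the reference triangle. -/
noncomputable def triInt (f : ℝ × ℝ → ℝ) : ℝ := ∫ p in refTri, f p

lemma integrable_tri {f : ℝ × ℝ → ℝ} (hf : Continuous f) : IntegrableOn f refTri :=
  hf.continuousOn.integrableOn_compact isCompact_refTri

lemma triInt_add {f g : ℝ × ℝ → ℝ} (hf : Continuous f) (hg : Continuous g) :
    triInt (fun p => f p + g p) = triInt f + triInt g :=
  integral_add (integrable_tri hf) (integrable_tri hg)

lemma triInt_const_mul (c : ℝ) (f : ℝ × ℝ → ℝ) :
    triInt (fun p => c * f p) = c * triInt f := integral_const_mul c f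

lemma triInt_sum {ι : Type*} (s : Finset ι) {f : ι → ℝ × ℝ → ℝ} (hf : ∀ i, Continuous (f i)) :
    triInt (fun p => ∑ i ∈ s, f i p) = ∑ i ∈ s, triInt (f i) :=
  integral_finsetSum s fun i _ => integrable_tri (hf i)

lemma triInt_nonneg {f : ℝ × ℝ → ℝ} (h : ∀ p ∈ refTri, 0 ≤ f p) : 0 ≤ triInt f :=
  setIntegral_nonneg measurableSet_refTri h

lemma triInt_mono {f g : ℝ × ℝ → ℝ} (hf : Continuous f) (hg : Continuous g)
    (h : ∀ p ∈ refTri, f p ≤ g p) : triInt f ≤ triInt g :=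
  setIntegral_mono_on (integrable_tri hf) (integrable_tri hg) measurableSet_refTri h

lemma triInt_eq_iterated {f : ℝ × ℝ → ℝ} (hf : Continuous f) :
    triInt f = ∫ x in (0:ℝ)..1, ∫ s in (-1:ℝ)..1, x * f (x, x * s) := by
  have h1 : triInt f = ∫ x : ℝ, ∫ y : ℝ, refTri.indicator f (x, y) := by
    unfold triInt
    rw [← integral_indicator measurableSet_refTri]
    rw [Measure.volume_eq_prod, integral_prod]
    rw [← Measure.volume_eq_prod, integrable_indicator_iff measurableSet_refTri]
    exact integrable_tri hf
  rw [h1, intervalIntegral.integral_of_le zero_le_one, ← integral_Icc_eq_integral_Ioc,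
    ← integral_indicator measurableSet_Icc]
  congr 1
  ext x
  by_cases hx : x ∈ Set.Icc (0:ℝ) 1
  · rw [Set.indicator_of_mem hx]
    have h2 : (fun y => refTri.indicator f (x, y)) =
        (Set.Icc (-x) x).indicator (fun y => f (x, y)) := by
      ext y
      have : (x, y) ∈ refTri ↔ y ∈ Set.Icc (-x) x := by
        simp only [refTri, Set.mem_ofPred_eq, Set.mem_Icc, abs_le]
        exact ⟨fun h => h.1, fun h => ⟨h, hx.2⟩⟩
      by_cases hy : y ∈ Set.Icc (-x) x
      · rw [Set.indicator_of_mem hy, Set.indicator_of_mem (this.2 hy)]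
      · rw [Set.indicator_of_notMem hy, Set.indicator_of_notMem (fun h => hy (this.1 h))]
    rw [h2, integral_indicator measurableSet_Icc, integral_Icc_eq_integral_Ioc,
      ← intervalIntegral.integral_of_le (by linarith [hx.1]), intervalIntegral.integral_const_mul]
    have := intervalIntegral.mul_integral_comp_mul_left (f := fun y => f (x, y)) (c := x)
      (a := -1) (b := 1)
    rw [this]
    simp
  · rw [Set.indicator_of_notMem hx]
    have h2 : (fun y => refTri.indicator f (x, y)) = fun _ => 0 := by
      ext y
      apply Set.indicator_of_notMem
      rintro ⟨h3, h4⟩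
      exact hx ⟨(abs_nonneg y).trans h3, h4⟩
    rw [h2]; simp

lemma triInt_monomial (i j : ℕ) :
    triInt (fun p => p.1 ^ i * p.2 ^ j) =
      ((if j % 2 = 0 then (2:ℝ) / (((j:ℝ) + 1) * ((i:ℝ) + j + 2)) else 0) : ℝ) := by
  rw [triInt_eq_iterated (by fun_prop)]
  have h : ∀ x s : ℝ, x * (x ^ i * (x * s) ^ j) = x ^ (i + j + 1) * s ^ j := by
    intro x s; rw [mul_pow]; ring
  simp only [h, intervalIntegral.integral_const_mul, intervalIntegral.integral_mul_const,
    integral_pow]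
  split_ifs with hj
  · have hodd : Odd (j + 1) := by
      rw [Nat.odd_iff]; omega
    rw [hodd.neg_one_pow]
    push_cast
    have : (j:ℝ) + 1 ≠ 0 := by positivity
    have : (i:ℝ) + j + 2 ≠ 0 := by positivity
    have : (i:ℝ) + j + 1 + 1 ≠ 0 := by positivity
    simp
    field_simp
    ring
  · have hev : Even (j + 1) := by
      rw [Nat.even_iff]; omega
    rw [hev.neg_one_pow]; simp

lemma triInt_comp_neg {f : ℝ × ℝ → ℝ} (hf : Continuous f) :
    triInt (fun p => f (p.1, -p.2)) = triInt f := by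
  rw [triInt_eq_iterated hf, triInt_eq_iterated (by fun_prop)]
  congr 1; ext x
  have := intervalIntegral.integral_comp_neg (a := -1) (b := 1) (f := fun s => x * f (x, x * s))
  simp only [neg_neg] at this
  rw [← this]
  congr 1; ext s; simp

/-- Partial derivatives. -/
noncomputable def pdx (f : ℝ × ℝ → ℝ) (p : ℝ × ℝ) : ℝ := fderiv ℝ f p (1, 0)
noncomputable def pdy (f : ℝ × ℝ → ℝ) (p : ℝ × ℝ) : ℝ := fderiv ℝ f p (0, 1)

lemma continuous_pdx {f : ℝ × ℝ → ℝ} (hf : ContDiff ℝ 1 f) : Continuous (pdx f) := by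
  have := hf.continuous_fderiv one_ne_zero
  unfold pdx; fun_prop
lemma continuous_pdy {f : ℝ × ℝ → ℝ} (hf : ContDiff ℝ 1 f) : Continuous (pdy f) := by
  have := hf.continuous_fderiv one_ne_zero
  unfold pdy; fun_prop

lemma fderiv_eq_pd (f : ℝ × ℝ → ℝ) (p v : ℝ × ℝ) :
    fderiv ℝ f p v = v.1 * pdx f p + v.2 * pdy f p := by
  have : v = v.1 • ((1:ℝ), (0:ℝ)) + v.2 • ((0:ℝ), (1:ℝ)) := by ext <;> simp
  conv_lhs => rw [this, map_add, map_smul, map_smul]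
  rfl

lemma hasDerivAt_curve {f : ℝ × ℝ → ℝ} (hf : ContDiff ℝ 1 f) {c : ℝ → ℝ × ℝ} {c' : ℝ × ℝ} {t : ℝ}
    (hc : HasDerivAt c c' t) :
    HasDerivAt (fun t => f (c t)) (c'.1 * pdx f (c t) + c'.2 * pdy f (c t)) t := by
  rw [← fderiv_eq_pd]
  exact ((hf.differentiable one_ne_zero _).hasFDerivAt).comp_hasDerivAt t hc

/-- Green's formula on the reference triangle. -/
lemma triInt_green {g h : ℝ × ℝ → ℝ} (hg : ContDiff ℝ 1 g) (hh : ContDiff ℝ 1 h)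
    (h1 : ∀ y ∈ Set.Icc (-1:ℝ) 1, g (1, y) = 0) :
    triInt (fun p => pdx g p + pdy h p) =
      (∫ t in (0:ℝ)..1, (h (t, t) - g (t, t))) - ∫ t in (0:ℝ)..1, (h (t, -t) + g (t, -t)) := by
  have cgx := continuous_pdx hg
  have cgy := continuous_pdy hg
  have chx := continuous_pdx hh
  have chy := continuous_pdy hh
  have cg := hg.continuous
  have ch := hh.continuous
  rw [triInt_eq_iterated (by fun_prop)]
  -- the Piola transform to the box
  set F : ℝ × ℝ → ℝ := fun q => q.1 * g (q.1, q.1 * q.2) with hF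
  set G : ℝ × ℝ → ℝ := fun q => h (q.1, q.1 * q.2) - q.2 * g (q.1, q.1 * q.2) with hG
  have hmap : ContDiff ℝ 1 (fun q : ℝ × ℝ => (q.1, q.1 * q.2)) := by fun_prop
  have hFd : ContDiff ℝ 1 F := contDiff_fst.mul (hg.comp hmap)
  have hGd : ContDiff ℝ 1 G := (hh.comp hmap).sub (contDiff_snd.mul (hg.comp hmap))
  have key : ∀ q : ℝ × ℝ, pdx F q + pdy G q =
      q.1 * (pdx g (q.1, q.1 * q.2) + pdy h (q.1, q.1 * q.2)) := by
    intro q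
    have e1 : pdx F q = 1 * g (q.1, q.1 * q.2) +
        q.1 * (1 * pdx g (q.1, q.1 * q.2) + q.2 * pdy g (q.1, q.1 * q.2)) := by
      have a1 : HasDerivAt (fun t : ℝ => (t, t * q.2)) (1, q.2) q.1 := by
        have := (hasDerivAt_id q.1).mul_const q.2
        simp only [one_mul] at this
        exact (hasDerivAt_id q.1).prodMk this
      have a2 := (hasDerivAt_id q.1).mul (hasDerivAt_curve hg a1)
      have a3 : HasDerivAt (fun t : ℝ => (t, q.2)) (1, 0) q.1 :=
        (hasDerivAt_id q.1).prodMk (hasDerivAt_const _ _)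
      have a4 := hasDerivAt_curve hFd a3
      simp only [one_mul, zero_mul, add_zero] at a4
      have := a4.unique a2
      simpa using this
    have e2 : pdy G q = q.1 * pdy h (q.1, q.1 * q.2) -
        (1 * g (q.1, q.1 * q.2) + q.2 * (q.1 * pdy g (q.1, q.1 * q.2))) := by
      have a1 : HasDerivAt (fun t : ℝ => (q.1, q.1 * t)) (0, q.1) q.2 := by
        have := (hasDerivAt_id q.2).const_mul q.1
        simp only [mul_one] at this
        exact (hasDerivAt_const _ _).prodMk this
      have a2 := (hasDerivAt_curve hh a1).sub ((hasDerivAt_id q.2).mul (hasDerivAt_curve hg a1))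
      have a3 : HasDerivAt (fun t : ℝ => (q.1, t)) (0, 1) q.2 :=
        (hasDerivAt_const _ _).prodMk (hasDerivAt_id q.2)
      have a4 := hasDerivAt_curve hGd a3
      simp only [one_mul, zero_mul, zero_add] at a4
      have := a4.unique a2
      simpa using this
    rw [e1, e2]; ring
  have hdiv := integral2_divergence_prod_of_hasFDerivAt_off_countable F G (fderiv ℝ F) (fderiv ℝ G)
    0 (-1) 1 1 ∅ Set.countable_empty hFd.continuous.continuousOn hGd.continuous.continuousOn
    (fun x _ => (hFd.differentiable one_ne_zero x).hasFDerivAt)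
    (fun x _ => (hGd.differentiable one_ne_zero x).hasFDerivAt) (by
      have c1 := continuous_pdx hFd
      have c2 := continuous_pdy hGd
      have : Continuous (fun q => pdx F q + pdy G q) := by fun_prop
      exact this.continuousOn.integrableOn_compact (isCompact_uIcc.prod isCompact_uIcc))
  have hl : (∫ x in (0:ℝ)..1, ∫ s in (-1:ℝ)..1, x * (pdx g (x, x * s) + pdy h (x, x * s))) =
      ∫ x in (0:ℝ)..1, ∫ y in (-1:ℝ)..1, fderiv ℝ F (x, y) (1, 0) + fderiv ℝ G (x, y) (0, 1) := by
    congr 1; ext x; congr 1; ext s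
    exact (key (x, s)).symm
  rw [hl, hdiv]
  have b1 : ∫ y in (-1:ℝ)..1, F (1, y) = 0 := by
    rw [intervalIntegral.integral_congr (g := fun _ => 0)]
    · simp
    · intro y hy
      rw [Set.uIcc_of_le (by norm_num)] at hy
      simp [hF, h1 y hy]
  have b2 : ∫ y in (-1:ℝ)..1, F (0, y) = 0 := by simp [hF]
  rw [b1, b2]
  simp [hG]

/-- Tuples of `C¹` functions on copies of the reference triangle that match along the
interfaces and vanish on the outer edge. -/
def Tup (n : ℕ) [NeZero n] : Submodule ℝ (Fin n → ℝ × ℝ → ℝ) where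
  carrier := {W | (∀ k, ContDiff ℝ 1 (W k)) ∧
    (∀ k, ∀ t ∈ Set.Icc (0:ℝ) 1, W k (t, t) = W (k + 1) (t, -t)) ∧
    ∀ k, ∀ y ∈ Set.Icc (-1:ℝ) 1, W k (1, y) = 0}
  add_mem' := by
    rintro V W ⟨h1, h2, h3⟩ ⟨k1, k2, k3⟩
    refine ⟨fun k => (h1 k).add (k1 k), fun k t ht => ?_, fun k y hy => ?_⟩
    · simp [h2 k t ht, k2 k t ht]
    · simp [h3 k y hy, k3 k y hy]
  zero_mem' := ⟨fun k => contDiff_const, fun k t ht => rfl, fun k y hy => rfl⟩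
  smul_mem' := by
    rintro c V ⟨h1, h2, h3⟩
    refine ⟨fun k => (h1 k).const_smul c, fun k t ht => ?_, fun k y hy => ?_⟩
    · simp [h2 k t ht]
    · simp [h3 k y hy]

section forms
variable {n : ℕ} [NeZero n]

lemma tup_contDiff (W : Tup n) (k : Fin n) : ContDiff ℝ 1 (W.1 k) := W.2.1 k
lemma tup_continuous (W : Tup n) (k : Fin n) : Continuous (W.1 k) := (tup_contDiff W k).continuous
lemma tup_continuous_pdx (W : Tup n) (k : Fin n) : Continuous (pdx (W.1 k)) :=
  continuous_pdx (tup_contDiff W k)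
lemma tup_continuous_pdy (W : Tup n) (k : Fin n) : Continuous (pdy (W.1 k)) :=
  continuous_pdy (tup_contDiff W k)

lemma pdx_add {f g : ℝ × ℝ → ℝ} (hf : ContDiff ℝ 1 f) (hg : ContDiff ℝ 1 g) (p : ℝ × ℝ) :
    pdx (f + g) p = pdx f p + pdx g p := by
  unfold pdx
  rw [fderiv_add (hf.differentiable one_ne_zero p) (hg.differentiable one_ne_zero p)]; rfl
lemma pdy_add {f g : ℝ × ℝ → ℝ} (hf : ContDiff ℝ 1 f) (hg : ContDiff ℝ 1 g) (p : ℝ × ℝ) :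
    pdy (f + g) p = pdy f p + pdy g p := by
  unfold pdy
  rw [fderiv_add (hf.differentiable one_ne_zero p) (hg.differentiable one_ne_zero p)]; rfl
lemma pdx_smul {f : ℝ × ℝ → ℝ} (c : ℝ) (p : ℝ × ℝ) :
    pdx (c • f) p = c * pdx f p := by
  unfold pdx; rw [fderiv_const_smul_field]; rfl
lemma pdy_smul {f : ℝ × ℝ → ℝ} (c : ℝ) (p : ℝ × ℝ) :
    pdy (c • f) p = c * pdy f p := by
  unfold pdy; rw [fderiv_const_smul_field]; rfl

/-- Integrand of a quadratic form with coefficients `c`. -/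
noncomputable def frmD (c : Fin 4 → ℝ) (v w : ℝ × ℝ → ℝ) (p : ℝ × ℝ) : ℝ :=
  c 0 * (pdx v p * pdx w p) + c 1 * (pdx v p * pdy w p + pdy v p * pdx w p) +
    c 2 * (pdy v p * pdy w p) + c 3 * (v p * w p)

lemma continuous_frmD (c : Fin 4 → ℝ) (V W : Tup n) (k : Fin n) :
    Continuous (frmD c (V.1 k) (W.1 k)) := by
  have := tup_continuous V k; have := tup_continuous_pdx V k; have := tup_continuous_pdy V k
  have := tup_continuous W k; have := tup_continuous_pdx W k; have := tup_continuous_pdy W k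
  unfold frmD; fun_prop

/-- The bilinear form on tuples with (piecewise constant) coefficients `C`. -/
noncomputable def frm (C : Fin n → Fin 4 → ℝ) : LinearMap.BilinForm ℝ (Tup n) :=
  LinearMap.mk₂ ℝ (fun V W => ∑ k, triInt (frmD (C k) (V.1 k) (W.1 k)))
    (by
      intro V V' W
      rw [← Finset.sum_add_distrib]
      refine Finset.sum_congr rfl fun k _ => ?_
      rw [← triInt_add (continuous_frmD _ _ _ _) (continuous_frmD _ _ _ _)]
      congr 1; ext p
      simp only [frmD, Submodule.coe_add, Pi.add_apply, pdx_add (tup_contDiff V k) (tup_contDiff V' k),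
        pdy_add (tup_contDiff V k) (tup_contDiff V' k)]
      ring)
    (by
      intro c V W
      rw [smul_eq_mul, Finset.mul_sum]
      refine Finset.sum_congr rfl fun k _ => ?_
      rw [← triInt_const_mul]
      congr 1; ext p
      simp only [frmD, Submodule.coe_smul, Pi.smul_apply, pdx_smul, pdy_smul, smul_eq_mul]
      ring)
    (by
      intro W V V'
      rw [← Finset.sum_add_distrib]
      refine Finset.sum_congr rfl fun k _ => ?_
      rw [← triInt_add (continuous_frmD _ _ _ _) (continuous_frmD _ _ _ _)]
      congr 1; ext p
      simp only [frmD, Submodule.coe_add, Pi.add_apply, pdx_add (tup_contDiff V k) (tup_contDiff V' k),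
        pdy_add (tup_contDiff V k) (tup_contDiff V' k)]
      ring)
    (by
      intro c W V
      rw [smul_eq_mul, Finset.mul_sum]
      refine Finset.sum_congr rfl fun k _ => ?_
      rw [← triInt_const_mul]
      congr 1; ext p
      simp only [frmD, Submodule.coe_smul, Pi.smul_apply, pdx_smul, pdy_smul, smul_eq_mul]
      ring)

lemma frm_apply (C : Fin n → Fin 4 → ℝ) (V W : Tup n) :
    frm C V W = ∑ k, triInt (frmD (C k) (V.1 k) (W.1 k)) := rfl

lemma frm_add (C D : Fin n → Fin 4 → ℝ) : frm (C + D) = frm C + frm D := by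
  ext V W
  simp only [frm_apply, LinearMap.add_apply]
  rw [← Finset.sum_add_distrib]
  refine Finset.sum_congr rfl fun k _ => ?_
  rw [← triInt_add (continuous_frmD _ _ _ _) (continuous_frmD _ _ _ _)]
  congr 1; ext p
  simp only [frmD, Pi.add_apply]; ring

lemma frm_smul (c : ℝ) (C : Fin n → Fin 4 → ℝ) : frm (c • C) = c • frm C := by
  ext V W
  simp only [frm_apply, LinearMap.smul_apply, smul_eq_mul]
  rw [Finset.mul_sum]
  refine Finset.sum_congr rfl fun k _ => ?_
  rw [← triInt_const_mul]
  congr 1; ext p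
  simp only [frmD, Pi.smul_apply, smul_eq_mul]; ring

lemma frm_symm (C : Fin n → Fin 4 → ℝ) (V W : Tup n) : frm C V W = frm C W V := by
  simp only [frm_apply]
  refine Finset.sum_congr rfl fun k _ => ?_
  congr 1; ext p
  simp only [frmD]; ring

lemma frm_nonneg {C : Fin n → Fin 4 → ℝ}
    (h : ∀ k, ∀ x y z : ℝ, 0 ≤ C k 0 * x ^ 2 + 2 * C k 1 * (x * y) + C k 2 * y ^ 2 + C k 3 * z ^ 2)
    (W : Tup n) : 0 ≤ frm C W W := by
  rw [frm_apply]
  refine Finset.sum_nonneg fun k _ => triInt_nonneg fun p _ => ?_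
  have := h k (pdx (W.1 k) p) (pdy (W.1 k) p) (W.1 k p)
  unfold frmD; nlinarith

/-- Admissible fluxes: the normal components match along the interfaces. -/
def IsFlux (g h : Fin n → ℝ × ℝ → ℝ) : Prop :=
  (∀ k, ContDiff ℝ 1 (g k)) ∧ (∀ k, ContDiff ℝ 1 (h k)) ∧
    ∀ k, ∀ t ∈ Set.Icc (0:ℝ) 1, h k (t, t) - g k (t, t) = h (k + 1) (t, -t) + g (k + 1) (t, -t)

lemma pdx_mul {f g : ℝ × ℝ → ℝ} (hf : ContDiff ℝ 1 f) (hg : ContDiff ℝ 1 g) (p : ℝ × ℝ) :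
    pdx (fun p => f p * g p) p = f p * pdx g p + g p * pdx f p := by
  unfold pdx
  have := fderiv_fun_mul (hf.differentiable one_ne_zero p) (hg.differentiable one_ne_zero p)
  rw [this]; rfl
lemma pdy_mul {f g : ℝ × ℝ → ℝ} (hf : ContDiff ℝ 1 f) (hg : ContDiff ℝ 1 g) (p : ℝ × ℝ) :
    pdy (fun p => f p * g p) p = f p * pdy g p + g p * pdy f p := by
  unfold pdy
  have := fderiv_fun_mul (hf.differentiable one_ne_zero p) (hg.differentiable one_ne_zero p)
  rw [this]; rfl

lemma IsFlux.sum_eq_zero {g h : Fin n → ℝ × ℝ → ℝ} (hF : IsFlux g h) (W : Tup n) :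
    ∑ k, triInt (fun p => g k p * pdx (W.1 k) p + h k p * pdy (W.1 k) p +
      (pdx (g k) p + pdy (h k) p) * W.1 k p) = 0 := by
  obtain ⟨hg, hh, hi⟩ := hF
  obtain ⟨hW, hWi, hW1⟩ := W.2
  have e : ∀ k, triInt (fun p => g k p * pdx (W.1 k) p + h k p * pdy (W.1 k) p +
      (pdx (g k) p + pdy (h k) p) * W.1 k p) =
      (∫ t in (0:ℝ)..1, (h k (t, t) - g k (t, t)) * W.1 k (t, t)) -
      ∫ t in (0:ℝ)..1, (h k (t, -t) + g k (t, -t)) * W.1 k (t, -t) := by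
    intro k
    have := triInt_green ((hg k).mul (hW k)) ((hh k).mul (hW k)) (by
      intro y hy; simp [hW1 k y hy])
    have this : triInt (fun p => pdx (g k * W.1 k) p + pdy (h k * W.1 k) p) = (∫ t in (0:ℝ)..1, (h k (t, t) * W.1 k (t, t) - g k (t, t) * W.1 k (t, t))) - ∫ t in (0:ℝ)..1, (h k (t, -t) * W.1 k (t, -t) + g k (t, -t) * W.1 k (t, -t)) := this
    rw [show (∫ t in (0:ℝ)..1, (h k (t, t) - g k (t, t)) * W.1 k (t, t)) =
      ∫ t in (0:ℝ)..1, (h k (t, t) * W.1 k (t, t) - g k (t, t) * W.1 k (t, t)) by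
        congr 1; ext t; ring]
    rw [show (∫ t in (0:ℝ)..1, (h k (t, -t) + g k (t, -t)) * W.1 k (t, -t)) =
      ∫ t in (0:ℝ)..1, (h k (t, -t) * W.1 k (t, -t) + g k (t, -t) * W.1 k (t, -t)) by
        congr 1; ext t; ring]
    rw [← this]
    congr 1; ext p
    have e1 := pdx_mul (hg k) (hW k) p
    have e2 := pdy_mul (hh k) (hW k) p
    have e1' : pdx (g k * W.1 k) p = g k p * pdx (W.1 k) p + W.1 k p * pdx (g k) p := e1
    have e2' : pdy (h k * W.1 k) p = h k p * pdy (W.1 k) p + W.1 k p * pdy (h k) p := e2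
    rw [e1', e2']; ring
  simp only [e, Finset.sum_sub_distrib]
  rw [sub_eq_zero, ← Equiv.sum_comp (Equiv.addRight (1 : Fin n))
    (fun k => ∫ t in (0:ℝ)..1, (h k (t, -t) + g k (t, -t)) * W.1 k (t, -t))]
  refine Finset.sum_congr rfl fun k _ => ?_
  refine intervalIntegral.integral_congr fun t ht => ?_
  rw [Set.uIcc_of_le zero_le_one] at ht
  simp only [Equiv.coe_addRight]
  rw [hi k t ht, hWi k t ht]

end forms

section spectral
variable {V : Type*} [AddCommGroup V] [Module ℝ V]

lemma form_young {B : LinearMap.BilinForm ℝ V} (hs : ∀ u v, B u v = B v u) (hB : ∀ v, 0 ≤ B v v)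
    (u v : V) {t : ℝ} (ht : 0 < t) : 2 * B u v ≤ t * B u u + t⁻¹ * B v v := by
  have h := hB (t • u - v)
  simp only [map_sub, LinearMap.sub_apply, map_smul, LinearMap.smul_apply, smul_eq_mul, hs v u] at h
  have h2 : t⁻¹ * (t * (t * B u u) - t * B u v - (t * B u v - B v v)) =
      t * B u u + t⁻¹ * B v v - 2 * B u v := by
    field_simp; ring
  have h3 : 0 ≤ t⁻¹ * (t * (t * B u u) - t * B u v - (t * B u v - B v v)) := by
    exact mul_nonneg (inv_nonneg.2 ht.le) (by linarith)
  linarith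

lemma form_young' {B : LinearMap.BilinForm ℝ V} (hs : ∀ u v, B u v = B v u) (hB : ∀ v, 0 ≤ B v v)
    (u v : V) {t : ℝ} (ht : 0 < t) : -(t * B u u + t⁻¹ * B v v) ≤ 2 * B u v := by
  have := form_young hs hB (-u) v ht
  simp only [map_neg, LinearMap.neg_apply, neg_neg] at this
  linarith

lemma form_cauchy {B : LinearMap.BilinForm ℝ V} (hs : ∀ u v, B u v = B v u) (hB : ∀ v, 0 ≤ B v v)
    (u v : V) : B u v ^ 2 ≤ B u u * B v v := by
  have h : ∀ t : ℝ, 0 ≤ B u u * (t * t) + (2 * B u v) * t + B v v := by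
    intro t
    have h := hB (t • u + v)
    simp only [map_add, LinearMap.add_apply, map_smul, LinearMap.smul_apply, smul_eq_mul,
      hs v u] at h
    nlinarith
  have := discrim_le_zero h
  unfold discrim at this
  nlinarith

/-- Spectral data: `l` is the bottom of the spectrum of `Q` relative to `N`, and there is only
a one-dimensional space of states below `L`. -/
structure SpecGap (Q N : LinearMap.BilinForm ℝ V) (l L : ℝ) : Prop where
  symmQ : ∀ u v, Q u v = Q v u
  symmN : ∀ u v, N u v = N v u
  nonnegN : ∀ v, 0 ≤ N v v
  l_nonneg : 0 ≤ l
  bound : ∀ v, l * N v v ≤ Q v v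
  exists_le : ∀ ε > 0, ∃ v, N v v = 1 ∧ Q v v ≤ l + ε
  gap : ∃ g : V →ₗ[ℝ] ℝ, ∀ v, g v = 0 → L * N v v ≤ Q v v

lemma SpecGap.gap_of_near_min {Q N : LinearMap.BilinForm ℝ V} {l L : ℝ} (H : SpecGap Q N l L)
    {g : V →ₗ[ℝ] ℝ} (hg : ∀ v, g v = 0 → L * N v v ≤ Q v v) {L' : ℝ} (hL : L' < L)
    (hL0 : 0 < L') (hlL : l < L') {v : V} (hNv : N v v = 1) {δ : ℝ} (hδ0 : 0 < δ)
    (hBv' : Q v v - l * N v v ≤ δ) (dB : δ ≤ (L - L') / 2) (h4 : δ * L' ≤ (L - L') / 2 * (L - L'))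
    {z : V} (hz : N v z = 0) : L' * N z z ≤ Q z z := by
  set B : LinearMap.BilinForm ℝ V := Q - l • N with hBdef
  have hBa : ∀ u v, B u v = Q u v - l * N u v := fun u v => by simp [hBdef]
  have hBs : ∀ u v, B u v = B v u := fun u v => by rw [hBa, hBa, H.symmQ, H.symmN]
  have hBn : ∀ v, 0 ≤ B v v := fun v => by rw [hBa]; linarith [H.bound v]
  have hBv : B v v ≤ δ := by rw [hBa]; exact hBv'
  have hQv : Q v v ≤ l + δ := by rw [hNv] at hBv'; linarith
  have hgv : g v ≠ 0 := fun h => by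
    have := hg _ h; rw [hNv] at this; linarith
  set c₀ := (L - L') / 2 with hc₀
  have hc₀0 : 0 < c₀ := by simp only [hc₀]; linarith
  have hz' : N z v = 0 := by rw [H.symmN, hz]
  have hz' : N z v = 0 := by rw [H.symmN, hz]
  set t := g z / g v with ht
  have h1 := hg (z - t • v) (by simp [ht, hgv])
  simp only [map_sub, LinearMap.sub_apply, map_smul, LinearMap.smul_apply, smul_eq_mul,
    hz, hz', hNv, H.symmQ z v] at h1
  set c := L - Q v v with hc
  have hcc : c₀ ≤ c := by linarith
  have hcs := form_cauchy hBs hBn v z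
  have hBvz : B v z = Q v z := by rw [hBa, hz]; ring
  rw [hBvz] at hcs
  have hBz : B z z ≤ Q z z := by
    rw [hBa]; have := mul_nonneg H.l_nonneg (H.nonnegN z); linarith
  have hQz : 0 ≤ Q z z := (hBn z).trans hBz
  -- `Q z z - L N z z ≥ c t² + 2 t Q v z ≥ - (Q v z)² / c`
  have h2 : Q v z ^ 2 ≤ δ * Q z z := hcs.trans (by
    calc B v v * B z z ≤ δ * B z z := mul_le_mul_of_nonneg_right hBv (hBn z)
      _ ≤ δ * Q z z := mul_le_mul_of_nonneg_left hBz hδ0.le)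
  have h3 : c * (L * N z z - Q z z) ≤ Q v z ^ 2 := by
    have : L * N z z - Q z z ≤ -(c * t ^ 2) - 2 * t * Q v z := by
      simp only [hc]; linarith
    have hc0 : 0 < c := by linarith
    nlinarith [mul_le_mul_of_nonneg_left this hc0.le, sq_nonneg (c * t + Q v z)]
  by_contra hcon
  push Not at hcon
  have h5 : c * (L * N z z - Q z z) ≤ δ * Q z z := h3.trans h2
  have hNz := H.nonnegN z
  have hNz0 : 0 < N z z := by
    rcases hNz.eq_or_lt with h | h
    · rw [← h] at hcon; linarith
    · exact h
  have h6 : c₀ * ((L - L') * N z z) ≤ c * (L * N z z - Q z z) := by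
    have h7 : 0 ≤ (L - L') * N z z := mul_nonneg (by linarith) hNz
    exact mul_le_mul hcc (by linarith) h7 (by linarith)
  have h7 : δ * Q z z < δ * (L' * N z z) := mul_lt_mul_of_pos_left hcon hδ0
  have h8 : δ * (L' * N z z) ≤ c₀ * (L - L') * N z z := by
    rw [← mul_assoc]; exact mul_le_mul_of_nonneg_right h4 hNz
  linarith

lemma SpecGap.exists_near_min {Q N : LinearMap.BilinForm ℝ V} {l L : ℝ} (H : SpecGap Q N l L)
    (S : V →ₗ[ℝ] V) (hSS : ∀ v, S (S v) = S v) (hSQ : ∀ u v, Q (S u) v = Q u (S v))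
    (hSN : ∀ u v, N (S u) v = N u (S v)) {u₀ : V} (hu₀ : S u₀ = u₀) {L' : ℝ} (hL : L' < L)
    (hL0 : 0 < L') (hu : Q u₀ u₀ < L' * N u₀ u₀) {ε : ℝ} (hε : 0 < ε) :
    ∃ u, S u = u ∧ Q u u - l * N u u ≤ ε ∧ N u (u₀ - u) = 0 ∧
      ∀ z, N u z = 0 → L' * N z z ≤ Q z z := by
  obtain ⟨g, hg⟩ := H.gap
  have hNu : 0 < N u₀ u₀ := by
    rcases (H.nonnegN u₀).eq_or_lt with h | h
    · have := H.bound u₀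
      rw [← h] at this hu; linarith
    · exact h
  have hlL : l < L' := by
    have := H.bound u₀
    by_contra h
    push Not at h
    nlinarith
  have huL : Q u₀ u₀ < L * N u₀ u₀ := by nlinarith
  have hgu : g u₀ ≠ 0 := fun h => by have := hg _ h; linarith
  -- the antisymmetric part is above the gap
  have hanti : ∀ r, S r = 0 → L * N r r ≤ Q r r := by
    intro r hr
    have h1 : Q u₀ r = 0 := by rw [← hu₀, hSQ, hr, map_zero]
    have h2 : N u₀ r = 0 := by rw [← hu₀, hSN, hr, map_zero]
    have h3 : Q r u₀ = 0 := by rw [H.symmQ, h1]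
    have h4 : N r u₀ = 0 := by rw [H.symmN, h2]
    have := hg (g u₀ • r - g r • u₀) (by simp [mul_comm])
    simp only [map_sub, LinearMap.sub_apply, map_smul, LinearMap.smul_apply, smul_eq_mul,
      h1, h2, h3, h4] at this
    have hp : 0 < g u₀ ^ 2 := by positivity
    have hq : 0 ≤ g r ^ 2 := by positivity
    by_contra hc
    push Not at hc
    nlinarith [mul_lt_mul_of_pos_left hc hp, mul_le_mul_of_nonneg_left huL.le hq]
  set B : LinearMap.BilinForm ℝ V := Q - l • N with hBdef
  have hBa : ∀ u v, B u v = Q u v - l * N u v := fun u v => by simp [hBdef]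
  have hBs : ∀ u v, B u v = B v u := fun u v => by rw [hBa, hBa, H.symmQ, H.symmN]
  have hBn : ∀ v, 0 ≤ B v v := fun v => by rw [hBa]; linarith [H.bound v]
  -- symmetric near minimizers
  have hsym : ∀ δ > 0, ∃ v, S v = v ∧ N v v = 1 ∧ B v v ≤ δ := by
    intro δ hδ
    set δ' := min (δ / 2) ((L - l) / 2) with hδ'
    have hδ'0 : 0 < δ' := lt_min (by linarith) (by linarith)
    obtain ⟨v, hv1, hv2⟩ := H.exists_le δ' hδ'0
    set r := v - S v with hr
    have hSr : S r = 0 := by simp [hr, hSS]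
    have hv : v = S v + r := by simp [hr]
    have q1 : Q (S v) r = 0 := by rw [hSQ, hSr, map_zero]
    have q2 : N (S v) r = 0 := by rw [hSN, hSr, map_zero]
    have q3 : Q v v = Q (S v) (S v) + Q r r := by
      conv_lhs => rw [hv]
      simp only [map_add, LinearMap.add_apply, q1, H.symmQ r (S v)]; ring
    have q4 : N v v = N (S v) (S v) + N r r := by
      conv_lhs => rw [hv]
      simp only [map_add, LinearMap.add_apply, q2, H.symmN r (S v)]; ring
    have hr1 := hanti r hSr
    have hb := H.bound (S v)
    have hrn := H.nonnegN r
    have d1 : δ' ≤ δ / 2 := min_le_left _ _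
    have d2 : δ' ≤ (L - l) / 2 := min_le_right _ _
    have hNr : N r r ≤ 1 / 2 := by
      have : (L - l) * N r r ≤ (L - l) / 2 := by nlinarith
      by_contra hc
      push Not at hc
      nlinarith
    have hN : 1 / 2 ≤ N (S v) (S v) := by linarith
    have hBv : B (S v) (S v) ≤ δ / 2 := by
      rw [hBa]
      have : l * N r r ≤ Q r r := H.bound r
      nlinarith
    set m := N (S v) (S v) with hm
    have hm0 : 0 < m := by linarith
    refine ⟨(Real.sqrt m)⁻¹ • S v, by rw [map_smul, hSS], ?_, ?_⟩
    · simp only [map_smul, LinearMap.smul_apply, smul_eq_mul, ← hm]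
      have := Real.mul_self_sqrt hm0.le
      have h0 : Real.sqrt m ≠ 0 := (Real.sqrt_pos.2 hm0).ne'
      field_simp
      rw [pow_two, this]
    · simp only [map_smul, LinearMap.smul_apply, smul_eq_mul]
      rw [← mul_assoc, ← mul_inv, Real.mul_self_sqrt hm0.le]
      rw [inv_mul_le_iff₀ hm0]
      nlinarith
  set c₀ := (L - L') / 2 with hc₀
  have hc₀0 : 0 < c₀ := by simp only [hc₀]; linarith
  set δ := min (min (ε / N u₀ u₀) c₀) (c₀ * (L - L') / L') with hδdef
  have hδ0 : 0 < δ := lt_min (lt_min (by positivity) hc₀0)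
    (div_pos (mul_pos hc₀0 (by linarith)) hL0)
  obtain ⟨v, hSv, hNv, hBv⟩ := hsym δ hδ0
  have dA : δ ≤ ε / N u₀ u₀ := (min_le_left _ _).trans (min_le_left _ _)
  have dB : δ ≤ c₀ := (min_le_left _ _).trans (min_le_right _ _)
  have dC : δ ≤ c₀ * (L - L') / L' := min_le_right _ _
  have hgap : ∀ z, N v z = 0 → L' * N z z ≤ Q z z := fun z hz =>
    H.gap_of_near_min hg hL hL0 hlL hNv hδ0 (by rw [← hBa]; exact hBv)
      dB (by rw [le_div_iff₀ hL0] at dC; exact dC) hz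
  set s := N v u₀ with hs
  have hs0 : s ≠ 0 := fun h => by
    have := hgap u₀ h; linarith
  refine ⟨s • v, by rw [map_smul, hSv], ?_, ?_, ?_⟩
  · simp only [map_smul, LinearMap.smul_apply, smul_eq_mul]
    have hcs := form_cauchy H.symmN H.nonnegN v u₀
    rw [hNv, one_mul, ← hs] at hcs
    have hb := hBn v
    rw [hBa] at hb hBv
    have h1 : s ^ 2 * (Q v v - l * N v v) ≤ N u₀ u₀ * (ε / N u₀ u₀) :=
      mul_le_mul hcs (hBv.trans dA) hb hNu.le
    rw [mul_div_cancel₀ _ hNu.ne'] at h1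
    calc _ = s ^ 2 * (Q v v - l * N v v) := by ring
      _ ≤ ε := h1
  · simp only [map_sub, map_smul, LinearMap.smul_apply, smul_eq_mul, ← hs, hNv]
    ring
  · intro z hz
    simp only [map_smul, LinearMap.smul_apply, smul_eq_mul, mul_eq_zero, hs0, false_or] at hz
    exact hgap z hz

end spectral

/-- Elements `a + b √5` of `ℚ(√5)`, in computable form. -/
structure Q5 where
  a : ℚ
  b : ℚ

namespace Q5
def add (x y : Q5) : Q5 := ⟨x.a + y.a, x.b + y.b⟩
def mul (x y : Q5) : Q5 := ⟨x.a * y.a + 5 * (x.b * y.b), x.a * y.b + x.b * y.a⟩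
def ofRat (x : ℚ) : Q5 := ⟨x, 0⟩
noncomputable def val (x : Q5) : ℝ := x.a + x.b * √5
/-- A certified rational lower bound. -/
def lb (x : Q5) : ℚ := x.a + x.b * (if 0 ≤ x.b then 22360679 / 10000000 else 2236068 / 1000000)

lemma val_add (x y : Q5) : (x.add y).val = x.val + y.val := by
  simp only [val, add]; push_cast; ring
lemma val_mul (x y : Q5) : (x.mul y).val = x.val * y.val := by
  have h : (√5 : ℝ) * √5 = 5 := Real.mul_self_sqrt (by norm_num)
  simp only [val, mul]; push_cast
  linear_combination (-(x.b * y.b) : ℝ) * h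
lemma val_ofRat (x : ℚ) : (ofRat x).val = x := by simp [val, ofRat]
lemma lb_le (x : Q5) : (x.lb : ℝ) ≤ x.val := by
  have h1 : (22360679 / 10000000 : ℝ) ≤ √5 := Real.le_sqrt_of_sq_le (by norm_num)
  have h2 : √5 ≤ (2236068 / 1000000 : ℝ) := Real.sqrt_le_iff.2 ⟨by norm_num, by norm_num⟩
  unfold lb val
  split_ifs with h
  · have : (0:ℝ) ≤ x.b := by exact_mod_cast h
    push_cast; nlinarith
  · have : (x.b:ℝ) ≤ 0 := by exact_mod_cast (not_le.1 h).le
    push_cast; nlinarith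
end Q5

/-- Polynomials in two variables as lists of terms `(c, i, j)` for `c X ^ i Y ^ j`. -/
abbrev Pol := List (Q5 × ℕ × ℕ)

namespace Pol
def smul (c : Q5) (P : Pol) : Pol := P.map fun t => (c.mul t.1, t.2.1, t.2.2)
def mul (P R : Pol) : Pol := P.flatMap fun s =>
  R.map fun t => (s.1.mul t.1, s.2.1 + t.2.1, s.2.2 + t.2.2)
def dX (P : Pol) : Pol := P.map fun t => ((Q5.ofRat t.2.1).mul t.1, t.2.1 - 1, t.2.2)
def dY (P : Pol) : Pol := P.map fun t => ((Q5.ofRat t.2.2).mul t.1, t.2.1, t.2.2 - 1)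
def mom (i j : ℕ) : ℚ := if j % 2 = 0 then 2 / ((j + 1) * (i + j + 2)) else 0
/-- Integral over the reference triangle. -/
def J : Pol → Q5
  | [] => ⟨0, 0⟩
  | t :: P => (t.1.mul (Q5.ofRat (mom t.2.1 t.2.2))).add (J P)
/-- Sum of the coefficients of total degree `d`. -/
def coefD (d : ℕ) : Pol → Q5
  | [] => ⟨0, 0⟩
  | t :: P => if t.2.1 + t.2.2 = d then t.1.add (coefD d P) else coefD d P
/-- Sum of the coefficients of total degree `d`, restricted to the line `Y = -X`. -/
def refl (P : Pol) : Pol := P.map fun t => (if t.2.2 % 2 = 0 then t.1 else (Q5.ofRat (-1)).mul t.1,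
  t.2.1, t.2.2)
/-- Collect like terms of degree at most `d`. -/
def coef (i j : ℕ) : Pol → Q5
  | [] => ⟨0, 0⟩
  | t :: P => if t.2.1 = i ∧ t.2.2 = j then t.1.add (coef i j P) else coef i j P

noncomputable def ev : Pol → ℝ × ℝ → ℝ
  | [], _ => 0
  | t :: P, p => t.1.val * (p.1 ^ t.2.1 * p.2 ^ t.2.2) + ev P p

@[simp] lemma ev_nil (p : ℝ × ℝ) : ev [] p = 0 := rfl
@[simp] lemma ev_cons (t : Q5 × ℕ × ℕ) (P : Pol) (p : ℝ × ℝ) :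
    ev (t :: P) p = t.1.val * (p.1 ^ t.2.1 * p.2 ^ t.2.2) + ev P p := rfl
lemma ev_append (P R : Pol) (p : ℝ × ℝ) : ev (P ++ R) p = ev P p + ev R p := by
  induction P with
  | nil => simp
  | cons t P ih => simp only [List.cons_append, ev_cons, ih]; ring
lemma ev_smul (c : Q5) (P : Pol) (p : ℝ × ℝ) : ev (smul c P) p = c.val * ev P p := by
  induction P with
  | nil => simp [smul]
  | cons t P ih =>
    have : smul c (t :: P) = (c.mul t.1, t.2.1, t.2.2) :: smul c P := rfl
    simp only [this, ev_cons, ih, Q5.val_mul]; ring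
lemma ev_map_mul (s : Q5 × ℕ × ℕ) (R : Pol) (p : ℝ × ℝ) :
    ev (R.map fun t => (s.1.mul t.1, s.2.1 + t.2.1, s.2.2 + t.2.2)) p =
      s.1.val * (p.1 ^ s.2.1 * p.2 ^ s.2.2) * ev R p := by
  induction R with
  | nil => simp
  | cons t R ih => simp only [List.map_cons, ev_cons, ih, Q5.val_mul, pow_add]; ring
lemma ev_mul (P R : Pol) (p : ℝ × ℝ) : ev (mul P R) p = ev P p * ev R p := by
  induction P with
  | nil => simp [mul]
  | cons s P ih =>
    have : mul (s :: P) R = (R.map fun t => (s.1.mul t.1, s.2.1 + t.2.1, s.2.2 + t.2.2)) ++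
      mul P R := rfl
    rw [this, ev_append, ih, ev_cons, ev_map_mul]; ring
lemma contDiff_ev (P : Pol) : ContDiff ℝ 1 (ev P) := by
  induction P with
  | nil => exact contDiff_const
  | cons t P ih =>
    have : ev (t :: P) = fun p => t.1.val * (p.1 ^ t.2.1 * p.2 ^ t.2.2) + ev P p := rfl
    rw [this]; fun_prop
lemma continuous_ev (P : Pol) : Continuous (ev P) := (contDiff_ev P).continuous
lemma pdx_ev (P : Pol) (p : ℝ × ℝ) : pdx (ev P) p = ev (dX P) p := by
  have h : HasDerivAt (fun x => ev P (x, p.2)) (ev (dX P) p) p.1 := by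
    induction P with
    | nil => exact hasDerivAt_const _ _
    | cons t P ih =>
      have e : dX (t :: P) = ((Q5.ofRat t.2.1).mul t.1, t.2.1 - 1, t.2.2) :: dX P := rfl
      rw [e]
      have := (((hasDerivAt_pow t.2.1 p.1).mul_const (p.2 ^ t.2.2)).const_mul t.1.val).add ih
      refine this.congr_deriv ?_
      simp only [ev_cons, Q5.val_mul, Q5.val_ofRat]
      push_cast; ring
  have a3 : HasDerivAt (fun t : ℝ => (t, p.2)) (1, 0) p.1 :=
    (hasDerivAt_id p.1).prodMk (hasDerivAt_const _ _)
  have := (hasDerivAt_curve (contDiff_ev P) a3).unique h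
  simpa using this
lemma pdy_ev (P : Pol) (p : ℝ × ℝ) : pdy (ev P) p = ev (dY P) p := by
  have h : HasDerivAt (fun y => ev P (p.1, y)) (ev (dY P) p) p.2 := by
    induction P with
    | nil => exact hasDerivAt_const _ _
    | cons t P ih =>
      have e : dY (t :: P) = ((Q5.ofRat t.2.2).mul t.1, t.2.1, t.2.2 - 1) :: dY P := rfl
      rw [e]
      have := (((hasDerivAt_pow t.2.2 p.2).const_mul (p.1 ^ t.2.1)).const_mul t.1.val).add ih
      refine this.congr_deriv ?_
      simp only [ev_cons, Q5.val_mul, Q5.val_ofRat]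
      push_cast; ring
  have a3 : HasDerivAt (fun t : ℝ => (p.1, t)) (0, 1) p.2 :=
    (hasDerivAt_const _ _).prodMk (hasDerivAt_id p.2)
  have := (hasDerivAt_curve (contDiff_ev P) a3).unique h
  simpa using this
lemma mom_eq (i j : ℕ) : triInt (fun p => p.1 ^ i * p.2 ^ j) = (mom i j : ℝ) := by
  rw [triInt_monomial, mom]
  split_ifs <;> push_cast <;> rfl
lemma triInt_ev (P : Pol) : triInt (ev P) = (J P).val := by
  induction P with
  | nil => simp [triInt, J, Q5.val, ev]
  | cons t P ih =>
    have : ev (t :: P) = fun p => t.1.val * (p.1 ^ t.2.1 * p.2 ^ t.2.2) + ev P p := rfl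
    rw [this, triInt_add (by fun_prop) (continuous_ev P), triInt_const_mul, mom_eq, ih, J,
      Q5.val_add, Q5.val_mul, Q5.val_ofRat]
lemma ev_refl (P : Pol) (x y : ℝ) : ev (refl P) (x, y) = ev P (x, -y) := by
  induction P with
  | nil => rfl
  | cons t P ih =>
    have e : refl (t :: P) = (if t.2.2 % 2 = 0 then t.1 else (Q5.ofRat (-1)).mul t.1,
      t.2.1, t.2.2) :: refl P := rfl
    rw [e, ev_cons, ev_cons, ih]
    congr 1
    split_ifs with h
    · rw [(Nat.even_iff.2 h).neg_pow]
    · rw [(Nat.odd_iff.2 (by omega)).neg_pow, Q5.val_mul, Q5.val_ofRat]; push_cast; ring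
lemma ev_diag (P : Pol) (D : ℕ) (hD : ∀ t ∈ P, t.2.1 + t.2.2 < D) (t : ℝ) :
    ev P (t, t) = ∑ d ∈ Finset.range D, (coefD d P).val * t ^ d := by
  induction P with
  | nil => simp [coefD, Q5.val]
  | cons s P ih =>
    rw [ev_cons, ih fun u hu => hD u (List.mem_cons_of_mem _ hu)]
    have h1 : ∀ d, (coefD d (s :: P)).val * t ^ d =
        (if s.2.1 + s.2.2 = d then s.1.val * t ^ d else 0) + (coefD d P).val * t ^ d := by
      intro d
      rw [coefD]
      split_ifs with h
      · rw [Q5.val_add]; ring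
      · ring
    simp only [h1, Finset.sum_add_distrib]
    rw [Finset.sum_ite_eq, if_pos (Finset.mem_range.2 (hD s List.mem_cons_self)), pow_add]

/-- A checkable criterion for a polynomial to vanish on the diagonal. -/
def vanDiag (P : Pol) : Bool :=
  (P.all fun t => t.2.1 + t.2.2 < 12) &&
    (List.range 12).all fun d => (coefD d P).a == 0 && (coefD d P).b == 0

lemma ev_eq_zero_of_vanDiag {P : Pol} (h : vanDiag P = true) (t : ℝ) : ev P (t, t) = 0 := by
  simp only [vanDiag, Bool.and_eq_true, List.all_eq_true, decide_eq_true_eq, beq_iff_eq,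
    List.mem_range] at h
  rw [ev_diag P 12 h.1]
  refine Finset.sum_eq_zero fun d hd => ?_
  have := h.2 d (Finset.mem_range.1 hd)
  simp [Q5.val, this.1, this.2]

/-- Collect like terms, for polynomials of degree less than `8` in each variable. -/
def norm (P : Pol) : Pol :=
  if P.all fun t => t.2.1 < 8 && t.2.2 < 8 then
    ((List.range 8).flatMap fun i => (List.range 8).map fun j => (coef i j P, i, j)).filter
      fun t => !(t.1.a == 0 && t.1.b == 0)
  else P

lemma ev_filter (P : Pol) (p : ℝ × ℝ) :
    ev (P.filter fun t => !(t.1.a == 0 && t.1.b == 0)) p = ev P p := by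
  induction P with
  | nil => rfl
  | cons t P ih =>
    rw [List.filter_cons]
    split_ifs with h
    · rw [ev_cons, ev_cons, ih]
    · simp only [Bool.not_eq_true, Bool.not_eq_false', Bool.and_eq_true, beq_iff_eq] at h
      rw [ev_cons, ih]; simp [Q5.val, h.1, h.2]

lemma ev_eq_sum (P : Pol) (h : ∀ t ∈ P, t.2.1 < 8 ∧ t.2.2 < 8) (p : ℝ × ℝ) :
    ev P p = ∑ i ∈ Finset.range 8, ∑ j ∈ Finset.range 8,
      (coef i j P).val * (p.1 ^ i * p.2 ^ j) := by
  induction P with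
  | nil => simp [coef, Q5.val]
  | cons s P ih =>
    rw [ev_cons, ih fun u hu => h u (List.mem_cons_of_mem _ hu)]
    have hs := h s List.mem_cons_self
    have h1 : ∀ i j, (coef i j (s :: P)).val * (p.1 ^ i * p.2 ^ j) =
        (if s.2.1 = i then if s.2.2 = j then s.1.val * (p.1 ^ i * p.2 ^ j) else 0 else 0) +
          (coef i j P).val * (p.1 ^ i * p.2 ^ j) := by
      intro i j
      rw [coef]
      by_cases h1 : s.2.1 = i <;> by_cases h2 : s.2.2 = j
      · simp only [h1, h2, and_self, if_true, Q5.val_add]; ring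
      all_goals simp [h1, h2]
    simp only [h1, Finset.sum_add_distrib]
    congr 1
    rw [Finset.sum_eq_single s.2.1]
    · simp only [if_true]
      rw [Finset.sum_ite_eq, if_pos (Finset.mem_range.2 hs.2)]
    · intro b _ hb
      simp [Ne.symm hb]
    · intro hn
      exact absurd (Finset.mem_range.2 hs.1) hn

lemma ev_flatMap {ι : Type*} (l : List ι) (g : ι → Pol) (p : ℝ × ℝ) :
    ev (l.flatMap g) p = (l.map fun i => ev (g i) p).sum := by
  induction l with
  | nil => rfl
  | cons i l ih => rw [List.flatMap_cons, ev_append, ih]; rfl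

lemma ev_map {ι : Type*} (l : List ι) (g : ι → Q5 × ℕ × ℕ) (p : ℝ × ℝ) :
    ev (l.map g) p = (l.map fun i => (g i).1.val * (p.1 ^ (g i).2.1 * p.2 ^ (g i).2.2)).sum := by
  induction l with
  | nil => rfl
  | cons i l ih => rw [List.map_cons, ev_cons, ih]; rfl

lemma list_sum_range (n : ℕ) (f : ℕ → ℝ) :
    ((List.range n).map f).sum = ∑ i ∈ Finset.range n, f i := by
  induction n with
  | zero => simp
  | succ n ih => rw [List.range_succ, List.map_append, List.sum_append, ih,
      Finset.sum_range_succ]; simp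

lemma ev_norm (P : Pol) (p : ℝ × ℝ) : ev (norm P) p = ev P p := by
  unfold norm
  split_ifs with h
  · simp only [List.all_eq_true, Bool.and_eq_true, decide_eq_true_eq] at h
    rw [ev_filter, ev_flatMap, ev_eq_sum P h]
    simp only [ev_map, list_sum_range]
  · rfl
end Pol

section trig
/-- `cos (2πmk/n)`. -/
noncomputable def cs (n : ℕ) (m : ℤ) (k : Fin n) : ℝ := Real.cos (2 * Real.pi * m * k / n)
/-- `sin (2πmk/n)`. -/
noncomputable def sn (n : ℕ) (m : ℤ) (k : Fin n) : ℝ := Real.sin (2 * Real.pi * m * k / n)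

lemma sum_cs_sn {n : ℕ} (hn : n ≠ 0) {m : ℤ} (hm : ¬ (n : ℤ) ∣ m) :
    ∑ k, cs n m k = 0 ∧ ∑ k, sn n m k = 0 := by
  set z : ℂ := Complex.exp ((2 * Real.pi * m / n : ℝ) * Complex.I) with hz
  have hn' : (n : ℂ) ≠ 0 := by exact_mod_cast hn
  have hnr : (n : ℝ) ≠ 0 := by exact_mod_cast hn
  have h1 : z ≠ 1 := by
    intro h
    rw [hz, Complex.exp_eq_one_iff] at h
    obtain ⟨N, hN⟩ := h
    have hpi : (Real.pi : ℂ) ≠ 0 := by exact_mod_cast Real.pi_ne_zero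
    have : (m : ℂ) = n * N := by
      have h2 := mul_right_cancel₀ Complex.I_ne_zero (a := ((2 * Real.pi * m / n : ℝ) : ℂ))
        (c := N * (2 * Real.pi)) (by rw [hN]; ring)
      push_cast at h2
      field_simp at h2
      rw [h2]
    exact hm ⟨N, by exact_mod_cast this⟩
  have h2 : z ^ n = 1 := by
    rw [hz, ← Complex.exp_nat_mul]
    rw [show (n : ℂ) * (((2 * Real.pi * m / n : ℝ) : ℂ) * Complex.I) =
      m * (2 * Real.pi * Complex.I) by push_cast; field_simp]
    exact Complex.exp_int_mul_two_pi_mul_I m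
  have h3 : ∑ k : Fin n, z ^ (k : ℕ) = 0 := by
    rw [Fin.sum_univ_eq_sum_range (fun k => z ^ k) n, geom_sum_eq h1, h2]; simp
  have h4 : ∀ k : Fin n, z ^ (k : ℕ) = cs n m k + sn n m k * Complex.I := by
    intro k
    rw [hz, ← Complex.exp_nat_mul, cs, sn,
      show ((k : ℕ) : ℂ) * (((2 * Real.pi * m / n : ℝ) : ℂ) * Complex.I) =
      ((2 * Real.pi * m * k / n : ℝ) : ℂ) * Complex.I by push_cast; ring, Complex.exp_mul_I]
    push_cast; rfl
  simp only [h4] at h3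
  constructor
  · have := congrArg Complex.re h3
    simpa using this
  · have := congrArg Complex.im h3
    simpa using this

lemma cs_sum_zero {n : ℕ} (hn : n ≠ 0) {m : ℤ} (hm : ¬ (n : ℤ) ∣ m) : ∑ k, cs n m k = 0 :=
  (sum_cs_sn hn hm).1
lemma sn_sum_zero {n : ℕ} (hn : n ≠ 0) {m : ℤ} (hm : ¬ (n : ℤ) ∣ m) : ∑ k, sn n m k = 0 :=
  (sum_cs_sn hn hm).2

lemma cs_mul_cs (n : ℕ) (a b : ℤ) (k : Fin n) :
    cs n a k * cs n b k = 1 / 2 * cs n (a + b) k + 1 / 2 * cs n (a - b) k := by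
  unfold cs
  push_cast
  rw [show 2 * Real.pi * ((a : ℝ) + b) * k / n = 2 * Real.pi * a * k / n + 2 * Real.pi * b * k / n by ring,
    show 2 * Real.pi * ((a : ℝ) - b) * k / n = 2 * Real.pi * a * k / n - 2 * Real.pi * b * k / n by ring,
    Real.cos_add, Real.cos_sub]; ring
lemma sn_mul_sn (n : ℕ) (a b : ℤ) (k : Fin n) :
    sn n a k * sn n b k = (-(1 / 2)) * cs n (a + b) k + 1 / 2 * cs n (a - b) k := by
  unfold cs sn
  push_cast
  rw [show 2 * Real.pi * ((a : ℝ) + b) * k / n = 2 * Real.pi * a * k / n + 2 * Real.pi * b * k / n by ring,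
    show 2 * Real.pi * ((a : ℝ) - b) * k / n = 2 * Real.pi * a * k / n - 2 * Real.pi * b * k / n by ring,
    Real.cos_add, Real.cos_sub]; ring
lemma cs_mul_sn (n : ℕ) (a b : ℤ) (k : Fin n) :
    cs n a k * sn n b k = 1 / 2 * sn n (a + b) k + (-(1 / 2)) * sn n (a - b) k := by
  unfold cs sn
  push_cast
  rw [show 2 * Real.pi * ((a : ℝ) + b) * k / n = 2 * Real.pi * a * k / n + 2 * Real.pi * b * k / n by ring,
    show 2 * Real.pi * ((a : ℝ) - b) * k / n = 2 * Real.pi * a * k / n - 2 * Real.pi * b * k / n by ring,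
    Real.sin_add, Real.sin_sub]; ring
lemma cs_zero (n : ℕ) (k : Fin n) : cs n 0 k = 1 := by simp [cs]
lemma sn_zero (n : ℕ) (k : Fin n) : sn n 0 k = 0 := by simp [sn]
lemma cs_self (n : ℕ) (k : Fin n) : cs n n k = 1 := by
  have hn : (n : ℝ) ≠ 0 := by exact_mod_cast (Fin.pos k).ne'
  rw [cs, show 2 * Real.pi * ((n : ℤ) : ℝ) * (k : ℕ) / (n : ℝ) = (k : ℕ) * (2 * Real.pi) by
    push_cast; field_simp]
  exact Real.cos_nat_mul_two_pi k

lemma angle_succ (n : ℕ) [NeZero n] (m : ℤ) (k : Fin n) : ∃ j : ℤ,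
    2 * Real.pi * m * ((k + 1 : Fin n) : ℕ) / n =
      2 * Real.pi * m * k / n + 2 * Real.pi * m / n - j * (2 * Real.pi) := by
  have hn : (n : ℝ) ≠ 0 := by exact_mod_cast NeZero.ne n
  have h : ((k + 1 : Fin n) : ℕ) = (k + 1) % n := by
    rw [Fin.val_add]; simp
  refine ⟨m * ((k + 1) / n : ℕ), ?_⟩
  have h2 : (((k + 1 : Fin n) : ℕ) : ℝ) + n * (((k : ℕ) + 1) / n : ℕ) = k + 1 := by
    rw [h]; exact_mod_cast Nat.mod_add_div _ _
  rw [show (((k + 1 : Fin n) : ℕ) : ℝ) = k + 1 - n * (((k : ℕ) + 1) / n : ℕ) by linarith]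
  rw [Int.cast_mul, Int.cast_natCast]
  generalize (((k : ℕ) + 1) / n : ℕ) = j
  field_simp
lemma cs_succ (n : ℕ) [NeZero n] (m : ℤ) (k : Fin n) : cs n m (k + 1) =
    cs n m k * Real.cos (2 * Real.pi * m / n) - sn n m k * Real.sin (2 * Real.pi * m / n) := by
  obtain ⟨j, hj⟩ := angle_succ n m k
  rw [cs, hj, Real.cos_sub_int_mul_two_pi, Real.cos_add]; rfl
lemma sn_succ (n : ℕ) [NeZero n] (m : ℤ) (k : Fin n) : sn n m (k + 1) =
    sn n m k * Real.cos (2 * Real.pi * m / n) + cs n m k * Real.sin (2 * Real.pi * m / n) := by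
  obtain ⟨j, hj⟩ := angle_succ n m k
  rw [sn, hj, Real.sin_sub_int_mul_two_pi, Real.sin_add]; rfl

/-- The alternating mode, present for `n = 6` only. -/
noncomputable def en (n : ℕ) (k : Fin n) : ℝ := if n = 6 then cs n 3 k else 0
noncomputable def n3 (n : ℕ) : ℝ := if n = 6 then 6 else 0

lemma en_succ {n : ℕ} [NeZero n] (k : Fin n) : en n (k + 1) = -en n k := by
  unfold en
  split_ifs with h
  · rw [cs_succ]
    subst h
    rw [show 2 * Real.pi * ((3 : ℤ) : ℝ) / ((6 : ℕ) : ℝ) = Real.pi by push_cast; ring]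
    simp
  · simp

lemma five_modes_sum {n : ℕ} (hn : n = 5 ∨ n = 6) (A1 B1 A2 B2 A3 A1' B1' A2' B2' A3' : ℝ) :
    ∑ k, (cs n 1 k * A1 + sn n 1 k * B1 + cs n 2 k * A2 + sn n 2 k * B2 + en n k * A3) *
      (cs n 1 k * A1' + sn n 1 k * B1' + cs n 2 k * A2' + sn n 2 k * B2' + en n k * A3') =
      n / 2 * (A1 * A1' + B1 * B1' + A2 * A2' + B2 * B2') + n3 n * (A3 * A3') := by
  have key : ∀ (f g : Fin n → ℝ) (A B : ℝ), ∑ k, (f k * A) * (g k * B) =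
      (∑ k, f k * g k) * (A * B) := by
    intro f g A B
    rw [Finset.sum_mul]; exact Finset.sum_congr rfl fun k _ => by ring
  have comm : ∀ (a b : ℤ) (k : Fin n), sn n b k * cs n a k =
    1 / 2 * sn n (a + b) k + (-(1 / 2)) * sn n (a - b) k := fun a b k => by
      rw [mul_comm, cs_mul_sn]
  have hn0 : n ≠ 0 := by omega
  have hneg : ∀ m k, cs n (-m) k = cs n m k := fun m k => by
    unfold cs; rw [← Real.cos_neg]; congr 1; push_cast; ring
  have hneg' : ∀ m k, sn n (-m) k = (-1) * sn n m k := fun m k => by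
    unfold sn; rw [neg_one_mul, ← Real.sin_neg]; congr 1; push_cast; ring
  have z1 := sum_cs_sn hn0 (m := 1) (by rcases hn with rfl | rfl <;> omega)
  have z2 := sum_cs_sn hn0 (m := 2) (by rcases hn with rfl | rfl <;> omega)
  have z3 := sum_cs_sn hn0 (m := 3) (by rcases hn with rfl | rfl <;> omega)
  have z4 := sum_cs_sn hn0 (m := 4) (by rcases hn with rfl | rfl <;> omega)
  obtain ⟨z11, z12⟩ := z1
  obtain ⟨z21, z22⟩ := z2
  obtain ⟨z31, z32⟩ := z3
  obtain ⟨z41, z42⟩ := z4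
  simp only [add_mul, mul_add, Finset.sum_add_distrib, key]
  rcases hn with rfl | rfl
  · simp only [en, n3, cs_mul_cs, sn_mul_sn, cs_mul_sn, comm]
    norm_num [Finset.sum_add_distrib, ← Finset.mul_sum, hneg, hneg', cs_zero, sn_zero, z11, z12, z21, z22, z31,
      z32, z41, z42]
  · obtain ⟨z51, z52⟩ := sum_cs_sn (n := 6) (by norm_num) (m := 5) (by omega)
    have z6 : ∀ k : Fin 6, cs 6 6 k = 1 := fun k => cs_self 6 k
    simp only [en, n3, if_true, cs_mul_cs, sn_mul_sn, cs_mul_sn, comm]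
    norm_num [Finset.sum_add_distrib, ← Finset.mul_sum, hneg, hneg', cs_zero, sn_zero, z11, z12, z21, z22, z31,
      z32, z41, z42, z51, z52, z6]

end trig

lemma triInt_sub {f g : ℝ × ℝ → ℝ} (hf : Continuous f) (hg : Continuous g) :
    triInt (fun p => f p - g p) = triInt f - triInt g :=
  integral_sub (integrable_tri hf) (integrable_tri hg)

/-- `tan (πm/n)`. -/
noncomputable def tn (n m : ℕ) : ℝ := Real.tan (Real.pi * m / n)

/-- Coefficients of the eight polynomial profiles on the `k`-th sector. -/
noncomputable def fc (n : ℕ) (v : Fin 8 → ℝ) (k : Fin n) : Fin 8 → ℝ :=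
  ![v 0 * cs n 1 k - v 1 * sn n 1 k, -(tn n 1 * (v 1 * cs n 1 k + v 0 * sn n 1 k)),
    v 2 * cs n 2 k - v 3 * sn n 2 k, -(tn n 2 * (v 3 * cs n 2 k + v 2 * sn n 2 k)),
    v 4 * cs n 2 k - v 5 * sn n 2 k, -(tn n 2 * (v 5 * cs n 2 k + v 4 * sn n 2 k)),
    v 6 * en n k, v 7 * en n k]

noncomputable def fldN (n : ℕ) (v D : Fin 8 → ℝ) (k : Fin n) : ℝ := ∑ i, fc n v k i * D i

lemma fldN_eq (n : ℕ) (v D : Fin 8 → ℝ) (k : Fin n) : fldN n v D k =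
    cs n 1 k * (v 0 * D 0 - v 1 * tn n 1 * D 1) + sn n 1 k * (-(v 1 * D 0 + v 0 * tn n 1 * D 1)) +
    cs n 2 k * (v 2 * D 2 - v 3 * tn n 2 * D 3 + v 4 * D 4 - v 5 * tn n 2 * D 5) +
    sn n 2 k * (-(v 3 * D 2 + v 2 * tn n 2 * D 3 + v 5 * D 4 + v 4 * tn n 2 * D 5)) +
    en n k * (v 6 * D 6 + v 7 * D 7) := by
  simp only [fldN, fc, Fin.sum_univ_eight]
  simp
  ring

/-- The quadratic form in the mode amplitudes associated with a Gram matrix. -/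
noncomputable def quadM (n : ℕ) (v : Fin 8 → ℝ) (M : Fin 8 → Fin 8 → ℝ) : ℝ :=
  n / 2 * ((v 0 ^ 2 + v 1 ^ 2) * (M 0 0 + tn n 1 ^ 2 * M 1 1) +
    (v 2 ^ 2 + v 3 ^ 2) * (M 2 2 + tn n 2 ^ 2 * M 3 3) +
    (v 4 ^ 2 + v 5 ^ 2) * (M 4 4 + tn n 2 ^ 2 * M 5 5) +
    (v 2 * v 4 + v 3 * v 5) * (M 2 4 + M 4 2 + tn n 2 ^ 2 * (M 3 5 + M 5 3)) +
    tn n 2 * (v 3 * v 4 - v 2 * v 5) * (M 2 5 + M 5 2 - M 3 4 - M 4 3)) +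
  n3 n * (v 6 ^ 2 * M 6 6 + v 7 ^ 2 * M 7 7 + v 6 * v 7 * (M 6 7 + M 7 6))

lemma fldN_sum {n : ℕ} (hn : n = 5 ∨ n = 6) (v D D' : Fin 8 → ℝ) :
    ∑ k, fldN n v D k * fldN n v D' k = quadM n v (fun i j => D i * D' j) := by
  simp only [fldN_eq]
  rw [five_modes_sum hn, quadM]
  ring

lemma fldN_sum_zero {n : ℕ} (hn : n = 5 ∨ n = 6) (v D : Fin 8 → ℝ) : ∑ k, fldN n v D k = 0 := by
  simp only [fldN_eq, Finset.sum_add_distrib, ← Finset.sum_mul]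
  have hn0 : n ≠ 0 := by omega
  rw [cs_sum_zero hn0 (by rcases hn with rfl | rfl <;> omega),
    sn_sum_zero hn0 (by rcases hn with rfl | rfl <;> omega),
    cs_sum_zero hn0 (by rcases hn with rfl | rfl <;> omega),
    sn_sum_zero hn0 (by rcases hn with rfl | rfl <;> omega)]
  have : ∑ k, en n k = 0 := by
    unfold en
    split_ifs with h
    · subst h; exact cs_sum_zero hn0 (by omega)
    · simp
  rw [this]; ring

lemma fldN_add (n : ℕ) (v D D' : Fin 8 → ℝ) (k : Fin n) :
    fldN n v (fun i => D i + D' i) k = fldN n v D k + fldN n v D' k := by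
  simp only [fldN, mul_add, Finset.sum_add_distrib]
lemma fldN_smul (n : ℕ) (v D : Fin 8 → ℝ) (c : ℝ) (k : Fin n) :
    fldN n v (fun i => c * D i) k = c * fldN n v D k := by
  simp only [fldN, Finset.mul_sum]
  exact Finset.sum_congr rfl fun i _ => by ring

/-- Matching conditions for profiles on neighbouring sectors. -/
def Match (n : ℕ) (Dp Dm : Fin 8 → ℝ) : Prop :=
  (Dp 0 + tn n 1 ^ 2 * Dp 1 = Dm 0 - tn n 1 ^ 2 * Dm 1 ∧ Dp 1 - Dp 0 = Dm 1 + Dm 0) ∧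
  (Dp 2 + tn n 2 ^ 2 * Dp 3 = Dm 2 - tn n 2 ^ 2 * Dm 3 ∧ Dp 3 - Dp 2 = Dm 3 + Dm 2) ∧
  (Dp 4 + tn n 2 ^ 2 * Dp 5 = Dm 4 - tn n 2 ^ 2 * Dm 5 ∧ Dp 5 - Dp 4 = Dm 5 + Dm 4) ∧
  Dp 6 = -Dm 6 ∧ Dp 7 = -Dm 7

lemma match_aux {t C S a b a' b' : ℝ} (hC : (1 + t ^ 2) * C = 1 - t ^ 2) (hS : (1 + t ^ 2) * S = 2 * t)
    (h1 : a + t ^ 2 * b = a' - t ^ 2 * b') (h2 : b - a = b' + a') :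
    a = C * a' - S * t * b' ∧ t * b = S * a' + C * t * b' := by
  have h : (1 + t ^ 2) ≠ 0 := by positivity
  constructor
  · apply mul_left_cancel₀ h
    linear_combination h1 - t ^ 2 * h2 - a' * hC + t * b' * hS
  · apply mul_left_cancel₀ h
    linear_combination t * (h1 + h2) - a' * hS - t * b' * hC

lemma tan_half (x : ℝ) (hx : Real.cos x ≠ 0) :
    (1 + Real.tan x ^ 2) * Real.cos (2 * x) = 1 - Real.tan x ^ 2 ∧
    (1 + Real.tan x ^ 2) * Real.sin (2 * x) = 2 * Real.tan x := by
  rw [Real.tan_eq_sin_div_cos, Real.cos_two_mul, Real.sin_two_mul]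
  have := Real.sin_sq_add_cos_sq x
  constructor
  · field_simp
    linear_combination 2 * Real.cos x ^ 2 * this
  · field_simp
    linear_combination Real.sin x * this

lemma cos_ne_zero_modes {n : ℕ} (hn : n = 5 ∨ n = 6) {m : ℕ} (hm : m = 1 ∨ m = 2) :
    Real.cos (Real.pi * m / n) ≠ 0 := by
  apply ne_of_gt
  apply Real.cos_pos_of_mem_Ioo
  have := Real.pi_pos
  rcases hn with rfl | rfl <;> rcases hm with rfl | rfl <;> constructor <;> push_cast <;> linarith

lemma fldN_match {n : ℕ} [NeZero n] (hn : n = 5 ∨ n = 6) (v : Fin 8 → ℝ) {Dp Dm : Fin 8 → ℝ}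
    (h : Match n Dp Dm) (k : Fin n) : fldN n v Dp k = fldN n v Dm (k + 1) := by
  obtain ⟨⟨a1, a2⟩, ⟨b1, b2⟩, ⟨c1, c2⟩, d6, d7⟩ := h
  have T1 := tan_half _ (cos_ne_zero_modes hn (m := 1) (Or.inl rfl))
  have T2 := tan_half _ (cos_ne_zero_modes hn (m := 2) (Or.inr rfl))
  rw [show 2 * (Real.pi * ((1 : ℕ) : ℝ) / n) = 2 * Real.pi * ((1 : ℤ) : ℝ) / n by push_cast; ring] at T1
  rw [show 2 * (Real.pi * ((2 : ℕ) : ℝ) / n) = 2 * Real.pi * ((2 : ℤ) : ℝ) / n by push_cast; ring] at T2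
  obtain ⟨p1, p2⟩ := match_aux T1.1 T1.2 a1 a2
  obtain ⟨q1, q2⟩ := match_aux T2.1 T2.2 b1 b2
  obtain ⟨r1, r2⟩ := match_aux T2.1 T2.2 c1 c2
  simp only [fldN_eq, cs_succ, sn_succ, en_succ]
  change Dp 0 = _ - _ * tn n 1 * _ at p1
  change tn n 1 * _ = _ + _ * tn n 1 * _ at p2
  change Dp 2 = _ - _ * tn n 2 * _ at q1
  change tn n 2 * _ = _ + _ * tn n 2 * _ at q2
  change Dp 4 = _ - _ * tn n 2 * _ at r1
  change tn n 2 * _ = _ + _ * tn n 2 * _ at r2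
  linear_combination (v 0 * cs n 1 k - v 1 * sn n 1 k) * p1 - (v 1 * cs n 1 k + v 0 * sn n 1 k) * p2 +
    (v 2 * cs n 2 k - v 3 * sn n 2 k) * q1 - (v 3 * cs n 2 k + v 2 * sn n 2 k) * q2 +
    (v 4 * cs n 2 k - v 5 * sn n 2 k) * r1 - (v 5 * cs n 2 k + v 4 * sn n 2 k) * r2 +
    v 6 * en n k * d6 + v 7 * en n k * d7

/-- A tuple of polynomial functions with amplitudes `v` and profiles `D`. -/
noncomputable def fldP (n : ℕ) (v : Fin 8 → ℝ) (D : Fin 8 → Pol) (k : Fin n) (p : ℝ × ℝ) : ℝ :=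
  fldN n v (fun i => (D i).ev p) k

lemma contDiff_fldP (n : ℕ) (v : Fin 8 → ℝ) (D : Fin 8 → Pol) (k : Fin n) :
    ContDiff ℝ 1 (fldP n v D k) := by
  unfold fldP fldN
  exact ContDiff.sum fun i _ => contDiff_const.mul (Pol.contDiff_ev _)
lemma continuous_fldP (n : ℕ) (v : Fin 8 → ℝ) (D : Fin 8 → Pol) (k : Fin n) :
    Continuous (fldP n v D k) := (contDiff_fldP n v D k).continuous

lemma pdx_fldP (n : ℕ) (v : Fin 8 → ℝ) (D : Fin 8 → Pol) (k : Fin n) (p : ℝ × ℝ) :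
    pdx (fldP n v D k) p = fldP n v (fun i => (D i).dX) k p := by
  unfold pdx fldP fldN
  rw [fderiv_fun_sum fun i _ => (((Pol.contDiff_ev (D i)).differentiable one_ne_zero p).const_mul _)]
  rw [_root_.sum_apply]
  refine Finset.sum_congr rfl fun i _ => ?_
  rw [fderiv_const_mul ((Pol.contDiff_ev (D i)).differentiable one_ne_zero p)]
  simp only [← Pol.pdx_ev]; rfl
lemma pdy_fldP (n : ℕ) (v : Fin 8 → ℝ) (D : Fin 8 → Pol) (k : Fin n) (p : ℝ × ℝ) :
    pdy (fldP n v D k) p = fldP n v (fun i => (D i).dY) k p := by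
  unfold pdy fldP fldN
  rw [fderiv_fun_sum fun i _ => (((Pol.contDiff_ev (D i)).differentiable one_ne_zero p).const_mul _)]
  rw [_root_.sum_apply]
  refine Finset.sum_congr rfl fun i _ => ?_
  rw [fderiv_const_mul ((Pol.contDiff_ev (D i)).differentiable one_ne_zero p)]
  simp only [← Pol.pdy_ev]; rfl

lemma triInt_ev_mul (P R : Pol) : triInt (fun p => P.ev p * R.ev p) = (Pol.J (P.mul R)).val := by
  rw [← Pol.triInt_ev]; congr 1; ext p; rw [Pol.ev_mul]

lemma fldP_pair {n : ℕ} (hn : n = 5 ∨ n = 6) (v : Fin 8 → ℝ) (D D' : Fin 8 → Pol) :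
    ∑ k, triInt (fun p => fldP n v D k p * fldP n v D' k p) =
      quadM n v (fun i j => (Pol.J ((D i).mul (D' j))).val) := by
  rw [← triInt_sum (f := fun k p => fldP n v D k p * fldP n v D' k p) _
    fun k => (continuous_fldP n v D k).mul (continuous_fldP n v D' k)]
  simp only [fldP, fldN_sum hn]
  simp only [quadM, ← triInt_ev_mul]
  have hc : ∀ i j, Continuous fun p => (D i).ev p * (D' j).ev p := fun i j =>
    (Pol.continuous_ev _).mul (Pol.continuous_ev _)
  simp (disch := fun_prop) only [triInt_add, triInt_const_mul, triInt_sub]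

/-- Coefficients of the Dirichlet form. -/
def dirC (n : ℕ) (κ : ℝ) : Fin n → Fin 4 → ℝ := fun _ => ![1, 0, κ, 0]
/-- Coefficients of the mass form. -/
def masC (n : ℕ) : Fin n → Fin 4 → ℝ := fun _ => ![0, 0, 0, 1]

lemma frmD_dirC {n : ℕ} (κ : ℝ) (k : Fin n) (v w : ℝ × ℝ → ℝ) (p : ℝ × ℝ) :
    frmD (dirC n κ k) v w p = pdx v p * pdx w p + κ * (pdy v p * pdy w p) := by
  simp [frmD, dirC]
lemma frmD_masC {n : ℕ} (k : Fin n) (v w : ℝ × ℝ → ℝ) (p : ℝ × ℝ) :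
    frmD (masC n k) v w p = v p * w p := by
  simp [frmD, masC]

lemma pdx_sub {f g : ℝ × ℝ → ℝ} (hf : ContDiff ℝ 1 f) (hg : ContDiff ℝ 1 g) (p : ℝ × ℝ) :
    pdx (f - g) p = pdx f p - pdx g p := by
  unfold pdx
  rw [fderiv_sub (hf.differentiable one_ne_zero p) (hg.differentiable one_ne_zero p)]; rfl
lemma pdy_sub {f g : ℝ × ℝ → ℝ} (hf : ContDiff ℝ 1 f) (hg : ContDiff ℝ 1 g) (p : ℝ × ℝ) :
    pdy (f - g) p = pdy f p - pdy g p := by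
  unfold pdy
  rw [fderiv_sub (hf.differentiable one_ne_zero p) (hg.differentiable one_ne_zero p)]; rfl

/-- A lower bound for a linear-quadratic functional from a trial tuple `f` and a trial flux
`(g, h)`, on tuples `w` for which `w - f` satisfies a spectral gap inequality. -/
lemma dual_bound {n : ℕ} [NeZero n] {κ e s l L : ℝ} (hκ : 0 < κ) (hes : s < e) (hs : 0 < s) (hsL : l < s * L)
    {σ₁ σ₂ σ₀ : Fin n → ℝ × ℝ → ℝ} (h1 : ∀ k, Continuous (σ₁ k)) (h2 : ∀ k, Continuous (σ₂ k))
    (h0 : ∀ k, Continuous (σ₀ k)) (f w : Tup n) {g h : Fin n → ℝ × ℝ → ℝ} (hF : IsFlux g h)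
    (hz : L * frm (masC n) (w - f) (w - f) ≤ frm (dirC n κ) (w - f) (w - f)) :
    ∑ k, triInt (fun p => 2 * (σ₁ k p * pdx (f.1 k) p + σ₂ k p * pdy (f.1 k) p + σ₀ k p * f.1 k p) +
      e * (pdx (f.1 k) p ^ 2 + κ * pdy (f.1 k) p ^ 2) - l * f.1 k p ^ 2 -
      ((e - s)⁻¹ * ((σ₁ k p + e * pdx (f.1 k) p - g k p) ^ 2 +
        κ⁻¹ * (σ₂ k p + e * (κ * pdy (f.1 k) p) - h k p) ^ 2) +
      (s * L - l)⁻¹ * (σ₀ k p - l * f.1 k p - (pdx (g k) p + pdy (h k) p)) ^ 2)) ≤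
    ∑ k, triInt (fun p => 2 * (σ₁ k p * pdx (w.1 k) p + σ₂ k p * pdy (w.1 k) p + σ₀ k p * w.1 k p)) +
      e * frm (dirC n κ) w w - l * frm (masC n) w w := by
  set z := w - f with hzdef
  have hfl := hF.sum_eq_zero z
  obtain ⟨hg, hh, -⟩ := hF
  have cg := fun k => (hg k).continuous
  have ch := fun k => (hh k).continuous
  have cgx := fun k => continuous_pdx (hg k)
  have chy := fun k => continuous_pdy (hh k)
  have cf := fun k => tup_continuous f k
  have cfx := fun k => tup_continuous_pdx f k
  have cfy := fun k => tup_continuous_pdy f k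
  have cw := fun k => tup_continuous w k
  have cwx := fun k => tup_continuous_pdx w k
  have cwy := fun k => tup_continuous_pdy w k
  have cz := fun k => tup_continuous z k
  have czx := fun k => tup_continuous_pdx z k
  have czy := fun k => tup_continuous_pdy z k
  have key : ∀ k, triInt (fun p => 2 * (σ₁ k p * pdx (f.1 k) p + σ₂ k p * pdy (f.1 k) p + σ₀ k p * f.1 k p) +
      e * (pdx (f.1 k) p ^ 2 + κ * pdy (f.1 k) p ^ 2) - l * f.1 k p ^ 2 -
      ((e - s)⁻¹ * ((σ₁ k p + e * pdx (f.1 k) p - g k p) ^ 2 +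
        κ⁻¹ * (σ₂ k p + e * (κ * pdy (f.1 k) p) - h k p) ^ 2) +
      (s * L - l)⁻¹ * (σ₀ k p - l * f.1 k p - (pdx (g k) p + pdy (h k) p)) ^ 2)) ≤
      triInt (fun p => 2 * (σ₁ k p * pdx (w.1 k) p + σ₂ k p * pdy (w.1 k) p + σ₀ k p * w.1 k p)) +
      e * triInt (frmD (dirC n κ k) (w.1 k) (w.1 k)) - l * triInt (frmD (masC n k) (w.1 k) (w.1 k)) -
      2 * triInt (fun p => g k p * pdx (z.1 k) p + h k p * pdy (z.1 k) p +
      (pdx (g k) p + pdy (h k) p) * z.1 k p) - s * triInt (frmD (dirC n κ k) (z.1 k) (z.1 k)) +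
      s * L * triInt (frmD (masC n k) (z.1 k) (z.1 k)) := by
    intro k
    have c1 := continuous_frmD (dirC n κ k) w w k
    have c2 := continuous_frmD (masC n k) w w k
    have c3 := continuous_frmD (dirC n κ k) z z k
    have c4 := continuous_frmD (masC n k) z z k
    have E : triInt (fun p => 2 * (σ₁ k p * pdx (w.1 k) p + σ₂ k p * pdy (w.1 k) p + σ₀ k p * w.1 k p)) +
      e * triInt (frmD (dirC n κ k) (w.1 k) (w.1 k)) - l * triInt (frmD (masC n k) (w.1 k) (w.1 k)) -
      2 * triInt (fun p => g k p * pdx (z.1 k) p + h k p * pdy (z.1 k) p +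
      (pdx (g k) p + pdy (h k) p) * z.1 k p) - s * triInt (frmD (dirC n κ k) (z.1 k) (z.1 k)) +
      s * L * triInt (frmD (masC n k) (z.1 k) (z.1 k)) =
      triInt (fun p => 2 * (σ₁ k p * pdx (w.1 k) p + σ₂ k p * pdy (w.1 k) p + σ₀ k p * w.1 k p) +
      e * (frmD (dirC n κ k) (w.1 k) (w.1 k) p) - l * (frmD (masC n k) (w.1 k) (w.1 k) p) -
      2 * (g k p * pdx (z.1 k) p + h k p * pdy (z.1 k) p +
      (pdx (g k) p + pdy (h k) p) * z.1 k p) - s * (frmD (dirC n κ k) (z.1 k) (z.1 k) p) +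
      s * L * (frmD (masC n k) (z.1 k) (z.1 k) p)) := by
      symm
      rw [triInt_add (by fun_prop) (by fun_prop), triInt_sub (by fun_prop) (by fun_prop),
        triInt_sub (by fun_prop) (by fun_prop), triInt_sub (by fun_prop) (by fun_prop),
        triInt_add (by fun_prop) (by fun_prop)]
      simp only [triInt_const_mul]
    rw [E]
    refine triInt_mono (by fun_prop) (by fun_prop) fun p _ => ?_
    have ex : pdx (w.1 k) p = pdx (f.1 k) p + pdx (z.1 k) p := by
      have := pdx_sub (tup_contDiff w k) (tup_contDiff f k) p
      have e2 : z.1 k = w.1 k - f.1 k := rfl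
      rw [e2, this]; ring
    have ey : pdy (w.1 k) p = pdy (f.1 k) p + pdy (z.1 k) p := by
      have := pdy_sub (tup_contDiff w k) (tup_contDiff f k) p
      have e2 : z.1 k = w.1 k - f.1 k := rfl
      rw [e2, this]; ring
    have e0 : w.1 k p = f.1 k p + z.1 k p := by
      have e2 : z.1 k = w.1 k - f.1 k := rfl
      rw [e2, Pi.sub_apply]; ring
    simp only [frmD_dirC, frmD_masC]
    rw [ex, ey, e0]
    have a1 : 0 < e - s := by linarith
    have a2 : 0 < s * L - l := by linarith
    generalize pdx (f.1 k) p = fx, pdy (f.1 k) p = fy, f.1 k p = f0, pdx (z.1 k) p = zx,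
      pdy (z.1 k) p = zy, z.1 k p = z0, pdx (g k) p + pdy (h k) p = dv, g k p = gg, h k p = hh,
      σ₁ k p = s1, σ₂ k p = s2, σ₀ k p = s0
    have q1 : 0 ≤ (e - s)⁻¹ * (s1 + e * fx - gg + (e - s) * zx) ^ 2 := by positivity
    have q2 : 0 ≤ ((e - s)⁻¹ * κ⁻¹) * (s2 + e * (κ * fy) - hh + (e - s) * κ * zy) ^ 2 := by positivity
    have q3 : 0 ≤ (s * L - l)⁻¹ * (s0 - l * f0 - dv + (s * L - l) * z0) ^ 2 := by positivity
    have r1 : (e - s)⁻¹ * (e - s) = 1 := inv_mul_cancel₀ a1.ne'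
    have r2 : κ⁻¹ * κ = 1 := inv_mul_cancel₀ hκ.ne'
    have r3 : (s * L - l)⁻¹ * (s * L - l) = 1 := inv_mul_cancel₀ a2.ne'
    generalize (e - s)⁻¹ = i1, κ⁻¹ = i2, (s * L - l)⁻¹ = i3 at *
    have q1' : i1 * (s1 + e * fx - gg + (e - s) * zx) ^ 2 = i1 * (s1 + e * fx - gg) ^ 2 +
        2 * (s1 + e * fx - gg) * zx + (e - s) * zx ^ 2 := by
      linear_combination (2 * (s1 + e * fx - gg) * zx + (e - s) * zx ^ 2) * r1
    have q2' : (i1 * i2) * (s2 + e * (κ * fy) - hh + (e - s) * κ * zy) ^ 2 =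
        i1 * i2 * (s2 + e * (κ * fy) - hh) ^ 2 + 2 * (s2 + e * (κ * fy) - hh) * zy +
        (e - s) * κ * zy ^ 2 := by
      linear_combination (2 * (s2 + e * (κ * fy) - hh) * zy + (e - s) * κ * zy ^ 2) * i2 * κ * r1 +
        (2 * (s2 + e * (κ * fy) - hh) * zy + (e - s) * κ * zy ^ 2) * r2
    have q3' : i3 * (s0 - l * f0 - dv + (s * L - l) * z0) ^ 2 = i3 * (s0 - l * f0 - dv) ^ 2 +
        2 * (s0 - l * f0 - dv) * z0 + (s * L - l) * z0 ^ 2 := by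
      linear_combination (2 * (s0 - l * f0 - dv) * z0 + (s * L - l) * z0 ^ 2) * r3
    linarith
  refine (Finset.sum_le_sum fun k _ => key k).trans ?_
  simp only [Finset.sum_add_distrib, Finset.sum_sub_distrib, ← Finset.mul_sum]
  rw [hfl]
  simp only [← frm_apply]
  nlinarith

section
/-- Constants and trial polynomials for the second order estimate. -/
structure Cert where
  kap : Q5
  ikap : Q5
  t1 : Q5
  t2 : Q5
  ra2 : Q5
  s1 : Q5
  s2 : Q5
  lam : ℚ
  Lp : ℚ
  ec : ℚ
  s : ℚ
  u : Pol
  E : Fin 8 → Pol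
  y1 : Fin 8 → Pol
  y2 : Fin 8 → Pol

namespace Pol
/-- The polynomial `1 - X`. -/
def oneSubX : Pol := [(⟨1, 0⟩, 0, 0), (⟨-1, 0⟩, 1, 0)]
def ofInts (L : List (ℤ × ℕ × ℕ)) : Pol := L.map fun t => (⟨t.1 / 1000, 0⟩, t.2)
def rsmul (c : ℚ) (P : Pol) : Pol := smul (Q5.ofRat c) P
lemma ev_rsmul (c : ℚ) (P : Pol) (p : ℝ × ℝ) : ev (rsmul c P) p = c * ev P p := by
  rw [rsmul, ev_smul, Q5.val_ofRat]
lemma ev_oneSubX (p : ℝ × ℝ) : ev oneSubX p = 1 - p.1 := by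
  simp [oneSubX, Q5.val]; ring
end Pol

namespace Cert
variable (C : Cert)
open Pol
def U : Pol := norm (mul oneSubX C.u)
def Ux : Pol := norm (dX C.U)
def Uy : Pol := norm (dY C.U)
def F (i : Fin 8) : Pol := norm (mul oneSubX (C.E i))
def Fx (i : Fin 8) : Pol := norm (dX (C.F i))
def Fy (i : Fin 8) : Pol := norm (smul C.kap (dY (C.F i)))
def S1 : Fin 8 → Pol := ![rsmul (-2) C.Ux, smul ((Q5.ofRat 2).mul C.kap) C.Uy, rsmul (-2) C.Ux, [], [],
  smul ((Q5.ofRat 2).mul C.ra2) C.Uy, rsmul (-2) C.Ux, rsmul (-2) C.Uy]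
def S2 : Fin 8 → Pol := ![smul ((Q5.ofRat 2).mul C.kap) C.Uy, smul ((Q5.ofRat 2).mul C.kap) C.Ux,
  smul ((Q5.ofRat 2).mul C.kap) C.Uy, [], [], smul ((Q5.ofRat 2).mul C.ra2) C.Ux,
  smul ((Q5.ofRat 2).mul C.kap) C.Uy, rsmul (-2) C.Ux]
def S0 : Fin 8 → Pol := ![smul ((Q5.ofRat (2 * C.lam)).mul C.s1) C.U, [],
  smul ((Q5.ofRat C.lam).mul C.s2) C.U, [], smul ((Q5.ofRat C.lam).mul C.s2) C.U, [],
  rsmul C.lam C.U, []]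
def P1 (i : Fin 8) : Pol := norm (rsmul 2 (C.S1 i) ++ rsmul C.ec (C.Fx i))
def P2 (i : Fin 8) : Pol := norm (rsmul 2 (C.S2 i) ++ rsmul C.ec (C.Fy i))
def P0 (i : Fin 8) : Pol := norm (rsmul 2 (C.S0 i) ++ rsmul (-C.lam) (C.F i))
def R1 (i : Fin 8) : Pol := norm (C.S1 i ++ rsmul C.ec (C.Fx i) ++ rsmul (-1) (C.y1 i))
def R2 (i : Fin 8) : Pol := norm (C.S2 i ++ rsmul C.ec (C.Fy i) ++ rsmul (-1) (C.y2 i))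
def R0 (i : Fin 8) : Pol := norm (C.S0 i ++ rsmul (-C.lam) (C.F i) ++
  rsmul (-1) (dX (C.y1 i) ++ dY (C.y2 i)))
def dens (i j : Fin 8) : Q5 :=
  ((J (mul (C.P1 i) (C.Fx j))).add (J (mul (C.P0 i) (C.F j)))).add <|
  (C.ikap.mul (J (mul (C.P2 i) (C.Fy j)))).add <|
  ((Q5.ofRat (-(C.ec - C.s)⁻¹)).mul
    ((J (mul (C.R1 i) (C.R1 j))).add (C.ikap.mul (J (mul (C.R2 i) (C.R2 j)))))).add <|
  (Q5.ofRat (-(C.s * C.Lp - C.lam)⁻¹)).mul (J (mul (C.R0 i) (C.R0 j)))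

def matchB (P M : Fin 8 → Pol) : Bool :=
  (vanDiag (P 0 ++ smul C.t1 (P 1) ++ rsmul (-1) (M 0) ++ smul C.t1 (M 1)) &&
    vanDiag (P 1 ++ rsmul (-1) (P 0) ++ rsmul (-1) (M 1) ++ rsmul (-1) (M 0))) &&
  (vanDiag (P 2 ++ smul C.t2 (P 3) ++ rsmul (-1) (M 2) ++ smul C.t2 (M 3)) &&
    vanDiag (P 3 ++ rsmul (-1) (P 2) ++ rsmul (-1) (M 3) ++ rsmul (-1) (M 2))) &&
  (vanDiag (P 4 ++ smul C.t2 (P 5) ++ rsmul (-1) (M 4) ++ smul C.t2 (M 5)) &&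
    vanDiag (P 5 ++ rsmul (-1) (P 4) ++ rsmul (-1) (M 5) ++ rsmul (-1) (M 4))) &&
  (vanDiag (P 6 ++ M 6) && vanDiag (P 7 ++ M 7))

/-- The constants of the certificate are those of the regular `n`-gon, and the trial
polynomials are admissible. -/
structure Valid (n : ℕ) (κ : ℝ) : Prop where
  hn : n = 5 ∨ n = 6
  kap : C.kap.val = κ
  kap_pos : 0 < κ
  ikap : C.ikap.val = κ⁻¹
  t1 : C.t1.val = tn n 1 ^ 2
  t2 : C.t2.val = tn n 2 ^ 2
  hes : C.s < C.ec
  hs : 0 < C.s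
  hsL : C.lam < C.s * C.Lp
  matchF : C.matchB C.F (fun i => refl (C.F i)) = true
  matchY : C.matchB (fun i => C.y2 i ++ rsmul (-1) (C.y1 i)) (fun i => refl (C.y2 i ++ C.y1 i)) = true

variable {C} {n : ℕ} {κ : ℝ}

lemma Valid.match_of (h : C.Valid n κ) {P M : Fin 8 → Pol} (hm : C.matchB P M = true) (t : ℝ) :
    Match n (fun i => (P i).ev (t, t)) (fun i => (M i).ev (t, t)) := by
  simp only [matchB, Bool.and_eq_true] at hm
  obtain ⟨⟨⟨⟨a1, a2⟩, b1, b2⟩, c1, c2⟩, d1, d2⟩ := hm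
  replace a1 := ev_eq_zero_of_vanDiag a1 t
  replace a2 := ev_eq_zero_of_vanDiag a2 t
  replace b1 := ev_eq_zero_of_vanDiag b1 t
  replace b2 := ev_eq_zero_of_vanDiag b2 t
  replace c1 := ev_eq_zero_of_vanDiag c1 t
  replace c2 := ev_eq_zero_of_vanDiag c2 t
  replace d1 := ev_eq_zero_of_vanDiag d1 t
  replace d2 := ev_eq_zero_of_vanDiag d2 t
  simp only [ev_append, ev_rsmul, ev_smul, h.t1, h.t2] at a1 a2 b1 b2 c1 c2 d1 d2
  push_cast at *
  refine ⟨⟨?_, ?_⟩, ⟨?_, ?_⟩, ⟨?_, ?_⟩, ?_, ?_⟩ <;> linarith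

/-- The trial tuple. -/
noncomputable def Valid.f [NeZero n] (h : C.Valid n κ) (v : Fin 8 → ℝ) : Tup n :=
  ⟨fldP n v C.F, fun k => contDiff_fldP n v C.F k, fun k t _ => by
    have := fldN_match h.hn v (h.match_of h.matchF t) k
    simp only [ev_refl] at this
    exact this, fun k y _ => by
    unfold fldP fldN
    refine Finset.sum_eq_zero fun i _ => ?_
    have : (C.F i).ev (1, y) = 0 := by
      unfold F; rw [ev_norm, ev_mul, ev_oneSubX]; simp
    exact mul_eq_zero_of_right _ this⟩

lemma Valid.sum_f [NeZero n] (h : C.Valid n κ) (v : Fin 8 → ℝ) (p : ℝ × ℝ) :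
    ∑ k, (h.f v).1 k p = 0 :=
  fldN_sum_zero h.hn v (fun i => (C.F i).ev p)

lemma Valid.isFlux [NeZero n] (h : C.Valid n κ) (v : Fin 8 → ℝ) :
    IsFlux (fldP n v C.y1) (fldP n v C.y2) := by
  refine ⟨contDiff_fldP n v _, contDiff_fldP n v _, fun k t _ => ?_⟩
  have := fldN_match h.hn v (h.match_of h.matchY t) k
  simp only [ev_refl, ev_append, ev_rsmul, fldN_add, fldN_smul] at this
  unfold fldP
  push_cast at this
  linarith

lemma fldP_congr {D D' : Fin 8 → Pol} {v : Fin 8 → ℝ} {k : Fin n} {p : ℝ × ℝ}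
    (h : ∀ i, (D i).ev p = (D' i).ev p) : fldP n v D k p = fldP n v D' k p := by
  unfold fldP; congr 1; ext i; exact h i
lemma fldP_norm (D : Fin 8 → Pol) (v : Fin 8 → ℝ) (k : Fin n) (p : ℝ × ℝ) :
    fldP n v (fun i => norm (D i)) k p = fldP n v D k p := fldP_congr fun i => ev_norm _ _
lemma fldP_append (D D' : Fin 8 → Pol) (v : Fin 8 → ℝ) (k : Fin n) (p : ℝ × ℝ) :
    fldP n v (fun i => D i ++ D' i) k p = fldP n v D k p + fldP n v D' k p := by
  unfold fldP; rw [← fldN_add]; congr 1; ext i; exact ev_append _ _ _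
lemma fldP_rsmul (c : ℚ) (D : Fin 8 → Pol) (v : Fin 8 → ℝ) (k : Fin n) (p : ℝ × ℝ) :
    fldP n v (fun i => rsmul c (D i)) k p = c * fldP n v D k p := by
  unfold fldP; rw [← fldN_smul]; congr 1; ext i; exact ev_rsmul _ _ _
lemma fldP_smul (c : Q5) (D : Fin 8 → Pol) (v : Fin 8 → ℝ) (k : Fin n) (p : ℝ × ℝ) :
    fldP n v (fun i => smul c (D i)) k p = c.val * fldP n v D k p := by
  unfold fldP; rw [← fldN_smul]; congr 1; ext i; exact ev_smul _ _ _

lemma quadM_add (v : Fin 8 → ℝ) (M M' : Fin 8 → Fin 8 → ℝ) :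
    quadM n v (fun i j => M i j + M' i j) = quadM n v M + quadM n v M' := by
  unfold quadM; ring
lemma quadM_smul (c : ℝ) (v : Fin 8 → ℝ) (M : Fin 8 → Fin 8 → ℝ) :
    quadM n v (fun i j => c * M i j) = c * quadM n v M := by
  unfold quadM; ring

theorem Valid.bound [NeZero n] (h : C.Valid n κ) (v : Fin 8 → ℝ) (w : Tup n)
    (hz : ∀ f : Tup n, (∀ p, ∑ k, f.1 k p = 0) →
      C.Lp * frm (masC n) (w - f) (w - f) ≤ frm (dirC n κ) (w - f) (w - f)) :
    quadM n v (fun i j => (C.dens i j).val) ≤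
    ∑ k, triInt (fun p => 2 * (fldP n v C.S1 k p * pdx (w.1 k) p + fldP n v C.S2 k p * pdy (w.1 k) p +
      fldP n v C.S0 k p * w.1 k p)) +
      C.ec * frm (dirC n κ) w w - C.lam * frm (masC n) w w := by
  have hes : (C.s : ℝ) < C.ec := by exact_mod_cast h.hes
  have hs : (0 : ℝ) < C.s := by exact_mod_cast h.hs
  have hsL : (C.lam : ℝ) < C.s * C.Lp := by exact_mod_cast h.hsL
  have := dual_bound h.kap_pos hes hs hsL (fun k => continuous_fldP n v C.S1 k)
    (fun k => continuous_fldP n v C.S2 k) (fun k => continuous_fldP n v C.S0 k) (h.f v) w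
    (h.isFlux v) (hz _ (h.sum_f v))
  refine le_trans (le_of_eq ?_) this
  have cc := fun (D : Fin 8 → Pol) (k : Fin n) => continuous_fldP n v D k
  have e : ∀ k : Fin n, triInt (fun p => 2 * (fldP n v C.S1 k p * pdx ((h.f v).1 k) p +
      fldP n v C.S2 k p * pdy ((h.f v).1 k) p + fldP n v C.S0 k p * (h.f v).1 k p) +
      C.ec * (pdx ((h.f v).1 k) p ^ 2 + κ * pdy ((h.f v).1 k) p ^ 2) - C.lam * (h.f v).1 k p ^ 2 -
      ((C.ec - C.s : ℝ)⁻¹ * ((fldP n v C.S1 k p + C.ec * pdx ((h.f v).1 k) p - fldP n v C.y1 k p) ^ 2 +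
        κ⁻¹ * (fldP n v C.S2 k p + C.ec * (κ * pdy ((h.f v).1 k) p) - fldP n v C.y2 k p) ^ 2) +
      (C.s * C.Lp - C.lam : ℝ)⁻¹ * (fldP n v C.S0 k p - C.lam * (h.f v).1 k p -
        (pdx (fldP n v C.y1 k) p + pdy (fldP n v C.y2 k) p)) ^ 2)) =
      (triInt (fun p => fldP n v C.P1 k p * fldP n v C.Fx k p) +
        triInt (fun p => fldP n v C.P0 k p * fldP n v C.F k p)) +
      (κ⁻¹ * triInt (fun p => fldP n v C.P2 k p * fldP n v C.Fy k p) +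
      ((-(C.ec - C.s : ℝ)⁻¹) * (triInt (fun p => fldP n v C.R1 k p * fldP n v C.R1 k p) +
        κ⁻¹ * triInt (fun p => fldP n v C.R2 k p * fldP n v C.R2 k p)) +
      (-(C.s * C.Lp - C.lam : ℝ)⁻¹) * triInt (fun p => fldP n v C.R0 k p * fldP n v C.R0 k p))) := by
    intro k
    have c1 := cc C.P1 k; have c2 := cc C.P2 k; have c3 := cc C.P0 k; have c4 := cc C.Fx k
    have c5 := cc C.Fy k; have c6 := cc C.F k; have c7 := cc C.R1 k; have c8 := cc C.R2 k
    have c9 := cc C.R0 k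
    simp (disch := fun_prop) only [← triInt_const_mul, ← triInt_add]
    congr 1; ext p
    have k0 : (h.f v).1 k p = fldP n v C.F k p := rfl
    have k1 : pdx ((h.f v).1 k) p = fldP n v C.Fx k p :=
      (pdx_fldP n v C.F k p).trans (fldP_norm _ v k p).symm
    have k2 : κ * pdy ((h.f v).1 k) p = fldP n v C.Fy k p := by
      have e1 : pdy ((h.f v).1 k) p = _ := pdy_fldP n v C.F k p
      have e2 : fldP n v C.Fy k p = _ := (fldP_norm _ v k p).trans (fldP_smul C.kap _ v k p)
      rw [e1, e2, h.kap]
    have p1 : fldP n v C.P1 k p = 2 * fldP n v C.S1 k p + C.ec * fldP n v C.Fx k p := by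
      have e2 : fldP n v C.P1 k p = _ := (fldP_norm _ v k p).trans (fldP_append _ _ v k p)
      rw [e2, fldP_rsmul, fldP_rsmul]; push_cast; rfl
    have p2 : fldP n v C.P2 k p = 2 * fldP n v C.S2 k p + C.ec * fldP n v C.Fy k p := by
      have e2 : fldP n v C.P2 k p = _ := (fldP_norm _ v k p).trans (fldP_append _ _ v k p)
      rw [e2, fldP_rsmul, fldP_rsmul]; push_cast; rfl
    have p0 : fldP n v C.P0 k p = 2 * fldP n v C.S0 k p - C.lam * fldP n v C.F k p := by
      have e2 : fldP n v C.P0 k p = _ := (fldP_norm _ v k p).trans (fldP_append _ _ v k p)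
      rw [e2, fldP_rsmul, fldP_rsmul]; push_cast; ring
    have r1 : fldP n v C.R1 k p = fldP n v C.S1 k p + C.ec * fldP n v C.Fx k p - fldP n v C.y1 k p := by
      have e2 : fldP n v C.R1 k p = _ := (fldP_norm _ v k p).trans (fldP_append _ _ v k p)
      rw [e2, fldP_append, fldP_rsmul, fldP_rsmul]; push_cast; ring
    have r2 : fldP n v C.R2 k p = fldP n v C.S2 k p + C.ec * fldP n v C.Fy k p - fldP n v C.y2 k p := by
      have e2 : fldP n v C.R2 k p = _ := (fldP_norm _ v k p).trans (fldP_append _ _ v k p)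
      rw [e2, fldP_append, fldP_rsmul, fldP_rsmul]; push_cast; ring
    have r0 : fldP n v C.R0 k p = fldP n v C.S0 k p - C.lam * fldP n v C.F k p -
        (pdx (fldP n v C.y1 k) p + pdy (fldP n v C.y2 k) p) := by
      have e2 : fldP n v C.R0 k p = _ := (fldP_norm _ v k p).trans (fldP_append _ _ v k p)
      rw [e2, fldP_append, fldP_rsmul, fldP_rsmul, fldP_append, pdx_fldP, pdy_fldP]; push_cast; ring
    have hk : κ⁻¹ * κ = 1 := inv_mul_cancel₀ h.kap_pos.ne'
    rw [p1, p2, p0, r1, r2, r0, k0, ← k2, ← k1]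
    generalize pdx ((h.f v).1 k) p = fx, pdy ((h.f v).1 k) p = fy, fldP n v C.F k p = f0
    linear_combination (-(2 * fldP n v C.S2 k p * fy) - C.ec * κ * fy ^ 2) * hk
  simp only [e, Finset.sum_add_distrib, ← Finset.mul_sum]
  simp only [fldP_pair h.hn]
  simp only [← quadM_smul, ← quadM_add]
  congr 1
  ext i j
  simp only [dens, Q5.val_add, Q5.val_mul, Q5.val_ofRat, h.ikap]
  push_cast
  ring
end Cert
end

open Pol in
/-- Trial data for the regular pentagon. -/
def Cert.pentagon : Cert where
  kap := ⟨1, 2/5⟩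
  ikap := ⟨5, -2⟩
  t1 := ⟨5, -2⟩
  t2 := ⟨5, 2⟩
  ra2 := ⟨0, 1/5⟩
  s1 := ⟨1/2, 1/2⟩
  s2 := ⟨-1/2, 1/2⟩
  lam := 5209/1000
  Lp := 181/20
  ec := 9/10
  s := 299/500
  u := ofInts [(1960, 0, 0), (-1351, 0, 2), (2038, 1, 0), (-1345, 1, 2), (-966, 2, 0), (-14, 3, 0)]
  E := ![ofInts [(10543, 0, 2), (-6324, 1, 0), (1575, 2, 0)],
    ofInts [(-6324, 0, 1), (12118, 1, 1)],
    ofInts [(2083, 0, 2), (129, 1, 0), (-1607, 2, 0)],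
    ofInts [(129, 0, 1), (476, 1, 1)],
    ofInts [(2216, 0, 2), (-98, 1, 0), (-32, 2, 0)],
    ofInts [(-98, 0, 1), (2184, 1, 1)],
    ofInts [],
    ofInts []]
  y1 := ![ofInts [(-4764, 0, 0), (10204, 0, 2), (4701, 0, 4), (15721, 1, 0), (-61920, 1, 2), (13782, 2, 0), (34969, 2, 2), (-15325, 3, 0), (446, 4, 0)],
    smul ⟨1, 2/5⟩ (ofInts [(580, 0, 1), (-9050, 0, 3), (1328, 1, 1), (12394, 1, 3), (-5594, 2, 1), (-1428, 3, 1)]),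
    ofInts [(-30, 0, 0), (-1464, 0, 2), (444, 0, 4), (7198, 1, 0), (-11012, 1, 2), (3627, 2, 0), (5624, 2, 2), (-1309, 3, 0), (-2632, 4, 0)],
    smul ⟨1, -2/5⟩ (ofInts [(8806, 0, 1), (-11586, 0, 3), (-24061, 1, 1), (14358, 1, 3), (9588, 2, 1), (460, 3, 1)]),
    ofInts [(38, 0, 0), (1707, 0, 2), (1506, 0, 4), (-923, 1, 0), (-11444, 1, 2), (2396, 2, 0), (7171, 2, 2), (-1555, 3, 0), (113, 4, 0)],
    smul ⟨1, -2/5⟩ (ofInts [(-8029, 0, 1), (-42276, 0, 3), (-1401, 1, 1), (64014, 1, 3), (-7734, 2, 1), (-15068, 3, 1)]),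
    ofInts [],
    ofInts []]
  y2 := ![ofInts [(17073, 0, 1), (-9516, 0, 3), (10107, 1, 1), (6616, 1, 3), (-53953, 2, 1), (27846, 3, 1)],
    smul ⟨1, 2/5⟩ (ofInts [(-4764, 0, 0), (7982, 0, 2), (-3126, 0, 4), (-772, 1, 0), (-19498, 1, 2), (7225, 2, 0), (18623, 2, 2), (-8922, 3, 0), (1123, 4, 0)]),
    ofInts [(-927, 0, 1), (-2181, 0, 3), (-7250, 1, 1), (2049, 1, 3), (2212, 2, 1), (6011, 3, 1)],
    smul ⟨1, -2/5⟩ (ofInts [(-30, 0, 0), (8889, 0, 2), (-3600, 0, 4), (16931, 1, 0), (-18118, 1, 2), (-23537, 2, 0), (10966, 2, 2), (3768, 3, 0), (2828, 4, 0)]),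
    ofInts [(7172, 0, 1), (-2294, 0, 3), (-3273, 1, 1), (1282, 1, 3), (-7072, 2, 1), (3548, 3, 1)],
    smul ⟨1, -2/5⟩ (ofInts [(38, 0, 0), (3060, 0, 2), (-16226, 0, 4), (-16124, 1, 0), (-47329, 1, 2), (2915, 2, 0), (75563, 2, 2), (-6314, 3, 0), (-6431, 4, 0)]),
    ofInts [],
    ofInts []]

open Pol in
/-- Trial data for the regular hexagon. -/
def Cert.hexagon : Cert where
  kap := ⟨3, 0⟩
  ikap := ⟨1/3, 0⟩
  t1 := ⟨1/3, 0⟩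
  t2 := ⟨3, 0⟩
  ra2 := ⟨1, 0⟩
  s1 := ⟨2, 0⟩
  s2 := ⟨1, 0⟩
  lam := 671/125
  Lp := 493/50
  ec := 9/10
  s := 569/1000
  u := ofInts [(1942, 0, 0), (-654, 0, 2), (2017, 1, 0), (-1485, 1, 2), (-1023, 2, 0), (-28, 3, 0)]
  E := ![ofInts [(9518, 0, 2), (-8729, 1, 0), (3528, 2, 0)],
    ofInts [(-8729, 0, 1), (13046, 1, 1)],
    ofInts [(2847, 0, 2), (30, 1, 0), (-1628, 2, 0)],
    ofInts [(30, 0, 1), (1219, 1, 1)],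
    ofInts [(2758, 0, 2), (-247, 1, 0), (689, 2, 0)],
    ofInts [(-247, 0, 1), (3447, 1, 1)],
    ofInts [(2372, 0, 2), (-2372, 2, 0)],
    ofInts [(116, 0, 1), (-4716, 1, 1)]]
  y1 := ![ofInts [(-6516, 0, 0), (16006, 0, 2), (1361, 0, 4), (19395, 1, 0), (-62106, 1, 2), (19110, 2, 0), (32156, 2, 2), (-27969, 3, 0), (6605, 4, 0)],
    smul ⟨3, 0⟩ (ofInts [(1100, 0, 1), (-4886, 0, 3), (-1077, 1, 1), (6254, 1, 3), (889, 2, 1), (-3604, 3, 1)]),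
    ofInts [(43, 0, 0), (4080, 0, 2), (381, 0, 4), (7744, 1, 0), (-22090, 1, 2), (-1134, 2, 0), (11613, 2, 2), (6363, 3, 0), (-6173, 4, 0)],
    smul ⟨1/3, 0⟩ (ofInts [(2497, 0, 1), (-4912, 0, 3), (3022, 1, 1), (5535, 1, 3), (-21852, 2, 1), (13460, 3, 1)]),
    ofInts [(97, 0, 0), (4841, 0, 2), (933, 0, 4), (-844, 1, 0), (-18602, 1, 2), (4144, 2, 0), (10817, 2, 2), (-6723, 3, 0), (3128, 4, 0)],
    smul ⟨1/3, 0⟩ (ofInts [(-2967, 0, 1), (-18814, 0, 3), (-6756, 1, 1), (26563, 1, 3), (9122, 2, 1), (-14245, 3, 1)]),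
    ofInts [(50, 0, 0), (241, 0, 2), (174, 0, 4), (4929, 1, 0), (-11690, 1, 2), (6353, 2, 0), (5561, 2, 2), (1378, 3, 0), (-5423, 4, 0)],
    ofInts [(-285, 0, 1), (7842, 0, 3), (3822, 1, 1), (-10690, 1, 3), (660, 2, 1), (1829, 3, 1)]]
  y2 := ![ofInts [(21968, 0, 1), (-7131, 0, 3), (15057, 1, 1), (6108, 1, 3), (-59128, 2, 1), (22177, 3, 1)],
    smul ⟨3, 0⟩ (ofInts [(-6516, 0, 0), (8256, 0, 2), (-1574, 0, 4), (-1473, 1, 0), (-20129, 1, 2), (10726, 2, 0), (16952, 2, 2), (-7684, 3, 0), (-891, 4, 0)]),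
    ofInts [(2589, 0, 1), (-412, 0, 3), (3670, 1, 1), (-50, 1, 3), (-29335, 2, 1), (23270, 3, 1)],
    smul ⟨1/3, 0⟩ (ofInts [(43, 0, 0), (-1752, 0, 2), (-1381, 0, 4), (7652, 1, 0), (12295, 1, 2), (4050, 2, 0), (-10407, 2, 2), (-25039, 3, 0), (13384, 4, 0)]),
    ofInts [(11157, 0, 1), (-1443, 0, 3), (-5099, 1, 1), (359, 1, 3), (-4590, 2, 1), (-1207, 3, 1)],
    smul ⟨1/3, 0⟩ (ofInts [(97, 0, 0), (5202, 0, 2), (-6726, 0, 4), (-14968, 1, 0), (-38129, 1, 2), (2126, 2, 0), (48672, 2, 2), (9145, 3, 0), (-13902, 4, 0)]),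
    ofInts [(5428, 0, 1), (-3015, 0, 3), (-11377, 1, 1), (3119, 1, 3), (-10112, 2, 1), (16059, 3, 1)],
    ofInts [(-2181, 0, 2), (2701, 0, 4), (-285, 1, 0), (12094, 1, 2), (6003, 2, 0), (-15262, 2, 2), (-3592, 3, 0), (3700, 4, 0)]]

section
namespace Q5
def isZero (x : Q5) : Bool := x.a == 0 && x.b == 0
lemma val_of_isZero {x : Q5} (h : x.isZero = true) : x.val = 0 := by
  simp only [isZero, Bool.and_eq_true, beq_iff_eq] at h
  simp [val, h.1, h.2]
def nonneg (x : Q5) : Bool := decide (0 ≤ x.lb)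
lemma val_nonneg {x : Q5} (h : x.nonneg = true) : 0 ≤ x.val := by
  have h := of_decide_eq_true h
  exact le_trans (by exact_mod_cast h) (lb_le x)
end Q5

namespace Cert
open Pol
variable (C : Cert)
def q1 : Q5 := (J (mul C.Ux C.Ux)).add (C.kap.mul (J (mul C.Uy C.Uy)))
def del : Q5 := (J (mul C.Ux C.Ux)).add ((Q5.ofRat (-1)).mul (C.kap.mul (J (mul C.Uy C.Uy))))
def base (c0 : ℚ) : Q5 := ((Q5.ofRat 2).mul C.q1).add (Q5.ofRat (-c0))
def diag1 (c0 : ℚ) : Q5 := ((Q5.ofRat 2).mul (C.base c0)).add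
  ((C.dens 0 0).add (C.t1.mul (C.dens 1 1)))
def diag2 (c0 : ℚ) : Q5 := ((C.base c0).add ((Q5.ofRat (-1)).mul (C.s2.mul C.del))).add
  ((C.dens 2 2).add (C.t2.mul (C.dens 3 3)))
def diag4 (c0 : ℚ) : Q5 := ((C.base c0).add (C.s2.mul C.del)).add
  ((C.dens 4 4).add (C.t2.mul (C.dens 5 5)))
def off : Q5 := ((C.dens 2 4).add (C.dens 4 2)).add (C.t2.mul ((C.dens 3 5).add (C.dens 5 3)))
def diag6 (c0 : ℚ) : Q5 := ((C.base c0).add ((Q5.ofRat (-1)).mul C.del)).add (C.dens 6 6)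
def diag7 (c0 : ℚ) : Q5 := ((C.base c0).add C.del).add ((Q5.ofRat 3).mul (C.dens 7 7))

def neg (x : Q5) : Q5 := (Q5.ofRat (-1)).mul x
def mirror : Bool :=
  (((C.dens 2 5).add (C.dens 5 2)).add (neg ((C.dens 3 4).add (C.dens 4 3)))).isZero

def check (c0 : ℚ) : Bool :=
  (C.diag1 c0).nonneg && (C.diag2 c0).nonneg && (C.diag4 c0).nonneg &&
  (((Q5.ofRat 4).mul ((C.diag2 c0).mul (C.diag4 c0))).add (neg (C.off.mul C.off))).nonneg &&
  C.mirror
def check3 (c0 : ℚ) : Bool :=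
  (C.diag6 c0).nonneg && (C.diag7 c0).nonneg && ((C.dens 6 7).add (C.dens 7 6)).isZero
end Cert

lemma form_two_nonneg {a b x : ℝ} (ha : 0 ≤ a) (hb : 0 ≤ b) (h : 0 ≤ 4 * (a * b) + -1 * (x * x)) (s t s' t' : ℝ) :
    0 ≤ a * (s ^ 2 + t ^ 2) + b * (s' ^ 2 + t' ^ 2) + x * (s * s' + t * t') := by
  rcases ha.eq_or_lt with rfl | ha
  · have : x = 0 := by nlinarith
    subst this
    have := mul_nonneg hb (add_nonneg (sq_nonneg s') (sq_nonneg t'))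
    linarith
  · have h2 : 0 ≤ 4 * a * (a * (s ^ 2 + t ^ 2) + b * (s' ^ 2 + t' ^ 2) + x * (s * s' + t * t')) := by
      nlinarith [sq_nonneg (2 * a * s + x * s'), sq_nonneg (2 * a * t + x * t'),
        mul_nonneg h (sq_nonneg s'), mul_nonneg h (sq_nonneg t')]
    by_contra hc
    nlinarith [mul_pos ha (sub_pos.2 (not_le.1 hc))]

/-- The squared size of the perturbation with amplitudes `v`. -/
noncomputable def sizeV (n : ℕ) (v : Fin 8 → ℝ) : ℝ :=
  n * (v 0 ^ 2 + v 1 ^ 2 + (v 2 ^ 2 + v 3 ^ 2 + v 4 ^ 2 + v 5 ^ 2) / 2) +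
    n3 n * (v 6 ^ 2 + v 7 ^ 2 / 3)

lemma Cert.combined {C : Cert} {n : ℕ} {κ : ℝ} (h : C.Valid n κ) {c0 : ℚ}
    (hc : C.check c0 = true) (h3 : n = 6 → C.check3 c0 = true) (v : Fin 8 → ℝ) :
    c0 * sizeV n v ≤ 2 * C.q1.val * sizeV n v - C.del.val *
      (n / 2 * C.s2.val * (v 2 ^ 2 + v 3 ^ 2 - v 4 ^ 2 - v 5 ^ 2) +
        n3 n * (v 6 ^ 2 - v 7 ^ 2 / 3)) + quadM n v (fun i j => (C.dens i j).val) := by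
  simp only [check, mirror, Bool.and_eq_true] at hc
  obtain ⟨⟨⟨⟨e1, e2⟩, e4⟩, eo⟩, em⟩ := hc
  replace e1 := Q5.val_nonneg e1
  replace e2 := Q5.val_nonneg e2
  replace e4 := Q5.val_nonneg e4
  replace eo := Q5.val_nonneg eo
  replace em := Q5.val_of_isZero em
  simp only [diag1, base, neg, Q5.val_add, Q5.val_mul, Q5.val_ofRat] at e1 e2 e4 eo em
  have hf := form_two_nonneg (x := C.off.val) e2 e4 (by push_cast at eo ⊢; linarith) (v 2) (v 3) (v 4) (v 5)
  have h6 : 0 ≤ n3 n * ((2 * C.q1.val - c0) * (v 6 ^ 2 + v 7 ^ 2 / 3) - C.del.val * (v 6 ^ 2 - v 7 ^ 2 / 3) +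
      (v 6 ^ 2 * (C.dens 6 6).val + v 7 ^ 2 * (C.dens 7 7).val +
        v 6 * v 7 * ((C.dens 6 7).val + (C.dens 7 6).val))) := by
    unfold n3
    split_ifs with hn
    · have h3 := h3 hn
      simp only [check3, Bool.and_eq_true] at h3
      obtain ⟨⟨f1, f2⟩, f3⟩ := h3
      replace f1 := Q5.val_nonneg f1
      replace f2 := Q5.val_nonneg f2
      replace f3 := Q5.val_of_isZero f3
      simp only [diag6, diag7, base, Q5.val_add, Q5.val_mul, Q5.val_ofRat] at f1 f2 f3
      rw [f3]
      push_cast at *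
      nlinarith [mul_nonneg f1 (sq_nonneg (v 6)), mul_nonneg f2 (sq_nonneg (v 7))]
    · simp
  have hn : (0 : ℝ) ≤ n / 2 := by positivity
  have a1 := mul_nonneg hn (mul_nonneg e1 (add_nonneg (sq_nonneg (v 0)) (sq_nonneg (v 1))))
  have a2 := mul_nonneg hn hf
  simp only [diag2, diag4, off, base, Q5.val_add, Q5.val_mul, Q5.val_ofRat] at a2
  unfold sizeV quadM
  rw [← h.t1, ← h.t2]
  have em' : (C.dens 2 5).val + (C.dens 5 2).val - (C.dens 3 4).val - (C.dens 4 3).val = 0 := by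
    push_cast at em; linarith
  rw [em']
  push_cast at *
  linarith
end

section Symmetrization
variable {n : ℕ}

/-- Average of a tuple over the symmetries of the polygon. -/
noncomputable def symFun (W : Fin n → ℝ × ℝ → ℝ) (p : ℝ × ℝ) : ℝ :=
  (2 * n : ℝ)⁻¹ * ∑ j, (W j p + W j (p.1, -p.2))

lemma contDiff_refl {f : ℝ × ℝ → ℝ} (hf : ContDiff ℝ 1 f) :
    ContDiff ℝ 1 (fun p : ℝ × ℝ => f (p.1, -p.2)) := by
  have : ContDiff ℝ 1 (fun p : ℝ × ℝ => (p.1, -p.2)) := by fun_prop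
  exact hf.comp this

lemma contDiff_symFun {W : Fin n → ℝ × ℝ → ℝ} (h : ∀ k, ContDiff ℝ 1 (W k)) :
    ContDiff ℝ 1 (symFun W) := by
  unfold symFun
  refine contDiff_const.mul (ContDiff.sum fun j _ => (h j).add (contDiff_refl (h j)))

lemma symFun_even (W : Fin n → ℝ × ℝ → ℝ) (x y : ℝ) : symFun W (x, -y) = symFun W (x, y) := by
  unfold symFun
  simp only [neg_neg]
  congr 1
  exact Finset.sum_congr rfl fun j _ => add_comm _ _

lemma hasDerivAt_fst {f : ℝ × ℝ → ℝ} (hf : ContDiff ℝ 1 f) (p : ℝ × ℝ) :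
    HasDerivAt (fun x => f (x, p.2)) (pdx f p) p.1 := by
  have a3 : HasDerivAt (fun t : ℝ => (t, p.2)) (1, 0) p.1 :=
    (hasDerivAt_id p.1).prodMk (hasDerivAt_const _ _)
  simpa using hasDerivAt_curve hf a3
lemma hasDerivAt_snd {f : ℝ × ℝ → ℝ} (hf : ContDiff ℝ 1 f) (p : ℝ × ℝ) :
    HasDerivAt (fun y => f (p.1, y)) (pdy f p) p.2 := by
  have a3 : HasDerivAt (fun t : ℝ => (p.1, t)) (0, 1) p.2 :=
    (hasDerivAt_const _ _).prodMk (hasDerivAt_id p.2)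
  simpa using hasDerivAt_curve hf a3

lemma pdx_symFun {W : Fin n → ℝ × ℝ → ℝ} (h : ∀ k, ContDiff ℝ 1 (W k)) (p : ℝ × ℝ) :
    pdx (symFun W) p = (2 * n : ℝ)⁻¹ * ∑ j, (pdx (W j) p + pdx (W j) (p.1, -p.2)) := by
  have h1 := hasDerivAt_fst (contDiff_symFun h) p
  have h2 : HasDerivAt (fun x => symFun W (x, p.2)) _ p.1 :=
    (HasDerivAt.fun_sum (u := Finset.univ) fun j _ => (hasDerivAt_fst (h j) p).add
      (hasDerivAt_fst (h j) (p.1, -p.2))).const_mul (2 * n : ℝ)⁻¹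
  exact h1.unique h2
lemma pdy_symFun {W : Fin n → ℝ × ℝ → ℝ} (h : ∀ k, ContDiff ℝ 1 (W k)) (p : ℝ × ℝ) :
    pdy (symFun W) p = (2 * n : ℝ)⁻¹ * ∑ j, (pdy (W j) p + -pdy (W j) (p.1, -p.2)) := by
  have h1 := hasDerivAt_snd (contDiff_symFun h) p
  have h2 : HasDerivAt (fun y => symFun W (p.1, y)) _ p.2 :=
    (HasDerivAt.fun_sum (u := Finset.univ) fun j _ => (hasDerivAt_snd (h j) p).add
      ((hasDerivAt_snd (h j) (p.1, -p.2)).comp_of_eq p.2 (hasDerivAt_neg p.2) rfl)).const_mul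
        (2 * n : ℝ)⁻¹
  rw [h1.unique h2]
  congr 1
  refine Finset.sum_congr rfl fun j _ => ?_
  simp

variable [NeZero n]

/-- The symmetrization operator. -/
noncomputable def symT : Tup n →ₗ[ℝ] Tup n where
  toFun W := ⟨fun _ => symFun W.1, fun _ => contDiff_symFun W.2.1,
    fun _ t _ => (symFun_even W.1 t t).symm, fun _ y hy => by
      unfold symFun
      refine mul_eq_zero_of_right _ (Finset.sum_eq_zero fun j _ => ?_)
      rw [W.2.2.2 j y hy, W.2.2.2 j (-y) ⟨by linarith [hy.2], by linarith [hy.1]⟩, add_zero]⟩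
  map_add' V W := by
    ext k p
    simp only [symFun, Submodule.coe_add, Pi.add_apply]
    rw [← mul_add, ← Finset.sum_add_distrib]
    congr 1; exact Finset.sum_congr rfl fun j _ => by ring
  map_smul' c W := by
    ext k p
    simp only [symFun, Submodule.coe_smul, Pi.smul_apply, smul_eq_mul, RingHom.id_apply]
    rw [Finset.mul_sum, Finset.mul_sum, Finset.mul_sum]
    exact Finset.sum_congr rfl fun j _ => by ring

lemma symT_apply (W : Tup n) (k : Fin n) : (symT W).1 k = symFun W.1 := rfl

lemma symT_of_const {f : ℝ × ℝ → ℝ} {W : Tup n} (h : ∀ k, W.1 k = f)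
    (he : ∀ x y, f (x, -y) = f (x, y)) : symT W = W := by
  ext k p
  rw [symT_apply, symFun]
  simp only [h, he, Finset.sum_const, Finset.card_univ, Fintype.card_fin, nsmul_eq_mul]
  have : (n : ℝ) ≠ 0 := by exact_mod_cast NeZero.ne n
  field_simp; ring

lemma symT_symT (W : Tup n) : symT (symT W) = symT W :=
  symT_of_const (fun _ => rfl) (symFun_even W.1)

/-- The reflected bilinear density. -/
noncomputable def frmR (c : Fin 4 → ℝ) (v w : ℝ × ℝ → ℝ) (p : ℝ × ℝ) : ℝ :=
  c 0 * (pdx v (p.1, -p.2) * pdx w p) - c 2 * (pdy v (p.1, -p.2) * pdy w p) +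
    c 3 * (v (p.1, -p.2) * w p)

lemma continuous_frmR (c : Fin 4 → ℝ) (V W : Tup n) (j k : Fin n) :
    Continuous (frmR c (V.1 j) (W.1 k)) := by
  have := tup_continuous V j; have := tup_continuous_pdx V j; have := tup_continuous_pdy V j
  have := tup_continuous W k; have := tup_continuous_pdx W k; have := tup_continuous_pdy W k
  unfold frmR; fun_prop

lemma continuous_frmD' (c : Fin 4 → ℝ) (V W : Tup n) (j k : Fin n) :
    Continuous (frmD c (V.1 j) (W.1 k)) := by
  have := tup_continuous V j; have := tup_continuous_pdx V j; have := tup_continuous_pdy V j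
  have := tup_continuous W k; have := tup_continuous_pdx W k; have := tup_continuous_pdy W k
  unfold frmD; fun_prop

lemma triInt_frmR_comm (c : Fin 4 → ℝ) (V W : Tup n) (j k : Fin n) :
    triInt (frmR c (V.1 j) (W.1 k)) = triInt (frmR c (W.1 k) (V.1 j)) := by
  rw [← triInt_comp_neg (continuous_frmR c V W j k)]
  congr 1; ext p
  simp only [frmR, neg_neg, Prod.mk.eta]; ring

lemma frm_symT_left {c : Fin 4 → ℝ} (hc : c 1 = 0) (V W : Tup n) :
    frm (fun _ => c) (symT V) W = (2 * n : ℝ)⁻¹ * ∑ k, ∑ j,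
      (triInt (frmD c (V.1 j) (W.1 k)) + triInt (frmR c (V.1 j) (W.1 k))) := by
  rw [frm_apply, Finset.mul_sum]
  refine Finset.sum_congr rfl fun k _ => ?_
  have e : ∀ j, triInt (frmD c (V.1 j) (W.1 k)) + triInt (frmR c (V.1 j) (W.1 k)) =
      triInt (fun p => frmD c (V.1 j) (W.1 k) p + frmR c (V.1 j) (W.1 k) p) := fun j =>
    (triInt_add (continuous_frmD' c V W j k) (continuous_frmR c V W j k)).symm
  simp only [e]
  rw [← triInt_sum (f := fun j p => frmD c (V.1 j) (W.1 k) p + frmR c (V.1 j) (W.1 k) p) _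
    fun j => (continuous_frmD' c V W j k).add (continuous_frmR c V W j k), ← triInt_const_mul]
  congr 1; ext p
  simp only [frmD, frmR, symT_apply, pdx_symFun V.2.1, pdy_symFun V.2.1, symFun, hc]
  simp only [Finset.sum_add_distrib, Finset.sum_sub_distrib, ← Finset.mul_sum, ← Finset.sum_mul,
    Finset.sum_neg_distrib]
  ring

lemma frm_symT {c : Fin 4 → ℝ} (hc : c 1 = 0) (V W : Tup n) :
    frm (fun _ => c) (symT V) W = frm (fun _ => c) V (symT W) := by
  rw [frm_symm _ V, frm_symT_left hc, frm_symT_left hc, Finset.sum_comm]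
  congr 1
  refine Finset.sum_congr rfl fun j _ => Finset.sum_congr rfl fun k _ => ?_
  rw [triInt_frmR_comm]
  congr 2
  ext p; simp only [frmD]; ring

end Symmetrization

section
namespace Cert
open Pol
variable (C : Cert)
/-- The squared mass of the base profile. -/
def m1 : Q5 := J (mul C.U C.U)

/-- Checks on the base profile, with trial flux `(g, h)` and splitting parameter `t`. -/
def fluxR (g h : Pol) (t : ℚ) : Q5 :=
  ((Q5.ofRat (1 - t)⁻¹).mul
    ((J (mul (norm (rsmul (-1) C.Ux ++ rsmul (-1) g)) (norm (rsmul (-1) C.Ux ++ rsmul (-1) g)))).add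
    (C.ikap.mul (J (mul (norm (rsmul (-1) (smul C.kap C.Uy) ++ rsmul (-1) h))
      (norm (rsmul (-1) (smul C.kap C.Uy) ++ rsmul (-1) h))))))).add
  ((Q5.ofRat (t * C.Lp - C.lam)⁻¹).mul
    (J (mul (norm (rsmul C.lam C.U ++ rsmul (-1) (dX g ++ dY h)))
      (norm (rsmul C.lam C.U ++ rsmul (-1) (dX g ++ dY h))))))

def baseCheck (g h : Pol) (t : ℚ) : Bool :=
  (C.U.all fun x => x.2.2 % 2 == 0) && vanDiag (h ++ rsmul (-1) g) && vanDiag (refl (h ++ g)) &&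
  decide (t < 1) && decide (0 < t) && decide (C.lam < t * C.Lp) && decide (5 ≤ C.lam) &&
  decide (C.lam ≤ 54/10) && decide (905/100 ≤ C.Lp) &&
  ((Q5.ofRat (76/10000 * (C.Lp - C.lam))).add (neg ((Q5.ofRat C.Lp).mul (C.fluxR g h t)))).nonneg &&
  (C.m1.add (Q5.ofRat (-99/100))).nonneg && ((Q5.ofRat (101/100)).add (neg C.m1)).nonneg &&
  (((Q5.ofRat C.lam).mul C.m1).add (neg C.q1)).nonneg &&
  ((C.q1.add (neg ((Q5.ofRat C.lam).mul C.m1))).add (Q5.ofRat (1/500))).nonneg &&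
  (C.kap.add (Q5.ofRat (-1))).nonneg

variable {C} {n : ℕ} {κ : ℝ}

lemma ev_even_of_all {P : Pol} (h : (P.all fun x => x.2.2 % 2 == 0) = true) (x y : ℝ) :
    P.ev (x, -y) = P.ev (x, y) := by
  induction P with
  | nil => rfl
  | cons t P ih =>
    simp only [List.all_cons, Bool.and_eq_true, beq_iff_eq] at h
    rw [ev_cons, ev_cons, ih h.2]
    simp [(Nat.even_iff.2 h.1).neg_pow]

/-- The base profile, as a tuple. -/
noncomputable def Ut (n : ℕ) [NeZero n] (h : (C.U.all fun x => x.2.2 % 2 == 0) = true) : Tup n :=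
  ⟨fun _ => C.U.ev, fun _ => contDiff_ev _, fun _ t _ => (ev_even_of_all h t t).symm,
    fun _ y _ => by
      show C.U.ev (1, y) = 0
      unfold U; rw [ev_norm, ev_mul, ev_oneSubX]; simp⟩

lemma pdx_U (p : ℝ × ℝ) : pdx C.U.ev p = C.Ux.ev p := by rw [pdx_ev, Ux, ev_norm]
lemma pdy_U (p : ℝ × ℝ) : pdy C.U.ev p = C.Uy.ev p := by rw [pdy_ev, Uy, ev_norm]

lemma flux_bound [NeZero n] (hκ : 0 < κ) (hk : C.kap.val = κ) (hik : C.ikap.val = κ⁻¹)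
    (hU : (C.U.all fun x => x.2.2 % 2 == 0) = true) {g h : Pol} {t : ℚ}
    (h1 : vanDiag (h ++ rsmul (-1) g) = true) (h2 : vanDiag (refl (h ++ g)) = true)
    (ht : t < 1) (ht0 : 0 < t) (htL : C.lam < t * C.Lp) (Z : Tup n)
    (hz : C.Lp * frm (masC n) Z Z ≤ frm (dirC n κ) Z Z) :
    2 * (frm (dirC n κ) (Ut n hU) Z - C.lam * frm (masC n) (Ut n hU) Z) ≤
      n * (C.fluxR g h t).val + (frm (dirC n κ) Z Z - C.lam * frm (masC n) Z Z) := by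
  have ht' : (t : ℝ) < 1 := by exact_mod_cast ht
  have ht0' : (0 : ℝ) < t := by exact_mod_cast ht0
  have htL' : (C.lam : ℝ) < t * C.Lp := by exact_mod_cast htL
  have cU := continuous_ev C.U; have cx := continuous_ev C.Ux; have cy := continuous_ev C.Uy
  have cg := continuous_ev g; have ch := continuous_ev h
  have hF : IsFlux (fun _ : Fin n => g.ev) (fun _ => h.ev) := by
    refine ⟨fun _ => contDiff_ev _, fun _ => contDiff_ev _, fun k s _ => ?_⟩
    have a := ev_eq_zero_of_vanDiag h1 s
    have b := ev_eq_zero_of_vanDiag h2 s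
    rw [ev_append, ev_rsmul] at a
    rw [ev_refl, ev_append] at b
    push_cast at a
    simp only; linarith
  have key := dual_bound hκ ht' ht0' htL' (σ₁ := fun _ : Fin n => fun p => -C.Ux.ev p)
    (σ₂ := fun _ p => -(κ * C.Uy.ev p)) (σ₀ := fun _ p => C.lam * C.U.ev p)
    (fun _ => by fun_prop) (fun _ => by fun_prop) (fun _ => by fun_prop) 0 Z hF (by simpa using hz)
  have e0 : ∀ p, pdx (0 : ℝ × ℝ → ℝ) p = 0 := fun p => by simp [pdx]
  have e1 : ∀ p, pdy (0 : ℝ × ℝ → ℝ) p = 0 := fun p => by simp [pdy]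
  have eL : ∑ k : Fin n, triInt (fun p => 2 * (-C.Ux.ev p * pdx (Z.1 k) p + -(κ * C.Uy.ev p) * pdy (Z.1 k) p +
      C.lam * C.U.ev p * Z.1 k p)) =
      -2 * (frm (dirC n κ) (Ut n hU) Z - C.lam * frm (masC n) (Ut n hU) Z) := by
    rw [frm_apply, frm_apply, Finset.mul_sum, ← Finset.sum_sub_distrib, Finset.mul_sum]
    refine Finset.sum_congr rfl fun k _ => ?_
    rw [← triInt_const_mul, ← triInt_sub (continuous_frmD _ _ _ _)
      ((continuous_frmD _ _ _ _).const_mul _), ← triInt_const_mul]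
    congr 1; ext p
    rw [frmD_dirC, frmD_masC]
    have a : pdx ((Ut n hU).1 k) p = C.Ux.ev p := pdx_U p
    have b : pdy ((Ut n hU).1 k) p = C.Uy.ev p := pdy_U p
    have c : (Ut n hU).1 k p = C.U.ev p := rfl
    rw [a, b, c]; ring
  have eR : ∀ k : Fin n, triInt (fun p => 2 * (-C.Ux.ev p * pdx ((0 : Tup n).1 k) p +
      -(κ * C.Uy.ev p) * pdy ((0 : Tup n).1 k) p + C.lam * C.U.ev p * (0 : Tup n).1 k p) +
      1 * (pdx ((0 : Tup n).1 k) p ^ 2 + κ * pdy ((0 : Tup n).1 k) p ^ 2) - C.lam * (0 : Tup n).1 k p ^ 2 -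
      ((1 - (t : ℝ))⁻¹ * ((-C.Ux.ev p + 1 * pdx ((0 : Tup n).1 k) p - g.ev p) ^ 2 +
        κ⁻¹ * (-(κ * C.Uy.ev p) + 1 * (κ * pdy ((0 : Tup n).1 k) p) - h.ev p) ^ 2) +
      (t * C.Lp - C.lam : ℝ)⁻¹ * (C.lam * C.U.ev p - C.lam * (0 : Tup n).1 k p -
        (pdx g.ev p + pdy h.ev p)) ^ 2)) = -(C.fluxR g h t).val := by
    intro k
    have z : (0 : Tup n).1 k = 0 := rfl
    simp only [z, e0, e1, Pi.zero_apply, fluxR, Q5.val_add, Q5.val_mul, Q5.val_ofRat, hik,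
      ← triInt_ev_mul, ev_norm, ev_append, ev_rsmul, ev_smul, hk, pdx_ev, pdy_ev]
    have cdx := continuous_ev (dX g); have cdy := continuous_ev (dY h)
    rw [← neg_one_mul]
    simp (disch := fun_prop) only [← triInt_const_mul, ← triInt_add]
    congr 1; ext p
    push_cast; ring
  rw [eL] at key
  simp only [eR, Finset.sum_const, Finset.card_univ, Fintype.card_fin, nsmul_eq_mul] at key
  linarith

/-- All the numerical facts needed for the second order estimate. -/
structure Nice (C : Cert) (n : ℕ) (κ : ℝ) : Prop where
  valid : C.Valid n κ
  even : (C.U.all fun x => x.2.2 % 2 == 0) = true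
  comb : ∀ v, 2 * sizeV n v ≤ 2 * C.q1.val * sizeV n v - C.del.val *
      (n / 2 * C.s2.val * (v 2 ^ 2 + v 3 ^ 2 - v 4 ^ 2 - v 5 ^ 2) +
        n3 n * (v 6 ^ 2 - v 7 ^ 2 / 3)) + quadM n v (fun i j => (C.dens i j).val)
  flux : ∃ R : ℝ, C.Lp * R ≤ 76/10000 * (C.Lp - C.lam) ∧ ∀ (_ : NeZero n) (Z : Tup n),
    C.Lp * frm (masC n) Z Z ≤ frm (dirC n κ) Z Z →
    2 * (frm (dirC n κ) (Ut n even) Z - C.lam * frm (masC n) (Ut n even) Z) ≤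
      n * R + (frm (dirC n κ) Z Z - C.lam * frm (masC n) Z Z)
  lam_ge : (5 : ℝ) ≤ C.lam
  lam_le : (C.lam : ℝ) ≤ 54/10
  Lp_ge : (905/100 : ℝ) ≤ C.Lp
  m1_ge : 99/100 ≤ C.m1.val
  m1_le : C.m1.val ≤ 101/100
  q1_le : C.q1.val ≤ C.lam * C.m1.val
  q1_ge : C.lam * C.m1.val - 1/500 ≤ C.q1.val
  kap_ge : 1 ≤ κ

lemma Nice.mk' (hv : C.Valid n κ) (hc : C.check 2 = true) (h3 : n = 6 → C.check3 2 = true)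
    {g h : Pol} {t : ℚ} (hb : C.baseCheck g h t = true) : C.Nice n κ := by
  simp only [baseCheck, Bool.and_eq_true, decide_eq_true_eq] at hb
  obtain ⟨⟨⟨⟨⟨⟨⟨⟨⟨⟨⟨⟨⟨⟨b1, b2⟩, b3⟩, b4⟩, b5⟩, b6⟩, b7⟩, b8⟩, b9⟩, b10⟩, b11⟩, b12⟩, b13⟩, b14⟩, b15⟩ := hb
  replace b10 := Q5.val_nonneg b10
  replace b11 := Q5.val_nonneg b11
  replace b12 := Q5.val_nonneg b12
  replace b13 := Q5.val_nonneg b13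
  replace b14 := Q5.val_nonneg b14
  replace b15 := Q5.val_nonneg b15
  simp only [neg, Q5.val_add, Q5.val_mul, Q5.val_ofRat, hv.kap] at b10 b11 b12 b13 b14 b15
  have b7' : ((5 : ℚ) : ℝ) ≤ C.lam := by exact_mod_cast b7
  have b8' : (C.lam : ℝ) ≤ ((54/10 : ℚ) : ℝ) := by exact_mod_cast b8
  have b9' : ((905/100 : ℚ) : ℝ) ≤ C.Lp := by exact_mod_cast b9
  push_cast at b7' b8' b9' b10 b11 b12 b13 b14 b15
  have hcomb := fun v => combined hv hc h3 v
  push_cast at hcomb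
  exact ⟨hv, b1, hcomb, ⟨(C.fluxR g h t).val, by linarith, fun _ Z hZ => flux_bound hv.kap_pos hv.kap
    hv.ikap b1 b2 b3 b4 b5 b6 Z hZ⟩, b7', b8', b9', by linarith, by linarith, by linarith,
    by linarith, by linarith⟩
end Cert
end

noncomputable def kapN (n : ℕ) : ℝ := (Real.cos (Real.pi / n) / Real.sin (Real.pi / n)) ^ 2

lemma tan_sq_eq {x c : ℝ} (h : Real.cos x ≠ 0) (hc : Real.cos x ^ 2 * (1 + c) = 1) : Real.tan x ^ 2 = c := by
  have := Real.sin_sq_add_cos_sq x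
  rw [Real.tan_eq_sin_div_cos, div_pow, div_eq_iff (by positivity)]
  linarith

lemma cot_sq_eq {x c d : ℝ} (h : Real.tan x ^ 2 = c) (hc : c * d = 1) :
    (Real.cos x / Real.sin x) ^ 2 = d := by
  have e : Real.cos x / Real.sin x = (Real.tan x)⁻¹ := by rw [Real.tan_eq_sin_div_cos, inv_div]
  rw [e, inv_pow, h]
  exact inv_eq_of_mul_eq_one_right hc

lemma tan_pi_fifth : Real.tan (Real.pi / 5) ^ 2 = 5 - 2 * √5 := by
  have h5 : (√5 : ℝ) ^ 2 = 5 := Real.sq_sqrt (by norm_num)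
  have hp : 0 < √(5:ℝ) := by positivity
  refine tan_sq_eq ?_ ?_ <;> rw [Real.cos_pi_div_five]
  · positivity
  · linear_combination (1/16*(6 -2*√5-4)) * h5

lemma tan_two_pi_fifth : Real.tan (2 * Real.pi / 5) ^ 2 = 5 + 2 * √5 := by
  have h5 : (√5 : ℝ) ^ 2 = 5 := Real.sq_sqrt (by norm_num)
  have hp : 1 < √(5:ℝ) := by nlinarith [Real.sqrt_nonneg 5]
  have e : Real.cos (2 * Real.pi / 5) = (√5 - 1) / 4 := by
    rw [mul_div_assoc, Real.cos_two_mul, Real.cos_pi_div_five]; linear_combination h5 / 8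
  refine tan_sq_eq ?_ ?_ <;> rw [e]
  · have : 0 < √(5:ℝ) - 1 := by linarith
    positivity
  · linear_combination (1/16*(6 +2*√5-4)) * h5

namespace Cert
set_option maxRecDepth 10000 in
lemma pentagon_valid : pentagon.Valid 5 (kapN 5) := by
  have h5 : (√5 : ℝ) ^ 2 = 5 := Real.sq_sqrt (by norm_num)
  have hk : kapN 5 = 1 + 2 / 5 * √5 :=
    cot_sq_eq (by exact_mod_cast tan_pi_fifth) (by linear_combination (-4/5) * h5)
  constructor
  · left; rfl
  · rw [hk]; simp [pentagon, Q5.val]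
  · rw [hk]; positivity
  · rw [hk]; refine eq_inv_of_mul_eq_one_left ?_
    simp only [pentagon, Q5.val]; push_cast; linear_combination (-4/5) * h5
  · unfold tn; simp only [pentagon, Q5.val]
    rw [show Real.pi * ((1:ℕ):ℝ) / ((5:ℕ):ℝ) = Real.pi / 5 by push_cast; ring, tan_pi_fifth]; push_cast; ring
  · unfold tn; simp only [pentagon, Q5.val]
    rw [show Real.pi * ((2:ℕ):ℝ) / ((5:ℕ):ℝ) = 2 * Real.pi / 5 by push_cast; ring, tan_two_pi_fifth]; push_cast; ring
  · decide +kernel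
  · decide +kernel
  · decide +kernel
  · decide +kernel
  · decide +kernel

set_option maxRecDepth 10000 in
lemma hexagon_valid : hexagon.Valid 6 (kapN 6) := by
  have h3 : (√3 : ℝ) ^ 2 = 3 := Real.sq_sqrt (by norm_num)
  have t1 : Real.tan (Real.pi / 6) ^ 2 = 1 / 3 := by
    rw [Real.tan_pi_div_six, div_pow, h3]; norm_num
  have hk : kapN 6 = 3 := cot_sq_eq (by exact_mod_cast t1) (by norm_num)
  constructor
  · right; rfl
  · rw [hk]; simp [hexagon, Q5.val]
  · rw [hk]; norm_num
  · rw [hk]; simp [hexagon, Q5.val]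
  · unfold tn; simp only [hexagon, Q5.val]
    rw [show Real.pi * ((1:ℕ):ℝ) / ((6:ℕ):ℝ) = Real.pi / 6 by push_cast; ring, t1]; push_cast; ring
  · unfold tn; simp only [hexagon, Q5.val]
    rw [show Real.pi * ((2:ℕ):ℝ) / ((6:ℕ):ℝ) = Real.pi / 3 by push_cast; ring, Real.tan_pi_div_three, h3]
    push_cast; ring
  · decide +kernel
  · decide +kernel
  · decide +kernel
  · decide +kernel
  · decide +kernel

set_option maxRecDepth 10000 in
lemma pentagon_nice : pentagon.Nice 5 (kapN 5) := by
  refine Nice.mk' pentagon_valid (by decide +kernel) (by norm_num) (t := 586 / 1000)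
    (g := Pol.ofInts [(2624,0,4),(5105,1,0),(-2035,1,2),(-3097,1,4),(134,2,0),(-3983,2,2),(-3818,3,0),
      (3739,3,2),(1796,4,0),(-226,5,0)])
    (h := Pol.ofInts [(5105,0,1),(-1664,0,3),(620,0,5),(134,1,1),(2656,1,3),(-4189,2,1),(-1400,2,3),
      (-2219,3,1),(1196,4,1)]) (by decide +kernel)

set_option maxRecDepth 10000 in
lemma hexagon_nice : hexagon.Nice 6 (kapN 6) := by
  refine Nice.mk' hexagon_valid (by decide +kernel) (fun _ => by decide +kernel) (t := 554 / 1000)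
    (g := Pol.ofInts [(-37,0,2),(4240,0,4),(5212,1,0),(-1190,1,2),(-5095,1,4),(147,2,0),(-3525,2,2),
      (-3975,3,0),(3218,3,2),(1097,4,0),(415,5,0)])
    (h := Pol.ofInts [(5212,0,1),(-770,0,3),(1020,0,5),(110,1,1),(851,1,3),(-4395,2,1),(-553,2,3),
      (961,3,1),(-1929,4,1)]) (by decide +kernel)

/-- The certificate for the regular `n`-gon. -/
def polygon (n : ℕ) : Cert := if n = 5 then pentagon else hexagon

lemma polygon_nice {n : ℕ} (hn : n = 5 ∨ n = 6) : (polygon n).Nice n (kapN n) := by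
  rcases hn with rfl | rfl
  · exact pentagon_nice
  · exact hexagon_nice
end Cert

namespace Cert
/-- Compatibility of the mode constants with the regular `n`-gon. -/
structure Modes (C : Cert) (n : ℕ) (κ : ℝ) : Prop where
  hn : n = 5 ∨ n = 6
  kap_pos : 0 < κ
  t1 : κ * tn n 1 ^ 2 = 1
  t2 : tn n 2 ^ 2 * C.ra2.val ^ 2 = κ
  three : n3 n / κ = n3 n / 3
  s1 : 0 ≤ C.s1.val ∧ C.s1.val ≤ 2
  s2 : 0 ≤ C.s2.val ∧ C.s2.val ≤ 1

/-- Real part of the tangential mode at the `k`-th side. -/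
noncomputable def bK (n : ℕ) (v : Fin 8 → ℝ) (k : Fin n) : ℝ := fldN n v ![1, 0, 1, 0, 0, 0, 1, 0] k
noncomputable def gK (C : Cert) (n : ℕ) (κ : ℝ) (v : Fin 8 → ℝ) (k : Fin n) : ℝ :=
  fldN n v ![0, 2 * κ, 0, 0, 0, 2 * C.ra2.val, 0, -2] k
noncomputable def aK (C : Cert) (n : ℕ) (v : Fin 8 → ℝ) (k : Fin n) : ℝ :=
  fldN n v ![C.s1.val, 0, C.s2.val / 2, 0, C.s2.val / 2, 0, 1 / 2, 0] k

/-- First variation of the coefficients. -/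
noncomputable def linC (C : Cert) (n : ℕ) (κ l : ℝ) (v : Fin 8 → ℝ) : Fin n → Fin 4 → ℝ := fun k =>
  ![-2 * bK n v k, gK C n κ v k, 2 * κ * bK n v k, 2 * l * aK C n v k]

/-- Half of the second variation of the area. -/
noncomputable def areaV (C : Cert) (n : ℕ) (v : Fin 8 → ℝ) : ℝ :=
  n / 2 * C.s2.val * (v 2 ^ 2 + v 3 ^ 2 - v 4 ^ 2 - v 5 ^ 2) + n3 n * (v 6 ^ 2 - v 7 ^ 2 / 3)

variable {C : Cert} {n : ℕ} {κ : ℝ}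

lemma n3_nonneg (n : ℕ) : 0 ≤ n3 n := by unfold n3; split_ifs <;> norm_num

lemma sizeV_nonneg (n : ℕ) (v : Fin 8 → ℝ) : 0 ≤ sizeV n v := by
  have := n3_nonneg n
  unfold sizeV; positivity

lemma Modes.sum_sq (h : C.Modes n κ) (v : Fin 8 → ℝ) :
    ∑ k, (bK n v k ^ 2 + gK C n κ v k ^ 2 / (4 * κ)) = sizeV n v := by
  have hk := h.kap_pos
  rw [Finset.sum_add_distrib, ← Finset.sum_div]
  simp only [bK, gK, sq, fldN_sum h.hn]
  simp only [quadM, Matrix.cons_val]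
  have h1 := h.t1; have h2 := h.t2; have h3 := h.three
  rw [div_eq_div_iff hk.ne' (by norm_num)] at h3
  unfold sizeV
  field_simp
  linear_combination (n * 12 * κ * (v 0 ^ 2 + v 1 ^ 2)) * h1 + n * 12 * (v 4 ^ 2 + v 5 ^ 2) * h2 +
    8 * v 7 ^ 2 * h3

lemma Modes.sum_aK_sq (h : C.Modes n κ) (v : Fin 8 → ℝ) : ∑ k, aK C n v k ^ 2 ≤ 2 * sizeV n v := by
  simp only [aK, sq, fldN_sum h.hn]
  simp only [quadM, Matrix.cons_val]
  have a1 : C.s1.val * C.s1.val ≤ 4 := by nlinarith [h.s1]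
  have a2 : C.s2.val * C.s2.val ≤ 1 := by nlinarith [h.s2]
  have p2 : 0 ≤ C.s2.val * C.s2.val := mul_self_nonneg _
  have e1 : (v 0 ^ 2 + v 1 ^ 2) * (C.s1.val * C.s1.val) ≤ (v 0 ^ 2 + v 1 ^ 2) * 4 :=
    mul_le_mul_of_nonneg_left a1 (by positivity)
  have e2 : ((v 2 + v 4) ^ 2 + (v 3 + v 5) ^ 2) / 4 * (C.s2.val * C.s2.val) ≤
      ((v 2 + v 4) ^ 2 + (v 3 + v 5) ^ 2) / 4 * 1 :=
    mul_le_mul_of_nonneg_left a2 (by positivity)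
  have e3 := mul_nonneg (n3_nonneg n) (sq_nonneg (v 6))
  have e4 := mul_nonneg (n3_nonneg n) (sq_nonneg (v 7))
  have hn : (0 : ℝ) ≤ n / 2 := by positivity
  have e5 := mul_le_mul_of_nonneg_left (add_le_add e1 e2) hn
  have e6 : n / 2 * ((v 0 ^ 2 + v 1 ^ 2) * 4 + ((v 2 + v 4) ^ 2 + (v 3 + v 5) ^ 2) / 4 * 1) ≤
      2 * (n * (v 0 ^ 2 + v 1 ^ 2 + (v 2 ^ 2 + v 3 ^ 2 + v 4 ^ 2 + v 5 ^ 2) / 2)) := by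
    nlinarith [mul_nonneg hn (sq_nonneg (v 2 - v 4)), mul_nonneg hn (sq_nonneg (v 3 - v 5)),
      mul_nonneg hn (sq_nonneg (v 2)), mul_nonneg hn (sq_nonneg (v 3)),
      mul_nonneg hn (sq_nonneg (v 4)), mul_nonneg hn (sq_nonneg (v 5))]
  unfold sizeV
  linarith

lemma Modes.abs_areaV_le (h : C.Modes n κ) (v : Fin 8 → ℝ) : |areaV C n v| ≤ sizeV n v := by
  have e3 := mul_nonneg (n3_nonneg n) (sq_nonneg (v 6))
  have e4 := mul_nonneg (n3_nonneg n) (sq_nonneg (v 7))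
  have hn : (0 : ℝ) ≤ n / 2 := by positivity
  have f : ∀ i, 0 ≤ n / 2 * v i ^ 2 := fun i => mul_nonneg hn (sq_nonneg _)
  have hs := h.s2
  have g : ∀ i, n / 2 * C.s2.val * v i ^ 2 ≤ n / 2 * v i ^ 2 := fun i => by nlinarith [f i]
  have g0 : ∀ i, 0 ≤ n / 2 * C.s2.val * v i ^ 2 := fun i =>
    mul_nonneg (mul_nonneg hn hs.1) (sq_nonneg _)
  unfold areaV sizeV
  rw [abs_le]
  constructor <;> linarith [f 0, f 1, f 2, f 3, f 4, f 5, g 2, g 3, g 4, g 5, g0 2, g0 3, g0 4, g0 5]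

set_option maxRecDepth 10000 in
lemma polygon_modes {n : ℕ} (hn : n = 5 ∨ n = 6) : (polygon n).Modes n (kapN n) := by
  have hv := (polygon_nice hn).valid
  have hk := hv.kap; have h1 := hv.t1; have h2 := hv.t2
  have h5 : (√5 : ℝ) ^ 2 = 5 := Real.sq_sqrt (by norm_num)
  have hp : 1 < √(5:ℝ) := by nlinarith [Real.sqrt_nonneg 5]
  have hp' : √(5:ℝ) < 3 := by nlinarith [Real.sqrt_nonneg 5]
  refine ⟨hn, hv.kap_pos, ?_, ?_, ?_, ?_, ?_⟩
  · rw [← hk, ← h1]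
    rcases hn with rfl | rfl <;> simp [polygon, pentagon, hexagon, Q5.val]
    linear_combination (-4/5) * h5
  · rw [← hk, ← h2]
    rcases hn with rfl | rfl <;> simp [polygon, pentagon, hexagon, Q5.val]
    linear_combination (1/5 + 2/25 * √5) * h5
  · rw [← hk]
    rcases hn with rfl | rfl <;> simp [polygon, pentagon, hexagon, Q5.val, n3]
  · rcases hn with rfl | rfl <;> simp [polygon, pentagon, hexagon, Q5.val] <;>
      exact ⟨by linarith, by linarith⟩
  · rcases hn with rfl | rfl <;> simp [polygon, pentagon, hexagon, Q5.val] <;>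
      exact ⟨by linarith, by linarith⟩

variable [NeZero n]

lemma fldP_S_eq (hk : C.kap.val = κ) (v : Fin 8 → ℝ)
    (hU : (C.U.all fun x => x.2.2 % 2 == 0) = true) (w : Tup n) :
    ∑ k, triInt (fun p => 2 * (fldP n v C.S1 k p * pdx (w.1 k) p + fldP n v C.S2 k p * pdy (w.1 k) p +
      fldP n v C.S0 k p * w.1 k p)) = 2 * frm (linC C n κ C.lam v) (Ut n hU) w := by
  rw [frm_apply, Finset.mul_sum]
  refine Finset.sum_congr rfl fun k _ => ?_
  rw [← triInt_const_mul]
  congr 1; ext p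
  have a : pdx ((Ut n hU).1 k) p = C.Ux.ev p := pdx_U p
  have b : pdy ((Ut n hU).1 k) p = C.Uy.ev p := pdy_U p
  have c : (Ut n hU).1 k p = C.U.ev p := rfl
  have e1 : fldP n v C.S1 k p = -2 * bK n v k * C.Ux.ev p + gK C n κ v k * C.Uy.ev p := by
    simp only [fldP, S1, bK, gK, fldN, Fin.sum_univ_eight, Matrix.cons_val, Pol.ev_rsmul, Pol.ev_smul, Q5.val_mul,
      Q5.val_ofRat, hk, Pol.ev_nil]
    push_cast; ring
  have e2 : fldP n v C.S2 k p = gK C n κ v k * C.Ux.ev p + 2 * κ * bK n v k * C.Uy.ev p := by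
    simp only [fldP, S2, bK, gK, fldN, Fin.sum_univ_eight, Matrix.cons_val, Pol.ev_rsmul, Pol.ev_smul, Q5.val_mul,
      Q5.val_ofRat, hk, Pol.ev_nil]
    push_cast; ring
  have e3 : fldP n v C.S0 k p = 2 * C.lam * aK C n v k * C.U.ev p := by
    simp only [fldP, S0, aK, fldN, Fin.sum_univ_eight, Matrix.cons_val, Pol.ev_rsmul, Pol.ev_smul, Q5.val_mul,
      Q5.val_ofRat, Pol.ev_nil]
    push_cast; ring
  rw [frmD, a, b, c, e1, e2, e3]
  simp only [linC, Matrix.cons_val]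
  ring
end Cert

section Pairing
variable {n : ℕ} [NeZero n]

lemma frm_pair_le {C : Fin n → Fin 4 → ℝ} {c : Fin 4 → ℝ} {η : ℝ} {M : Fin n → ℝ}
    (h : ∀ k, ∀ x y z x' y' z' : ℝ, 2 * (C k 0 * (x * x') + C k 1 * (x * y' + y * x') + C k 2 * (y * y') +
      C k 3 * (z * z')) ≤ η * (c 0 * (x' * x') + c 1 * (x' * y' + y' * x') + c 2 * (y' * y') + c 3 * (z' * z')) +
        M k * (c 0 * (x * x) + c 1 * (x * y + y * x) + c 2 * (y * y) + c 3 * (z * z)))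
    {Z : Tup n} (hZ : symT Z = Z) (w : Tup n) :
    2 * frm C Z w ≤ η * frm (fun _ => c) w w + (∑ k, M k) / n * frm (fun _ => c) Z Z := by
  have hz : ∀ k, Z.1 k = symFun Z.1 := fun k => by rw [← symT_apply Z k, hZ]
  have hn : (n : ℝ) ≠ 0 := by exact_mod_cast NeZero.ne n
  have e : frm (fun _ => c) Z Z = n * triInt (frmD c (symFun Z.1) (symFun Z.1)) := by
    rw [frm_apply]; simp only [hz]; simp
  rw [e, div_mul_eq_mul_div, mul_left_comm, mul_div_cancel_left₀ _ hn, Finset.sum_mul, frm_apply,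
    frm_apply, Finset.mul_sum, Finset.mul_sum, ← Finset.sum_add_distrib]
  refine Finset.sum_le_sum fun k _ => ?_
  have c1 := continuous_frmD (C k) Z w k
  have c2 := continuous_frmD c w w k
  have c3 := continuous_frmD c Z Z k
  rw [← hz k]
  rw [← triInt_const_mul, ← triInt_const_mul, ← triInt_const_mul, ← triInt_add (by fun_prop) (by fun_prop)]
  refine triInt_mono (by fun_prop) (by fun_prop) fun p _ => ?_
  exact h k _ _ _ _ _ _

lemma triInt_odd {f : ℝ × ℝ → ℝ} (hf : Continuous f) (h : ∀ p : ℝ × ℝ, f (p.1, -p.2) = -f p) :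
    triInt f = 0 := by
  have h1 := triInt_comp_neg hf
  have h2 : triInt (fun p => f (p.1, -p.2)) = -triInt f := by
    rw [← neg_one_mul, ← triInt_const_mul]; congr 1; ext p; rw [h]; ring
  linarith

lemma frm_self_of_symm {κ : ℝ} (hκ : 0 < κ) (C : Fin n → Fin 4 → ℝ) {U : Tup n} (hU : symT U = U) :
    frm C U U = (∑ k, C k 0) / n * frm (fun _ => ![1, 0, 0, 0]) U U +
      (∑ k, C k 2 / κ) / n * frm (fun _ => ![0, 0, κ, 0]) U U + (∑ k, C k 3) / n * frm (masC n) U U := by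
  have hz : ∀ k, U.1 k = symFun U.1 := fun k => by rw [← symT_apply U k, hU]
  have hn : (n : ℝ) ≠ 0 := by exact_mod_cast NeZero.ne n
  set f := symFun U.1 with hf
  have hfc : ContDiff ℝ 1 f := contDiff_symFun U.2.1
  have c1 := continuous_pdx hfc
  have c2 := continuous_pdy hfc
  have c0 := hfc.continuous
  have e : ∀ c : Fin 4 → ℝ, triInt (frmD c f f) = c 0 * triInt (fun p => pdx f p * pdx f p) +
      c 2 * triInt (fun p => pdy f p * pdy f p) + c 3 * triInt (fun p => f p * f p) := by
    intro c
    have o : triInt (fun p => pdx f p * pdy f p) = 0 := by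
      refine triInt_odd (by fun_prop) fun p => ?_
      have hx : pdx f (p.1, -p.2) = pdx f p := by
        rw [hf, pdx_symFun U.2.1, pdx_symFun U.2.1]
        simp only [neg_neg, add_comm]
      have hy : pdy f (p.1, -p.2) = -pdy f p := by
        rw [hf, pdy_symFun U.2.1, pdy_symFun U.2.1, ← mul_neg, ← Finset.sum_neg_distrib]
        simp only [neg_neg, neg_add, add_comm]
      rw [hx, hy]; ring
    have o2 : triInt (frmD c f f) = c 0 * triInt (fun p => pdx f p * pdx f p) +
      (2 * c 1) * triInt (fun p => pdx f p * pdy f p) +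
      c 2 * triInt (fun p => pdy f p * pdy f p) + c 3 * triInt (fun p => f p * f p) := by
      simp (disch := fun_prop) only [← triInt_const_mul, ← triInt_add]
      congr 1; ext p; rw [frmD]; ring
    rw [o2, o]; ring
  have e2 : ∀ D : Fin n → Fin 4 → ℝ, frm D U U = (∑ k, D k 0) * triInt (fun p => pdx f p * pdx f p) +
      (∑ k, D k 2) * triInt (fun p => pdy f p * pdy f p) +
      (∑ k, D k 3) * triInt (fun p => f p * f p) := by
    intro D
    rw [frm_apply]
    simp only [hz, e, Finset.sum_add_distrib, Finset.sum_mul]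
  rw [e2, e2, e2, e2, ← Finset.sum_div]
  simp [masC]
  field_simp

lemma frm_le_of_abs {κ d : ℝ} (hκ : 1 ≤ κ) {C : Fin n → Fin 4 → ℝ} (h : ∀ k i, |C k i| ≤ d) (W : Tup n) :
    -(2 * d * (frm (dirC n κ) W W + frm (masC n) W W)) ≤ frm C W W := by
  have : frm (C + (2 * d) • (dirC n κ + masC n)) W W =
      frm C W W + 2 * d * (frm (dirC n κ) W W + frm (masC n) W W) := by
    rw [frm_add, frm_smul, frm_add]
    simp; ring
  have h2 : 0 ≤ frm (C + (2 * d) • (dirC n κ + masC n)) W W := by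
    refine frm_nonneg (fun k x y z => ?_) W
    have h0 := abs_le.1 (h k 0); have h1 := abs_le.1 (h k 1)
    have h2 := abs_le.1 (h k 2); have h3 := abs_le.1 (h k 3)
    have hd : 0 ≤ d := (abs_nonneg _).trans (h k 0)
    simp [dirC, masC]
    have e1 : d * (y ^ 2 * (κ - 1)) ≥ 0 := mul_nonneg hd (mul_nonneg (sq_nonneg _) (by linarith))
    nlinarith [mul_nonneg (by linarith : 0 ≤ C k 0 + d) (sq_nonneg x),
      mul_nonneg (by linarith : 0 ≤ C k 2 + d) (sq_nonneg y),
      mul_nonneg (by linarith : 0 ≤ C k 3 + d) (sq_nonneg z), mul_nonneg hd (sq_nonneg z),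
      mul_nonneg (by linarith : 0 ≤ d - C k 1) (sq_nonneg (x - y)),
      mul_nonneg (by linarith : 0 ≤ d + C k 1) (sq_nonneg (x + y))]
  linarith

lemma frm_pair_le_of_abs {κ d : ℝ} (hκ : 1 ≤ κ) {C : Fin n → Fin 4 → ℝ} (h : ∀ k i, |C k i| ≤ d)
    (U W : Tup n) {t : ℝ} (ht : 0 < t) :
    2 * frm C U W ≤ 2 * d * (t * (frm (dirC n κ) U U + frm (masC n) U U) +
      t⁻¹ * (frm (dirC n κ) W W + frm (masC n) W W)) := by
  have hd : 0 ≤ d := (abs_nonneg _).trans (h 0 0)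
  set B := (frm (C + (2 * d) • (dirC n κ + masC n)) : LinearMap.BilinForm ℝ (Tup n)) with hB
  have hBa : ∀ X Y, B X Y = frm C X Y + 2 * d * (frm (dirC n κ) X Y + frm (masC n) X Y) := by
    intro X Y
    rw [hB, frm_add, frm_smul, frm_add]
    simp; ring
  set D := (frm (-C + (2 * d) • (dirC n κ + masC n)) : LinearMap.BilinForm ℝ (Tup n)) with hD
  have hneg : frm (-C) = -frm C := by
    ext X Y
    rw [show -C = (-1 : ℝ) • C by simp, frm_smul]
    simp only [LinearMap.smul_apply, LinearMap.neg_apply, smul_eq_mul]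
    ring
  have hDa : ∀ X Y, D X Y = -frm C X Y + 2 * d * (frm (dirC n κ) X Y + frm (masC n) X Y) := by
    intro X Y
    rw [hD, frm_add, frm_smul, frm_add, hneg]
    simp; ring
  have p1 : ∀ X, 0 ≤ B X X := fun X => by rw [hBa]; linarith [frm_le_of_abs hκ h X]
  have p2 : ∀ X, 0 ≤ D X X := fun X => by
    rw [hDa]
    have := frm_le_of_abs hκ (C := -C) (d := d) (fun k i => by simpa using h k i) X
    rw [hneg] at this
    simp at this; linarith
  have s1 := form_young (B := B) (fun u v => frm_symm _ u v) p1 U W ht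
  have s2 := form_young' (B := D) (fun u v => frm_symm _ u v) p2 U W ht
  simp only [hBa, hDa] at s1 s2
  linarith
end Pairing

namespace Cert
variable {C : Cert} {n : ℕ} {κ : ℝ} [NeZero n]

lemma frm_Ut (hk : C.kap.val = κ) (hU : (C.U.all fun x => x.2.2 % 2 == 0) = true) :
    frm (dirC n κ) (Ut n hU) (Ut n hU) = n * C.q1.val ∧
    frm (masC n) (Ut n hU) (Ut n hU) = n * C.m1.val ∧
    frm (fun _ => ![1, 0, 0, 0]) (Ut n hU) (Ut n hU) -
      frm (fun _ => ![0, 0, κ, 0]) (Ut n hU) (Ut n hU) = n * C.del.val := by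
  have a : ∀ k, pdx ((Ut n hU).1 k) = C.Ux.ev := fun k => funext pdx_U
  have b : ∀ k, pdy ((Ut n hU).1 k) = C.Uy.ev := fun k => funext pdy_U
  have c : ∀ k, (Ut n hU).1 k = C.U.ev := fun k => rfl
  have c1 := Pol.continuous_ev C.Ux
  have c2 := Pol.continuous_ev C.Uy
  have c3 := Pol.continuous_ev C.U
  simp only [frm_apply, q1, m1, del, Q5.val_add, Q5.val_mul, Q5.val_ofRat, ← triInt_ev_mul, hk]
  refine ⟨?_, ?_, ?_⟩
  · have : ∀ k, triInt (frmD (dirC n κ k) ((Ut n hU).1 k) ((Ut n hU).1 k)) =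
        triInt (fun p => C.Ux.ev p * C.Ux.ev p) + κ * triInt (fun p => C.Uy.ev p * C.Uy.ev p) := by
      intro k
      rw [← triInt_const_mul, ← triInt_add (by fun_prop) (by fun_prop)]
      congr 1; ext p; rw [frmD_dirC, a, b]
    simp [this, mul_add]
  · have : ∀ k, triInt (frmD (masC n k) ((Ut n hU).1 k) ((Ut n hU).1 k)) =
        triInt (fun p => C.U.ev p * C.U.ev p) := by
      intro k; congr 1; ext p; rw [frmD_masC, c]
    simp [this, mul_add]
  · have e1 : ∀ k, triInt (frmD ![1, 0, 0, 0] ((Ut n hU).1 k) ((Ut n hU).1 k)) =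
        triInt (fun p => C.Ux.ev p * C.Ux.ev p) := by
      intro k; congr 1; ext p; simp [frmD, a]
    have e2 : ∀ k, triInt (frmD ![0, 0, κ, 0] ((Ut n hU).1 k) ((Ut n hU).1 k)) =
        κ * triInt (fun p => C.Uy.ev p * C.Uy.ev p) := by
      intro k
      rw [← triInt_const_mul]
      congr 1; ext p; simp [frmD, b]
    simp [e1, e2]
    ring

lemma base_arith {m q1 m1 lam Lp l QU NU QUZ QZ NZ R ε : ℝ} (hn : 0 < m) (hlam : 5 ≤ lam)
    (hlam' : lam ≤ 54 / 10) (hLp : 905 / 100 ≤ Lp) (hm : 99 / 100 ≤ m1) (hm' : m1 ≤ 101 / 100)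
    (hq : q1 ≤ lam * m1) (hq' : lam * m1 - 1 / 500 ≤ q1) (hεn : ε ≤ m / 10 ^ 9)
    (hB : QU - l * NU ≤ ε) (hBZ : 0 ≤ QZ - l * NZ) (hNZ0 : 0 ≤ NZ) (hNU0 : 0 ≤ NU) (hl0 : 0 ≤ l)
    (hgap : Lp * NZ ≤ QZ) (eN : m * m1 = NU + NZ) (eQ : m * q1 = QU + 2 * QUZ + QZ)
    (h1 : 2 * QUZ ≤ m / 10 ^ 5 + QZ / 10 ^ 4) (h2 : -(2 * QUZ) ≤ m / 10 ^ 5 + QZ / 10 ^ 4)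
    (hR : Lp * R ≤ 76 / 10000 * (Lp - lam))
    (hfl : 2 * (QUZ + QZ - lam * NZ) ≤ m * R + (QZ - lam * NZ))
    (hb : l * (m * m1) ≤ m * q1) :
    0 < NU ∧ NU ≤ 101 / 100 * m ∧ l ≤ lam ∧ lam - l ≤ 1 / 100 ∧ QZ ≤ 77 / 10000 * m ∧
      m * q1 - QZ - m / 10000 ≤ QU ∧ QU ≤ 546 / 100 * m := by
  have hl : l ≤ lam := by
    have h3 : l * m1 ≤ lam * m1 := by
      refine le_of_mul_le_mul_left ?_ hn
      linarith [mul_le_mul_of_nonneg_left hq hn.le]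
    exact le_of_mul_le_mul_right h3 (by linarith)
  have hQZ0 : 0 ≤ QZ := (mul_nonneg (by linarith) hNZ0).trans hgap
  have hQZ : QZ ≤ 77 / 10000 * m := by
    have a1 : QZ - lam * NZ ≤ m * R + m / 10 ^ 5 + QZ / 10 ^ 4 := by linarith
    have a2 := mul_le_mul_of_nonneg_left a1 (by linarith : 0 ≤ Lp)
    have a3 := mul_le_mul_of_nonneg_left hR hn.le
    have a4 := mul_le_mul_of_nonneg_left hgap (by linarith : 0 ≤ lam)
    have a5 : Lp ≤ 5 / 2 * (Lp - lam) := by linarith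
    have a6 := mul_le_mul_of_nonneg_right a5 (by positivity : 0 ≤ m / 10 ^ 5 + QZ / 10 ^ 4)
    have hd : 0 < Lp - lam := by linarith
    have a7 : (Lp - lam) * QZ ≤ (Lp - lam) *
        (76 / 10000 * m + 5 / 2 * (m / 10 ^ 5 + QZ / 10 ^ 4)) := by
      linear_combination a2 + a3 + a4 + a6
    have := le_of_mul_le_mul_left a7 hd
    linarith
  have hQU : m * q1 - QZ - m / 10000 ≤ QU := by linarith
  have hNU : NU ≤ 101 / 100 * m := by linarith [mul_le_mul_of_nonneg_left hm' hn.le]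
  have hlN : l * NU ≤ 54 / 10 * (101 / 100 * m) := mul_le_mul (by linarith) hNU hNU0 (by norm_num)
  refine ⟨?_, hNU, hl, ?_, hQZ, hQU, by linarith⟩
  · rcases hNU0.eq_or_lt with h0 | h0
    · exfalso
      have : 5 * (99 / 100) ≤ lam * m1 := mul_le_mul hlam hm (by norm_num) (by linarith)
      have := mul_le_mul_of_nonneg_left (this.trans (by linarith : lam * m1 ≤ q1 + 1 / 500)) hn.le
      rw [← h0] at hB
      linarith
    · exact h0
  · have b1 : l * NU ≤ l * (m * m1) := mul_le_mul_of_nonneg_left (by linarith) hl0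
    have b2 := mul_le_mul_of_nonneg_left hq' hn.le
    have b3 : m * ((lam - l) * m1) ≤ m * (99 / 10000) := by linear_combination b1 + b2 + hQU + hB + hεn + hQZ + (99 / 10000 - (1 / 500 + 1 / 10000 + 1 / 10 ^ 9 + 77 / 10000)) * hn
    have b4 := le_of_mul_le_mul_left b3 hn
    by_contra! hc
    linarith [mul_lt_mul hc hm (by norm_num) (by linarith)]

/-- A near minimizer close to the base profile. -/
lemma Nice.exists_base (h : C.Nice n κ) {l L : ℝ} (S : SpecGap (frm (dirC n κ)) (frm (masC n)) l L)
    (hL : C.Lp < L) {ε : ℝ} (hε : 0 < ε) (hεn : ε ≤ n / 10 ^ 9) :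
    ∃ U Z : Tup n, symT U = U ∧ symT Z = Z ∧ Ut n h.even = U + Z ∧
      frm (dirC n κ) U U - l * frm (masC n) U U ≤ ε ∧ frm (masC n) U Z = 0 ∧
      (∀ w, frm (masC n) U w = 0 → C.Lp * frm (masC n) w w ≤ frm (dirC n κ) w w) ∧
      0 < frm (masC n) U U ∧ frm (masC n) U U ≤ 101 / 100 * n ∧ l ≤ C.lam ∧ C.lam - l ≤ 1 / 100 ∧
      frm (dirC n κ) Z Z ≤ 77 / 10000 * n ∧
      n * C.q1.val - frm (dirC n κ) Z Z - n / 10000 ≤ frm (dirC n κ) U U ∧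
      frm (dirC n κ) U U ≤ 546 / 100 * n := by
  have hn : (0 : ℝ) < n := by exact_mod_cast NeZero.pos n
  obtain ⟨hQ, hN, -⟩ := frm_Ut (n := n) h.valid.kap h.even
  have hlam := h.lam_ge; have hlam' := h.lam_le; have hLp := h.Lp_ge
  have hm := h.m1_ge; have hm' := h.m1_le; have hq := h.q1_le; have hq' := h.q1_ge
  have hs0 : symT (Ut n h.even) = Ut n h.even := symT_of_const (fun _ => rfl) (ev_even_of_all h.even)
  have hlt : frm (dirC n κ) (Ut n h.even) (Ut n h.even) <
      C.Lp * frm (masC n) (Ut n h.even) (Ut n h.even) := by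
    rw [hQ, hN, mul_left_comm]
    refine mul_lt_mul_of_pos_left (hq.trans_lt ?_) hn
    nlinarith
  obtain ⟨U, hSU, hB, hNz, hgap⟩ := S.exists_near_min symT symT_symT
    (fun u v => frm_symT (c := ![1, 0, κ, 0]) rfl u v) (fun u v => frm_symT (c := ![0, 0, 0, 1]) rfl u v)
    hs0 hL (by linarith) hlt hε
  set Z := Ut n h.even - U with hZ
  have hUZ : Ut n h.even = U + Z := by rw [hZ]; abel
  have hSZ : symT Z = Z := by rw [hZ, map_sub, hs0, hSU]
  set Q := (frm (dirC n κ) : LinearMap.BilinForm ℝ (Tup n)) with hQdef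
  set N := (frm (masC n) : LinearMap.BilinForm ℝ (Tup n)) with hNdef
  have hZgap := hgap Z hNz
  have hNZ0 := S.nonnegN Z
  have hNU0 := S.nonnegN U
  have eN : (n : ℝ) * C.m1.val = N U U + N Z Z := by
    rw [← hN, hUZ]; simp only [map_add, LinearMap.add_apply]
    rw [S.symmN Z U, hNz]; ring
  have eQ : (n : ℝ) * C.q1.val = Q U U + 2 * Q U Z + Q Z Z := by
    rw [← hQ, hUZ]; simp only [map_add, LinearMap.add_apply]
    rw [S.symmQ Z U]; ring
  -- Young's inequality for `Q - l N`
  have hBs := S.bound Z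
  have hl0 := S.l_nonneg
  have hBUZ : ∀ c : ℝ, |c| = 1 → 2 * (c * Q U Z) ≤ n / 10 ^ 5 + Q Z Z / 10 ^ 4 := by
    intro c hc
    have hBB : ∀ X Y, (Q - l • N) X Y = Q X Y - l * N X Y := fun X Y => by simp
    have := form_young (B := Q - l • N) (fun u v => by rw [hBB, hBB, S.symmQ, S.symmN])
      (fun v => by rw [hBB]; linarith [S.bound v]) U (c • Z) (t := 10 ^ 4) (by norm_num)
    simp only [hBB, map_smul, LinearMap.smul_apply, smul_eq_mul, hNz] at this
    have hcc : c * c = 1 := by rw [← abs_mul_abs_self, hc]; norm_num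
    have e : c * (c * (Q Z Z - l * N Z Z)) = Q Z Z - l * N Z Z := by
      linear_combination (Q Z Z - l * N Z Z) * hcc
    rw [e] at this
    have hlN : 0 ≤ l * N Z Z := mul_nonneg hl0 hNZ0
    linarith
  have h1 := hBUZ 1 (by norm_num)
  have h2 := hBUZ (-1) (by norm_num)
  obtain ⟨R, hR, hflux⟩ := h.flux
  have hfl := hflux inferInstance Z hZgap
  have eF : frm (dirC n κ) (Ut n h.even) Z = Q U Z + Q Z Z := by
    rw [hUZ, map_add, LinearMap.add_apply]
  have eF' : frm (masC n) (Ut n h.even) Z = N Z Z := by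
    rw [hUZ, map_add, LinearMap.add_apply, hNz, zero_add]
  rw [eF, eF'] at hfl
  have hb := S.bound (Ut n h.even)
  rw [hQ, hN] at hb
  obtain ⟨r1, r2, r3, r4, r5, r6, r7⟩ := base_arith hn hlam hlam' hLp hm hm' hq hq' hεn hB
    (by linarith [S.bound Z]) hNZ0 hNU0 hl0 hZgap eN eQ (by simpa using h1) (by simpa using h2) hR
    hfl hb
  exact ⟨U, Z, hSU, hSZ, hUZ, hB, hNz, hgap, r1, r2, r3, r4, r5, r6, r7⟩
end Cert

namespace Cert
variable {C : Cert} {n : ℕ} {κ : ℝ}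

lemma linC_smul (C : Cert) (n : ℕ) (κ l a : ℝ) (v : Fin 8 → ℝ) :
    linC C n κ l (a • v) = a • linC C n κ l v := by
  have e : ∀ D k, fldN n (a • v) D k = a * fldN n v D k := by
    intro D k
    simp only [fldN_eq, Pi.smul_apply, smul_eq_mul]; ring
  ext k i
  fin_cases i <;> simp [linC, bK, gK, aK, e] <;> ring

lemma linC_eq_zero (h : C.Modes n κ) {v : Fin 8 → ℝ} (hv : sizeV n v = 0) (l : ℝ) :
    linC C n κ l v = 0 := by
  have hk := h.kap_pos
  have h1 := h.sum_sq v
  have h2 := h.sum_aK_sq v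
  rw [hv] at h1 h2
  rw [Finset.sum_eq_zero_iff_of_nonneg (fun k _ => by positivity)] at h1
  have h2' := le_antisymm (h2.trans (by norm_num)) (Finset.sum_nonneg fun k _ => sq_nonneg (aK C n v k))
  rw [Finset.sum_eq_zero_iff_of_nonneg (fun k _ => by positivity)] at h2'
  ext k i
  have b1 := h1 k (Finset.mem_univ _)
  have b2 := h2' k (Finset.mem_univ _)
  have b3 : bK n v k ^ 2 = 0 := by
    have : 0 ≤ gK C n κ v k ^ 2 / (4 * κ) := by positivity
    nlinarith [sq_nonneg (bK n v k)]
  have b4 : gK C n κ v k ^ 2 / (4 * κ) = 0 := by linarith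
  have b5 : gK C n κ v k = 0 := by
    rcases div_eq_zero_iff.1 b4 with h | h
    · exact pow_eq_zero_iff two_ne_zero |>.1 h
    · linarith
  fin_cases i <;> simp [linC, b5, pow_eq_zero_iff two_ne_zero |>.1 b3, pow_eq_zero_iff two_ne_zero |>.1 b2]

variable [NeZero n]

/-- The energy of a perturbed polygon on the near minimizer. -/
lemma energy_base {C' : Fin n → Fin 4 → ℝ} {l s A q1 del : ℝ} (hκ : 0 < κ) {U Z : Tup n} (hU : symT U = U)
    {U0 : Tup n} (hU0 : U0 = U + Z)
    (hdel : frm (fun _ => ![1, 0, 0, 0]) U0 U0 - frm (fun _ => ![0, 0, κ, 0]) U0 U0 = n * del)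
    (hB0 : l * frm (masC n) U U ≤ frm (dirC n κ) U U)
    (hQZ : frm (dirC n κ) Z Z ≤ 77 / 10000 * n)
    (hQU : n * q1 - frm (dirC n κ) Z Z - n / 10000 ≤ frm (dirC n κ) U U)
    (hQU' : frm (dirC n κ) U U ≤ 546 / 100 * n)
    (hs : 0 ≤ s) (hA : |A| ≤ s) (h1 : s * (2 - 1 / 20) - A ≤ ∑ k, (C' k 0 - 1))
    (h2 : s * (2 - 1 / 20) + A ≤ ∑ k, (C' k 2 / κ - 1)) (h3 : ∑ k, C' k 3 = -(n * l)) :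
    s * (2 * q1 - 7072 / 10000) - A * del ≤ frm C' U U := by
  have hn : (0 : ℝ) < n := by exact_mod_cast NeZero.pos n
  rw [frm_self_of_symm hκ C' hU, h3]
  have hX : ∀ V : Tup n, 0 ≤ frm (fun _ => ![1, 0, 0, 0]) V V := frm_nonneg fun k x y z => by
    simp; positivity
  have hY : ∀ V : Tup n, 0 ≤ frm (fun _ => ![0, 0, κ, 0]) V V := frm_nonneg fun k x y z => by
    simp; positivity
  have hsX : ∀ u v : Tup n, frm (fun _ => ![1, 0, 0, 0]) u v = frm (fun _ => ![1, 0, 0, 0]) v u := frm_symm _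
  have hsY : ∀ u v : Tup n, frm (fun _ => ![0, 0, κ, 0]) u v = frm (fun _ => ![0, 0, κ, 0]) v u := frm_symm _
  have hQ : ∀ V : Tup n, frm (dirC n κ) V V = frm (fun _ => ![1, 0, 0, 0]) V V + frm (fun _ => ![0, 0, κ, 0]) V V := by
    intro V
    rw [← LinearMap.add_apply, ← LinearMap.add_apply, ← frm_add]
    congr 2
    congr 1
    ext k i; fin_cases i <;> simp [dirC]
  have y1 := form_young hsX hX U Z (t := 1 / 25) (by norm_num)
  have y2 := form_young' hsX hX U Z (t := 1 / 25) (by norm_num)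
  have y3 := form_young hsY hY U Z (t := 1 / 25) (by norm_num)
  have y4 := form_young' hsY hY U Z (t := 1 / 25) (by norm_num)
  have xz := hX Z
  have yz := hY Z
  have xu := hX U
  have yu := hY U
  rw [hU0] at hdel
  simp only [map_add, LinearMap.add_apply] at hdel
  rw [hsX Z U, hsY Z U] at hdel
  rw [hQ] at hB0 hQZ hQU hQU'
  rw [hQ] at hQU
  generalize frm (fun _ => ![1, 0, 0, 0]) U U = XU at *
  generalize frm (fun _ => ![1, 0, 0, 0]) Z Z = XZ at *
  generalize frm (fun _ => ![1, 0, 0, 0]) U Z = XUZ at *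
  generalize frm (fun _ => ![0, 0, κ, 0]) U U = YU at *
  generalize frm (fun _ => ![0, 0, κ, 0]) Z Z = YZ at *
  generalize frm (fun _ => ![0, 0, κ, 0]) U Z = YUZ at *
  generalize frm (masC n) U U = NU at *
  simp only [Finset.sum_sub_distrib, Finset.sum_const, Finset.card_univ, Fintype.card_fin, nsmul_eq_mul,
    mul_one] at h1 h2
  generalize ∑ k, C' k 0 = S0 at *
  generalize ∑ k, C' k 2 / κ = S2 at *
  have hD : |XU - YU - n * del| ≤ 4186 / 10000 * n := by
    rw [abs_le]; constructor <;> linarith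
  have hAD : |A * (XU - YU - n * del)| ≤ s * (4186 / 10000 * n) := by
    rw [abs_mul]; exact mul_le_mul hA hD (abs_nonneg _) hs
  rw [abs_le] at hAD
  refine le_of_mul_le_mul_left ?_ hn
  have e : n * (S0 / n * XU + S2 / n * YU + -(n * l) / n * NU) = S0 * XU + S2 * YU - n * l * NU := by
    field_simp; ring
  rw [e]
  have m1 := mul_le_mul_of_nonneg_right h1 xu
  have m2 := mul_le_mul_of_nonneg_right h2 yu
  have m3 := mul_le_mul_of_nonneg_left hB0 hn.le
  have m4 := mul_le_mul_of_nonneg_left hQU hs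
  have m5 := mul_le_mul_of_nonneg_left hQU' hs
  have m6 := mul_le_mul_of_nonneg_left hQZ hs
  linarith [hAD.1, hAD.2]

lemma grad_pair_le (h : C.Modes n κ) (v : Fin 8 → ℝ) {Z : Tup n} (hZ : symT Z = Z) (w : Tup n) :
    2 * frm (fun k => ![-2 * bK n v k, gK C n κ v k, 2 * κ * bK n v k, 0]) Z w ≤
      1 / 20 * frm (dirC n κ) w w + 80 * sizeV n v / n * frm (dirC n κ) Z Z := by
  have hk := h.kap_pos
  have := frm_pair_le (C := fun k => ![-2 * bK n v k, gK C n κ v k, 2 * κ * bK n v k, 0])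
    (c := ![1, 0, κ, 0]) (η := 1 / 20) (M := fun k => 80 * (bK n v k ^ 2 + gK C n κ v k ^ 2 / (4 * κ)))
    (fun k x y z x' y' z' => ?_) hZ w
  · rwa [← Finset.mul_sum, h.sum_sq] at this
  · simp only [Matrix.cons_val]
    generalize bK n v k = b
    generalize gK C n κ v k = g
    have h1 : 0 ≤ 1 / 20 * (x' - 20 * (-2 * b * x + g * y)) ^ 2 := by positivity
    have h2 : 0 ≤ 1 / 20 * κ * (y' - 20 * (g * x / κ + 2 * b * y)) ^ 2 := by positivity
    have e : 1 / 20 * (1 * (x' * x') + 0 * (x' * y' + y' * x') + κ * (y' * y') + 0 * (z' * z')) +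
      80 * (b ^ 2 + g ^ 2 / (4 * κ)) * (1 * (x * x) + 0 * (x * y + y * x) + κ * (y * y) + 0 * (z * z)) -
      2 * (-2 * b * (x * x') + g * (x * y' + y * x') + 2 * κ * b * (y * y') + 0 * (z * z')) =
      1 / 20 * (x' - 20 * (-2 * b * x + g * y)) ^ 2 +
        1 / 20 * κ * (y' - 20 * (g * x / κ + 2 * b * y)) ^ 2 := by
      field_simp; ring
    linarith

lemma mass_pair_le (h : C.Modes n κ) (v : Fin 8 → ℝ) {Y : Tup n} (hY : symT Y = Y) (w : Tup n) :
    2 * frm (fun k => ![0, 0, 0, 2 * aK C n v k]) Y w ≤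
      2 / 5 * frm (masC n) w w + 20 * sizeV n v / n * frm (masC n) Y Y := by
  have hn : (0 : ℝ) < n := by exact_mod_cast NeZero.pos n
  have := frm_pair_le (C := fun k => ![0, 0, 0, 2 * aK C n v k])
    (c := ![0, 0, 0, 1]) (η := 2 / 5) (M := fun k => 10 * aK C n v k ^ 2)
    (fun k x y z x' y' z' => ?_) hY w
  · rw [← Finset.mul_sum] at this
    have h0 : 0 ≤ frm (masC n) Y Y := frm_nonneg (fun k x y z => by simp [masC]; positivity) Y
    refine this.trans (add_le_add_right (mul_le_mul_of_nonneg_right ?_ h0) _)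
    exact div_le_div_of_nonneg_right (by linarith [h.sum_aK_sq v]) hn.le
  · simp only [Matrix.cons_val]
    generalize aK C n v k = a
    have h1 : 0 ≤ 2 / 5 * (z' - 5 * a * z) ^ 2 := by positivity
    linarith
end Cert

namespace Cert
variable {C : Cert} {n : ℕ} {κ : ℝ}

lemma quadM_smul_left (n : ℕ) (a : ℝ) (v : Fin 8 → ℝ) (M : Fin 8 → Fin 8 → ℝ) :
    quadM n (a • v) M = a ^ 2 * quadM n v M := by
  simp only [quadM, Pi.smul_apply, smul_eq_mul]; ring

lemma masC_sum_zero [NeZero n] {U f : Tup n} (hU : symT U = U) (hf : ∀ p, ∑ k, f.1 k p = 0) :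
    frm (masC n) U f = 0 := by
  have hz : ∀ k, U.1 k = symFun U.1 := fun k => by rw [← symT_apply U k, hU]
  have hc : Continuous (symFun U.1) := (contDiff_symFun U.2.1).continuous
  have e : ∀ k, triInt (frmD (masC n k) (U.1 k) (f.1 k)) = triInt (fun p => symFun U.1 p * f.1 k p) := by
    intro k; congr 1; ext p; rw [frmD_masC, hz k]
  rw [frm_apply]
  simp only [e]
  have hcf : ∀ k, Continuous (f.1 k) := fun k => (f.2.1 k).continuous
  rw [← triInt_sum (f := fun k p => symFun U.1 p * f.1 k p) Finset.univ (fun k => hc.mul (hcf k))]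
  simp only [← Finset.mul_sum, hf, mul_zero]
  simp [triInt]

lemma local_arith {T Qw Nw QZ NU NZ NY l lam Lp QUN ec qm q1 ad F1 X1 X2 X3 X4 X5 Ew s a m K d t ε BUw Bw : ℝ}
    (hm : 0 < m) (hs : 0 ≤ s) (hT : T = a ^ 2 * s) (hec : ec = 9 / 10) (hK : 0 ≤ K)
    (hlam : 0 ≤ lam) (hlam' : lam ≤ 54 / 10) (hLp : 905 / 100 ≤ Lp) (hl : l ≤ lam) (hll : lam - l ≤ 1 / 100)
    (hQw : Lp * Nw ≤ Qw) (hNw : 0 ≤ Nw) (hQZ : QZ ≤ 77 / 10000 * m) (hNZ : Lp * NZ ≤ QZ) (hNZ0 : 0 ≤ NZ)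
    (hNU : NU ≤ 101 / 100 * m) (hNU0 : 0 ≤ NU)
    (hNY : NY = (lam - l) ^ 2 * NU + lam ^ 2 * NZ)
    (hF1 : s * (2 * q1 - 7072 / 10000) - ad ≤ F1)
    (hF2 : -(1000 / 3 * (a ^ 2 * ε) + 3 / 1000 * Bw) ≤ 2 * (a * BUw)) (hε : ε ≤ 3 / 100000 * s)
    (hBw : Bw = Qw - l * Nw) (hl0 : 0 ≤ l)
    (hF3 : a ^ 2 * qm ≤ 2 * X1 + ec * Qw - lam * Nw)
    (hqm : 2 * s ≤ 2 * q1 * s - ad + qm)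
    (hF4 : 2 * X2 ≤ 1 / 20 * Qw + 80 * s / m * (a ^ 2 * QZ))
    (hF4' : 2 * X3 ≤ 2 / 5 * Nw + 20 * s / m * (a ^ 2 * NY))
    (hX : X4 = X1 - X2 - X3)
    (hQUN : QUN ≤ 647 / 100 * m) (ht : t = 1 / (260 * (K + 1) * m))
    (hF5 : -(2 * (K * s) * (t * (a ^ 2 * QUN) + t⁻¹ * (Qw + Nw))) ≤ 2 * X5)
    (hd : 2 * d ≤ 1 / 10000) (hsd : s * (520 * K * (K + 1) * m) ≤ 1 / 10000)
    (hEw : -(2 * d * (Qw + Nw)) ≤ Ew) :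
    0 ≤ a ^ 2 * F1 + 2 * (a * BUw) + 2 * X4 + 2 * X5 + Bw + Ew := by
  have ha := sq_nonneg a
  have hT0 : 0 ≤ T := by rw [hT]; positivity
  have hQw0 : 0 ≤ Qw := (mul_nonneg (by linarith) hNw).trans hQw
  have f1 := mul_le_mul_of_nonneg_left hF1 ha
  have f6 := mul_le_mul_of_nonneg_left hqm ha
  have f2 := mul_le_mul_of_nonneg_left hε ha
  have f2' : Bw ≤ Qw := by rw [hBw]; linarith [mul_nonneg hl0 hNw]
  have f4 : 80 * s / m * (a ^ 2 * QZ) ≤ 616 / 1000 * T := by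
    have := mul_le_mul_of_nonneg_left hQZ (by positivity : 0 ≤ 80 * s / m * a ^ 2)
    calc _ = 80 * s / m * a ^ 2 * QZ := by ring
      _ ≤ _ := this
      _ = _ := by rw [hT]; field_simp; ring
  have hNZ' : NZ ≤ 77 / 90500 * m := by
    have := mul_le_mul_of_nonneg_right hLp hNZ0
    linarith
  have hNY' : NY ≤ 2492 / 100000 * m := by
    have h1 : (lam - l) ^ 2 ≤ 1 / 10000 := by
      have := mul_self_le_mul_self (by linarith : 0 ≤ lam - l) hll
      linarith
    have h2 : lam ^ 2 ≤ 2916 / 100 := by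
      have := mul_self_le_mul_self hlam hlam'
      linarith
    have h3 := mul_le_mul h1 hNU hNU0 (by norm_num)
    have h4 := mul_le_mul h2 hNZ' hNZ0 (by norm_num)
    linarith
  have f4' : 20 * s / m * (a ^ 2 * NY) ≤ 4984 / 10000 * T := by
    have := mul_le_mul_of_nonneg_left hNY' (by positivity : 0 ≤ 20 * s / m * a ^ 2)
    calc _ = 20 * s / m * a ^ 2 * NY := by ring
      _ ≤ _ := this
      _ = _ := by rw [hT]; field_simp; ring
  have ht0 : 0 < t := by rw [ht]; positivity
  have f5 : 2 * (K * s) * (t * (a ^ 2 * QUN)) ≤ 5 / 100 * T := by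
    have h1 := mul_le_mul_of_nonneg_left hQUN (by positivity : 0 ≤ 2 * (K * s) * (t * a ^ 2))
    calc _ = 2 * (K * s) * (t * a ^ 2) * QUN := by ring
      _ ≤ _ := h1
      _ = (647 / 13000 * T) * (K / (K + 1)) := by rw [hT, ht]; field_simp; ring
      _ ≤ (647 / 13000 * T) * 1 := by
        refine mul_le_mul_of_nonneg_left ?_ (by positivity)
        rw [div_le_one (by positivity)]; linarith
      _ ≤ _ := by linarith
  have f5' : 2 * (K * s) * (t⁻¹ * (Qw + Nw)) ≤ 1 / 10000 * (Qw + Nw) := by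
    calc _ = s * (520 * K * (K + 1) * m) * (Qw + Nw) := by rw [ht]; field_simp; ring
      _ ≤ _ := mul_le_mul_of_nonneg_right hsd (by linarith)
  have f7 := mul_le_mul_of_nonneg_right hd (by linarith : 0 ≤ Qw + Nw)
  have f8 : 905 / 100 * Nw ≤ Qw := (mul_le_mul_of_nonneg_right hLp hNw).trans hQw
  have f9 := mul_le_mul_of_nonneg_right hl hNw
  have e5 : 2 * (K * s) * (t * (a ^ 2 * QUN) + t⁻¹ * (Qw + Nw)) =
    2 * (K * s) * (t * (a ^ 2 * QUN)) + 2 * (K * s) * (t⁻¹ * (Qw + Nw)) := by ring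
  rw [e5] at hF5
  subst hX hec hBw
  have hT' : a ^ 2 * s = T := hT.symm
  have g1 : a ^ 2 * (s * (2 * q1 - 7072 / 10000) - ad) + a ^ 2 * qm ≥ (2 - 7072 / 10000) * T := by
    rw [hT]; linarith
  have g2 : a ^ 2 * ε ≤ 3 / 100000 * T := by rw [hT]; linarith
  have g3 : 2 * X2 ≤ 1 / 20 * Qw + 616 / 1000 * T := by linarith only [hF4, f4]
  have g4 : 2 * X3 ≤ 2 / 5 * Nw + 4984 / 10000 * T := by linarith only [hF4', f4']
  have g5 : -(5 / 100 * T + 1 / 10000 * (Qw + Nw)) ≤ 2 * X5 := by linarith only [hF5, f5, f5']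
  have g6 : -(1 / 10000 * (Qw + Nw)) ≤ Ew := by linarith only [hEw, f7]
  have g7 : -(1 / 100 * T + 3 / 1000 * Qw) ≤ 2 * (a * BUw) := by linarith only [hF2, f2', g2]
  linarith only [g1, g3, g4, g5, g6, g7, f1, hF3, f8, f9, hT0, hNw]

variable [NeZero n]

set_option maxHeartbeats 1000000 in
theorem Nice.local_nonneg (h : C.Nice n κ) (hm : C.Modes n κ) (hec : (C.ec : ℝ) = 9 / 10) {l L : ℝ}
    (S : SpecGap (frm (dirC n κ)) (frm (masC n)) l L) (hL : C.Lp < L) (K : ℝ) :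
    ∃ δ > 0, ∀ (v : Fin 8 → ℝ) (C' : Fin n → Fin 4 → ℝ), sizeV n v < δ →
      (∀ k i, |C' k i - ![1, 0, κ, -l] i| ≤ δ) →
      (∀ k i, |C' k i - ![1, 0, κ, -l] i - linC C n κ l v k i| ≤ K * sizeV n v) →
      sizeV n v * (2 - 1 / 20) - areaV C n v ≤ ∑ k, (C' k 0 - 1) →
      sizeV n v * (2 - 1 / 20) + areaV C n v ≤ ∑ k, (C' k 2 / κ - 1) →
      ∑ k, C' k 3 = -(n * l) → ∀ W : Tup n, 0 ≤ frm C' W W := by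
  have hn : (0 : ℝ) < n := by exact_mod_cast NeZero.pos n
  have hκ := hm.kap_pos
  set c0 : Fin n → Fin 4 → ℝ := fun _ => ![1, 0, κ, -l] with hc0
  have hB : ∀ V W : Tup n, frm c0 V W = frm (dirC n κ) V W - l * frm (masC n) V W := by
    intro V W
    have : c0 = dirC n κ + (-l) • masC n := by
      ext k i; fin_cases i <;> simp [hc0, dirC, masC]
    rw [this, frm_add, frm_smul]; simp; ring
  have hBs : ∀ V W : Tup n, frm c0 V W = frm c0 W V := frm_symm _
  have hBn : ∀ V : Tup n, 0 ≤ frm c0 V V := fun V => by rw [hB]; linarith [S.bound V]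
  refine ⟨1 / 10000 / (520 * (K + 1) ^ 2 * n + 2), by positivity, ?_⟩
  intro v C' hsδ hδ hK h1 h2 h3 W
  set s := sizeV n v with hs
  set δ : ℝ := 1 / 10000 / (520 * (K + 1) ^ 2 * n + 2) with hδdef
  have hδ0 : 0 < δ := by positivity
  have hδe : δ * (520 * (K + 1) ^ 2 * n + 2) = 1 / 10000 := by rw [hδdef]; field_simp
  have hs0 : 0 ≤ s := sizeV_nonneg n v
  rcases hs0.eq_or_lt with hs00 | hspos
  · have hl0 := linC_eq_zero hm hs00.symm l
    have : C' = c0 := by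
      ext k i
      have := hK k i
      rw [← hs00, mul_zero, hl0] at this
      have := abs_eq_zero.1 (le_antisymm this (abs_nonneg _))
      simp only [Pi.zero_apply, sub_zero] at this
      linarith
    rw [this]; exact hBn W
  have hK0 : 0 ≤ K := by
    have := (abs_nonneg _).trans (hK 0 0)
    exact nonneg_of_mul_nonneg_left this hspos
  obtain ⟨U, Z, hSU, hSZ, hUZ, hBU, hNUZ, hgap, hNU0, hNU, hl, hll, hQZ, hQU, hQU'⟩ :=
    h.exists_base S hL (ε := min ((n : ℝ) / 10 ^ 9) (3 / 100000 * s)) (by positivity) (min_le_left _ _)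
  set ε := min ((n : ℝ) / 10 ^ 9) (3 / 100000 * s) with hε
  set a := frm (masC n) U W / frm (masC n) U U with ha
  set w := W - a • U with hw
  have hWe : W = a • U + w := by rw [hw]; abel
  have hNUw : frm (masC n) U w = 0 := by
    rw [hw, map_sub, map_smul, ha, smul_eq_mul, div_mul_cancel₀ _ hNU0.ne', sub_self]
  set E := C' - c0 with hE
  set E' := E - linC C n κ l v with hE'
  set gr : Fin n → Fin 4 → ℝ := fun k => ![-2 * bK n v k, gK C n κ v k, 2 * κ * bK n v k, 0] with hgr
  set ms : Fin n → Fin 4 → ℝ := fun k => ![0, 0, 0, 2 * aK C n v k] with hms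
  have hlin : ∀ r : ℝ, linC C n κ r v = gr + r • ms := by
    intro r; ext k i; fin_cases i <;> simp [linC, hgr, hms]; ring
  have hCe : C' = c0 + (gr + l • ms) + E' := by rw [hE', hE, hlin]; abel
  have hCe2 : C' = c0 + E := by rw [hE]; abel
  set Y := (C.lam : ℝ) • Ut n h.even - l • U with hY
  have hs0' : symT (Ut n h.even) = Ut n h.even := symT_of_const (fun _ => rfl) (ev_even_of_all h.even)
  have hSY : symT Y = Y := by rw [hY, map_sub, map_smul, map_smul, hs0', hSU]
  have hYe : Y = ((C.lam : ℝ) - l) • U + (C.lam : ℝ) • Z := by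
    rw [hY, hUZ]; module
  -- pieces
  have F1 := energy_base (C' := C') hκ hSU hUZ (frm_Ut h.valid.kap h.even).2.2 (S.bound U) hQZ hQU hQU'
    hs0 (hm.abs_areaV_le v) h1 h2 h3
  have F2 := form_young' hBs hBn (a • U) w (t := 1000 / 3) (by norm_num)
  have F3 := h.valid.bound (a • v) w (fun f hf => hgap _ (by
    rw [map_sub, hNUw, masC_sum_zero hSU hf, sub_zero]))
  rw [fldP_S_eq h.valid.kap _ h.even, linC_smul, quadM_smul_left, frm_smul] at F3
  have F4 := grad_pair_le hm v (Z := a • Z) (by rw [map_smul, hSZ]) w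
  have F4' := mass_pair_le hm v (Y := a • Y) (by rw [map_smul, hSY]) w
  have hE'b : ∀ k i, |E' k i| ≤ K * s := hK
  have hEb : ∀ k i, |E k i| ≤ δ := hδ
  have ht0 : 0 < 1 / (260 * (K + 1) * n) := by positivity
  have F5 := frm_pair_le_of_abs h.kap_ge hE'b (-(a • U)) w ht0
  have F7 := frm_le_of_abs h.kap_ge hEb w
  have hmain := local_arith (T := a ^ 2 * s) (Qw := frm (dirC n κ) w w) (Nw := frm (masC n) w w)
    (QZ := frm (dirC n κ) Z Z) (NU := frm (masC n) U U) (NZ := frm (masC n) Z Z) (NY := frm (masC n) Y Y)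
    (l := l) (lam := C.lam) (Lp := C.Lp) (QUN := frm (dirC n κ) U U + frm (masC n) U U) (ec := C.ec)
    (qm := quadM n v (fun i j => (C.dens i j).val)) (q1 := C.q1.val) (ad := areaV C n v * C.del.val)
    (F1 := frm C' U U) (X1 := a * frm (linC C n κ C.lam v) (Ut n h.even) w)
    (X2 := a * frm gr Z w) (X3 := a * frm ms Y w) (X4 := a * frm (gr + l • ms) U w)
    (X5 := a * frm E' U w) (Ew := frm E w w) (s := s) (a := a) (m := n) (K := K) (d := δ)
    (t := 1 / (260 * (K + 1) * n)) (ε := ε) (BUw := frm c0 U w) (Bw := frm c0 w w)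
    hn hs0 rfl hec hK0 (by linarith [h.lam_ge]) h.lam_le h.Lp_ge hl hll (hgap w hNUw) (S.nonnegN w)
    hQZ (hgap Z hNUZ) (S.nonnegN Z) hNU hNU0.le ?_ F1 ?_ (min_le_right _ _) (hB w w) S.l_nonneg
    ?_ ?_ ?_ ?_ ?_ (by linarith) rfl ?_ ?_ ?_ F7
  · have key : frm C' W W = a ^ 2 * frm C' U U + 2 * (a * frm c0 U w) + 2 * (a * frm (gr + l • ms) U w) +
        2 * (a * frm E' U w) + frm c0 w w + frm E w w := by
      have e1 : frm C' W W = a ^ 2 * frm C' U U + 2 * a * frm C' U w + frm C' w w := by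
        rw [hWe]
        simp only [map_add, LinearMap.add_apply, map_smul, LinearMap.smul_apply, smul_eq_mul]
        rw [frm_symm C' w U]; ring
      have e2 : frm C' U w = frm c0 U w + frm (gr + l • ms) U w + frm E' U w := by
        conv_lhs => rw [hCe]
        rw [frm_add, frm_add]; rfl
      have e3 : frm C' w w = frm c0 w w + frm E w w := by
        conv_lhs => rw [hCe2]
        rw [frm_add]; rfl
      rw [e1, e2, e3]; ring
    rw [key]; exact hmain
  · rw [hYe]
    simp only [map_add, LinearMap.add_apply, map_smul, LinearMap.smul_apply, smul_eq_mul]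
    rw [S.symmN Z U, hNUZ]; ring
  · simp only [map_smul, LinearMap.smul_apply, smul_eq_mul] at F2
    have : frm c0 U U ≤ ε := by rw [hB]; exact hBU
    have := mul_le_mul_of_nonneg_left this (sq_nonneg a)
    norm_num at F2 ⊢
    linarith
  · simp only [LinearMap.smul_apply, smul_eq_mul] at F3
    linarith
  · have := h.comb v
    unfold areaV; linarith
  · simp only [map_smul, LinearMap.smul_apply, smul_eq_mul] at F4
    linarith
  · simp only [map_smul, LinearMap.smul_apply, smul_eq_mul] at F4'
    linarith
  · rw [hlin, hY, hUZ]
    simp only [frm_add, frm_smul, map_add, map_sub, LinearMap.add_apply, LinearMap.sub_apply, map_smul,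
      LinearMap.smul_apply, smul_eq_mul]
    ring
  · simp only [map_neg, map_smul, LinearMap.neg_apply, LinearMap.smul_apply, smul_eq_mul] at F5
    linarith
  · nlinarith [mul_nonneg hδ0.le (by positivity : 0 ≤ 520 * (K + 1) ^ 2 * n)]
  · have a1 : s * (520 * K * (K + 1) * n) ≤ δ * (520 * K * (K + 1) * n) :=
      mul_le_mul_of_nonneg_right hsδ.le (by positivity)
    have a2 : δ * (520 * K * (K + 1) * n) ≤ δ * (520 * (K + 1) ^ 2 * n + 2) := by
      refine mul_le_mul_of_nonneg_left ?_ hδ0.le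
      have : 0 ≤ 520 * (K + 1) * n := by positivity
      nlinarith
    linarith
end Cert

/-- The cross product of plane vectors. -/
def cross (u v : ℝ × ℝ) : ℝ := u.1 * v.2 - u.2 * v.1

/-- The linear map with columns `p` and `q`. -/
noncomputable def colMap (p q : ℝ × ℝ) : ℝ × ℝ →ₗ[ℝ] ℝ × ℝ :=
  Matrix.toLin (Module.Basis.finTwoProd ℝ) (Module.Basis.finTwoProd ℝ) !![p.1, q.1; p.2, q.2]

lemma colMap_apply (p q z : ℝ × ℝ) : colMap p q z = (p.1 * z.1 + q.1 * z.2, p.2 * z.1 + q.2 * z.2) := by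
  rw [colMap, Matrix.toLin_finTwoProd_apply]

lemma det_colMap (p q : ℝ × ℝ) : LinearMap.det (colMap p q) = cross p q := by
  rw [colMap, LinearMap.det_toLin, Matrix.det_fin_two_of, cross]; ring

lemma continuous_colMap (p q : ℝ × ℝ) : Continuous (colMap p q) :=
  LinearMap.continuous_of_finiteDimensional _

/-- The open cone around the horizontal half axis. -/
def refCone : Set (ℝ × ℝ) := {p | |p.2| < p.1}

/-- A closed star-shaped chain of vertices, convex and positively oriented, with centroid `0`. -/
structure Fan (n : ℕ) [NeZero n] (y : Fin n → ℝ × ℝ) : Prop where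
  three : 3 ≤ n
  sum_zero : ∑ k, y k = 0
  pos : ∀ k, 0 < cross (y k) (y (k + 1))
  supp : ∀ k j, j ≠ k → j ≠ k + 1 → cross (y j) (y (k + 1) - y k) < cross (y k) (y (k + 1))

namespace Fan
variable {n : ℕ} [NeZero n] {y : Fin n → ℝ × ℝ}

noncomputable def mid (y : Fin n → ℝ × ℝ) (k : Fin n) : ℝ × ℝ := (1 / 2 : ℝ) • (y k + y (k + 1))
noncomputable def half (y : Fin n → ℝ × ℝ) (k : Fin n) : ℝ × ℝ := (1 / 2 : ℝ) • (y (k + 1) - y k)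
/-- The affine-linear chart of the `k`-th sector. -/
noncomputable def chart (y : Fin n → ℝ × ℝ) (k : Fin n) : ℝ × ℝ →ₗ[ℝ] ℝ × ℝ := colMap (mid y k) (half y k)
def sector (y : Fin n → ℝ × ℝ) (k : Fin n) : Set (ℝ × ℝ) := {z | 0 < cross (y k) z ∧ 0 < cross z (y (k + 1))}
noncomputable def jac (y : Fin n → ℝ × ℝ) (k : Fin n) : ℝ := cross (y k) (y (k + 1)) / 2

lemma chart_apply (y : Fin n → ℝ × ℝ) (k : Fin n) (z : ℝ × ℝ) :
    chart y k z = ((z.1 - z.2) / 2) • y k + ((z.1 + z.2) / 2) • y (k + 1) := by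
  rw [chart, colMap_apply, mid, half]
  ext <;> simp <;> ring

lemma det_chart (y : Fin n → ℝ × ℝ) (k : Fin n) : LinearMap.det (chart y k) = jac y k := by
  rw [chart, det_colMap, jac, mid, half]; simp [cross]; ring

lemma cross_chart (y : Fin n → ℝ × ℝ) (k : Fin n) (u z : ℝ × ℝ) : cross (chart y k z) u =
    ((z.1 - z.2) / 2) * cross (y k) u + ((z.1 + z.2) / 2) * cross (y (k + 1)) u := by
  rw [chart_apply]; simp [cross]; ring

lemma cross_swap (u v : ℝ × ℝ) : cross u v = -cross v u := by simp [cross]; ring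
lemma cross_self (u : ℝ × ℝ) : cross u u = 0 := by simp [cross]; ring

lemma preimage_sector (h : Fan n y) (k : Fin n) : chart y k ⁻¹' sector y k = refCone := by
  ext z
  have hp := h.pos k
  simp only [sector, refCone, Set.mem_preimage, Set.mem_ofPred_eq, cross_swap (y k) (chart y k z), cross_chart,
    cross_self, abs_lt]
  rw [cross_swap (y (k + 1)) (y k)]
  constructor
  · rintro ⟨h1, h2⟩
    have h1' : 0 < (z.1 + z.2) / 2 := pos_of_mul_pos_left (by linarith) hp.le
    have h2' : 0 < (z.1 - z.2) / 2 := pos_of_mul_pos_left (by linarith) hp.le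
    constructor <;> linarith
  · rintro ⟨h1, h2⟩
    have h1' := mul_pos (by linarith : 0 < (z.1 + z.2) / 2) hp
    have h2' := mul_pos (by linarith : 0 < (z.1 - z.2) / 2) hp
    constructor <;> linarith

/-- Points of a sector are positive combinations of its two spanning vertices. -/
lemma exists_comb (h : Fan n y) {k : Fin n} {z : ℝ × ℝ} (hz : z ∈ sector y k) :
    ∃ a b : ℝ, 0 < a ∧ 0 < b ∧ z = a • y k + b • y (k + 1) := by
  have hp := h.pos k
  refine ⟨cross z (y (k + 1)) / cross (y k) (y (k + 1)), cross (y k) z / cross (y k) (y (k + 1)),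
    div_pos hz.2 hp, div_pos hz.1 hp, ?_⟩
  ext <;> simp only [Prod.fst_add, Prod.snd_add, Prod.smul_fst, Prod.smul_snd, smul_eq_mul] <;>
    field_simp <;> simp only [cross] <;> ring

lemma supp_le (h : Fan n y) (k j : Fin n) : cross (y j) (y (k + 1) - y k) ≤ cross (y k) (y (k + 1)) := by
  by_cases h1 : j = k
  · subst h1; simp [cross]; linarith
  by_cases h2 : j = k + 1
  · subst h2; simp [cross]; linarith
  exact (h.supp k j h1 h2).le

/-- The support function of the `k`-th side. -/
noncomputable def side (y : Fin n → ℝ × ℝ) (k : Fin n) (z : ℝ × ℝ) : ℝ :=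
  cross z (y (k + 1) - y k) / cross (y k) (y (k + 1))

lemma side_comb (y : Fin n → ℝ × ℝ) (k : Fin n) (a b : ℝ) (u v : ℝ × ℝ) :
    side y k (a • u + b • v) = a * side y k u + b * side y k v := by
  simp [side, cross]; ring

lemma side_le (h : Fan n y) (k j : Fin n) : side y k (y j) ≤ 1 :=
  (div_le_one (h.pos k)).2 (h.supp_le k j)

lemma side_lt (h : Fan n y) {k j : Fin n} (h1 : j ≠ k) (h2 : j ≠ k + 1) : side y k (y j) < 1 :=
  (div_lt_one (h.pos k)).2 (h.supp k j h1 h2)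

lemma side_left (h : Fan n y) (k : Fin n) : side y k (y k) = 1 := by
  rw [side, div_eq_one_iff_eq (h.pos k).ne']; simp [cross]; ring

lemma side_right (h : Fan n y) (k : Fin n) : side y k (y (k + 1)) = 1 := by
  rw [side, div_eq_one_iff_eq (h.pos k).ne']; simp [cross]; ring

lemma side_chart (h : Fan n y) (k : Fin n) (z : ℝ × ℝ) : side y k (chart y k z) = z.1 := by
  rw [chart_apply, side_comb, h.side_left, h.side_right]; ring

lemma add_two_ne (h : 3 ≤ n) (j : Fin n) : j + 1 + 1 ≠ j := by
  intro e
  rw [add_assoc, add_eq_left] at e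
  have := congrArg Fin.val e
  simp [Fin.val_add] at this
  rw [Nat.mod_eq_of_lt (by omega)] at this
  omega

lemma side_lt_of_ne (h : Fan n y) {i j : Fin n} (hij : i ≠ j) {z : ℝ × ℝ} (hz : z ∈ sector y i) :
    side y j z < side y i z := by
  obtain ⟨a, b, ha, hb, rfl⟩ := h.exists_comb hz
  rw [side_comb, side_comb, h.side_left, h.side_right]
  by_cases h1 : i = j + 1
  · have := h.side_lt (k := j) (j := i + 1) (by rw [h1]; exact add_two_ne h.three j)
      (fun e => hij (add_right_cancel e))
    have := mul_lt_mul_of_pos_left this hb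
    have := mul_le_mul_of_nonneg_left (h.side_le j i) ha.le
    linarith
  · have := mul_lt_mul_of_pos_left (h.side_lt hij h1) ha
    have := mul_le_mul_of_nonneg_left (h.side_le j (i + 1)) hb.le
    linarith

lemma disjoint_sector (h : Fan n y) : Pairwise (Function.onFun Disjoint (sector y)) := by
  intro i j hij
  refine Set.disjoint_left.2 fun z hi hj => ?_
  exact lt_asymm (h.side_lt_of_ne hij hi) (h.side_lt_of_ne hij.symm hj)

open scoped Fin.NatCast in
lemma exists_sign_change {f : Fin n → ℝ} (hf : ∀ k, f k ≠ 0) (hs : ∑ k, f k = 0) :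
    ∃ k, 0 < f k ∧ f (k + 1) < 0 := by
  by_contra! H
  have H' : ∀ k, 0 < f k → 0 < f (k + 1) := fun k hk => (H k hk).lt_of_ne (hf _).symm
  obtain ⟨k0, hk0⟩ : ∃ k, 0 < f k := by
    by_contra! H2
    have := Finset.sum_lt_sum_of_nonempty (s := Finset.univ) ⟨(0 : Fin n), Finset.mem_univ _⟩
      (fun k _ => (H2 k).lt_of_ne (hf k))
    simp [hs] at this
  have H3 : ∀ m : ℕ, 0 < f (k0 + (m : Fin n)) := by
    intro m
    induction m with
    | zero => simpa using hk0
    | succ m ih => simpa [add_assoc] using H' _ ih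
  have H4 : ∀ k, 0 < f k := by
    intro k
    have := H3 (k - k0).val
    rwa [Fin.cast_val_eq_self, add_sub_cancel] at this
  exact (Finset.sum_pos (fun k _ => H4 k) ⟨0, Finset.mem_univ _⟩).ne' hs

lemma isOpen_sector (y : Fin n → ℝ × ℝ) (k : Fin n) : IsOpen (sector y k) := by
  have h1 : Continuous fun z => cross (y k) z := by unfold cross; fun_prop
  have h2 : Continuous fun z => cross z (y (k + 1)) := by unfold cross; fun_prop
  exact (isOpen_lt continuous_const h1).inter (isOpen_lt continuous_const h2)

lemma null_line {u : ℝ × ℝ} (hu : u ≠ 0) : volume {z | cross u z = 0} = 0 := by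
  let S : Submodule ℝ (ℝ × ℝ) :=
    { carrier := {z | cross u z = 0}
      add_mem' := by intro a b ha hb; simp [cross] at *; linarith
      zero_mem' := by simp [cross]
      smul_mem' := by intro c a ha; simp [cross] at *; linear_combination c * ha }
  refine Measure.addHaar_submodule volume S fun h => hu ?_
  have h1 : ((1, 0) : ℝ × ℝ) ∈ S := h ▸ Submodule.mem_top
  have h2 : ((0, 1) : ℝ × ℝ) ∈ S := h ▸ Submodule.mem_top
  have h1' : cross u (1, 0) = 0 := h1
  have h2' : cross u (0, 1) = 0 := h2
  simp [cross] at h1' h2'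
  ext <;> simp [h1', h2']

lemma iUnion_sector (h : Fan n y) : (⋃ k, sector y k) =ᵐ[volume] Set.univ := by
  have h0 : ∀ᵐ z : ℝ × ℝ, ∀ k, cross (y k) z ≠ 0 := by
    rw [ae_all_iff]
    intro k
    have : y k ≠ 0 := fun e => by have := h.pos k; rw [e] at this; simp [cross] at this
    exact measure_eq_zero_iff_ae_notMem.1 (null_line this)
  rw [Filter.eventuallyEq_univ]
  filter_upwards [h0] with z hz
  obtain ⟨k, h1, h2⟩ := exists_sign_change hz (by
    have : ∑ k, cross (y k) z = cross (∑ k, y k) z := by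
      simp [cross, Prod.fst_sum, Prod.snd_sum, Finset.sum_mul, Finset.sum_sub_distrib]
    rw [this, h.sum_zero]; simp [cross])
  exact Set.mem_iUnion.2 ⟨k, h1, by rw [cross_swap]; linarith⟩

theorem volume_eq (h : Fan n y) : (volume : Measure (ℝ × ℝ)) =
    ∑ k, ENNReal.ofReal (jac y k) • (volume.restrict refCone).map (chart y k) := by
  have hk : ∀ k, ENNReal.ofReal (jac y k) • (volume.restrict refCone).map (chart y k) =
      volume.restrict (sector y k) := by
    intro k
    have hj : 0 < jac y k := half_pos (h.pos k)
    have hm : Measurable (chart y k) := (continuous_colMap _ _).measurable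
    rw [← h.preimage_sector k, ← Measure.restrict_map hm (isOpen_sector y k).measurableSet,
      Measure.map_linearMap_addHaar_eq_smul_addHaar volume (by rw [det_chart]; exact hj.ne'), det_chart,
      Measure.restrict_smul, smul_smul, abs_of_pos (inv_pos.2 hj), ← ENNReal.ofReal_mul hj.le,
      mul_inv_cancel₀ hj.ne', ENNReal.ofReal_one, one_smul]
  simp only [hk]
  rw [← Measure.sum_fintype, ← Measure.restrict_iUnion h.disjoint_sector
    (fun k => (isOpen_sector y k).measurableSet), Measure.restrict_congr_set h.iUnion_sector,
    Measure.restrict_univ]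
end Fan

namespace Fan
variable {n : ℕ} [NeZero n] {y : Fin n → ℝ × ℝ}

lemma jac_pos (h : Fan n y) (k : Fin n) : 0 < jac y k := half_pos (h.pos k)

lemma chart_injective (h : Fan n y) (k : Fin n) : Function.Injective (chart y k) := by
  have : IsUnit (LinearMap.det (chart y k)) := by
    rw [det_chart]; exact (h.jac_pos k).ne'.isUnit
  exact (LinearMap.equivOfDetNeZero (chart y k) this.ne_zero).injective

lemma measurableEmbedding_chart (h : Fan n y) (k : Fin n) : MeasurableEmbedding (chart y k) :=
  (continuous_colMap _ _).measurableEmbedding (h.chart_injective k)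

lemma measurableSet_refCone : MeasurableSet refCone :=
  (isOpen_lt (by fun_prop) (by fun_prop) : IsOpen {p : ℝ × ℝ | |p.2| < p.1}).measurableSet

lemma refTri_inter_refCone : (refTri ∩ refCone : Set (ℝ × ℝ)) =ᵐ[volume] refTri := by
  have h1 := measure_eq_zero_iff_ae_notMem.1 (null_line (u := (1, 1)) (by simp))
  have h2 := measure_eq_zero_iff_ae_notMem.1 (null_line (u := (1, -1)) (by simp))
  filter_upwards [h1, h2] with z hz1 hz2
  refine propext ⟨fun h => h.1, fun h => ⟨h, lt_of_le_of_ne h.1 fun e => ?_⟩⟩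
  have hz1 : ¬ cross (1, 1) z = 0 := hz1
  have hz2 : ¬ cross (1, -1) z = 0 := hz2
  rcases abs_choice z.2 with h | h
  · exact hz1 (by simp [cross]; linarith)
  · exact hz2 (by simp [cross]; linarith)

/-- A function on the plane whose pullbacks by the charts agree with `F` on the triangles and
vanish outside. -/
structure Pieces (y : Fin n → ℝ × ℝ) (f : ℝ × ℝ → ℝ) (F : Fin n → ℝ × ℝ → ℝ) : Prop where
  cont : ∀ k, Continuous (F k)
  inner : ∀ k, ∀ p ∈ refCone, p.1 ≤ 1 → f (chart y k p) = F k p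
  outer : ∀ k, ∀ p ∈ refCone, 1 < p.1 → f (chart y k p) = 0

namespace Pieces
variable {f : ℝ × ℝ → ℝ} {F : Fin n → ℝ × ℝ → ℝ}

lemma eqOn (P : Pieces y f F) (k : Fin n) :
    Set.EqOn (f ∘ chart y k) (refTri.indicator (F k)) refCone := by
  intro p hp
  have hp' : |p.2| < p.1 := hp
  by_cases h : p.1 ≤ 1
  · rw [Set.indicator_of_mem (show p ∈ refTri from ⟨hp'.le, h⟩)]
    exact P.inner k p hp h
  · rw [Set.indicator_of_notMem (fun h2 => h h2.2)]
    exact P.outer k p hp (not_le.1 h)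

lemma integrable (P : Pieces y f F) (h : Fan n y) : Integrable f := by
  rw [h.volume_eq, integrable_finsetSum_measure]
  intro k _
  refine Integrable.smul_measure ?_ ENNReal.ofReal_ne_top
  rw [(h.measurableEmbedding_chart k).integrable_map_iff]
  refine (integrableOn_congr_fun (P.eqOn k) measurableSet_refCone).2 ?_
  exact ((integrable_tri (P.cont k)).integrable_indicator measurableSet_refTri).integrableOn

theorem integral_eq (P : Pieces y f F) (h : Fan n y) : ∫ z, f z = ∑ k, jac y k * triInt (F k) := by
  have hI := P.integrable h
  rw [h.volume_eq, integrable_finsetSum_measure] at hI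
  rw [h.volume_eq, integral_finsetSum_measure hI]
  refine Finset.sum_congr rfl fun k _ => ?_
  rw [integral_smul_measure, ENNReal.toReal_ofReal (h.jac_pos k).le, smul_eq_mul,
    (h.measurableEmbedding_chart k).integral_map]
  congr 1
  have e : ∫ p in refCone, f (chart y k p) = ∫ p in refCone, refTri.indicator (F k) p :=
    setIntegral_congr_fun measurableSet_refCone (P.eqOn k)
  rw [e, setIntegral_indicator measurableSet_refTri, Set.inter_comm,
    setIntegral_congr_set refTri_inter_refCone, triInt]
end Pieces

/-! ### The polygon spanned by the fan -/

/-- The open polygon with vertices `y`. -/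
def region (y : Fin n → ℝ × ℝ) : Set (ℝ × ℝ) := {z | ∀ k, side y k z < 1}

lemma continuous_side (y : Fin n → ℝ × ℝ) (k : Fin n) : Continuous (side y k) := by
  unfold side cross; fun_prop

lemma isOpen_region (y : Fin n → ℝ × ℝ) : IsOpen (region y) := by
  have : region y = ⋂ k, {z | side y k z < 1} := by ext; simp [region]
  rw [this]
  exact isOpen_iInter_of_finite fun k => isOpen_lt (continuous_side y k) continuous_const

lemma side_smul (y : Fin n → ℝ × ℝ) (k : Fin n) (a : ℝ) (z : ℝ × ℝ) : side y k (a • z) = a * side y k z := by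
  have := side_comb y k a 0 z z
  simpa using this

lemma side_le_of_mem_hull (h : Fan n y) (k : Fin n) {z : ℝ × ℝ} (hz : z ∈ convexHull ℝ (Set.range y)) :
    side y k z ≤ 1 := by
  have hc : Convex ℝ {z | side y k z ≤ 1} := by
    intro u hu v hv a b ha hb hab
    have hu : side y k u ≤ 1 := hu
    have hv : side y k v ≤ 1 := hv
    show side y k _ ≤ 1
    rw [side_comb]; nlinarith
  exact convexHull_min (by rintro _ ⟨j, rfl⟩; exact h.side_le k j) hc hz

lemma chart_mem_hull (h : Fan n y) (k : Fin n) {p : ℝ × ℝ} (hp : p ∈ refTri) :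
    chart y k p ∈ convexHull ℝ (Set.range y) := by
  have hs := subset_convexHull ℝ (Set.range y)
  have hc := convex_convexHull ℝ (Set.range y)
  have h0 : (0 : ℝ × ℝ) ∈ convexHull ℝ (Set.range y) := by
    have hn : (n : ℝ) ≠ 0 := Nat.cast_ne_zero.2 (NeZero.ne n)
    have := hc.sum_mem (t := Finset.univ) (w := fun _ : Fin n => (n : ℝ)⁻¹) (z := y)
      (fun _ _ => by positivity) (by simp [hn]) (fun i _ => hs ⟨i, rfl⟩)
    rwa [← Finset.smul_sum, h.sum_zero, smul_zero] at this
  obtain ⟨h1, h2⟩ := hp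
  rw [abs_le] at h1
  have := hc.sum_mem (t := Finset.univ) (w := ![1 - p.1, (p.1 - p.2) / 2, (p.1 + p.2) / 2])
    (z := ![0, y k, y (k + 1)]) (by
      intro i _; fin_cases i <;> simp <;> linarith) (by simp [Fin.sum_univ_three]; ring)
    (by intro i _; fin_cases i
        · simpa using h0
        · exact hs ⟨k, rfl⟩
        · exact hs ⟨k + 1, rfl⟩)
  simpa [Fin.sum_univ_three, chart_apply] using this

lemma ae_exists_chart (h : Fan n y) : ∀ᵐ z : ℝ × ℝ, ∃ k, ∃ p ∈ refCone, z = chart y k p := by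
  filter_upwards [h.iUnion_sector] with z hz
  have : z ∈ ⋃ k, sector y k := by
    have e : (⋃ k, sector y k) z = Set.univ z := hz
    exact e.mpr trivial
  obtain ⟨k, hk⟩ := Set.mem_iUnion.1 this
  obtain ⟨a, b, ha, hb, hz⟩ := h.exists_comb hk
  refine ⟨k, (a + b, b - a), ?_, ?_⟩
  · show |b - a| < a + b
    rw [abs_lt]; constructor <;> linarith
  · rw [chart_apply, hz]; congr 2 <;> ring

lemma region_subset_hull (h : Fan n y) : region y ⊆ convexHull ℝ (Set.range y) := by
  have hd : Dense {z : ℝ × ℝ | ∃ k, ∃ p ∈ refCone, z = chart y k p} :=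
    Measure.dense_of_ae h.ae_exists_chart
  have hcl : IsClosed (convexHull ℝ (Set.range y)) := (Set.finite_range y).isCompact_convexHull ℝ |>.isClosed
  refine (hd.open_subset_closure_inter (isOpen_region y)).trans (hcl.closure_subset_iff.2 ?_)
  rintro z ⟨hz, k, p, hp, rfl⟩
  have := hz k
  rw [h.side_chart] at this
  exact h.chart_mem_hull k ⟨le_of_lt hp, this.le⟩

theorem interior_hull (h : Fan n y) : interior (convexHull ℝ (Set.range y)) = region y := by
  refine Set.Subset.antisymm (fun z hz k => ?_) (interior_maximal h.region_subset_hull (isOpen_region y))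
  have hz' := mem_interior_iff_mem_nhds.1 hz
  have hcont : Filter.Tendsto (fun a : ℝ => a • z) (nhds 1) (nhds z) := by
    have : Continuous fun a : ℝ => a • z := by fun_prop
    simpa using this.tendsto 1
  have he := hcont.eventually hz'
  obtain ⟨δ, hδ, hb⟩ := Metric.eventually_nhds_iff.1 he
  have h1 := h.side_le_of_mem_hull k (hb (y := 1 + δ / 2) (by simp [abs_of_pos hδ]; linarith))
  rw [side_smul] at h1
  nlinarith

lemma chart_notMem_region (h : Fan n y) (k : Fin n) {p : ℝ × ℝ} (hp : 1 ≤ p.1) : chart y k p ∉ region y := by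
  intro hz
  have := hz k
  rw [h.side_chart] at this
  linarith

theorem volume_region (h : Fan n y) : volume.real (region y) = ∑ k, jac y k := by
  have hc : triInt (fun _ => (1 : ℝ)) = 1 := by
    have := triInt_monomial 0 0
    norm_num at this; exact this
  have hcl : IsClosed (convexHull ℝ (Set.range y)) := ((Set.finite_range y).isCompact_convexHull ℝ).isClosed
  have P : Pieces y ((convexHull ℝ (Set.range y)).indicator fun _ => (1 : ℝ)) fun _ _ => 1 :=
    { cont := fun _ => continuous_const
      inner := fun k p hp hp1 => Set.indicator_of_mem (h.chart_mem_hull k ⟨le_of_lt hp, hp1⟩) _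
      outer := fun k p hp hp1 => Set.indicator_of_notMem (fun hm => by
        have := h.side_le_of_mem_hull k hm
        rw [h.side_chart] at this
        linarith) _ }
  have := P.integral_eq h
  rw [integral_indicator_const _ hcl.measurableSet] at this
  simp only [hc, mul_one, smul_eq_mul] at this
  rw [← this, ← h.interior_hull]
  refine measureReal_congr (interior_ae_eq_of_null_frontier ?_)
  exact (convex_convexHull ℝ _).addHaar_frontier _
end Fan

/-- Smooth functions with compact support in `U`. -/
structure IsTest (U : Set (ℝ × ℝ)) (u : ℝ × ℝ → ℝ) : Prop where
  smooth : ContDiff ℝ (⊤ : ℕ∞) u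
  compact : HasCompactSupport u
  supp : tsupport u ⊆ U

noncomputable def mass (u : ℝ × ℝ → ℝ) : ℝ := ∫ z, u z ^ 2
noncomputable def energy (u : ℝ × ℝ → ℝ) : ℝ := ∫ z, (pdx u z ^ 2 + pdy u z ^ 2)

lemma IsTest.contDiff_one {U : Set (ℝ × ℝ)} {u : ℝ × ℝ → ℝ} (h : IsTest U u) : ContDiff ℝ 1 u :=
  h.smooth.of_le (by exact_mod_cast le_top)

lemma IsTest.eq_zero {U : Set (ℝ × ℝ)} {u : ℝ × ℝ → ℝ} (h : IsTest U u) {z : ℝ × ℝ} (hz : z ∉ U) : u z = 0 :=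
  image_eq_zero_of_notMem_tsupport fun hm => hz (h.supp hm)

lemma IsTest.fderiv_eq_zero {U : Set (ℝ × ℝ)} {u : ℝ × ℝ → ℝ} (h : IsTest U u) {z : ℝ × ℝ} (hz : z ∉ U) :
    fderiv ℝ u z = 0 :=
  fderiv_of_notMem_tsupport (𝕜 := ℝ) fun hm => hz (h.supp hm)

namespace Fan
variable {n : ℕ} [NeZero n] {y : Fin n → ℝ × ℝ}

/-- Coefficients of the Dirichlet form pulled back to the reference triangles. -/
noncomputable def dirK (y : Fin n → ℝ × ℝ) (k : Fin n) : Fin 4 → ℝ :=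
  ![((half y k).1 ^ 2 + (half y k).2 ^ 2) / jac y k,
    -((half y k).1 * (mid y k).1 + (half y k).2 * (mid y k).2) / jac y k,
    ((mid y k).1 ^ 2 + (mid y k).2 ^ 2) / jac y k, 0]
/-- Coefficients of the mass form pulled back to the reference triangles. -/
noncomputable def masK (y : Fin n → ℝ × ℝ) (k : Fin n) : Fin 4 → ℝ := ![0, 0, 0, jac y k]

lemma jac_eq (y : Fin n → ℝ × ℝ) (k : Fin n) : jac y k = cross (mid y k) (half y k) := by
  rw [← det_chart, chart, det_colMap]

lemma contDiff_chart (y : Fin n → ℝ × ℝ) (k : Fin n) {m : WithTop ℕ∞} : ContDiff ℝ m (chart y k) :=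
  (LinearMap.toContinuousLinearMap (chart y k)).contDiff

lemma hasFDerivAt_chart (y : Fin n → ℝ × ℝ) (k : Fin n) (p : ℝ × ℝ) :
    HasFDerivAt (chart y k) (LinearMap.toContinuousLinearMap (chart y k)) p :=
  (LinearMap.toContinuousLinearMap (chart y k)).hasFDerivAt

lemma fderiv_comp_chart {u : ℝ × ℝ → ℝ} (hu : ContDiff ℝ 1 u) (k : Fin n) (p v : ℝ × ℝ) :
    fderiv ℝ (fun p => u (chart y k p)) p v = fderiv ℝ u (chart y k p) (chart y k v) := by
  have h1 := (hu.differentiable one_ne_zero (chart y k p)).hasFDerivAt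
  have h2 := (h1.comp p (hasFDerivAt_chart y k p)).fderiv
  have h3 : fderiv ℝ (fun p => u (chart y k p)) p =
      (fderiv ℝ u (chart y k p)).comp (LinearMap.toContinuousLinearMap (chart y k)) := h2
  rw [h3]; rfl

lemma pdx_comp_chart {u : ℝ × ℝ → ℝ} (hu : ContDiff ℝ 1 u) (k : Fin n) (p : ℝ × ℝ) :
    pdx (fun p => u (chart y k p)) p =
      (mid y k).1 * pdx u (chart y k p) + (mid y k).2 * pdy u (chart y k p) := by
  rw [pdx, fderiv_comp_chart hu, fderiv_eq_pd, chart, colMap_apply]; simp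

lemma pdy_comp_chart {u : ℝ × ℝ → ℝ} (hu : ContDiff ℝ 1 u) (k : Fin n) (p : ℝ × ℝ) :
    pdy (fun p => u (chart y k p)) p =
      (half y k).1 * pdx u (chart y k p) + (half y k).2 * pdy u (chart y k p) := by
  rw [pdy, fderiv_comp_chart hu, fderiv_eq_pd, chart, colMap_apply]; simp

lemma chart_diag (y : Fin n → ℝ × ℝ) (k : Fin n) (t : ℝ) : chart y k (t, t) = t • y (k + 1) := by
  rw [chart_apply]; simp
lemma chart_antidiag (y : Fin n → ℝ × ℝ) (k : Fin n) (t : ℝ) : chart y k (t, -t) = t • y k := by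
  rw [chart_apply]; simp

/-- The pullback of a test function on the polygon. -/
noncomputable def pull (h : Fan n y) {u : ℝ × ℝ → ℝ} (hu : IsTest (region y) u) : Tup n :=
  ⟨fun k p => u (chart y k p), fun k => hu.contDiff_one.comp (contDiff_chart y k),
    fun k t _ => by simp only [chart_diag, chart_antidiag],
    fun k _ _ => hu.eq_zero (h.chart_notMem_region k le_rfl)⟩

lemma integral_mul_eq (h : Fan n y) {u φ : ℝ × ℝ → ℝ} (hu : IsTest (region y) u) (hφ : Continuous φ) :
    ∫ z, u z * φ z = ∑ k, jac y k * triInt (fun p => (h.pull hu).1 k p * φ (chart y k p)) := by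
  have hc := hu.smooth.continuous
  have hk := fun k => continuous_colMap (mid y k) (half y k)
  refine Pieces.integral_eq (y := y) ⟨fun k => ?_, fun k p _ _ => rfl, fun k p _ hp => ?_⟩ h
  · exact (hc.mul hφ).comp (hk k)
  · rw [hu.eq_zero (h.chart_notMem_region k hp.le), zero_mul]

lemma mass_eq (h : Fan n y) {u : ℝ × ℝ → ℝ} (hu : IsTest (region y) u) :
    mass u = frm (masK y) (h.pull hu) (h.pull hu) := by
  have := h.integral_mul_eq hu hu.smooth.continuous
  rw [mass, frm_apply]
  simp only [sq]
  rw [this]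
  refine Finset.sum_congr rfl fun k _ => ?_
  rw [← triInt_const_mul]
  congr 1; ext p
  simp [frmD, masK, pull]

lemma energy_density (h : Fan n y) (k : Fin n) (a b : ℝ) : jac y k * (a ^ 2 + b ^ 2) =
    dirK y k 0 * (((mid y k).1 * a + (mid y k).2 * b) * ((mid y k).1 * a + (mid y k).2 * b)) +
    dirK y k 1 * (2 * (((mid y k).1 * a + (mid y k).2 * b) * ((half y k).1 * a + (half y k).2 * b))) +
    dirK y k 2 * (((half y k).1 * a + (half y k).2 * b) * ((half y k).1 * a + (half y k).2 * b)) := by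
  have hj := (h.jac_pos k).ne'
  simp only [dirK, Matrix.cons_val]
  field_simp
  rw [jac_eq, cross]; ring

lemma energy_eq (h : Fan n y) {u : ℝ × ℝ → ℝ} (hu : IsTest (region y) u) :
    energy u = frm (dirK y) (h.pull hu) (h.pull hu) := by
  have hc := hu.contDiff_one
  have hx := continuous_pdx hc
  have hy := continuous_pdy hc
  have hk := fun k => continuous_colMap (mid y k) (half y k)
  have P : Pieces y (fun z => pdx u z ^ 2 + pdy u z ^ 2)
      (fun k p => pdx u (chart y k p) ^ 2 + pdy u (chart y k p) ^ 2) := by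
    refine ⟨fun k => ?_, fun k p _ _ => rfl, fun k p _ hp => ?_⟩
    · exact ((hx.pow 2).add (hy.pow 2)).comp (hk k)
    · have := hu.fderiv_eq_zero (h.chart_notMem_region k hp.le)
      simp [pdx, pdy, this]
  rw [energy, P.integral_eq h, frm_apply]
  refine Finset.sum_congr rfl fun k _ => ?_
  rw [← triInt_const_mul]
  congr 1; ext p
  rw [h.energy_density]
  have e1 : pdx ((h.pull hu).1 k) p = _ := pdx_comp_chart hc k p
  have e2 : pdy ((h.pull hu).1 k) p = _ := pdy_comp_chart hc k p
  have e3 : dirK y k 3 = 0 := rfl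
  rw [frmD, e1, e2, e3]; ring
end Fan

/-- A sequence of bump functions on the plane shrinking to the origin. -/
noncomputable def bumpSeq (j : ℕ) : ContDiffBump (0 : ℝ × ℝ) where
  rIn := 1 / (2 * ((j : ℝ) + 1))
  rOut := 1 / ((j : ℝ) + 1)
  rIn_pos := by positivity
  rIn_lt_rOut := by
    rw [div_lt_div_iff₀ (by positivity) (by positivity)]
    have : (0:ℝ) ≤ j := j.cast_nonneg
    linarith

noncomputable def rho (j : ℕ) : ℝ × ℝ → ℝ := (bumpSeq j).normed volume

lemma rho_contDiff (j : ℕ) : ContDiff ℝ (⊤ : ℕ∞) (rho j) := (bumpSeq j).contDiff_normed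
lemma rho_compact (j : ℕ) : HasCompactSupport (rho j) := (bumpSeq j).hasCompactSupport_normed
lemma rho_support (j : ℕ) : Function.support (rho j) = Metric.ball 0 (1 / ((j : ℝ) + 1)) :=
  (bumpSeq j).support_normed_eq

/-- Regularization by convolution. -/
noncomputable def mol (j : ℕ) (f : ℝ × ℝ → ℝ) : ℝ × ℝ → ℝ :=
  convolution (rho j) f (ContinuousLinearMap.lsmul ℝ ℝ) volume

lemma mol_apply (j : ℕ) (f : ℝ × ℝ → ℝ) (x : ℝ × ℝ) : mol j f x = ∫ z, rho j (x - z) * f z :=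
  convolution_lsmul_swap

lemma mol_contDiff (j : ℕ) {f : ℝ × ℝ → ℝ} (hf : Integrable f) : ContDiff ℝ (⊤ : ℕ∞) (mol j f) :=
  (rho_compact j).contDiff_convolution_left _ (rho_contDiff j) hf.locallyIntegrable

lemma mol_compact (j : ℕ) {f : ℝ × ℝ → ℝ} (hf : HasCompactSupport f) : HasCompactSupport (mol j f) :=
  (rho_compact j).convolution _ hf

lemma mol_ne_zero {j : ℕ} {f : ℝ × ℝ → ℝ} {z : ℝ × ℝ} (h : mol j f z ≠ 0) :
    ∃ a b, f a ≠ 0 ∧ ‖b‖ < 1 / ((j : ℝ) + 1) ∧ z = a + b := by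
  have := support_convolution_subset_swap (μ := volume) (f := rho j) (g := f)
    (ContinuousLinearMap.lsmul ℝ ℝ) h
  obtain ⟨a, ha, b, hb, hab⟩ := Set.mem_add.1 this
  rw [rho_support, mem_ball_zero_iff] at hb
  exact ⟨a, b, ha, hb, hab.symm⟩

lemma abs_mol_le (j : ℕ) {f : ℝ × ℝ → ℝ} {M : ℝ} (hM : ∀ z, |f z| ≤ M) (z : ℝ × ℝ) : |mol j f z| ≤ M := by
  have e : mol j f z = ∫ t, rho j t * f (z - t) := rfl
  rw [e, ← Real.norm_eq_abs]
  have := norm_integral_le_of_norm_le (μ := volume) (f := fun t => rho j t * f (z - t))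
    (g := fun t => rho j t * M) ((bumpSeq j).integrable_normed.mul_const M) (by
      filter_upwards with t
      have h0 : 0 ≤ rho j t := (bumpSeq j).nonneg_normed t
      rw [Real.norm_eq_abs, abs_mul, abs_of_nonneg h0]
      exact mul_le_mul_of_nonneg_left (hM _) h0)
  rwa [integral_mul_const, show ∫ t, rho j t = 1 from (bumpSeq j).integral_normed, one_mul] at this

lemma mol_tendsto {f : ℝ × ℝ → ℝ} (hf : Integrable f) :
    ∀ᵐ z, Filter.Tendsto (fun j => mol j f z) Filter.atTop (nhds (f z)) := by
  refine ContDiffBump.ae_convolution_tendsto_right_of_locallyIntegrable (K := 2) (φ := bumpSeq)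
    tendsto_one_div_add_atTop_nhds_zero_nat ?_ hf.locallyIntegrable
  filter_upwards with j
  show 1 / ((j : ℝ) + 1) ≤ 2 * (1 / (2 * ((j : ℝ) + 1)))
  rw [← mul_div_assoc, mul_one, div_mul_eq_div_div, div_self two_ne_zero]

/-- Integrals of continuous expressions in a regularization converge. -/
lemma tendsto_integral_mol {f : ℝ × ℝ → ℝ} (hf : Integrable f) {M R : ℝ} (hM : ∀ z, |f z| ≤ M)
    (hR : ∀ z, f z ≠ 0 → ‖z‖ ≤ R) {Φ : ℝ × ℝ → ℝ → ℝ} (hΦ : Continuous (Function.uncurry Φ))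
    (h0 : ∀ z, Φ z 0 = 0) :
    Filter.Tendsto (fun j => ∫ z, Φ z (mol j f z)) Filter.atTop (nhds (∫ z, Φ z (f z))) := by
  obtain ⟨B, hB⟩ := ((isCompact_closedBall (0 : ℝ × ℝ) (R + 1)).prod
    (isCompact_closedBall (0 : ℝ) M)).exists_bound_of_continuousOn hΦ.continuousOn
  refine tendsto_integral_of_dominated_convergence
    ((Metric.closedBall (0 : ℝ × ℝ) (R + 1)).indicator fun _ => B) (fun j => ?_) ?_ (fun j => ?_) ?_
  · have := (mol_contDiff j hf).continuous
    exact (hΦ.comp (continuous_id.prodMk this)).aestronglyMeasurable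
  · exact (integrable_indicator_iff measurableSet_closedBall).2
      (integrableOn_const measure_closedBall_lt_top.ne)
  · filter_upwards with z
    by_cases hz : z ∈ Metric.closedBall (0 : ℝ × ℝ) (R + 1)
    · rw [Set.indicator_of_mem hz]
      refine hB (z, mol j f z) ⟨hz, ?_⟩
      rw [mem_closedBall_zero_iff, Real.norm_eq_abs]
      exact abs_mol_le j hM z
    · rw [Set.indicator_of_notMem hz]
      have : mol j f z = 0 := by
        by_contra hne
        obtain ⟨a, b, ha, hb, rfl⟩ := mol_ne_zero hne
        refine hz ?_
        rw [mem_closedBall_zero_iff]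
        have h1 : 1 / ((j : ℝ) + 1) ≤ 1 := by
          rw [div_le_one (by positivity)]; linarith [(j.cast_nonneg : (0:ℝ) ≤ j)]
        linarith [norm_add_le a b, hR a ha]
      rw [this, h0, norm_zero]
  · filter_upwards [mol_tendsto hf] with z hz
    have h2 : Continuous (Φ z) := hΦ.comp (Continuous.prodMk_right z)
    exact (h2.tendsto _).comp hz

/-- `G` is the weak partial derivative of `f` in direction `v`. -/
def WeakDeriv (v : ℝ × ℝ) (f G : ℝ × ℝ → ℝ) : Prop :=
  ∀ ψ : ℝ × ℝ → ℝ, ContDiff ℝ 1 ψ → ∫ z, fderiv ℝ ψ z v * f z = -∫ z, ψ z * G z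

lemma WeakDeriv.fderiv_mol {v : ℝ × ℝ} {f G : ℝ × ℝ → ℝ} (h : WeakDeriv v f G) (hf : Integrable f)
    (j : ℕ) (x : ℝ × ℝ) : fderiv ℝ (mol j f) x v = mol j G x := by
  have hr : ContDiff ℝ 1 (rho j) := (rho_contDiff j).of_le (by exact_mod_cast le_top)
  have h1 := (rho_compact j).hasFDerivAt_convolution_left (ContinuousLinearMap.lsmul ℝ ℝ) hr
    hf.locallyIntegrable x
  have hd := h1.fderiv
  have hψ : ContDiff ℝ 1 fun z => rho j (x - z) := hr.comp (contDiff_const.sub contDiff_id)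
  have h2 := h _ hψ
  have e : ∀ z, fderiv ℝ (fun z => rho j (x - z)) z v = -fderiv ℝ (rho j) (x - z) v := by
    intro z
    have h3 := ((hr.differentiable one_ne_zero (x - z)).hasFDerivAt.comp z
      ((hasFDerivAt_id z).const_sub x)).fderiv
    have h4 : fderiv ℝ (fun z => rho j (x - z)) z = _ := h3
    rw [h4]; simp
  simp only [e, neg_mul, integral_neg, neg_inj] at h2
  have hd' : fderiv ℝ (mol j f) x = _ := hd
  rw [mol_apply, ← h2, hd', convolution_eq_swap]
  rw [ContinuousLinearMap.integral_apply]
  · rfl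
  · have := ((rho_compact j).fderiv (𝕜 := ℝ)).convolutionExists_left
      ((ContinuousLinearMap.lsmul ℝ ℝ).precompL (ℝ × ℝ)) (hr.continuous_fderiv one_ne_zero)
      hf.locallyIntegrable x
    exact this.integrable_swap

namespace Fan
variable {n : ℕ} [NeZero n] {y : Fin n → ℝ × ℝ}

lemma chart_unique (h : Fan n y) {k k' : Fin n} {p p' : ℝ × ℝ} (hp : p ∈ refCone) (hp' : p' ∈ refCone)
    (e : chart y k p = chart y k' p') : k = k' ∧ p = p' := by
  have h1 : chart y k p ∈ sector y k := by
    rw [← h.preimage_sector k] at hp; exact hp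
  have h2 : chart y k' p' ∈ sector y k' := by
    rw [← h.preimage_sector k'] at hp'; exact hp'
  have hk : k = k' := by
    by_contra hne
    exact Set.disjoint_left.1 (h.disjoint_sector hne) h1 (e ▸ h2)
  subst hk
  exact ⟨rfl, h.chart_injective k e⟩

open scoped Classical in
/-- The function on the plane with prescribed pullbacks to the triangles. -/
noncomputable def glue (y : Fin n → ℝ × ℝ) (F : Fin n → ℝ × ℝ → ℝ) (z : ℝ × ℝ) : ℝ :=
  if h : ∃ q : Fin n × (ℝ × ℝ), q.2 ∈ refCone ∧ q.2.1 ≤ 1 ∧ chart y q.1 q.2 = z then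
    F h.choose.1 h.choose.2 else 0

lemma glue_chart (h : Fan n y) (F : Fin n → ℝ × ℝ → ℝ) {k : Fin n} {p : ℝ × ℝ} (hp : p ∈ refCone)
    (hp1 : p.1 ≤ 1) : glue y F (chart y k p) = F k p := by
  have hex : ∃ q : Fin n × (ℝ × ℝ), q.2 ∈ refCone ∧ q.2.1 ≤ 1 ∧ chart y q.1 q.2 = chart y k p :=
    ⟨(k, p), hp, hp1, rfl⟩
  rw [glue, dif_pos hex]
  obtain ⟨h1, -, h3⟩ := hex.choose_spec
  obtain ⟨e1, e2⟩ := h.chart_unique h1 hp h3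
  rw [e1, e2]

lemma glue_ne_zero {F : Fin n → ℝ × ℝ → ℝ} {z : ℝ × ℝ} (hz : glue y F z ≠ 0) :
    ∃ k, ∃ p ∈ refCone, p.1 ≤ 1 ∧ chart y k p = z := by
  by_contra hne
  refine hz (dif_neg ?_)
  rintro ⟨q, h1, h2, h3⟩
  exact hne ⟨q.1, q.2, h1, h2, h3⟩

lemma glue_mem_hull (h : Fan n y) {F : Fin n → ℝ × ℝ → ℝ} {z : ℝ × ℝ} (hz : glue y F z ≠ 0) :
    z ∈ convexHull ℝ (Set.range y) := by
  obtain ⟨k, p, hp, hp1, rfl⟩ := glue_ne_zero hz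
  exact h.chart_mem_hull k ⟨le_of_lt hp, hp1⟩

lemma pieces_glue (h : Fan n y) {F : Fin n → ℝ × ℝ → ℝ} (hF : ∀ k, Continuous (F k)) :
    Pieces y (glue y F) F where
  cont := hF
  inner := fun _ _ hp hp1 => h.glue_chart F hp hp1
  outer := fun k p hp hp1 => by
    by_contra hne
    obtain ⟨k', p', hp', hp1', e⟩ := glue_ne_zero hne
    obtain ⟨-, rfl⟩ := h.chart_unique hp' hp e
    linarith

lemma pieces_glue_mul (h : Fan n y) {F : Fin n → ℝ × ℝ → ℝ} (hF : ∀ k, Continuous (F k)) {φ : ℝ × ℝ → ℝ}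
    (hφ : Continuous φ) :
    Pieces y (fun z => φ z * glue y F z) (fun k p => φ (chart y k p) * F k p) where
  cont := fun k => (hφ.comp (continuous_colMap _ _)).mul (hF k)
  inner := fun k p hp hp1 => by rw [h.glue_chart F hp hp1]
  outer := fun k p hp hp1 => by rw [(h.pieces_glue hF).outer k p hp hp1, mul_zero]

lemma pieces_glue_sq (h : Fan n y) {F : Fin n → ℝ × ℝ → ℝ} (hF : ∀ k, Continuous (F k)) :
    Pieces y (fun z => glue y F z ^ 2) (fun k p => F k p ^ 2) where
  cont := fun k => (hF k).pow 2
  inner := fun k p hp hp1 => by rw [h.glue_chart F hp hp1]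
  outer := fun k p hp hp1 => by rw [(h.pieces_glue hF).outer k p hp hp1]; simp

lemma exists_glue_bound {F : Fin n → ℝ × ℝ → ℝ} (hF : ∀ k, Continuous (F k)) :
    ∃ M, ∀ z, |glue y F z| ≤ M := by
  choose B hB using fun k => isCompact_refTri.exists_bound_of_continuousOn (hF k).continuousOn
  refine ⟨∑ k, |B k|, fun z => ?_⟩
  by_cases hz : ∃ q : Fin n × (ℝ × ℝ), q.2 ∈ refCone ∧ q.2.1 ≤ 1 ∧ chart y q.1 q.2 = z
  · rw [glue, dif_pos hz]
    obtain ⟨h1, h2, -⟩ := hz.choose_spec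
    have := hB hz.choose.1 hz.choose.2 ⟨le_of_lt h1, h2⟩
    rw [Real.norm_eq_abs] at this
    exact this.trans ((le_abs_self _).trans
      (Finset.single_le_sum (f := fun k => |B k|) (fun _ _ => abs_nonneg _) (Finset.mem_univ _)))
  · rw [glue, dif_neg hz, abs_zero]; positivity

omit [NeZero n] in
lemma exists_hull_bound (y : Fin n → ℝ × ℝ) : ∃ R, ∀ z ∈ convexHull ℝ (Set.range y), ‖z‖ ≤ R :=
  ((Set.finite_range y).isCompact_convexHull ℝ).isBounded.exists_norm_le

/-- Components of the gradient of a tuple in the plane. -/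
noncomputable def gradX (y : Fin n → ℝ × ℝ) (W : Tup n) (k : Fin n) (p : ℝ × ℝ) : ℝ :=
  ((half y k).2 * pdx (W.1 k) p - (mid y k).2 * pdy (W.1 k) p) / jac y k
noncomputable def gradY (y : Fin n → ℝ × ℝ) (W : Tup n) (k : Fin n) (p : ℝ × ℝ) : ℝ :=
  ((mid y k).1 * pdy (W.1 k) p - (half y k).1 * pdx (W.1 k) p) / jac y k

lemma continuous_gradX (y : Fin n → ℝ × ℝ) (W : Tup n) (k : Fin n) : Continuous (gradX y W k) := by
  have := tup_continuous_pdx W k; have := tup_continuous_pdy W k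
  unfold gradX; fun_prop
lemma continuous_gradY (y : Fin n → ℝ × ℝ) (W : Tup n) (k : Fin n) : Continuous (gradY y W k) := by
  have := tup_continuous_pdx W k; have := tup_continuous_pdy W k
  unfold gradY; fun_prop

lemma frm_dirK_eq (h : Fan n y) (W : Tup n) : frm (dirK y) W W =
    (∫ z, glue y (gradX y W) z ^ 2) + ∫ z, glue y (gradY y W) z ^ 2 := by
  have P := h.pieces_glue_sq (continuous_gradX y W)
  have P' := h.pieces_glue_sq (continuous_gradY y W)
  have hx := continuous_gradX y W
  have hy := continuous_gradY y W
  rw [P.integral_eq h, P'.integral_eq h, ← Finset.sum_add_distrib, frm_apply]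
  refine Finset.sum_congr rfl fun k _ => ?_
  rw [← mul_add, ← triInt_add (f := fun p => gradX y W k p ^ 2) (g := fun p => gradY y W k p ^ 2)
    ((hx k).pow 2) ((hy k).pow 2), ← triInt_const_mul]
  congr 1; ext p
  have hj := (h.jac_pos k).ne'
  rw [h.energy_density]
  have e1 : (mid y k).1 * gradX y W k p + (mid y k).2 * gradY y W k p = pdx (W.1 k) p := by
    unfold gradX gradY; field_simp; rw [jac_eq, cross]; ring
  have e2 : (half y k).1 * gradX y W k p + (half y k).2 * gradY y W k p = pdy (W.1 k) p := by
    unfold gradX gradY; field_simp; rw [jac_eq, cross]; ring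
  have e3 : dirK y k 3 = 0 := rfl
  rw [e1, e2, frmD, e3]; ring

lemma frm_masK_eq (h : Fan n y) (W : Tup n) : frm (masK y) W W = ∫ z, glue y W.1 z ^ 2 := by
  rw [(h.pieces_glue_sq (tup_continuous W)).integral_eq h, frm_apply]
  refine Finset.sum_congr rfl fun k _ => ?_
  rw [← triInt_const_mul]
  congr 1; ext p
  simp [frmD, masK, sq]

lemma weakDeriv_glue (h : Fan n y) (W : Tup n) (v : ℝ × ℝ) :
    WeakDeriv v (glue y W.1) (glue y fun k p => v.1 * gradX y W k p + v.2 * gradY y W k p) := by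
  intro ψ hψ
  have hx := continuous_gradX y W
  have hy := continuous_gradY y W
  have hd : Continuous fun z => fderiv ℝ ψ z v := by
    have := hψ.continuous_fderiv one_ne_zero; fun_prop
  have hk := fun k => continuous_colMap (mid y k) (half y k)
  have hW := tup_continuous W
  rw [(h.pieces_glue_mul hW hd).integral_eq h, (h.pieces_glue_mul (by fun_prop) hψ.continuous).integral_eq h,
    eq_neg_iff_add_eq_zero, ← Finset.sum_add_distrib]
  have hc : ∀ k, ContDiff ℝ 1 fun p => ψ (chart y k p) := fun k => hψ.comp (contDiff_chart y k)
  have F : IsFlux (fun k p => (v.1 * (half y k).2 - v.2 * (half y k).1) * ψ (chart y k p))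
      (fun k p => (v.2 * (mid y k).1 - v.1 * (mid y k).2) * ψ (chart y k p)) := by
    refine ⟨fun k => contDiff_const.mul (hc k), fun k => contDiff_const.mul (hc k), fun k t _ => ?_⟩
    simp only [chart_diag, chart_antidiag, mid, half]
    simp
    ring
  rw [← F.sum_eq_zero W]
  refine Finset.sum_congr rfl fun k _ => ?_
  have hψc := hψ.continuous
  rw [← mul_add, ← triInt_add, ← triInt_const_mul]
  rotate_left
  · exact (hd.comp (hk k)).mul (hW k)
  · exact (hψc.comp (hk k)).mul (by fun_prop)
  congr 1; ext p
  have hj := (h.jac_pos k).ne'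
  have d1 : pdx (fun p => (v.1 * (half y k).2 - v.2 * (half y k).1) * ψ (chart y k p)) p = _ :=
    pdx_smul (f := fun p => ψ (chart y k p)) (v.1 * (half y k).2 - v.2 * (half y k).1) p
  have d2 : pdy (fun p => (v.2 * (mid y k).1 - v.1 * (mid y k).2) * ψ (chart y k p)) p = _ :=
    pdy_smul (f := fun p => ψ (chart y k p)) (v.2 * (mid y k).1 - v.1 * (mid y k).2) p
  rw [d1, d2, pdx_comp_chart hψ, pdy_comp_chart hψ, fderiv_eq_pd]
  unfold gradX gradY
  field_simp
  rw [jac_eq, cross]; ring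
end Fan

section
open Filter

namespace Fan
variable {n : ℕ} [NeZero n] {y : Fin n → ℝ × ℝ}

lemma exists_side_bound (y : Fin n → ℝ × ℝ) : ∃ B, 0 < B ∧ ∀ k z, side y k z ≤ B * ‖z‖ := by
  let b : Fin n → ℝ := fun k => (|(y (k + 1) - y k).1| + |(y (k + 1) - y k).2|) / |cross (y k) (y (k + 1))|
  have hb : ∀ k, 0 ≤ b k := fun k => by positivity
  refine ⟨1 + ∑ k, b k, by have := Finset.sum_nonneg fun k (_ : k ∈ Finset.univ) => hb k; linarith, fun k z => ?_⟩
  have h1 : side y k z ≤ b k * ‖z‖ := by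
    refine (le_abs_self _).trans ?_
    rw [side, abs_div, div_mul_eq_mul_div]
    gcongr
    have e1 : |z.1| ≤ ‖z‖ := norm_fst_le z
    have e2 : |z.2| ≤ ‖z‖ := norm_snd_le z
    rw [cross]
    refine (abs_sub _ _).trans ?_
    rw [abs_mul, abs_mul]
    have := mul_le_mul_of_nonneg_right e1 (abs_nonneg (y (k + 1) - y k).2)
    have := mul_le_mul_of_nonneg_right e2 (abs_nonneg (y (k + 1) - y k).1)
    linarith
  have h2 := Finset.single_le_sum (f := b) (fun k _ => hb k) (Finset.mem_univ k)
  have := mul_le_mul_of_nonneg_right h2 (norm_nonneg z)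
  linarith [norm_nonneg z]

lemma hasCompactSupport_glue (h : Fan n y) (F : Fin n → ℝ × ℝ → ℝ) : HasCompactSupport (glue y F) := by
  refine HasCompactSupport.intro ((Set.finite_range y).isCompact_convexHull ℝ) fun z hz => ?_
  by_contra hne
  exact hz (h.glue_mem_hull hne)

lemma integrable_mol_sq (h : Fan n y) {F : Fin n → ℝ × ℝ → ℝ} (hF : ∀ k, Continuous (F k)) (j : ℕ) :
    Integrable fun z => mol j (glue y F) z ^ 2 := by
  have hc := (mol_contDiff j ((h.pieces_glue hF).integrable h)).continuous
  refine (hc.pow 2).integrable_of_hasCompactSupport ?_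
  have := mol_compact j (h.hasCompactSupport_glue F)
  simp only [sq]
  exact this.mul_right

/-- A dilated regularization is a test function. -/
lemma isTest_mol (h : Fan n y) {F : Fin n → ℝ × ℝ → ℝ} (hF : ∀ k, Continuous (F k)) {s : ℝ} (hs : 1 < s) :
    ∀ᶠ j in atTop, IsTest (region y) fun z => mol j (glue y F) (s • z) := by
  obtain ⟨B, hB0, hB⟩ := exists_side_bound y
  have hlim : Tendsto (fun j : ℕ => 1 + B * (1 / ((j : ℝ) + 1))) atTop (nhds (1 + B * 0)) :=
    (tendsto_one_div_add_atTop_nhds_zero_nat.const_mul B).const_add 1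
  rw [mul_zero, add_zero] at hlim
  have hs0 : 0 < s := by linarith
  filter_upwards [hlim.eventually_lt_const hs] with j hj
  refine ⟨(mol_contDiff j ((h.pieces_glue hF).integrable h)).comp (contDiff_const_smul s),
    (mol_compact j (h.hasCompactSupport_glue F)).comp_smul hs0.ne', ?_⟩
  have hsub : tsupport (fun z => mol j (glue y F) (s • z)) ⊆
      {z | ∀ k, side y k z ≤ (1 + B * (1 / ((j : ℝ) + 1))) / s} := by
    refine closure_minimal (fun z hz k => ?_) ?_
    · obtain ⟨a, b, ha, hb, e⟩ := mol_ne_zero hz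
      have h1 := h.side_le_of_mem_hull k (h.glue_mem_hull ha)
      have h2 := (hB k b).trans (mul_le_mul_of_nonneg_left hb.le hB0.le)
      have h3 := side_comb y k 1 1 a b
      rw [one_smul, one_smul, one_mul, one_mul, ← e, side_smul] at h3
      rw [le_div_iff₀ hs0]; linarith
    · have : {z | ∀ k, side y k z ≤ (1 + B * (1 / ((j : ℝ) + 1))) / s} =
          ⋂ k, {z | side y k z ≤ (1 + B * (1 / ((j : ℝ) + 1))) / s} := by ext; simp
      rw [this]
      exact isClosed_iInter fun k => isClosed_le (continuous_side y k) continuous_const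
  refine hsub.trans fun z hz k => (hz k).trans_lt ?_
  rw [div_lt_one hs0]; exact hj

/-- Quadratic inequalities for test functions on the polygon extend to tuples. -/
theorem transfer (h : Fan n y) {L C B : ℝ} {φ : ℝ × ℝ → ℝ} (hφ : Continuous φ) (hb : ∀ z, |φ z| ≤ B)
    (H : ∀ u, IsTest (region y) u → L * mass u ≤ energy u + C * (∫ z, u z * φ z) ^ 2) (W : Tup n) :
    L * frm (masK y) W W ≤ frm (dirK y) W W +
      C * (∑ k, jac y k * triInt (fun p => φ (chart y k p) * W.1 k p)) ^ 2 := by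
  have hW := tup_continuous W
  have hx := continuous_gradX y W
  have hy := continuous_gradY y W
  set w := glue y W.1 with hw
  set gx := glue y (gradX y W) with hgx
  set gy := glue y (gradY y W) with hgy
  have iw := (h.pieces_glue hW).integrable h
  have ix := (h.pieces_glue hx).integrable h
  have iy := (h.pieces_glue hy).integrable h
  obtain ⟨Mw, bw⟩ := exists_glue_bound (y := y) hW
  obtain ⟨Mx, bx⟩ := exists_glue_bound (y := y) hx
  obtain ⟨My, by'⟩ := exists_glue_bound (y := y) hy
  obtain ⟨R, hR⟩ := exists_hull_bound y
  have wx : WeakDeriv (1, 0) w gx := by simpa using h.weakDeriv_glue W (1, 0)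
  have wy : WeakDeriv (0, 1) w gy := by simpa using h.weakDeriv_glue W (0, 1)
  rw [h.frm_masK_eq, h.frm_dirK_eq, ← (h.pieces_glue_mul hW hφ).integral_eq h]
  have key : ∀ s : ℝ, 1 < s → L * ((s ^ 2)⁻¹ * ∫ z, w z ^ 2) ≤ ((∫ z, gx z ^ 2) + ∫ z, gy z ^ 2) +
      C * ((s ^ 2)⁻¹ * ∫ z, φ (s⁻¹ • z) * w z) ^ 2 := by
    intro s hs
    have hs0 : 0 < s := by linarith
    have l1 := tendsto_integral_mol iw bw (fun z hz => hR z (h.glue_mem_hull hz))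
      (Φ := fun _ a => a ^ 2) (by fun_prop) (by simp)
    have l2 := tendsto_integral_mol ix bx (fun z hz => hR z (h.glue_mem_hull hz))
      (Φ := fun _ a => a ^ 2) (by fun_prop) (by simp)
    have l3 := tendsto_integral_mol iy by' (fun z hz => hR z (h.glue_mem_hull hz))
      (Φ := fun _ a => a ^ 2) (by fun_prop) (by simp)
    have l4 := tendsto_integral_mol iw bw (fun z hz => hR z (h.glue_mem_hull hz))
      (Φ := fun z a => φ (s⁻¹ • z) * a) (by fun_prop) (by simp)
    refine le_of_tendsto_of_tendsto ((l1.const_mul (s ^ 2)⁻¹).const_mul L)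
      ((l2.add l3).add (((l4.const_mul (s ^ 2)⁻¹).pow 2).const_mul C)) ?_
    filter_upwards [h.isTest_mol hW hs] with j hj
    have hu := mol_contDiff j iw
    have hsc : ∀ f : ℝ × ℝ → ℝ, ∫ z, f (s • z) = (s ^ 2)⁻¹ * ∫ z, f z := by
      intro f
      have := Measure.integral_comp_smul_of_nonneg (volume : Measure (ℝ × ℝ)) f s (hR := hs0.le)
      simpa using this
    have e1 : mass (fun z => mol j w (s • z)) = (s ^ 2)⁻¹ * ∫ z, mol j w z ^ 2 :=
      hsc fun z => mol j w z ^ 2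
    have e2 : ∫ z, mol j w (s • z) * φ z = (s ^ 2)⁻¹ * ∫ z, φ (s⁻¹ • z) * mol j w z := by
      rw [← hsc fun z => φ (s⁻¹ • z) * mol j w z]
      congr 1; ext z
      rw [smul_smul, inv_mul_cancel₀ hs0.ne', one_smul, mul_comm]
    have e3 : ∀ z v, fderiv ℝ (fun z => mol j w (s • z)) z v = s * fderiv ℝ (mol j w) (s • z) v := by
      intro z v
      rw [fderiv_comp_smul]; rfl
    have e4 : energy (fun z => mol j w (s • z)) = (∫ z, mol j gx z ^ 2) + ∫ z, mol j gy z ^ 2 := by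
      have d1 : ∀ z, pdx (fun z => mol j w (s • z)) z = s * mol j gx (s • z) := fun z => by
        rw [pdx, e3, wx.fderiv_mol iw]
      have d2 : ∀ z, pdy (fun z => mol j w (s • z)) z = s * mol j gy (s • z) := fun z => by
        rw [pdy, e3, wy.fderiv_mol iw]
      have i1 : Integrable fun z => mol j gx z ^ 2 := h.integrable_mol_sq hx j
      have i2 : Integrable fun z => mol j gy z ^ 2 := h.integrable_mol_sq hy j
      rw [energy, ← integral_add i1 i2]
      simp only [d1, d2]
      have := hsc fun z => s ^ 2 * (mol j gx z ^ 2 + mol j gy z ^ 2)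
      simp only [mul_pow, ← mul_add]
      rw [this, integral_const_mul, ← mul_assoc, inv_mul_cancel₀ (by positivity), one_mul]
    have := H _ hj
    rwa [e1, e2, e4] at this
  have c1 : Tendsto (fun s : ℝ => (s ^ 2)⁻¹) (nhdsWithin 1 (Set.Ioi 1)) (nhds 1) := by
    have : ContinuousAt (fun s : ℝ => (s ^ 2)⁻¹) 1 := by
      refine ContinuousAt.inv₀ (by fun_prop) (by norm_num)
    simpa using this.tendsto.mono_left nhdsWithin_le_nhds
  have c2 : Tendsto (fun s : ℝ => ∫ z, φ (s⁻¹ • z) * w z) (nhdsWithin 1 (Set.Ioi 1))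
      (nhds (∫ z, φ z * w z)) := by
    refine tendsto_integral_filter_of_dominated_convergence (fun z => B * |w z|) ?_ ?_
      (iw.abs.const_mul B) ?_
    · filter_upwards with s
      exact (by fun_prop : Continuous fun z => φ (s⁻¹ • z)).aestronglyMeasurable.mul iw.aestronglyMeasurable
    · filter_upwards with s
      filter_upwards with z
      rw [Real.norm_eq_abs, abs_mul]
      exact mul_le_mul_of_nonneg_right (hb _) (abs_nonneg _)
    · filter_upwards with z
      have : ContinuousAt (fun s : ℝ => φ (s⁻¹ • z) * w z) 1 := by
        refine ContinuousAt.mul ?_ continuousAt_const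
        refine hφ.continuousAt.comp ?_
        exact (continuousAt_inv₀ one_ne_zero).smul continuousAt_const
      simpa using this.tendsto.mono_left nhdsWithin_le_nhds
  have t1 := (c1.mul_const (∫ z, w z ^ 2)).const_mul L
  have t2 := (((c1.mul c2).pow 2).const_mul C).const_add ((∫ z, gx z ^ 2) + ∫ z, gy z ^ 2)
  simp only [one_mul] at t1 t2
  exact le_of_tendsto_of_tendsto t1 t2 (by
    filter_upwards [self_mem_nhdsWithin] with s hs using key s hs)
end Fan
end

/-- Passing from the symmetric interval to the line. -/
lemma intervalIntegral_eq_of_support {E : Type*} [NormedAddCommGroup E] [NormedSpace ℝ E] {g : ℝ → E} {l : ℝ}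
    (hl : 0 < l) (hg : ∀ t, t ∉ Set.Ioo (-l) l → g t = 0) : ∫ t in (-l)..l, g t = ∫ t, g t := by
  rw [intervalIntegral.integral_of_le (by linarith)]
  refine setIntegral_eq_integral_of_forall_compl_eq_zero fun t ht => hg t fun h => ht ?_
  exact Set.Ioo_subset_Ioc_self h

lemma integrable_of_Ioo {g : ℝ → ℝ} {l : ℝ} (hgc : Continuous g) (hg : ∀ t, t ∉ Set.Ioo 0 l → g t = 0) :
    Integrable g :=
  hgc.integrable_of_hasCompactSupport (HasCompactSupport.intro (isCompact_Icc (a := (0:ℝ)) (b := l)) fun t ht =>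
    hg t fun h => ht (Set.Ioo_subset_Icc_self h))

lemma norm_sq_oddExt {g : ℝ → ℝ} {l s : ℝ} (hl : 0 < l) (hg : ∀ t, t ∉ Set.Ioo 0 l → g t = 0)
    (hs : s ^ 2 = 1) (hgc : Continuous g) :
    ∫ t in (-l)..l, ‖((g t + s * g (-t) : ℝ) : ℂ)‖ ^ 2 = 2 * ∫ t, g t ^ 2 := by
  rw [intervalIntegral_eq_of_support hl]
  · have e : ∀ t, ‖((g t + s * g (-t) : ℝ) : ℂ)‖ ^ 2 = g t ^ 2 + g (-t) ^ 2 := by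
      intro t
      have h0 : g t * g (-t) = 0 := by
        rcases le_total t 0 with h | h
        · rw [hg t fun h2 => by linarith [h2.1], zero_mul]
        · rw [hg (-t) fun h2 => by linarith [h2.1], mul_zero]
      rw [Complex.norm_real, Real.norm_eq_abs, sq_abs]
      linear_combination 2 * s * h0 + g (-t) ^ 2 * hs
    have hi : Integrable fun t => g t ^ 2 := integrable_of_Ioo (l := l) (by fun_prop) fun t ht => by simp [hg t ht]
    simp only [e]
    rw [integral_add hi hi.comp_neg, integral_neg_eq_self (fun t => g t ^ 2)]
    ring
  · intro t ht
    have h1 := hg t fun h => ht ⟨by linarith [h.1], h.2⟩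
    have h2 := hg (-t) fun h => ht ⟨by linarith [h.2], by linarith [h.1]⟩
    simp [h1, h2]

lemma integral_oddExt_mul {f g : ℝ → ℝ} {l : ℝ} (hl : 0 < l) (hf : ∀ t, t ∉ Set.Ioo 0 l → f t = 0)
    (hfc : Continuous f) (hgc : Continuous g) :
    ∫ t in (-l)..l, (f t - f (-t)) * g t = ∫ t, f t * (g t - g (-t)) := by
  rw [intervalIntegral_eq_of_support hl]
  · have h1 : Integrable fun t => f t * g t := integrable_of_Ioo (l := l) (by fun_prop) fun t ht => by simp [hf t ht]
    have h2 : Integrable fun t => f t * g (-t) := integrable_of_Ioo (l := l) (by fun_prop) fun t ht => by simp [hf t ht]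
    have h3 : Integrable fun t => f (-t) * g t := by simpa using h2.comp_neg
    simp only [sub_mul, mul_sub]
    rw [integral_sub h1 h3, integral_sub h1 h2]
    congr 1
    rw [← integral_neg_eq_self]; simp
  · intro t ht
    have h1 := hf t fun h => ht ⟨by linarith [h.1], h.2⟩
    have h2 := hf (-t) fun h => ht ⟨by linarith [h.2], by linarith [h.1]⟩
    simp [h1, h2]

/-- Spectral gap estimate for the Dirichlet problem on an interval. -/
theorem interval_gap {f : ℝ → ℝ} (hf : ContDiff ℝ 1 f) {l : ℝ} (hl : 0 < l)
    (hs : tsupport f ⊆ Set.Ioo 0 l) :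
    4 * (Real.pi / l) ^ 2 * ∫ t, f t ^ 2 ≤
      (∫ t, deriv f t ^ 2) + 6 * (Real.pi / l) ^ 2 / l * (∫ t, f t * Real.sin (Real.pi / l * t)) ^ 2 := by
  have hl2 : -l < l := by linarith
  have hfc := hf.continuous
  have hdc : Continuous (deriv f) := hf.continuous_deriv le_rfl
  have hd : ∀ t, HasDerivAt f (deriv f t) t := fun t => (hf.differentiable one_ne_zero t).hasDerivAt
  have h0 : ∀ t, t ∉ Set.Ioo 0 l → f t = 0 := fun t ht =>
    image_eq_zero_of_notMem_tsupport fun h => ht (hs h)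
  have h0' : ∀ t, t ∉ Set.Ioo 0 l → deriv f t = 0 := fun t ht => by
    have : fderiv ℝ f t = 0 := fderiv_of_notMem_tsupport (𝕜 := ℝ) fun h => ht (hs h)
    rw [← fderiv_apply_one_eq_deriv, this]; rfl
  let F : ℝ → ℂ := fun t => ((f t - f (-t) : ℝ) : ℂ)
  let F' : ℝ → ℂ := fun t => ((deriv f t + deriv f (-t) : ℝ) : ℂ)
  have hF : ∀ t, HasDerivAt F (F' t) t := fun t => by
    have h1 : HasDerivAt (fun t => f (-t)) (deriv f (-t) * -1) t := (hd (-t)).comp t (hasDerivAt_neg t)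
    have h2 := ((hd t).sub h1).ofReal_comp
    rwa [show deriv f t - deriv f (-t) * -1 = deriv f t + deriv f (-t) by ring] at h2
  have hFc : Continuous F := by fun_prop
  have hFc' : Continuous F' := by fun_prop
  have hmem : ∀ {g : ℝ → ℂ}, Continuous g → MemLp g 2 (volume.restrict (Set.Ioc (-l) l)) := by
    intro g hg
    obtain ⟨C, hC⟩ := isCompact_Icc.exists_bound_of_continuousOn (hg.continuousOn (s := Set.Icc (-l) l))
    refine MemLp.of_bound hg.aestronglyMeasurable C ?_
    exact (ae_restrict_mem measurableSet_Ioc).mono fun t ht => hC t (Set.Ioc_subset_Icc_self ht)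
  have S1 := hasSum_sq_fourierCoeffOn hl2 (hmem hFc)
  have S2 := hasSum_sq_fourierCoeffOn hl2 (hmem hFc')
  have J1 : ∫ t in (-l)..l, ‖F t‖ ^ 2 = 2 * ∫ t, f t ^ 2 := by
    rw [← norm_sq_oddExt hl h0 (s := -1) (by norm_num) hfc]; simp [F, sub_eq_add_neg]
  have J2 : ∫ t in (-l)..l, ‖F' t‖ ^ 2 = 2 * ∫ t, deriv f t ^ 2 := by
    rw [← norm_sq_oddExt hl h0' (s := 1) (by norm_num) hdc]; simp [F']
  have E0 : F l - F (-l) = 0 := by simp [F, h0 l (by simp), h0 (-l) (by simp [hl.le])]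
  have cg : ∀ k : ℤ, fourierCoeffOn hl2 F k = ((1 / (2 * l) : ℝ) : ℂ) *
      (-2 * Complex.I * (∫ t, f t * Real.sin (Real.pi / l * (k * t)) : ℝ)) := by
    intro k
    rw [fourierCoeffOn_eq_integral, Complex.real_smul, show l - -l = 2 * l by ring]
    congr 1
    have e : ∀ t : ℝ, fourier (-k) (t : AddCircle (2 * l)) • F t =
        (((f t - f (-t)) * Real.cos (Real.pi / l * (k * t)) : ℝ) : ℂ) -
        Complex.I * (((f t - f (-t)) * Real.sin (Real.pi / l * (k * t)) : ℝ) : ℂ) := by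
      intro t
      rw [fourier_coe_apply, show 2 * (Real.pi : ℂ) * Complex.I * ((-k : ℤ) : ℂ) * t / ((2 * l : ℝ) : ℂ) =
        ((-(Real.pi / l * (k * t)) : ℝ) : ℂ) * Complex.I by push_cast; field_simp, Complex.exp_mul_I,
        ← Complex.ofReal_cos, ← Complex.ofReal_sin, Real.cos_neg, Real.sin_neg, smul_eq_mul]
      simp only [F]; push_cast; ring
    rw [show (fun t : ℝ => fourier (-k) (t : AddCircle (2 * l)) • F t) = _ from funext e]
    rw [intervalIntegral.integral_sub (Continuous.intervalIntegrable (by fun_prop) _ _)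
      (Continuous.intervalIntegrable (by fun_prop) _ _), intervalIntegral.integral_const_mul,
      intervalIntegral.integral_ofReal, intervalIntegral.integral_ofReal,
      integral_oddExt_mul hl h0 hfc (g := fun t => Real.cos (Real.pi / l * (k * t))) (by fun_prop),
      integral_oddExt_mul hl h0 hfc (g := fun t => Real.sin (Real.pi / l * (k * t))) (by fun_prop)]
    have e1 : ∀ t : ℝ, f t * (Real.cos (Real.pi / l * (k * t)) - Real.cos (Real.pi / l * (k * -t))) = 0 := by
      intro t; rw [show Real.pi / l * (k * -t) = -(Real.pi / l * (k * t)) by ring, Real.cos_neg]; ring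
    have e2 : ∀ t : ℝ, f t * (Real.sin (Real.pi / l * (k * t)) - Real.sin (Real.pi / l * (k * -t))) =
        2 * (f t * Real.sin (Real.pi / l * (k * t))) := by
      intro t; rw [show Real.pi / l * (k * -t) = -(Real.pi / l * (k * t)) by ring, Real.sin_neg]; ring
    simp only [e1, e2, integral_zero]
    rw [integral_const_mul]
    push_cast; ring
  have c0 : fourierCoeffOn hl2 F 0 = 0 := by
    rw [cg]; simp
  have c1 : ∀ k : ℤ, k = 1 ∨ k = -1 → ‖fourierCoeffOn hl2 F k‖ ^ 2 =
      (∫ t, f t * Real.sin (Real.pi / l * t)) ^ 2 / l ^ 2 := by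
    intro k hk
    have : (∫ t, f t * Real.sin (Real.pi / l * (k * t))) ^ 2 = (∫ t, f t * Real.sin (Real.pi / l * t)) ^ 2 := by
      rcases hk with rfl | rfl
      · simp
      · simp [integral_neg]
    rw [cg, norm_mul, norm_mul, Complex.norm_real, Complex.norm_real, ← this, mul_pow, mul_pow]
    simp only [norm_mul, norm_neg, Complex.norm_I, Real.norm_eq_abs, sq_abs]
    simp; field_simp
  have cd : ∀ k : ℤ, ‖fourierCoeffOn hl2 F' k‖ ^ 2 = (Real.pi / l) ^ 2 * k ^ 2 * ‖fourierCoeffOn hl2 F k‖ ^ 2 := by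
    intro k
    rcases eq_or_ne k 0 with rfl | hk
    · rw [fourierCoeffOn_eq_integral]
      simp only [neg_zero, fourier_zero, one_smul]
      rw [intervalIntegral.integral_eq_sub_of_hasDerivAt (fun t _ => hF t) (hFc'.intervalIntegrable _ _), E0]
      simp
    · have := fourierCoeffOn_of_hasDerivAt hl2 hk (fun x _ => hF x) (hFc'.intervalIntegrable _ _)
      rw [E0, mul_zero, zero_sub] at this
      have hk' : (k : ℝ) ≠ 0 := by exact_mod_cast hk
      have hpi := Real.pi_ne_zero
      rw [this]
      have e : (((l : ℝ) : ℂ) - ((-l : ℝ) : ℂ)) = ((2 * l : ℝ) : ℂ) := by push_cast; ring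
      rw [e]
      simp only [norm_mul, norm_neg, norm_div, Complex.norm_real, Complex.norm_I, Complex.norm_intCast, mul_pow, div_pow]
      simp only [Real.norm_eq_abs, sq_abs, norm_one]
      simp only [Complex.norm_ofNat]
      field_simp
  set A := (∫ t, f t * Real.sin (Real.pi / l * t)) ^ 2 / l ^ 2 with hA
  have S3 : HasSum (fun k : ℤ => if k = 1 then A else 0) A := hasSum_ite_eq 1 A
  have S4 : HasSum (fun k : ℤ => if k = -1 then A else 0) A := hasSum_ite_eq (-1) A
  have key := hasSum_le (fun k : ℤ => ?_) (S1.mul_left (4 * (Real.pi / l) ^ 2))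
    (S2.add ((S3.add S4).mul_left (3 * (Real.pi / l) ^ 2)))
  · rw [J1, J2, show l - -l = 2 * l by ring] at key
    simp only [smul_eq_mul] at key
    have := mul_le_mul_of_nonneg_left key hl.le
    rw [hA] at this
    field_simp at this ⊢
    linarith
  · simp only [cd]
    have hp : 0 ≤ (Real.pi / l) ^ 2 * ‖fourierCoeffOn hl2 F k‖ ^ 2 := by positivity
    by_cases h1 : k = 1
    · subst h1
      rw [c1 1 (Or.inl rfl)]; simp; linarith
    by_cases h2 : k = -1
    · subst h2
      rw [c1 (-1) (Or.inr rfl)]; simp; linarith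
    by_cases h3 : k = 0
    · subst h3; rw [c0]; simp
    have hk : (4 : ℝ) ≤ (k : ℝ) ^ 2 := by
      have : 4 ≤ k ^ 2 := by
        rcases lt_or_gt_of_ne h3 with h | h
        · have : k ≤ -2 := by omega
          nlinarith
        · have : 2 ≤ k := by omega
          nlinarith
      exact_mod_cast this
    simp only [h1, h2, if_false]
    nlinarith

lemma interval_gap_shift {f : ℝ → ℝ} (hf : ContDiff ℝ 1 f) {s l : ℝ} (hl : 0 < l)
    (hs : tsupport f ⊆ Set.Ioo s (s + l)) :
    4 * (Real.pi / l) ^ 2 * ∫ t, f t ^ 2 ≤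
      (∫ t, deriv f t ^ 2) + 6 * (Real.pi / l) ^ 2 / l * (∫ t, f t * Real.sin (Real.pi / l * (t - s))) ^ 2 := by
  have h1 : tsupport (fun t => f (t + s)) ⊆ Set.Ioo 0 l := by
    refine (closure_minimal (t := (fun t => t + s) ⁻¹' tsupport f) (fun t ht => subset_tsupport f ht)
      ((isClosed_tsupport f).preimage (by fun_prop))).trans fun t ht => ?_
    have := hs ht
    exact ⟨by linarith [this.1], by linarith [this.2]⟩
  have h2 := interval_gap (f := fun t => f (t + s)) (by fun_prop) hl h1
  simp only [deriv_comp_add_const] at h2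
  rw [integral_add_right_eq_self (fun t => f t ^ 2) s, integral_add_right_eq_self (fun t => deriv f t ^ 2) s] at h2
  rw [← integral_add_right_eq_self (fun t => f t * Real.sin (Real.pi / l * (t - s))) s]
  simpa using h2

lemma integral_sin_sq_interval {s l : ℝ} (hl : 0 < l) :
    ∫ t in Set.Ioo s (s + l), Real.sin (Real.pi / l * (t - s)) ^ 2 = l / 2 := by
  rw [← integral_Ioc_eq_integral_Ioo, ← intervalIntegral.integral_of_le (by linarith)]
  have h1 := intervalIntegral.integral_comp_sub_right (a := s) (b := s + l)
    (fun t => Real.sin (Real.pi / l * t) ^ 2) s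
  rw [h1]
  have hpi := Real.pi_pos
  have h2 := intervalIntegral.integral_comp_mul_left (a := s - s) (b := s + l - s)
    (fun t => Real.sin t ^ 2) (c := Real.pi / l) (by positivity)
  rw [h2, integral_sin_sq]
  have : Real.pi / l * (s + l - s) = Real.pi := by field_simp; ring
  rw [this, sub_self, mul_zero]
  simp; field_simp

/-- The Cauchy-Schwarz inequality against the first mode. -/
lemma sq_integral_mul_sin_le {f : ℝ → ℝ} (hf : Continuous f) {s l : ℝ} (hl : 0 < l)
    (h0 : ∀ t, t ∉ Set.Ioo s (s + l) → f t = 0) :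
    (∫ t, f t * Real.sin (Real.pi / l * (t - s))) ^ 2 ≤ l / 2 * ∫ t, f t ^ 2 := by
  set h := ∫ t, f t * Real.sin (Real.pi / l * (t - s)) with hh
  have hsup : HasCompactSupport f := HasCompactSupport.intro (isCompact_Icc (a := s) (b := s + l)) fun t ht =>
    h0 t fun h => ht (Set.Ioo_subset_Icc_self h)
  have i1 : Integrable fun t => f t ^ 2 := (hf.pow 2).integrable_of_hasCompactSupport (by
    simpa [pow_two] using hsup.mul_left (f := f))
  have i2 : Integrable fun t => f t * Real.sin (Real.pi / l * (t - s)) :=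
    Continuous.integrable_of_hasCompactSupport (by fun_prop) hsup.mul_right
  have i3 : IntegrableOn (fun t => Real.sin (Real.pi / l * (t - s)) ^ 2) (Set.Ioo s (s + l)) :=
    (Continuous.integrableOn_Icc (by fun_prop)).mono_set Set.Ioo_subset_Icc_self
  have key : 0 ≤ ∫ t in Set.Ioo s (s + l), (f t - 2 / l * h * Real.sin (Real.pi / l * (t - s))) ^ 2 :=
    integral_nonneg fun t => sq_nonneg _
  have e : ∀ t, (f t - 2 / l * h * Real.sin (Real.pi / l * (t - s))) ^ 2 =
      f t ^ 2 - 4 / l * h * (f t * Real.sin (Real.pi / l * (t - s))) +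
        (2 / l * h) ^ 2 * Real.sin (Real.pi / l * (t - s)) ^ 2 := fun t => by ring
  simp only [e] at key
  have i4 : IntegrableOn (fun t => f t ^ 2 - 4 / l * h * (f t * Real.sin (Real.pi / l * (t - s))))
    (Set.Ioo s (s + l)) := i1.integrableOn.sub (i2.integrableOn.const_mul _)
  rw [integral_add i4 (i3.const_mul _), integral_sub i1.integrableOn (i2.integrableOn.const_mul _), integral_const_mul, integral_const_mul,
    integral_sin_sq_interval hl,
    setIntegral_eq_integral_of_forall_compl_eq_zero (fun t ht => by simp [h0 t ht]),
    setIntegral_eq_integral_of_forall_compl_eq_zero (fun t ht => by simp [h0 t ht]), ← hh] at key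
  have : (∫ t, f t ^ 2) - 4 / l * h * h + (2 / l * h) ^ 2 * (l / 2) = (∫ t, f t ^ 2) - 2 / l * h ^ 2 := by
    field_simp; ring
  rw [this] at key
  have h3 := mul_nonneg (by positivity : 0 ≤ l / 2) key
  rw [mul_sub, ← mul_assoc, show l / 2 * (2 / l) = 1 by field_simp, one_mul] at h3
  linarith

lemma interval_poincare {f : ℝ → ℝ} (hf : ContDiff ℝ 1 f) {s l : ℝ} (hl : 0 < l)
    (hs : tsupport f ⊆ Set.Ioo s (s + l)) :
    (Real.pi / l) ^ 2 * ∫ t, f t ^ 2 ≤ ∫ t, deriv f t ^ 2 := by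
  have h1 := interval_gap_shift hf hl hs
  have h2 := sq_integral_mul_sin_le hf.continuous hl fun t ht => image_eq_zero_of_notMem_tsupport fun h => ht (hs h)
  have h3 := mul_le_mul_of_nonneg_left h2 (by positivity : 0 ≤ 6 * (Real.pi / l) ^ 2 / l)
  have : 6 * (Real.pi / l) ^ 2 / l * (l / 2 * ∫ t, f t ^ 2) = 3 * (Real.pi / l) ^ 2 * ∫ t, f t ^ 2 := by
    field_simp; ring
  linarith

lemma tsupport_slice_subset {u : ℝ × ℝ → ℝ} {S : Set ℝ} {g : ℝ → ℝ × ℝ} (hg : Continuous g)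
    (h : ∀ {t}, g t ∈ tsupport u → t ∈ S) : tsupport (fun t => u (g t)) ⊆ S :=
  (closure_minimal (t := g ⁻¹' tsupport u) (fun t ht => subset_tsupport u ht)
      ((isClosed_tsupport u).preimage hg)).trans fun _ => h

lemma deriv_slice_fst {u : ℝ × ℝ → ℝ} (hu : ContDiff ℝ 1 u) (x y : ℝ) :
    HasDerivAt (fun x => u (x, y)) (pdx u (x, y)) x := by
  have h1 := (hu.differentiable one_ne_zero (x, y)).hasFDerivAt
  have h2 : HasDerivAt (fun x : ℝ => (x, y)) ((1 : ℝ), (0 : ℝ)) x :=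
    (hasDerivAt_id x).prodMk (hasDerivAt_const x y)
  exact h1.comp_hasDerivAt x h2

lemma deriv_slice_snd {u : ℝ × ℝ → ℝ} (hu : ContDiff ℝ 1 u) (x y : ℝ) :
    HasDerivAt (fun y => u (x, y)) (pdy u (x, y)) y := by
  have h1 := (hu.differentiable one_ne_zero (x, y)).hasFDerivAt
  have h2 : HasDerivAt (fun y : ℝ => (x, y)) ((0 : ℝ), (1 : ℝ)) y :=
    (hasDerivAt_const y x).prodMk (hasDerivAt_id y)
  exact h1.comp_hasDerivAt y h2

/-- The first Fourier coefficient in the first variable is continuously differentiable. -/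
lemma hasDerivAt_slice_integral {u : ℝ × ℝ → ℝ} (hu : ContDiff ℝ 1 u) {s : ℝ → ℝ} (hs : Continuous s)
    {a b : ℝ} (hc : HasCompactSupport u)
    (y : ℝ) : HasDerivAt (fun y => ∫ x in Set.Icc a b, u (x, y) * s x) (∫ x in Set.Icc a b, pdy u (x, y) * s x) y := by
  have hpy := (continuous_pdy hu)
  have hpc : HasCompactSupport (pdy u) := by
    unfold pdy; exact hc.fderiv_apply (𝕜 := ℝ) (0, 1)
  obtain ⟨B, hB⟩ := hpc.exists_bound_of_continuous hpy
  refine (hasDerivAt_integral_of_dominated_loc_of_deriv_le (bound := fun x => B * |s x|)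
    (F' := fun y x => pdy u (x, y) * s x) (s := Set.univ) Filter.univ_mem
    (Filter.Eventually.of_forall fun y => ?_) ?_ ?_ ?_ ?_ ?_).2
  · exact Continuous.aestronglyMeasurable (by fun_prop)
  · exact Continuous.integrableOn_Icc (by fun_prop)
  · exact Continuous.aestronglyMeasurable (by fun_prop)
  · refine Filter.Eventually.of_forall fun x z _ => ?_
    rw [norm_mul, Real.norm_eq_abs (s x)]
    exact mul_le_mul_of_nonneg_right (hB _) (abs_nonneg _)
  · exact Continuous.integrableOn_Icc (by fun_prop)
  · exact Filter.Eventually.of_forall fun x z _ => (deriv_slice_snd hu x z).mul_const (s x)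

lemma continuous_slice_integral {u : ℝ × ℝ → ℝ} (hu : Continuous u) (a b : ℝ) :
    Continuous fun y => ∫ x in Set.Icc a b, u (x, y) :=
  continuous_parametric_integral_of_continuous (f := fun y x => u (x, y)) (by fun_prop) isCompact_Icc

/-- Spectral gap estimate for the Dirichlet problem on a rectangle. -/
theorem box_gap {u : ℝ × ℝ → ℝ} (hu : ContDiff ℝ 1 u) (hc : HasCompactSupport u) {x0 y0 l1 l2 L : ℝ}
    (hl1 : 0 < l1) (hl2 : 0 < l2)
    (hs : tsupport u ⊆ Set.Ioo x0 (x0 + l1) ×ˢ Set.Ioo y0 (y0 + l2))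
    (hL1 : L ≤ 4 * (Real.pi / l1) ^ 2 + (Real.pi / l2) ^ 2) (hL2 : L ≤ (Real.pi / l1) ^ 2 + 4 * (Real.pi / l2) ^ 2) :
    L * ∫ z, u z ^ 2 ≤ (∫ z, (pdx u z ^ 2 + pdy u z ^ 2)) + 12 * (Real.pi / l2) ^ 2 / (l1 * l2) *
      (∫ z, u z * (Real.sin (Real.pi / l1 * (z.1 - x0)) * Real.sin (Real.pi / l2 * (z.2 - y0)))) ^ 2 := by
  set a := Real.pi / l1 with ha
  set b := Real.pi / l2 with hb
  have huc := hu.continuous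
  have hxc := continuous_pdx hu
  have hyc := continuous_pdy hu
  have hxs : HasCompactSupport (pdx u) := by unfold pdx; exact hc.fderiv_apply (𝕜 := ℝ) (1, 0)
  have hys : HasCompactSupport (pdy u) := by unfold pdy; exact hc.fderiv_apply (𝕜 := ℝ) (0, 1)
  have z1 : ∀ z, z ∉ Set.Ioo x0 (x0 + l1) ×ˢ Set.Ioo y0 (y0 + l2) → u z = 0 ∧ pdy u z = 0 := fun z hz => by
    have h1 : z ∉ tsupport u := fun h => hz (hs h)
    refine ⟨image_eq_zero_of_notMem_tsupport h1, ?_⟩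
    rw [pdy, fderiv_of_notMem_tsupport (𝕜 := ℝ) h1]; rfl
  have zx : ∀ x y, x ∉ Set.Ioo x0 (x0 + l1) → u (x, y) = 0 ∧ pdy u (x, y) = 0 := fun x y h =>
    z1 _ fun hz => h hz.1
  have zy : ∀ x y, y ∉ Set.Ioo y0 (y0 + l2) → u (x, y) = 0 ∧ pdy u (x, y) = 0 := fun x y h =>
    z1 _ fun hz => h hz.2
  let s : ℝ → ℝ := fun x => Real.sin (a * (x - x0))
  have hsc : Continuous s := by fun_prop
  let h : ℝ → ℝ := fun y => ∫ x in Set.Icc x0 (x0 + l1), u (x, y) * s x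
  let h' : ℝ → ℝ := fun y => ∫ x in Set.Icc x0 (x0 + l1), pdy u (x, y) * s x
  have eh : ∀ y, h y = ∫ x, u (x, y) * s x := fun y =>
    setIntegral_eq_integral_of_forall_compl_eq_zero fun x hx => by
      rw [(zx x y fun h => hx (Set.Ioo_subset_Icc_self h)).1, zero_mul]
  have eh' : ∀ y, h' y = ∫ x, pdy u (x, y) * s x := fun y =>
    setIntegral_eq_integral_of_forall_compl_eq_zero fun x hx => by
      rw [(zx x y fun h => hx (Set.Ioo_subset_Icc_self h)).2, zero_mul]
  have hd : ∀ y, HasDerivAt h (h' y) y := hasDerivAt_slice_integral hu hsc hc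
  have dh : deriv h = h' := funext fun y => (hd y).deriv
  have hcont' : Continuous h' := continuous_slice_integral (u := fun z => pdy u z * s z.1) (by fun_prop) _ _
  have h1 : ContDiff ℝ 1 h := contDiff_one_iff_deriv.2 ⟨fun y => (hd y).differentiableAt, by rwa [dh]⟩
  have hcont := h1.continuous
  have hsupp : tsupport h ⊆ Set.Ioo y0 (y0 + l2) := by
    refine (closure_minimal (t := Prod.snd '' tsupport u) (fun y hy => ?_)
      (hc.isCompact.image continuous_snd).isClosed).trans ?_
    · by_contra hn
      refine hy ?_
      have : ∀ x, u (x, y) = 0 := fun x => image_eq_zero_of_notMem_tsupport fun hm => hn ⟨_, hm, rfl⟩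
      simp [h, this]
    · rintro _ ⟨z, hz, rfl⟩
      exact (hs hz).2
  have hz0 : ∀ y, y ∉ Set.Ioo y0 (y0 + l2) → h y = 0 ∧ h' y = 0 := fun y hy => by
    constructor <;> simp [h, h', (zy _ y hy).1, (zy _ y hy).2]
  have hcs : ∀ {g : ℝ → ℝ}, Continuous g → (∀ y, y ∉ Set.Ioo y0 (y0 + l2) → g y = 0) → Integrable g :=
    fun hg h0 => hg.integrable_of_hasCompactSupport (HasCompactSupport.intro isCompact_Icc fun t ht =>
      h0 t fun h => ht (Set.Ioo_subset_Icc_self h))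
  -- integrability on the plane
  have hcp : ∀ {g : ℝ × ℝ → ℝ}, Continuous g → (∀ z, z ∉ tsupport u → g z = 0) →
      Integrable g (volume.prod volume) := fun hg h0 =>
    hg.integrable_of_hasCompactSupport (HasCompactSupport.intro hc.isCompact h0)
  have nu : ∀ z, z ∉ tsupport u → u z = 0 := fun z hz => image_eq_zero_of_notMem_tsupport hz
  have nx : ∀ z, z ∉ tsupport u → pdx u z = 0 := fun z hz => by
    rw [pdx, fderiv_of_notMem_tsupport (𝕜 := ℝ) hz]; rfl
  have ny : ∀ z, z ∉ tsupport u → pdy u z = 0 := fun z hz => by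
    rw [pdy, fderiv_of_notMem_tsupport (𝕜 := ℝ) hz]; rfl
  have iu : Integrable (fun z => u z ^ 2) (volume.prod volume) := hcp (by fun_prop) fun z hz => by simp [nu z hz]
  have ix : Integrable (fun z => pdx u z ^ 2) (volume.prod volume) := hcp (by fun_prop) fun z hz => by simp [nx z hz]
  have iy : Integrable (fun z => pdy u z ^ 2) (volume.prod volume) := hcp (by fun_prop) fun z hz => by simp [ny z hz]
  set M := ∫ z, u z ^ 2 with hM
  set H := ∫ y, h y ^ 2 with hH
  set H' := ∫ y, h' y ^ 2 with hH'
  have ihh : Integrable fun y => h y ^ 2 := hcs (by fun_prop) fun y hy => by simp [hz0 y hy]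
  have ihh' : Integrable fun y => h' y ^ 2 := hcs (by fun_prop) fun y hy => by simp [hz0 y hy]
  have X : 4 * a ^ 2 * M ≤ (∫ z, pdx u z ^ 2) + 6 * a ^ 2 / l1 * H := by
    have e1 : M = ∫ y, ∫ x, u (x, y) ^ 2 := integral_prod_symm _ iu
    have e2 : ∫ z, pdx u z ^ 2 = ∫ y, ∫ x, pdx u (x, y) ^ 2 := integral_prod_symm _ ix
    have j1 := iu.integral_prod_right
    have j2 := ix.integral_prod_right
    rw [e1, e2, ← integral_const_mul, hH, ← integral_const_mul, ← integral_add j2 (ihh.const_mul _)]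
    refine integral_mono (j1.const_mul _) (j2.add (ihh.const_mul _)) fun y => ?_
    have := interval_gap_shift (f := fun x => u (x, y)) (by fun_prop) hl1
      (tsupport_slice_subset (by fun_prop) fun h => (hs h).1)
    simp only [(deriv_slice_fst hu _ y).deriv] at this
    simpa only [eh] using this
  have Hg : 4 * b ^ 2 * H ≤ H' + 6 * b ^ 2 / l2 *
      (∫ z, u z * (Real.sin (a * (z.1 - x0)) * Real.sin (b * (z.2 - y0)))) ^ 2 := by
    have e1 : ∫ z, u z * (Real.sin (a * (z.1 - x0)) * Real.sin (b * (z.2 - y0))) =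
        ∫ y, h y * Real.sin (b * (y - y0)) := by
      refine (integral_prod_symm _ (hcp (by fun_prop) fun z hz => by simp [nu z hz])).trans ?_
      refine integral_congr_ae (Filter.Eventually.of_forall fun y => ?_)
      simp only [eh, ← integral_mul_const, s]
      refine integral_congr_ae (Filter.Eventually.of_forall fun x => ?_)
      ring
    have := interval_gap_shift h1 hl2 hsupp
    rw [dh] at this
    rw [e1]; exact this
  have Y : b ^ 2 * M + 2 / l1 * (H' - b ^ 2 * H) ≤ ∫ z, pdy u z ^ 2 := by
    have iz : ∀ {g : ℝ × ℝ → ℝ} (x : ℝ), Continuous g → (∀ z, z ∉ tsupport u → g z = 0) →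
        Integrable fun y => g (x, y) := fun x hg h0 => hcs (by fun_prop) fun y hy =>
      h0 _ fun hm => hy (hs hm).2
    let D : ℝ → ℝ := fun x => ∫ y, (pdy u (x, y) ^ 2 - b ^ 2 * u (x, y) ^ 2)
    let E : ℝ → ℝ := fun x => ∫ y, (pdy u (x, y) * h' y - b ^ 2 * (u (x, y) * h y))
    have px : ∀ x, 0 ≤ D x - 4 / l1 * (s x * E x) + 4 / l1 ^ 2 * s x ^ 2 * (H' - b ^ 2 * H) := by
      intro x
      have hpo := interval_poincare (f := fun y => u (x, y) - 2 / l1 * s x * h y) (by fun_prop) hl2 (by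
        refine closure_minimal (t := Prod.snd '' tsupport u) (fun y hy => ?_)
          (hc.isCompact.image continuous_snd).isClosed |>.trans ?_
        · by_contra hn
          refine hy ?_
          have : ∀ x, u (x, y) = 0 := fun x => image_eq_zero_of_notMem_tsupport fun hm => hn ⟨_, hm, rfl⟩
          simp [h, this]
        · rintro _ ⟨z, hz, rfl⟩
          exact (hs hz).2)
      have e1 : ∀ y, deriv (fun y => u (x, y) - 2 / l1 * s x * h y) y = pdy u (x, y) - 2 / l1 * s x * h' y :=
        fun y => ((deriv_slice_snd hu x y).sub ((hd y).const_mul _)).deriv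
      simp only [e1] at hpo
      have k1 : Integrable fun y => (pdy u (x, y) - 2 / l1 * s x * h' y) ^ 2 := hcs (by fun_prop) fun y hy => by
        simp [hz0 y hy, zy x y hy]
      have k2 : Integrable fun y => (u (x, y) - 2 / l1 * s x * h y) ^ 2 := hcs (by fun_prop) fun y hy => by
        simp [hz0 y hy, zy x y hy]
      have k3 : Integrable fun y => pdy u (x, y) ^ 2 - b ^ 2 * u (x, y) ^ 2 := hcs (by fun_prop) fun y hy => by
        simp [zy x y hy]
      have k4 : Integrable fun y => pdy u (x, y) * h' y - b ^ 2 * (u (x, y) * h y) := hcs (by fun_prop) fun y hy => by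
        simp [zy x y hy]
      rw [← sub_nonneg, ← integral_const_mul, ← integral_sub k1 (k2.const_mul _)] at hpo
      refine hpo.trans_eq ?_
      have k5 : Integrable fun y => (pdy u (x, y) ^ 2 - b ^ 2 * u (x, y) ^ 2) -
          4 / l1 * s x * (pdy u (x, y) * h' y - b ^ 2 * (u (x, y) * h y)) := k3.sub (k4.const_mul _)
      have k6 : Integrable fun y => h' y ^ 2 - b ^ 2 * h y ^ 2 := ihh'.sub (ihh.const_mul _)
      calc _ = ∫ y, (((pdy u (x, y) ^ 2 - b ^ 2 * u (x, y) ^ 2) -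
          4 / l1 * s x * (pdy u (x, y) * h' y - b ^ 2 * (u (x, y) * h y))) +
          4 / l1 ^ 2 * s x ^ 2 * (h' y ^ 2 - b ^ 2 * h y ^ 2)) :=
            integral_congr_ae (Filter.Eventually.of_forall fun y => by ring)
        _ = _ := by
          rw [integral_add k5 (k6.const_mul _), integral_sub k3 (k4.const_mul _), integral_const_mul,
            integral_const_mul, integral_sub ihh' (ihh.const_mul _), integral_const_mul]
          ring
    have iD : Integrable (fun z : ℝ × ℝ => pdy u z ^ 2 - b ^ 2 * u z ^ 2) (volume.prod volume) :=
      iy.sub (iu.const_mul _)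
    have iE1 : Integrable (fun z : ℝ × ℝ => s z.1 * (pdy u z * h' z.2)) (volume.prod volume) :=
      hcp (by fun_prop) fun z hz => by simp [ny z hz]
    have iE2 : Integrable (fun z : ℝ × ℝ => s z.1 * (u z * h z.2)) (volume.prod volume) :=
      hcp (by fun_prop) fun z hz => by simp [nu z hz]
    have iE : Integrable (fun z : ℝ × ℝ => s z.1 * (pdy u z * h' z.2) - b ^ 2 * (s z.1 * (u z * h z.2)))
        (volume.prod volume) := iE1.sub (iE2.const_mul _)
    have jD : Integrable D := iD.integral_prod_left
    have fE : (fun x => s x * E x) = fun x => ∫ y, (s x * (pdy u (x, y) * h' y) - b ^ 2 * (s x * (u (x, y) * h y))) := by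
      funext x
      simp only [E]
      rw [← integral_const_mul]
      exact integral_congr_ae (Filter.Eventually.of_forall fun y => by ring)
    have jE : Integrable fun x => s x * E x := by rw [fE]; exact iE.integral_prod_left
    have vD : ∫ x, D x = (∫ z, pdy u z ^ 2) - b ^ 2 * M := by
      rw [hM, ← integral_const_mul]
      exact (integral_prod _ iD).symm.trans (integral_sub iy (iu.const_mul _))
    have vE : ∫ x, s x * E x = H' - b ^ 2 * H := by
      rw [fE]
      refine (integral_prod _ iE).symm.trans ?_
      rw [integral_sub iE1 (iE2.const_mul _), integral_const_mul]
      congr 1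
      · refine (integral_prod_symm _ iE1).trans (integral_congr_ae (Filter.Eventually.of_forall fun y => ?_))
        simp only
        rw [show h' y ^ 2 = ∫ x, h' y * (pdy u (x, y) * s x) by rw [integral_const_mul, ← eh', pow_two]]
        exact integral_congr_ae (Filter.Eventually.of_forall fun x => by ring)
      · congr 1
        refine (integral_prod_symm _ iE2).trans (integral_congr_ae (Filter.Eventually.of_forall fun y => ?_))
        simp only
        rw [show h y ^ 2 = ∫ x, h y * (u (x, y) * s x) by rw [integral_const_mul, ← eh, pow_two]]
        exact integral_congr_ae (Filter.Eventually.of_forall fun x => by ring)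
    have is : IntegrableOn (fun x => s x ^ 2) (Set.Ioo x0 (x0 + l1)) :=
      (Continuous.integrableOn_Icc (by fun_prop)).mono_set Set.Ioo_subset_Icc_self
    have tot : 0 ≤ ∫ x in Set.Ioo x0 (x0 + l1),
        (D x - 4 / l1 * (s x * E x) + 4 / l1 ^ 2 * s x ^ 2 * (H' - b ^ 2 * H)) := integral_nonneg px
    have i4 : IntegrableOn (fun x => D x - 4 / l1 * (s x * E x)) (Set.Ioo x0 (x0 + l1)) :=
      jD.integrableOn.sub (jE.integrableOn.const_mul _)
    rw [integral_add i4 ((is.const_mul _).mul_const _), integral_sub jD.integrableOn (jE.integrableOn.const_mul _),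
      integral_const_mul, integral_mul_const, integral_const_mul, integral_sin_sq_interval hl1,
      setIntegral_eq_integral_of_forall_compl_eq_zero (fun x hx => by simp [D, zx x _ hx]),
      setIntegral_eq_integral_of_forall_compl_eq_zero (fun x hx => by simp [E, zx x _ hx]), vD, vE] at tot
    have : 4 / l1 ^ 2 * (l1 / 2) * (H' - b ^ 2 * H) = 2 / l1 * (H' - b ^ 2 * H) := by field_simp; ring
    rw [this] at tot
    have h4 : 4 / l1 * (H' - b ^ 2 * H) = 2 * (2 / l1 * (H' - b ^ 2 * H)) := by ring
    linarith
  have T : (∫ z, (pdx u z ^ 2 + pdy u z ^ 2)) = (∫ z, pdx u z ^ 2) + ∫ z, pdy u z ^ 2 := integral_add ix iy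
  have HM : 2 / l1 * H ≤ M := by
    have e1 : M = ∫ y, ∫ x, u (x, y) ^ 2 := integral_prod_symm _ iu
    rw [e1, hH, ← integral_const_mul]
    refine integral_mono (ihh.const_mul _) iu.integral_prod_right fun y => ?_
    have := sq_integral_mul_sin_le (f := fun x => u (x, y)) (by fun_prop) hl1 fun x hx => (zx x y hx).1
    simp only [eh]
    have h3 := mul_le_mul_of_nonneg_left this (by positivity : 0 ≤ 2 / l1)
    rw [← mul_assoc, show 2 / l1 * (l1 / 2) = 1 by field_simp, one_mul] at h3
    exact h3
  have H0 : 0 ≤ H := integral_nonneg fun y => sq_nonneg _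
  have HH : 0 ≤ 2 / l1 * H := by positivity
  rw [T]
  set G := (∫ z, u z * (Real.sin (a * (z.1 - x0)) * Real.sin (b * (z.2 - y0)))) ^ 2
  have e5 := mul_le_mul_of_nonneg_left Hg (by positivity : 0 ≤ 2 / l1)
  have e6 : 2 / l1 * (H' + 6 * b ^ 2 / l2 * G) = 2 / l1 * H' + 12 * b ^ 2 / (l1 * l2) * G := by field_simp; ring
  have e7 : 6 * a ^ 2 / l1 * H = 3 * a ^ 2 * (2 / l1 * H) := by ring
  have e8 : 2 / l1 * (4 * b ^ 2 * H) = 4 * b ^ 2 * (2 / l1 * H) := by ring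
  have e9 : 2 / l1 * (H' - b ^ 2 * H) = 2 / l1 * H' - b ^ 2 * (2 / l1 * H) := by ring
  rw [e6, e8] at e5
  rw [e7] at X
  rw [e9] at Y
  set q := 2 / l1 * H
  have hmn : L * M ≤ (4 * a ^ 2 + b ^ 2) * M + 3 * (b ^ 2 - a ^ 2) * q := by
    rcases le_total a b with hab | hab
    · have : a ^ 2 ≤ b ^ 2 := by
        have : 0 ≤ a := by have := Real.pi_pos; positivity
        nlinarith
      nlinarith
    · have : b ^ 2 ≤ a ^ 2 := by
        have : 0 ≤ b := by have := Real.pi_pos; positivity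
        nlinarith
      nlinarith
  linarith

/-- The vertices of the regular polygon. -/
noncomputable def regY (n : ℕ) (k : Fin n) : ℝ × ℝ := (cs n 1 k, sn n 1 k)

lemma cos_lt_cos_of_mem {α θ : ℝ} (hα : 0 ≤ α) (h1 : α < θ) (h2 : θ < 2 * Real.pi - α) :
    Real.cos θ < Real.cos α := by
  rcases le_total θ Real.pi with h | h
  · exact Real.cos_lt_cos_of_nonneg_of_le_pi hα h h1
  · rw [← Real.cos_two_pi_sub θ]
    exact Real.cos_lt_cos_of_nonneg_of_le_pi hα (by linarith) (by linarith)

lemma cs_sq_add_sn_sq {n : ℕ} (m : ℤ) (k : Fin n) : cs n m k ^ 2 + sn n m k ^ 2 = 1 := Real.cos_sq_add_sin_sq _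

section
variable {n : ℕ} [NeZero n]

lemma cs_succ_one (k : Fin n) : cs n 1 (k + 1) =
    cs n 1 k * Real.cos (2 * Real.pi / n) - sn n 1 k * Real.sin (2 * Real.pi / n) := by
  rw [cs_succ]; norm_num

lemma sn_succ_one (k : Fin n) : sn n 1 (k + 1) =
    sn n 1 k * Real.cos (2 * Real.pi / n) + cs n 1 k * Real.sin (2 * Real.pi / n) := by
  rw [sn_succ]; norm_num

lemma cross_regY (k : Fin n) : cross (regY n k) (regY n (k + 1)) = Real.sin (2 * Real.pi / n) := by
  simp only [cross, regY, cs_succ_one, sn_succ_one]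
  linear_combination Real.sin (2 * Real.pi / n) * cs_sq_add_sn_sq 1 k

lemma two_pi_div (n : ℕ) : 2 * Real.pi / n = 2 * (Real.pi / n) := by ring

lemma fan_regY (hn : 3 ≤ n) : Fan n (regY n) := by
  have hn0 : (3 : ℝ) ≤ n := by exact_mod_cast hn
  have hpi := Real.pi_pos
  have hs0 : 0 < Real.sin (Real.pi / n) := Real.sin_pos_of_pos_of_lt_pi (by positivity)
    ((div_lt_iff₀ (by linarith)).2 (by nlinarith))
  have hnd : ¬ ((n : ℤ) ∣ 1) := fun h => by
    have := Int.le_of_dvd one_pos h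
    omega
  refine ⟨hn, ?_, fun k => ?_, fun k j h1 h2 => ?_⟩
  · ext <;> simp [regY, Prod.fst_sum, Prod.snd_sum, cs_sum_zero (by omega) hnd, sn_sum_zero (by omega) hnd]
  · rw [cross_regY]
    exact Real.sin_pos_of_pos_of_lt_pi (by positivity) ((div_lt_iff₀ (by linarith)).2 (by nlinarith))
  · have hkey : Real.cos (2 * Real.pi * (k - j : ℤ) / n + Real.pi / n) < Real.cos (Real.pi / n) := by
      have hj := j.2
      have hk := k.2
      have hd : ∃ d : ℤ, 1 ≤ d ∧ d + 2 ≤ n ∧ ((d : ℤ) = k - j ∨ (d : ℤ) = k - j + n) := by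
        have n1 : (j : ℕ) ≠ k := fun h => h1 (Fin.ext h)
        rcases lt_or_gt_of_ne n1 with h | h
        · refine ⟨k - j, by omega, ?_, Or.inl rfl⟩
          by_contra hc
          refine h2 (Fin.ext ?_)
          rw [Fin.val_add, Fin.val_one', Nat.mod_eq_of_lt (show 1 < n by omega), show (k : ℕ) + 1 = n by omega,
            Nat.mod_self]
          omega
        · refine ⟨k - j + n, by omega, ?_, Or.inr rfl⟩
          by_contra hc
          refine h2 (Fin.ext ?_)
          rw [Fin.val_add, Fin.val_one', Nat.mod_eq_of_lt (show 1 < n by omega), Nat.mod_eq_of_lt (by omega)]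
          omega
      obtain ⟨d, hd1, hd2, hd3⟩ := hd
      have e : Real.cos (2 * Real.pi * (k - j : ℤ) / n + Real.pi / n) =
          Real.cos (2 * Real.pi * d / n + Real.pi / n) := by
        rcases hd3 with h | h
        · rw [h]
        · rw [h, ← Real.cos_add_two_pi]
          congr 1
          push_cast
          field_simp
          ring
      rw [e]
      have d1 : (1 : ℝ) ≤ d := by exact_mod_cast hd1
      have d2 : (d : ℝ) + 2 ≤ n := by exact_mod_cast hd2
      have e2 : 2 * Real.pi * d / n + Real.pi / n = Real.pi / n * (2 * d + 1) := by ring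
      have e3 : 2 * Real.pi - Real.pi / n = Real.pi / n * (2 * n - 1) := by field_simp
      have hp : 0 < Real.pi / n := by positivity
      refine cos_lt_cos_of_mem hp.le ?_ ?_
      · rw [e2]; nlinarith
      · rw [e2, e3]; exact mul_lt_mul_of_pos_left (by linarith) hp
    have e1 : cross (regY n j) (regY n (k + 1) - regY n k) =
        2 * Real.sin (Real.pi / n) * Real.cos (2 * Real.pi * (k - j : ℤ) / n + Real.pi / n) := by
      have h3 : Real.cos (2 * Real.pi * (k - j : ℤ) / n) = cs n 1 k * cs n 1 j + sn n 1 k * sn n 1 j := by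
        rw [cs, cs, sn, sn, ← Real.cos_sub]; congr 1; push_cast; ring
      have h4 : Real.sin (2 * Real.pi * (k - j : ℤ) / n) = sn n 1 k * cs n 1 j - cs n 1 k * sn n 1 j := by
        rw [cs, cs, sn, sn, ← Real.sin_sub]; congr 1; push_cast; ring
      rw [Real.cos_add, h3, h4]
      simp only [cross, regY, cs_succ_one, sn_succ_one, Prod.fst_sub, Prod.snd_sub, two_pi_div,
        Real.sin_two_mul, Real.cos_two_mul]
      have := Real.sin_sq_add_cos_sq (Real.pi / n)
      linear_combination (2 * cs n 1 j * sn n 1 k - 2 * sn n 1 j * cs n 1 k) * this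
    rw [e1, cross_regY, two_pi_div, Real.sin_two_mul]
    exact mul_lt_mul_of_pos_left hkey (by positivity)

lemma jac_regY (k : Fin n) : Fan.jac (regY n) k = Real.cos (Real.pi / n) * Real.sin (Real.pi / n) := by
  rw [Fan.jac, cross_regY, two_pi_div, Real.sin_two_mul]; ring

lemma half_regY (k : Fin n) : (Fan.half (regY n) k).1 ^ 2 + (Fan.half (regY n) k).2 ^ 2 = Real.sin (Real.pi / n) ^ 2 := by
  have h1 := cs_sq_add_sn_sq 1 k
  have h2 := Real.sin_sq_add_cos_sq (Real.pi / n)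
  simp only [Fan.half, regY, Prod.smul_fst, Prod.smul_snd, Prod.fst_sub, Prod.snd_sub, cs_succ_one, sn_succ_one,
    two_pi_div, Real.sin_two_mul, Real.cos_two_mul, smul_eq_mul]
  rw [Real.cos_sq' (Real.pi / n)]
  linear_combination (Real.sin (Real.pi / n) ^ 2) * h1 + (Real.sin (Real.pi / n) ^ 2 *(cs n 1 k ^ 2 + sn n 1 k ^ 2)) * h2

lemma mid_regY (k : Fin n) : (Fan.mid (regY n) k).1 ^ 2 + (Fan.mid (regY n) k).2 ^ 2 = Real.cos (Real.pi / n) ^ 2 := by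
  have h1 := cs_sq_add_sn_sq 1 k
  have h2 := Real.sin_sq_add_cos_sq (Real.pi / n)
  simp only [Fan.mid, regY, Prod.smul_fst, Prod.smul_snd, Prod.fst_add, Prod.snd_add, cs_succ_one, sn_succ_one,
    two_pi_div, Real.sin_two_mul, Real.cos_two_mul, smul_eq_mul]
  linear_combination (Real.cos (Real.pi / n) ^ 2) * h1 + (Real.cos (Real.pi / n) ^ 2 * (cs n 1 k ^ 2 + sn n 1 k ^ 2)) * h2

lemma half_mid_regY (k : Fin n) : (Fan.half (regY n) k).1 * (Fan.mid (regY n) k).1 +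
    (Fan.half (regY n) k).2 * (Fan.mid (regY n) k).2 = 0 := by
  have h1 := cs_sq_add_sn_sq 1 k
  have h2 := cs_sq_add_sn_sq 1 (k + 1)
  simp only [Fan.mid, Fan.half, regY, Prod.smul_fst, Prod.smul_snd, Prod.fst_add, Prod.snd_add, Prod.fst_sub, Prod.snd_sub,
    smul_eq_mul]
  linear_combination (h2 - h1) / 4

lemma dirK_regY (hn : 3 ≤ n) : Fan.dirK (regY n) =
    (Real.sin (Real.pi / n) / Real.cos (Real.pi / n)) • dirC n (kapN n) := by
  have hn0 : (3 : ℝ) ≤ n := by exact_mod_cast hn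
  have hpi := Real.pi_pos
  have hs0 : 0 < Real.sin (Real.pi / n) := Real.sin_pos_of_pos_of_lt_pi (by positivity)
    ((div_lt_iff₀ (by linarith)).2 (by nlinarith))
  have hc0 : 0 < Real.cos (Real.pi / n) := Real.cos_pos_of_mem_Ioo
    ⟨by have : 0 < Real.pi / n := by positivity
        linarith, (div_lt_iff₀ (by linarith)).2 (by nlinarith)⟩
  funext k i
  fin_cases i <;> simp [Fan.dirK, dirC, jac_regY, half_regY, mid_regY, half_mid_regY, kapN, -mul_eq_zero,
    -div_eq_zero_iff, -neg_add_rev]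
  · field_simp
  · field_simp

lemma masK_regY : Fan.masK (regY n) = (Real.cos (Real.pi / n) * Real.sin (Real.pi / n)) • masC n := by
  funext k i
  fin_cases i <;> simp [Fan.masK, masC, jac_regY]

end

/-- The first Dirichlet eigenvalue in coordinates. -/
noncomputable def dirEig (U : Set (ℝ × ℝ)) : ℝ :=
  sInf {R | ∃ u, IsTest U u ∧ u ≠ 0 ∧ R = energy u / mass u}

lemma trig_pos {n : ℕ} (hn : 3 ≤ n) : 0 < Real.sin (Real.pi / n) ∧ 0 < Real.cos (Real.pi / n) := by
  have hn0 : (3 : ℝ) ≤ n := by exact_mod_cast hn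
  have hpi := Real.pi_pos
  have hp : 0 < Real.pi / n := by positivity
  exact ⟨Real.sin_pos_of_pos_of_lt_pi hp ((div_lt_iff₀ (by linarith)).2 (by nlinarith)),
    Real.cos_pos_of_mem_Ioo ⟨by linarith, (div_lt_iff₀ (by linarith)).2 (by nlinarith)⟩⟩

section
variable {U : Set (ℝ × ℝ)} {u : ℝ × ℝ → ℝ}

lemma energy_nonneg (u : ℝ × ℝ → ℝ) : 0 ≤ energy u := integral_nonneg fun _ => by positivity

lemma IsTest.mass_pos (h : IsTest U u) (h0 : u ≠ 0) : 0 < mass u := by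
  have hc := h.smooth.continuous
  obtain ⟨z, hz⟩ := Function.ne_iff.1 h0
  refine (hc.pow 2).integral_pos_of_hasCompactSupport_nonneg_nonzero ?_ (fun _ => sq_nonneg _)
    (x := z) (pow_ne_zero 2 hz)
  simpa only [pow_two] using! h.compact.mul_left (f := u)

lemma dirEig_bddBelow (U : Set (ℝ × ℝ)) : BddBelow {R | ∃ u, IsTest U u ∧ u ≠ 0 ∧ R = energy u / mass u} :=
  ⟨0, by
    rintro _ ⟨u, -, -, rfl⟩
    exact div_nonneg (energy_nonneg u) (integral_nonneg fun _ => sq_nonneg _)⟩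

lemma exists_isTest (hU : IsOpen U) (hne : U.Nonempty) : ∃ u, IsTest U u ∧ u ≠ 0 := by
  obtain ⟨z, hz⟩ := hne
  obtain ⟨f, h1, h2, h3, -, h4⟩ := exists_contDiff_tsupport_subset (n := (⊤ : ℕ∞)) (hU.mem_nhds hz)
  exact ⟨f, ⟨h3, h2, h1⟩, fun h => by simp [h] at h4⟩

lemma dirEig_set_nonempty (hU : IsOpen U) (hne : U.Nonempty) :
    {R | ∃ u, IsTest U u ∧ u ≠ 0 ∧ R = energy u / mass u}.Nonempty :=
  (exists_isTest hU hne).imp' (fun u => energy u / mass u) fun u h => ⟨u, h.1, h.2, rfl⟩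

lemma dirEig_nonneg (U : Set (ℝ × ℝ)) : 0 ≤ dirEig U :=
  Real.sInf_nonneg (by
    rintro _ ⟨u, -, -, rfl⟩
    exact div_nonneg (energy_nonneg u) (integral_nonneg fun _ => sq_nonneg _))

lemma IsTest.dirEig_bound (h : IsTest U u) : dirEig U * mass u ≤ energy u := by
  rcases eq_or_ne u 0 with rfl | h0
  · have : mass 0 = 0 := by simp [mass]
    rw [this, mul_zero]; exact energy_nonneg _
  · rw [← le_div_iff₀ (h.mass_pos h0)]
    exact csInf_le (dirEig_bddBelow U) ⟨u, h, h0, rfl⟩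

lemma exists_near_dirEig (hU : IsOpen U) (hne : U.Nonempty) {ε : ℝ} (hε : 0 < ε) :
    ∃ u, IsTest U u ∧ u ≠ 0 ∧ energy u ≤ (dirEig U + ε) * mass u := by
  obtain ⟨_, ⟨u, h1, h2, rfl⟩, h3⟩ := exists_lt_of_csInf_lt (dirEig_set_nonempty hU hne)
    (show sInf _ < dirEig U + ε from lt_add_of_pos_right _ hε)
  exact ⟨u, h1, h2, ((div_lt_iff₀ (h1.mass_pos h2)).1 h3).le⟩

lemma le_dirEig (hU : IsOpen U) (hne : U.Nonempty) {L : ℝ} (H : ∀ u, IsTest U u → L * mass u ≤ energy u) :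
    L ≤ dirEig U := by
  refine le_csInf (dirEig_set_nonempty hU hne) ?_
  rintro _ ⟨u, h1, h2, rfl⟩
  exact (le_div_iff₀ (h1.mass_pos h2)).2 (H u h1)
end

section
variable {n : ℕ} [NeZero n]

lemma Fan.region_subset_box {y : Fin n → ℝ × ℝ} (h : Fan n y) {a b c d : ℝ}
    (hy : ∀ k, y k ∈ Set.Icc a b ×ˢ Set.Icc c d) : Fan.region y ⊆ Set.Ioo a b ×ˢ Set.Ioo c d := by
  have h1 : convexHull ℝ (Set.range y) ⊆ Set.Icc a b ×ˢ Set.Icc c d :=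
    convexHull_min (Set.range_subset_iff.2 hy) ((convex_Icc a b).prod (convex_Icc c d))
  rw [← h.interior_hull]
  refine (interior_mono h1).trans ?_
  rw [interior_prod_eq, interior_Icc, interior_Icc]

lemma Fan.zero_mem_region (y : Fin n → ℝ × ℝ) : (0 : ℝ × ℝ) ∈ Fan.region y := by
  intro k
  simp [Fan.side, cross]

/-- A bounding box of the regular polygon yields a spectral gap. -/
theorem specGap_of_box (hn : 3 ≤ n) {x0 y0 l1 l2 L : ℝ} (hl1 : 0 < l1) (hl2 : 0 < l2)
    (hbox : ∀ k, regY n k ∈ Set.Icc x0 (x0 + l1) ×ˢ Set.Icc y0 (y0 + l2))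
    (hL1 : L ≤ 4 * (Real.pi / l1) ^ 2 + (Real.pi / l2) ^ 2) (hL2 : L ≤ (Real.pi / l1) ^ 2 + 4 * (Real.pi / l2) ^ 2) :
    SpecGap (frm (dirC n (kapN n))) (frm (masC n)) (dirEig (Fan.region (regY n)) * Real.cos (Real.pi / n) ^ 2)
      (L * Real.cos (Real.pi / n) ^ 2) := by
  obtain ⟨hs, hc⟩ := trig_pos hn
  have F := fan_regY hn
  set σ := Real.sin (Real.pi / n)
  set ρ := Real.cos (Real.pi / n)
  set Λ := dirEig (Fan.region (regY n))
  have hQ : ∀ W, frm (Fan.dirK (regY n)) W W = σ / ρ * frm (dirC n (kapN n)) W W := fun W => by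
    rw [dirK_regY hn, frm_smul]; rfl
  have hN : ∀ W, frm (Fan.masK (regY n)) W W = ρ * σ * frm (masC n) W W := fun W => by
    rw [masK_regY, frm_smul]; rfl
  have conv : ∀ {l q m : ℝ}, l * (ρ * σ * m) ≤ σ / ρ * q → l * ρ ^ 2 * m ≤ q := fun {l q m} h => by
    have h1 := mul_le_mul_of_nonneg_left h (by positivity : 0 ≤ ρ / σ)
    calc l * ρ ^ 2 * m = ρ / σ * (l * (ρ * σ * m)) := by field_simp
      _ ≤ _ := h1
      _ = q := by field_simp
  have hm : 0 < ρ * σ := mul_pos hc hs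
  have hQ0 : ∀ W, 0 ≤ frm (masC n) W W := fun W => by
    exact frm_nonneg (fun k x y z => by simp [masC]; positivity) W
  refine ⟨frm_symm _, frm_symm _, hQ0, mul_nonneg (dirEig_nonneg _) (sq_nonneg _), fun W => ?_, fun ε hε => ?_, ?_⟩
  · have h1 := F.transfer (L := Λ) (C := 0) (B := 0) (φ := fun _ => 0) continuous_const (by simp)
      (fun u hu => by simpa using hu.dirEig_bound) W
    rw [hQ, hN, zero_mul, add_zero] at h1
    exact conv h1
  · obtain ⟨u, hu, h0, h1⟩ := exists_near_dirEig (Fan.isOpen_region (regY n)) ⟨0, Fan.zero_mem_region _⟩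
      (ε := ε / ρ ^ 2) (by positivity)
    have h2 := hu.mass_pos h0
    rw [F.mass_eq hu, F.energy_eq hu, hQ, hN] at h1
    rw [F.mass_eq hu, hN] at h2
    set W := F.pull hu
    have h3 : 0 < frm (masC n) W W := (mul_pos_iff_of_pos_left hm).1 h2
    have h4 : frm (dirC n (kapN n)) W W ≤ (Λ * ρ ^ 2 + ε) * frm (masC n) W W := by
      have h5 := mul_le_mul_of_nonneg_left h1 (by positivity : 0 ≤ ρ / σ)
      calc frm (dirC n (kapN n)) W W = ρ / σ * (σ / ρ * frm (dirC n (kapN n)) W W) := by field_simp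
        _ ≤ _ := h5
        _ = _ := by field_simp; ring
    set m := frm (masC n) W W
    have h6 : (√m)⁻¹ * (√m)⁻¹ = m⁻¹ := by rw [← mul_inv, Real.mul_self_sqrt h3.le]
    refine ⟨(√m)⁻¹ • W, ?_, ?_⟩
    · simp only [map_smul, LinearMap.smul_apply, smul_eq_mul, ← mul_assoc, h6]
      exact inv_mul_cancel₀ h3.ne'
    · simp only [map_smul, LinearMap.smul_apply, smul_eq_mul, ← mul_assoc, h6]
      rw [inv_mul_le_iff₀ h3]; linarith
  · set φ : ℝ × ℝ → ℝ := fun z => Real.sin (Real.pi / l1 * (z.1 - x0)) * Real.sin (Real.pi / l2 * (z.2 - y0)) with hφ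
    have hφc : Continuous φ := by fun_prop
    have hcc : ∀ k, Continuous fun p => φ (Fan.chart (regY n) k p) := fun k =>
      hφc.comp (Fan.contDiff_chart (m := 0) _ k).continuous
    have hb : ∀ z, |φ z| ≤ 1 := fun z => by
      rw [hφ, abs_mul]
      exact mul_le_one₀ (Real.abs_sin_le_one _) (abs_nonneg _) (Real.abs_sin_le_one _)
    refine ⟨{ toFun := fun W => ∑ k, Fan.jac (regY n) k * triInt (fun p => φ (Fan.chart (regY n) k p) * W.1 k p)
              map_add' := fun V W => ?_
              map_smul' := fun c W => ?_ }, fun W hW => ?_⟩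
    · rw [← Finset.sum_add_distrib]
      refine Finset.sum_congr rfl fun k _ => ?_
      rw [← mul_add, ← triInt_add (f := fun p => φ (Fan.chart (regY n) k p) * V.1 k p)
        (g := fun p => φ (Fan.chart (regY n) k p) * W.1 k p)
        ((hcc k).mul (tup_continuous V k)) ((hcc k).mul (tup_continuous W k))]
      congr 2; funext p; simp [mul_add]
    · simp only [RingHom.id_apply, smul_eq_mul]
      rw [Finset.mul_sum]
      refine Finset.sum_congr rfl fun k _ => ?_
      rw [mul_left_comm, ← triInt_const_mul (f := fun p => φ (Fan.chart (regY n) k p) * W.1 k p)]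
      congr 2; funext p; simp; ring
    · have h1 := F.transfer (L := L) (C := 12 * (Real.pi / l2) ^ 2 / (l1 * l2)) hφc hb
        (fun u hu => box_gap hu.contDiff_one hu.compact hl1 hl2
          (hu.supp.trans (F.region_subset_box hbox)) hL1 hL2) W
      have h2 : ∑ k, Fan.jac (regY n) k * triInt (fun p => φ (Fan.chart (regY n) k p) * W.1 k p) = 0 := hW
      rw [h2, hQ, hN] at h1
      refine conv (h1.trans_eq ?_)
      ring
end

lemma sq_cos_pi_div_five : Real.cos (Real.pi / 5) ^ 2 = (3 + √5) / 8 := by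
  rw [Real.cos_pi_div_five]
  have := Real.sq_sqrt (show (0:ℝ) ≤ 5 by norm_num)
  linear_combination this / 16

lemma regY_five (k : Fin 5) : regY 5 k ∈ Set.Icc (-81 / 100 : ℝ) (-81 / 100 + 181 / 100) ×ˢ
    Set.Icc (-952 / 1000 : ℝ) (-952 / 1000 + 1904 / 1000) := by
  have hp := Real.cos_pi_div_five
  have h5 : Real.cos (2 * Real.pi / 5) = (√5 - 1) / 4 := by
    rw [show 2 * Real.pi / 5 = 2 * (Real.pi / 5) by ring, Real.cos_two_mul, sq_cos_pi_div_five]; ring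
  have s1 : (2.236 : ℝ) ≤ √5 := Real.le_sqrt_of_sq_le (by norm_num)
  have s2 : √5 ≤ 2.2361 := Real.sqrt_le_iff.2 ⟨by norm_num, by norm_num⟩
  have hc : cs 5 1 k = 1 ∨ cs 5 1 k = (√5 - 1) / 4 ∨ cs 5 1 k = -((1 + √5) / 4) := by
    fin_cases k <;> simp [cs]
    · right; left; exact h5
    · right; right
      rw [show 2 * Real.pi * 2 / 5 = Real.pi - Real.pi / 5 by ring, Real.cos_pi_sub, hp]
    · right; right
      rw [show 2 * Real.pi * 3 / 5 = Real.pi / 5 + Real.pi by ring, Real.cos_add_pi, hp]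
    · right; left
      rw [show 2 * Real.pi * 4 / 5 = 2 * Real.pi - 2 * Real.pi / 5 by ring, Real.cos_two_pi_sub, h5]
  have hq := cs_sq_add_sn_sq 1 k
  have hs : sn 5 1 k ^ 2 ≤ (952 / 1000) ^ 2 := by rcases hc with h | h | h <;> rw [h] at hq <;> nlinarith
  have hs' := abs_le.1 (abs_le_of_sq_le_sq hs (by norm_num))
  refine ⟨⟨?_, ?_⟩, ?_, ?_⟩ <;> simp only [regY]
  · rcases hc with h | h | h <;> linarith
  · rcases hc with h | h | h <;> linarith
  · linarith
  · linarith

lemma regY_six (k : Fin 6) : regY 6 k ∈ Set.Icc (-1 : ℝ) (-1 + 2) ×ˢ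
    Set.Icc (-867 / 1000 : ℝ) (-867 / 1000 + 1734 / 1000) := by
  have h3 := Real.cos_pi_div_three
  have hc : cs 6 1 k = 1 ∨ cs 6 1 k = 1 / 2 ∨ cs 6 1 k = -(1 / 2) ∨ cs 6 1 k = -1 := by
    fin_cases k <;> simp [cs]
    · right; left
      rw [show 2 * Real.pi / 6 = Real.pi / 3 by ring, h3]; norm_num
    · right; right; left
      rw [show 2 * Real.pi * 2 / 6 = Real.pi - Real.pi / 3 by ring, Real.cos_pi_sub, h3]; norm_num
    · right; right; right
      rw [show 2 * Real.pi * 3 / 6 = Real.pi by ring, Real.cos_pi]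
    · right; right; left
      rw [show 2 * Real.pi * 4 / 6 = Real.pi / 3 + Real.pi by ring, Real.cos_add_pi, h3]; norm_num
    · right; left
      rw [show 2 * Real.pi * 5 / 6 = 2 * Real.pi - Real.pi / 3 by ring, Real.cos_two_pi_sub, h3]; norm_num
  have hq := cs_sq_add_sn_sq 1 k
  have hs : sn 6 1 k ^ 2 ≤ (867 / 1000) ^ 2 := by rcases hc with h | h | h | h <;> rw [h] at hq <;> nlinarith
  have hs' := abs_le.1 (abs_le_of_sq_le_sq hs (by norm_num))
  refine ⟨⟨?_, ?_⟩, ?_, ?_⟩ <;> simp only [regY]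
  · rcases hc with h | h | h | h <;> linarith
  · rcases hc with h | h | h | h <;> linarith
  · linarith
  · linarith

theorem polygon_specGap {n : ℕ} [NeZero n] (hn : n = 5 ∨ n = 6) : ∃ L, ((Cert.polygon n).Lp : ℝ) < L ∧
    SpecGap (frm (dirC n (kapN n))) (frm (masC n)) (dirEig (Fan.region (regY n)) * Real.cos (Real.pi / n) ^ 2) L := by
  have hpi : (9.86902 : ℝ) ≤ Real.pi ^ 2 := by nlinarith [Real.pi_gt_d4]
  rcases hn with rfl | rfl
  · refine ⟨13.9 * Real.cos (Real.pi / (5 : ℕ)) ^ 2, ?_, specGap_of_box (by norm_num) (by norm_num) (by norm_num)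
      regY_five ?_ ?_⟩
    · have : (Cert.polygon 5).Lp = 181 / 20 := rfl
      have s1 : (2.236 : ℝ) ≤ √5 := Real.le_sqrt_of_sq_le (by norm_num)
      have h5 := sq_cos_pi_div_five
      rw [this]; push_cast; rw [h5]; linarith
    · rw [div_pow, div_pow]; linarith
    · rw [div_pow, div_pow]; linarith
  · refine ⟨13.15 * Real.cos (Real.pi / (6 : ℕ)) ^ 2, ?_, specGap_of_box (by norm_num) (by norm_num) (by norm_num)
      regY_six ?_ ?_⟩
    · have : (Cert.polygon 6).Lp = 493 / 50 := rfl
      rw [this]; push_cast; rw [Real.sq_cos_pi_div_six]; norm_num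
    · rw [div_pow, div_pow]; norm_num; linarith
    · rw [div_pow, div_pow]; norm_num; linarith

/-- The coordinate chart of the Euclidean plane centred at `c`. -/
noncomputable def planeEquiv : EuclideanSpace ℝ (Fin 2) ≃L[ℝ] ℝ × ℝ :=
  (EuclideanSpace.equiv (Fin 2) ℝ).trans (ContinuousLinearEquiv.finTwoArrow ℝ ℝ)

lemma planeEquiv_apply (z : EuclideanSpace ℝ (Fin 2)) : planeEquiv z = (z 0, z 1) := rfl

noncomputable def planeHomeo (c : ℝ × ℝ) : EuclideanSpace ℝ (Fin 2) ≃ₜ ℝ × ℝ :=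
  planeEquiv.toHomeomorph.trans (Homeomorph.subRight c)

lemma planeHomeo_apply (c : ℝ × ℝ) (z : EuclideanSpace ℝ (Fin 2)) : planeHomeo c z = planeEquiv z - c := rfl

lemma planeHomeo_symm_apply (c w : ℝ × ℝ) : (planeHomeo c).symm w = planeEquiv.symm (w + c) := by
  rw [Homeomorph.symm_apply_eq, planeHomeo_apply, ContinuousLinearEquiv.apply_symm_apply, add_sub_cancel_right]

lemma contDiff_planeHomeo (c : ℝ × ℝ) {m : WithTop ℕ∞} : ContDiff ℝ m (planeHomeo c) :=
  planeEquiv.contDiff.sub contDiff_const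

lemma contDiff_planeHomeo_symm (c : ℝ × ℝ) {m : WithTop ℕ∞} : ContDiff ℝ m (planeHomeo c).symm := by
  have : ⇑(planeHomeo c).symm = fun w => planeEquiv.symm (w + c) := funext (planeHomeo_symm_apply c)
  rw [this]
  exact planeEquiv.symm.contDiff.comp (contDiff_id.add contDiff_const)

lemma measurePreserving_planeHomeo (c : ℝ × ℝ) : MeasurePreserving (planeHomeo c) := by
  have h1 : MeasurePreserving (planeEquiv : EuclideanSpace ℝ (Fin 2) → ℝ × ℝ) :=
    (volume_preserving_finTwoArrow ℝ).comp (PiLp.volume_preserving_ofLp (Fin 2))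
  exact (measurePreserving_sub_right volume c).comp h1

lemma norm_fderiv_comp_planeHomeo (c : ℝ × ℝ) {w : ℝ × ℝ → ℝ} (hw : Differentiable ℝ w)
    (z : EuclideanSpace ℝ (Fin 2)) : ‖fderiv ℝ (w ∘ planeHomeo c) z‖ ^ 2 =
      pdx w (planeHomeo c z) ^ 2 + pdy w (planeHomeo c z) ^ 2 := by
  have hd : HasFDerivAt (w ∘ planeHomeo c) ((fderiv ℝ w (planeHomeo c z)).comp
      (planeEquiv : EuclideanSpace ℝ (Fin 2) →L[ℝ] ℝ × ℝ)) z :=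
    (hw _).hasFDerivAt.comp z (planeEquiv.hasFDerivAt.sub_const c)
  rw [hd.fderiv]
  set T := (fderiv ℝ w (planeHomeo c z)).comp (planeEquiv : EuclideanSpace ℝ (Fin 2) →L[ℝ] ℝ × ℝ) with hT
  have h0 : T (EuclideanSpace.single 0 1) = pdx w (planeHomeo c z) := by
    simp [hT, pdx, planeEquiv_apply]
  have h1 : T (EuclideanSpace.single 1 1) = pdy w (planeHomeo c z) := by
    simp [hT, pdy, planeEquiv_apply]
  rw [← h0, ← h1]
  set g := (InnerProductSpace.toDual ℝ (EuclideanSpace ℝ (Fin 2))).symm T with hg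
  have hTg : ∀ v, T v = inner ℝ g v := fun v => by rw [hg, InnerProductSpace.toDual_symm_apply]
  have hn : ‖T‖ = ‖g‖ := by rw [hg, LinearIsometryEquiv.norm_map]
  rw [hn, hTg, hTg, EuclideanSpace.real_norm_sq_eq, Fin.sum_univ_two]
  simp [EuclideanSpace.inner_single_right]

section
variable {n : ℕ} [NeZero n]

lemma interior_hull_eq_preimage (x : Fin n → EuclideanSpace ℝ (Fin 2)) (c : ℝ × ℝ)
    (F : Fan n (fun k => (x k 0, x k 1) - c)) : interior (convexHull ℝ (Set.range x)) =
      planeHomeo c ⁻¹' Fan.region (fun k => (x k 0, x k 1) - c) := by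
  rw [← F.interior_hull, Homeomorph.preimage_interior]
  congr 1
  have himg : planeHomeo c '' convexHull ℝ (Set.range x) =
      convexHull ℝ (Set.range fun k => (x k 0, x k 1) - c) := by
    let A : EuclideanSpace ℝ (Fin 2) →ᵃ[ℝ] ℝ × ℝ :=
      (planeEquiv : EuclideanSpace ℝ (Fin 2) →L[ℝ] ℝ × ℝ).toLinearMap.toAffineMap - AffineMap.const ℝ _ c
    have hA : ⇑A = planeHomeo c := rfl
    rw [← hA, AffineMap.image_convexHull, ← Set.range_comp]
    rfl
  rw [← himg, Set.preimage_image_eq _ (planeHomeo c).injective]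

theorem firstDirichletEigenvalue_preimage (c : ℝ × ℝ) (U : Set (ℝ × ℝ)) :
    firstDirichletEigenvalue (planeHomeo c ⁻¹' U) = dirEig U := by
  have hm := measurePreserving_planeHomeo c
  have he := (planeHomeo c).measurableEmbedding
  have key : ∀ w, IsTest U w →
      (∫ x in planeHomeo c ⁻¹' U, ‖fderiv ℝ (w ∘ planeHomeo c) x‖ ^ 2) = energy w ∧
      (∫ x in planeHomeo c ⁻¹' U, (w ∘ planeHomeo c) x ^ 2) = mass w := by
    intro w hw
    have hz : ∀ z, z ∉ planeHomeo c ⁻¹' U → planeHomeo c z ∉ tsupport w := fun z hz h => hz (hw.supp h)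
    have hd : Differentiable ℝ w := hw.smooth.differentiable (by simp)
    constructor
    · simp_rw [norm_fderiv_comp_planeHomeo c hd]
      rw [setIntegral_eq_integral_of_forall_compl_eq_zero, energy,
        ← hm.integral_comp he (fun z => pdx w z ^ 2 + pdy w z ^ 2)]
      intro z h
      have : fderiv ℝ w (planeHomeo c z) = 0 :=
        Function.notMem_support.1 fun h' => hz z h (support_fderiv_subset ℝ h')
      simp [pdx, pdy, this]
    · rw [setIntegral_eq_integral_of_forall_compl_eq_zero, mass, ← hm.integral_comp he (fun z => w z ^ 2)]
      · rfl
      intro z h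
      simp [image_eq_zero_of_notMem_tsupport (hz z h)]
  unfold firstDirichletEigenvalue dirEig
  congr 1
  ext R
  constructor
  · rintro ⟨u, h1, h2, h3, h4, rfl⟩
    have hu : u = (u ∘ (planeHomeo c).symm) ∘ planeHomeo c := by ext z; simp
    have hw : IsTest U (u ∘ (planeHomeo c).symm) := by
      refine ⟨h1.comp (contDiff_planeHomeo_symm c), h2.comp_homeomorph _, ?_⟩
      rw [tsupport_comp_eq_preimage]
      intro z hz
      simpa using h3 hz
    refine ⟨_, hw, fun h => h4 ?_, ?_⟩
    · rw [hu, h]; rfl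
    · rw [← (key _ hw).1, ← (key _ hw).2, ← hu]
  · rintro ⟨w, hw, h0, rfl⟩
    refine ⟨w ∘ planeHomeo c, hw.smooth.comp (contDiff_planeHomeo c), hw.compact.comp_homeomorph _, ?_, fun h => h0 ?_, ?_⟩
    · rw [tsupport_comp_eq_preimage]
      exact Set.preimage_mono hw.supp
    · ext z
      simpa using congrFun h ((planeHomeo c).symm z)
    · rw [(key _ hw).1, (key _ hw).2]

theorem polyaFunctional_eq (x : Fin n → EuclideanSpace ℝ (Fin 2)) (c : ℝ × ℝ)
    (F : Fan n (fun k => (x k 0, x k 1) - c)) : polyaFunctional x =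
      dirEig (Fan.region fun k => (x k 0, x k 1) - c) * ∑ k, Fan.jac (fun k => (x k 0, x k 1) - c) k := by
  rw [polyaFunctional, interior_hull_eq_preimage x c F, firstDirichletEigenvalue_preimage, ← F.volume_region,
    ← Measure.real, (measurePreserving_planeHomeo c).measureReal_preimage
      (Fan.isOpen_region _).measurableSet.nullMeasurableSet]
end

lemma quotient_bounds {a b : ℂ} {ε : ℝ} (ha : ‖a‖ ≤ 2 * ε) (hb : ‖b‖ ≤ ε) (hε : ε ≤ 1 / 100) :
    ‖b / (1 + a)‖ ≤ 2 * ε ∧ ‖b / (1 + a) - b‖ ≤ 4 * ε ^ 2 ∧ ‖b / (1 + a) - b + a * b‖ ≤ 8 * ε ^ 3 := by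
  have hε0 : 0 ≤ ε := (norm_nonneg b).trans hb
  have h1 : 1 / 2 ≤ ‖1 + a‖ := by
    have := norm_sub_le_norm_add (1 : ℂ) a
    rw [norm_one] at this
    linarith
  have hne : 1 + a ≠ 0 := fun h => by rw [h, norm_zero] at h1; linarith
  have hw : ‖b / (1 + a)‖ ≤ 2 * ε := by
    rw [norm_div, div_le_iff₀ (by linarith)]
    nlinarith
  have e2 : b / (1 + a) - b = -a * (b / (1 + a)) := by field_simp; ring
  have e3 : b / (1 + a) - b + a * b = a * a * (b / (1 + a)) := by field_simp; ring
  refine ⟨hw, ?_, ?_⟩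
  · rw [e2, norm_mul, norm_neg]
    calc ‖a‖ * ‖b / (1 + a)‖ ≤ (2 * ε) * (2 * ε) := by gcongr
      _ = _ := by ring
  · rw [e3, norm_mul, norm_mul]
    calc ‖a‖ * ‖a‖ * ‖b / (1 + a)‖ ≤ (2 * ε) * (2 * ε) * (2 * ε) := by gcongr
      _ = _ := by ring

lemma moebius_bounds {q x ε : ℝ} (hq : 0 ≤ q) (hq' : q ≤ 4 * ε ^ 2) (hx : |x| ≤ 2 * ε) (hε : 0 ≤ ε) (hε' : ε ≤ 1 / 100) :
    |(1 + q - 2 * x) / (1 - q) - 1 + 2 * x| ≤ 20 * ε ^ 2 ∧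
      2 * q - 2 * x - 32 * ε ^ 3 ≤ (1 + q - 2 * x) / (1 - q) - 1 ∧
      |-2 * x / (1 - q) + 2 * x| ≤ ε ^ 2 := by
  have h1 : 1 / 2 ≤ 1 - q := by nlinarith
  have hx' := abs_le.1 hx
  have e1 : (1 + q - 2 * x) / (1 - q) - 1 + 2 * x = (2 * q - 2 * x * q) / (1 - q) := by
    field_simp [show (1 - q) ≠ 0 by linarith]; ring
  have e2 : (1 + q - 2 * x) / (1 - q) - 1 = (2 * q - 2 * x) + q * (2 * q - 2 * x) / (1 - q) := by
    field_simp [show (1 - q) ≠ 0 by linarith]; ring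
  have e3 : -2 * x / (1 - q) + 2 * x = -2 * x * q / (1 - q) := by
    field_simp [show (1 - q) ≠ 0 by linarith]; ring
  have hxq : |x * q| ≤ 8 * ε ^ 3 := by
    rw [abs_mul, abs_of_nonneg hq]
    calc |x| * q ≤ (2 * ε) * (4 * ε ^ 2) := by gcongr
      _ = _ := by ring
  have hxq' := abs_le.1 hxq
  have hc : ε ^ 3 ≤ 1 / 100 * ε ^ 2 := by nlinarith [sq_nonneg ε]
  refine ⟨?_, ?_, ?_⟩
  · rw [e1, abs_div, abs_of_pos (show 0 < 1 - q by linarith), div_le_iff₀ (by linarith), abs_le]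
    constructor <;> nlinarith [sq_nonneg ε]
  · rw [e2]
    have : -(32 * ε ^ 3) ≤ q * (2 * q - 2 * x) / (1 - q) := by
      rw [le_div_iff₀ (by linarith)]
      nlinarith [pow_nonneg hε 3, mul_nonneg hq hq]
    linarith
  · rw [e3, abs_div, abs_of_pos (show 0 < 1 - q by linarith), div_le_iff₀ (by linarith), abs_le]
    constructor <;> nlinarith [sq_nonneg ε]

lemma sum_sq_le_imp {n : ℕ} {a : Fin n → ℂ} {c ε : ℝ} (hc : 0 ≤ c) (hε : 0 ≤ ε) (h : ∑ k, ‖a k‖ ^ 2 ≤ (c * ε) ^ 2)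
    (k : Fin n) : ‖a k‖ ≤ c * ε :=
  abs_le_of_sq_le_sq' ((Finset.single_le_sum (f := fun k => ‖a k‖ ^ 2) (fun _ _ => by positivity)
    (Finset.mem_univ k)).trans h) (by positivity) |>.2

set_option maxHeartbeats 1000000 in
/-- The coefficients of the transplanted energy form, and their expansion in the tangential and normal
parts `b` and `a` of the deformation. -/
theorem coeff_estimates {n : ℕ} (hn : 3 ≤ n) {r l : ℝ} (hr : 0 < r) (hl : 0 ≤ l) :
    ∃ K : ℝ, ∀ δ > 0, ∃ η > 0, ∀ (S : ℝ) (a b : Fin n → ℂ) (C' : Fin n → Fin 4 → ℝ), S < η →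
      ∑ k, ‖b k‖ ^ 2 = S → ∑ k, ‖a k‖ ^ 2 ≤ 4 * S → ∑ k, (b k).re = 0 → ∑ k, (a k).re = 0 →
      (∀ k, C' k 0 = (1 + ‖b k / (1 + a k)‖ ^ 2 - 2 * (b k / (1 + a k)).re) / (1 - ‖b k / (1 + a k)‖ ^ 2)) →
      (∀ k, C' k 1 = r * (-2 * (b k / (1 + a k)).im / (1 - ‖b k / (1 + a k)‖ ^ 2))) →
      (∀ k, C' k 2 = r ^ 2 * ((1 + ‖b k / (1 + a k)‖ ^ 2 + 2 * (b k / (1 + a k)).re) /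
        (1 - ‖b k / (1 + a k)‖ ^ 2))) →
      (∀ k, C' k 3 = -(l * n * (‖1 + a k‖ ^ 2 - ‖b k‖ ^ 2) / ∑ j, (‖1 + a j‖ ^ 2 - ‖b j‖ ^ 2))) →
      (∀ k i, |C' k i - ![1, 0, r ^ 2, -l] i| ≤ δ) ∧
      (∀ k i, |C' k i - ![1, 0, r ^ 2, -l] i -
        ![-2 * (b k).re, -2 * r * (b k).im, 2 * r ^ 2 * (b k).re, -2 * l * (a k).re] i| ≤ K * S) ∧
      S * (2 - 1 / 20) + 2 * ∑ k, (a k * b k).re ≤ ∑ k, (C' k 0 - 1) ∧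
      S * (2 - 1 / 20) - 2 * ∑ k, (a k * b k).re ≤ ∑ k, (C' k 2 / r ^ 2 - 1) ∧
      ∑ k, C' k 3 = -(n * l) := by
  set D : ℝ := 1 + r + r ^ 2 + l with hD
  have hn1 : (3 : ℝ) ≤ n := by exact_mod_cast hn
  refine ⟨40 * D, fun δ hδ => ?_⟩
  set e0 : ℝ := min (1 / (3000 * n)) (δ / (50 * D)) with he0
  have hD0 : 0 < D := by positivity
  have he0' : 0 < e0 := lt_min (by positivity) (by positivity)
  refine ⟨e0 ^ 2, by positivity, fun S a b C' hS hb ha hb0 ha0 h0 h1 h2 h3 => ?_⟩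
  have hS0 : 0 ≤ S := hb ▸ Finset.sum_nonneg fun _ _ => by positivity
  set ε := √S with hε
  have hεS : ε ^ 2 = S := Real.sq_sqrt hS0
  have hε0 : 0 ≤ ε := Real.sqrt_nonneg S
  have hεe : ε < e0 := by
    rw [hε, Real.sqrt_lt' he0']; exact hS
  have hε1 : ε * (3000 * n) ≤ 1 := by
    have := hεe.le.trans (min_le_left _ _)
    rwa [le_div_iff₀ (by positivity)] at this
  have hε2 : ε * (50 * D) ≤ δ := by
    have := hεe.le.trans (min_le_right _ _)
    rwa [le_div_iff₀ (by positivity)] at this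
  have hε3 : ε ≤ 1 / 100 := by nlinarith
  have Hb : ∀ k, ‖b k‖ ≤ ε := fun k => by
    have := sum_sq_le_imp (c := 1) (a := b) zero_le_one hε0 (by rw [one_mul, hεS, hb]) k
    rwa [one_mul] at this
  have Ha : ∀ k, ‖a k‖ ≤ 2 * ε := sum_sq_le_imp (by norm_num) hε0 (by rw [mul_pow, hεS]; linarith)
  set w : Fin n → ℂ := fun k => b k / (1 + a k) with hw
  have Hq := fun k => quotient_bounds (Ha k) (Hb k) hε3
  have hwq : ∀ k, ‖w k‖ ^ 2 ≤ 4 * ε ^ 2 := fun k => by nlinarith [(Hq k).1, norm_nonneg (w k)]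
  have hwr : ∀ k, |(w k).re| ≤ 2 * ε := fun k => (Complex.abs_re_le_norm _).trans (Hq k).1
  have hwi : ∀ k, |(w k).im| ≤ 2 * ε := fun k => (Complex.abs_im_le_norm _).trans (Hq k).1
  have hdr : ∀ k, |(w k).re - (b k).re| ≤ 4 * ε ^ 2 := fun k => by
    rw [← Complex.sub_re]; exact (Complex.abs_re_le_norm _).trans (Hq k).2.1
  have hdi : ∀ k, |(w k).im - (b k).im| ≤ 4 * ε ^ 2 := fun k => by
    rw [← Complex.sub_im]; exact (Complex.abs_im_le_norm _).trans (Hq k).2.1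
  have hd3 : ∀ k, |(w k).re - (b k).re + (a k * b k).re| ≤ 8 * ε ^ 3 := fun k => by
    rw [← Complex.sub_re, ← Complex.add_re]; exact (Complex.abs_re_le_norm _).trans (Hq k).2.2
  have hwb : ∀ k, ‖b k‖ ^ 2 - 12 * ε ^ 3 ≤ ‖w k‖ ^ 2 := fun k => by
    have h := norm_sub_norm_le (b k) (w k)
    rw [norm_sub_rev] at h
    have h' := (Hq k).2.1
    have h3 : ‖b k‖ ≤ ‖w k‖ + 4 * ε ^ 2 := by linarith
    have h4 : ‖b k‖ ^ 2 - ‖w k‖ ^ 2 = (‖b k‖ - ‖w k‖) * (‖b k‖ + ‖w k‖) := by ring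
    have h5 : (‖b k‖ - ‖w k‖) * (‖b k‖ + ‖w k‖) ≤ (4 * ε ^ 2) * (‖b k‖ + ‖w k‖) := by
      gcongr; linarith
    have h6 : (4 * ε ^ 2) * (‖b k‖ + ‖w k‖) ≤ (4 * ε ^ 2) * (ε + 2 * ε) := by
      gcongr
      · exact Hb k
      · exact (Hq k).1
    nlinarith
  have M0 := fun k => moebius_bounds (sq_nonneg ‖w k‖) (hwq k) (hwr k) hε0 hε3
  have M2 := fun k => moebius_bounds (sq_nonneg ‖w k‖) (hwq k) (x := -(w k).re) (by rw [abs_neg]; exact hwr k) hε0 hε3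
  have M1 := fun k => (moebius_bounds (sq_nonneg ‖w k‖) (hwq k) (hwi k) hε0 hε3).2.2
  have hr2 : 0 < r ^ 2 := by positivity
  -- the area terms
  set q : Fin n → ℝ := fun k => ‖a k‖ ^ 2 - ‖b k‖ ^ 2 with hq
  have ht : ∀ k, ‖1 + a k‖ ^ 2 - ‖b k‖ ^ 2 = 1 + 2 * (a k).re + q k := fun k => by
    simp only [hq, Complex.sq_norm, Complex.normSq_apply, Complex.add_re, Complex.add_im, Complex.one_re, Complex.one_im]
    ring
  have hQ : ∑ k, (‖1 + a k‖ ^ 2 - ‖b k‖ ^ 2) = n + ∑ k, q k := by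
    simp_rw [ht]
    rw [Finset.sum_add_distrib, Finset.sum_add_distrib, ← Finset.mul_sum, ha0]; simp
  have hQb : |∑ k, q k| ≤ 4 * ε ^ 2 := by
    have : 0 ≤ ∑ k, ‖a k‖ ^ 2 := Finset.sum_nonneg fun _ _ => by positivity
    rw [Finset.sum_sub_distrib, hb, hεS, abs_le]; constructor <;> linarith
  have hqb : ∀ k, |q k| ≤ 4 * ε ^ 2 := fun k => by
    have h1 := Ha k; have h2 := Hb k
    have := norm_nonneg (a k); have := norm_nonneg (b k)
    rw [abs_le]; constructor <;> simp only [hq] <;> nlinarith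
  set T := (n : ℝ) + ∑ k, q k with hT
  have hTn : (n : ℝ) / 2 ≤ T := by
    have := (abs_le.1 hQb).1
    nlinarith
  have hTpos : 0 < T := by linarith
  have F0 : ∀ k, |C' k 0 - 1 + 2 * (b k).re| ≤ 40 * ε ^ 2 := fun k => by
    have e := (abs_le.1 (M0 k).1); have e' := abs_le.1 (hdr k)
    rw [h0 k, abs_le]; constructor <;> linarith
  have F1 : ∀ k, |C' k 1 + 2 * r * (b k).im| ≤ 40 * r * ε ^ 2 := fun k => by
    have e := (abs_le.1 (M1 k)); have e' := abs_le.1 (hdi k)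
    have : C' k 1 + 2 * r * (b k).im = r * ((-2 * (w k).im / (1 - ‖w k‖ ^ 2) + 2 * (w k).im) -
      2 * ((w k).im - (b k).im)) := by rw [h1 k]; ring
    rw [this, abs_mul, abs_of_pos hr, show 40 * r * ε ^ 2 = r * (40 * ε ^ 2) by ring]
    refine mul_le_mul_of_nonneg_left ?_ hr.le
    rw [abs_le]; constructor <;> nlinarith
  have F2 : ∀ k, |C' k 2 - r ^ 2 - 2 * r ^ 2 * (b k).re| ≤ 40 * r ^ 2 * ε ^ 2 := fun k => by
    have e := (abs_le.1 (M2 k).1); have e' := abs_le.1 (hdr k)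
    have : C' k 2 - r ^ 2 - 2 * r ^ 2 * (b k).re = r ^ 2 * (((1 + ‖w k‖ ^ 2 - 2 * -(w k).re) / (1 - ‖w k‖ ^ 2) - 1
      + 2 * -(w k).re) + 2 * ((w k).re - (b k).re)) := by rw [h2 k]; ring
    rw [this, abs_mul, abs_of_pos hr2, show 40 * r ^ 2 * ε ^ 2 = r ^ 2 * (40 * ε ^ 2) by ring]
    refine mul_le_mul_of_nonneg_left ?_ hr2.le
    rw [abs_le]; constructor <;> linarith
  have F3 : ∀ k, |C' k 3 + l + 2 * l * (a k).re| ≤ 40 * l * ε ^ 2 := fun k => by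
    have : C' k 3 + l + 2 * l * (a k).re = l * ((∑ k, q k - n * q k + 2 * (a k).re * ∑ k, q k) / T) := by
      rw [h3 k, hQ, ht]
      field_simp
      simp only [hT]
      ring
    rw [this, abs_mul, abs_of_nonneg hl, show 40 * l * ε ^ 2 = l * (40 * ε ^ 2) by ring]
    refine mul_le_mul_of_nonneg_left ?_ hl
    rw [abs_div, abs_of_pos hTpos, div_le_iff₀ hTpos]
    have hre : |2 * (a k).re| ≤ 1 := by
      rw [abs_mul, abs_two]
      have := (Complex.abs_re_le_norm (a k)).trans (Ha k)
      linarith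
    calc |∑ k, q k - n * q k + 2 * (a k).re * ∑ k, q k| ≤ |∑ k, q k - n * q k| + |2 * (a k).re * ∑ k, q k| :=
          abs_add_le _ _
      _ ≤ (|∑ k, q k| + |n * q k|) + |2 * (a k).re * ∑ k, q k| := by gcongr; exact abs_sub _ _
      _ = |∑ k, q k| + n * |q k| + |2 * (a k).re| * |∑ k, q k| := by
          rw [abs_mul, abs_mul (2 * (a k).re), abs_of_nonneg (show (0 : ℝ) ≤ n by linarith)]
      _ ≤ 4 * ε ^ 2 + n * (4 * ε ^ 2) + 1 * (4 * ε ^ 2) := by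
          gcongr
          exact hqb k
      _ ≤ 40 * ε ^ 2 * T := by nlinarith [sq_nonneg ε]
  have hDε : ∀ c, 0 ≤ c → c ≤ D → 40 * c * ε ^ 2 ≤ 40 * D * S := fun c _ hc => by
    rw [hεS]; gcongr
  have c1 : 1 ≤ D := by rw [hD]; linarith
  have c2 : r ≤ D := by rw [hD]; linarith
  have c3 : r ^ 2 ≤ D := by rw [hD]; linarith
  have c4 : l ≤ D := by rw [hD]; linarith
  have main : ∀ k i, |C' k i - ![1, 0, r ^ 2, -l] i -
      ![-2 * (b k).re, -2 * r * (b k).im, 2 * r ^ 2 * (b k).re, -2 * l * (a k).re] i| ≤ 40 * D * S := by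
    intro k i
    fin_cases i
    · refine le_trans (le_of_eq ?_) ((F0 k).trans (by linarith [hDε 1 zero_le_one c1]))
      congr 1; simp; try ring
    · refine le_trans (le_of_eq ?_) ((F1 k).trans (hDε r hr.le c2))
      congr 1; simp; try ring
    · exact (F2 k).trans (hDε _ hr2.le c3)
    · refine le_trans (le_of_eq ?_) ((F3 k).trans (hDε l hl c4))
      congr 1; simp; try ring
  refine ⟨fun k i => ?_, main, ?_, ?_, ?_⟩
  · have hlin : |![-2 * (b k).re, -2 * r * (b k).im, 2 * r ^ 2 * (b k).re, -2 * l * (a k).re] i| ≤ 4 * D * ε := by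
      have hbr := (Complex.abs_re_le_norm (b k)).trans (Hb k)
      have hbi := (Complex.abs_im_le_norm (b k)).trans (Hb k)
      have har := (Complex.abs_re_le_norm (a k)).trans (Ha k)
      have gen : ∀ c x y : ℝ, 0 ≤ c → c ≤ D → |x| ≤ 2 * ε → |y| = 2 * c * |x| → |y| ≤ 4 * D * ε := by
        intro c x y hc hc' hx hy
        rw [hy]
        calc 2 * c * |x| ≤ 2 * D * (2 * ε) := by gcongr
          _ = _ := by ring
      fin_cases i
      · exact gen 1 (b k).re _ zero_le_one c1 (by linarith) (by simp [abs_mul])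
      · exact gen r (b k).im _ hr.le c2 (by linarith) (by simp [abs_mul, abs_of_pos hr])
      · exact gen (r ^ 2) (b k).re _ hr2.le c3 (by linarith) (by simp [abs_mul])
      · exact gen l (a k).re _ hl c4 har (by simp [abs_mul, abs_of_nonneg hl])
    have hm := main k i
    have tri : |C' k i - ![1, 0, r ^ 2, -l] i| ≤ |C' k i - ![1, 0, r ^ 2, -l] i -
      ![-2 * (b k).re, -2 * r * (b k).im, 2 * r ^ 2 * (b k).re, -2 * l * (a k).re] i| +
        |![-2 * (b k).re, -2 * r * (b k).im, 2 * r ^ 2 * (b k).re, -2 * l * (a k).re] i| := by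
      refine le_trans (le_of_eq ?_) (abs_add_le _ _)
      congr 1; ring
    have : 40 * D * S ≤ D * ε := by rw [← hεS]; nlinarith [mul_nonneg hD0.le hε0]
    nlinarith [mul_nonneg hD0.le hε0]
  · have P : ∀ k, 2 * ‖b k‖ ^ 2 - 2 * (b k).re + 2 * (a k * b k).re - 100 * ε ^ 3 ≤ C' k 0 - 1 := fun k => by
      have e := (M0 k).2.1; have e' := (abs_le.1 (hd3 k)); have e2 := hwb k
      rw [h0 k]; linarith
    have := Finset.sum_le_sum fun k (_ : k ∈ Finset.univ) => P k
    rw [Finset.sum_sub_distrib, Finset.sum_add_distrib, Finset.sum_sub_distrib, ← Finset.mul_sum, ← Finset.mul_sum,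
      ← Finset.mul_sum, hb, hb0] at this
    simp only [Finset.sum_const, Finset.card_univ, Fintype.card_fin, nsmul_eq_mul] at this
    have h4 : n * (100 * ε ^ 3) ≤ S * (1 / 20) := by rw [← hεS]; nlinarith [sq_nonneg ε]
    linarith
  · have P : ∀ k, 2 * ‖b k‖ ^ 2 + 2 * (b k).re - 2 * (a k * b k).re - 100 * ε ^ 3 ≤ C' k 2 / r ^ 2 - 1 := fun k => by
      have e := (M2 k).2.1; have e' := (abs_le.1 (hd3 k)); have e2 := hwb k
      rw [h2 k, mul_div_cancel_left₀ _ hr2.ne']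
      rw [show 1 + ‖w k‖ ^ 2 - 2 * -(w k).re = 1 + ‖w k‖ ^ 2 + 2 * (w k).re by ring] at e
      linarith
    have := Finset.sum_le_sum fun k (_ : k ∈ Finset.univ) => P k
    rw [Finset.sum_sub_distrib, Finset.sum_sub_distrib, Finset.sum_add_distrib, ← Finset.mul_sum, ← Finset.mul_sum,
      ← Finset.mul_sum, hb, hb0] at this
    simp only [Finset.sum_const, Finset.card_univ, Fintype.card_fin, nsmul_eq_mul] at this
    have h4 : n * (100 * ε ^ 3) ≤ S * (1 / 20) := by rw [← hεS]; nlinarith [sq_nonneg ε]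
    linarith
  · simp_rw [h3]
    rw [Finset.sum_neg_distrib, ← Finset.sum_div, ← Finset.mul_sum, mul_div_assoc, div_self (by rw [hQ]; exact hTpos.ne')]
    ring

/-- The complex number with the given coordinates. -/
def toC (p : ℝ × ℝ) : ℂ := ⟨p.1, p.2⟩

/-- The point `exp (ix)` of the unit circle. -/
noncomputable def circ (x : ℝ) : ℂ := Complex.exp (x * Complex.I)

/-- The `k`-th power of the `m`-th power of the primitive root of unity. -/
noncomputable def ex (n : ℕ) (m : ℤ) (k : Fin n) : ℂ := ⟨cs n m k, sn n m k⟩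

lemma circ_add (x y : ℝ) : circ (x + y) = circ x * circ y := by
  simp only [circ, ← Complex.exp_add]; push_cast; ring_nf

lemma circ_zero : circ 0 = 1 := by simp [circ]
lemma circ_ne_zero (x : ℝ) : circ x ≠ 0 := Complex.exp_ne_zero _
lemma circ_neg (x : ℝ) : circ (-x) = (circ x)⁻¹ := by
  refine eq_inv_of_mul_eq_one_left ?_
  rw [← circ_add, neg_add_cancel, circ_zero]
lemma norm_circ (x : ℝ) : ‖circ x‖ = 1 := Complex.norm_exp_ofReal_mul_I x

lemma circ_eq (x : ℝ) : circ x = ⟨Real.cos x, Real.sin x⟩ := by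
  apply Complex.ext <;> simp [circ, Complex.exp_ofReal_mul_I_re, Complex.exp_ofReal_mul_I_im]

lemma ex_eq_circ (n : ℕ) (m : ℤ) (k : Fin n) : ex n m k = circ (2 * Real.pi * m * k / n) := by
  rw [circ_eq]; rfl

lemma norm_ex (n : ℕ) (m : ℤ) (k : Fin n) : ‖ex n m k‖ = 1 := by rw [ex_eq_circ, norm_circ]

lemma ex_mul_ex (n : ℕ) (a b : ℤ) (k : Fin n) : ex n a k * ex n b k = ex n (a + b) k := by
  rw [ex_eq_circ, ex_eq_circ, ex_eq_circ, ← circ_add]; congr 1; push_cast; ring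

lemma ex_zero (n : ℕ) (k : Fin n) : ex n 0 k = 1 := by simp [ex_eq_circ, circ_zero]
lemma ex_self (n : ℕ) (k : Fin n) : ex n n k = 1 := by
  have hn : (n : ℝ) ≠ 0 := by exact_mod_cast (Fin.pos k).ne'
  have : 2 * Real.pi * ((n : ℤ) : ℝ) * k / n = (k : ℕ) * (2 * Real.pi) := by push_cast; field_simp
  rw [ex_eq_circ, circ_eq, this, Real.cos_nat_mul_two_pi]
  have := Real.sin_nat_mul_pi (2 * k)
  rw [show (k : ℕ) * (2 * Real.pi) = ((2 * k : ℕ) : ℝ) * Real.pi by push_cast; ring, this]; rfl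

lemma ex_succ (n : ℕ) [NeZero n] (m : ℤ) (k : Fin n) : ex n m (k + 1) = ex n m k * circ (2 * Real.pi * m / n) := by
  rw [circ_eq]
  apply Complex.ext
  · simp only [ex, Complex.mul_re]; rw [cs_succ]
  · simp only [ex, Complex.mul_im]; rw [sn_succ]; ring

lemma sum_ex (n : ℕ) (hn : n ≠ 0) {m : ℤ} (hm : ¬ (n : ℤ) ∣ m) : ∑ k, ex n m k = 0 := by
  apply Complex.ext
  · rw [Complex.re_sum]; exact cs_sum_zero hn hm
  · rw [Complex.im_sum]; exact sn_sum_zero hn hm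

/-- The action of a Fourier mode on midpoints. -/
lemma mode_mid (θ φ : ℝ) : (1 + circ (2 * θ) * circ (2 * φ)) * circ (-φ) * Real.sin (2 * θ) =
    2 * Real.cos θ * circ θ * (Real.sin (φ + 2 * θ) - Real.sin φ) := by
  have a := circ_ne_zero θ
  have b := circ_ne_zero φ
  rw [two_mul, two_mul, circ_add, circ_add, circ_neg]
  push_cast
  simp only [Complex.sin, Complex.cos]
  have e : ∀ x : ℝ, Complex.exp (x * Complex.I) = circ x := fun _ => rfl
  have e' : ∀ x : ℝ, Complex.exp (-x * Complex.I) = (circ x)⁻¹ := fun x => by rw [← circ_neg, circ]; push_cast; rfl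
  rw [show ((φ : ℂ) + (θ + θ)) * Complex.I = ((φ + (θ + θ) : ℝ) : ℂ) * Complex.I by push_cast; ring,
    show (-((φ : ℂ) + (θ + θ))) * Complex.I = -((φ + (θ + θ) : ℝ) : ℂ) * Complex.I by push_cast; ring,
    show ((θ : ℂ) + θ) * Complex.I = ((θ + θ : ℝ) : ℂ) * Complex.I by push_cast; ring,
    show (-((θ : ℂ) + θ)) * Complex.I = -((θ + θ : ℝ) : ℂ) * Complex.I by push_cast; ring]
  simp only [e, e', circ_add]
  field_simp
  ring

/-- The action of a Fourier mode on edge vectors. -/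
lemma mode_half (θ φ : ℝ) : (circ (2 * θ) * circ (2 * φ) - 1) * circ (-φ) * Real.sin (2 * θ) =
    2 * Real.sin θ * Complex.I * circ θ * (Real.sin (φ + 2 * θ) + Real.sin φ) := by
  have a := circ_ne_zero θ
  have b := circ_ne_zero φ
  rw [two_mul, two_mul, circ_add, circ_add, circ_neg]
  push_cast
  simp only [Complex.sin]
  have e : ∀ x : ℝ, Complex.exp (x * Complex.I) = circ x := fun _ => rfl
  have e' : ∀ x : ℝ, Complex.exp (-x * Complex.I) = (circ x)⁻¹ := fun x => by rw [← circ_neg, circ]; push_cast; rfl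
  rw [show ((φ : ℂ) + (θ + θ)) * Complex.I = ((φ + (θ + θ) : ℝ) : ℂ) * Complex.I by push_cast; ring,
    show (-((φ : ℂ) + (θ + θ))) * Complex.I = -((φ + (θ + θ) : ℝ) : ℂ) * Complex.I by push_cast; ring,
    show ((θ : ℂ) + θ) * Complex.I = ((θ + θ : ℝ) : ℂ) * Complex.I by push_cast; ring,
    show (-((θ : ℂ) + θ)) * Complex.I = -((θ + θ : ℝ) : ℂ) * Complex.I by push_cast; ring]
  simp only [e, e', circ_add]
  field_simp
  ring_nf
  rw [Complex.I_sq]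
  ring

section
variable {n : ℕ} [NeZero n]

/-- The discrete Fourier coefficients of a closed chain. -/
noncomputable def dft (n : ℕ) (j : ℤ) (y : Fin n → ℝ × ℝ) : ℂ := (n : ℂ)⁻¹ * ∑ l, toC (y l) * ex n (-j) l

lemma continuous_toC : Continuous toC := by
  have : toC = Complex.equivRealProdCLM.symm := rfl
  rw [this]; exact ContinuousLinearEquiv.continuous _

lemma toC_add (p q : ℝ × ℝ) : toC (p + q) = toC p + toC q := rfl
omit [NeZero n] in
lemma toC_sum (y : Fin n → ℝ × ℝ) : ∑ k, toC (y k) = toC (∑ k, y k) := by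
  have : toC = Complex.equivRealProdCLM.symm := rfl
  rw [this, map_sum]

omit [NeZero n] in
lemma continuous_dft (j : ℤ) : Continuous (dft n j) := by
  have := continuous_toC
  unfold dft; fun_prop

lemma dft_inversion (y : Fin n → ℝ × ℝ) (k : Fin n) : toC (y k) = ∑ j : Fin n, dft n j y * ex n j k := by
  have hn : n ≠ 0 := NeZero.ne n
  have hn' : (n : ℂ) ≠ 0 := by exact_mod_cast hn
  have key : ∀ l : Fin n, ∑ j : Fin n, ex n (-(j : ℤ)) l * ex n j k = if l = k then (n : ℂ) else 0 := by
    intro l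
    have : ∀ j : Fin n, ex n (-(j : ℤ)) l * ex n j k = ex n ((k : ℤ) - l) j := fun j => by
      rw [ex_eq_circ, ex_eq_circ, ex_eq_circ, ← circ_add]; congr 1; push_cast; ring
    simp_rw [this]
    split_ifs with h
    · subst h; simp [ex_zero]
    · refine sum_ex n hn fun hd => h ?_
      have h1 := Int.eq_zero_of_abs_lt_dvd hd (by rw [abs_lt]; have := k.2; have := l.2; omega)
      exact Fin.ext (by omega)
  simp only [dft, Finset.mul_sum, Finset.sum_mul]
  rw [Finset.sum_comm]
  have : ∀ l : Fin n, ∑ j : Fin n, (n : ℂ)⁻¹ * (toC (y l) * ex n (-(j : ℤ)) l) * ex n j k =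
      if l = k then toC (y k) else 0 := fun l => by
    have := key l
    calc _ = (n : ℂ)⁻¹ * toC (y l) * ∑ j : Fin n, ex n (-(j : ℤ)) l * ex n j k := by
          rw [Finset.mul_sum]; exact Finset.sum_congr rfl fun _ _ => by ring
      _ = _ := by
          rw [this]; split_ifs with h
          · subst h; field_simp
          · simp
  simp_rw [this]; simp

lemma dft_regY (j : ℤ) (hj : ¬ (n : ℤ) ∣ 1 - j) : dft n j (regY n) = 0 := by
  have : ∀ l, toC (regY n l) * ex n (-j) l = ex n (1 - j) l := fun l => ex_mul_ex n 1 (-j) l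
  simp_rw [dft, this, sum_ex n (NeZero.ne n) hj, mul_zero]

lemma dft_one_regY : dft n 1 (regY n) = 1 := by
  have : ∀ l, toC (regY n l) * ex n (-1) l = 1 := fun l => (ex_mul_ex n 1 (-1) l).trans (ex_zero n l)
  have hn' : (n : ℂ) ≠ 0 := by exact_mod_cast NeZero.ne n
  simp_rw [dft, this]; simp [hn']

omit [NeZero n] in
lemma dft_zero {y : Fin n → ℝ × ℝ} (hy : ∑ k, y k = 0) : dft n 0 y = 0 := by
  simp only [dft, neg_zero, ex_zero, mul_one, toC_sum, hy]
  simp [toC]; exact Or.inr rfl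

omit [NeZero n] in
lemma dft_periodic (j : ℤ) (y : Fin n → ℝ × ℝ) : dft n (j - n) y = dft n j y := by
  have : ∀ l, ex n (-(j - n)) l = ex n (-j) l := fun l => by
    rw [show -(j - n) = -j + n by ring, ← ex_mul_ex, ex_self, mul_one]
  simp_rw [dft, this]

/-- Expansion of a centred pentagon or hexagon around its dominating Fourier mode. -/
lemma chain_expansion (hn : n = 5 ∨ n = 6) {y : Fin n → ℝ × ℝ} (hy : ∑ k, y k = 0) (k : Fin n) :
    toC (y k) = ex n 1 k * (dft n 1 y + dft n 2 y * ex n 1 k + dft n 3 y * ex n 2 k + dft n (-1) y * ex n (-2) k +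
      dft n 4 y * en n k) := by
  have e1 : ex n 1 k * ex n 1 k = ex n 2 k := ex_mul_ex n 1 1 k
  have e2 : ex n 1 k * ex n 2 k = ex n 3 k := ex_mul_ex n 1 2 k
  have e3 : ex n 1 k * ex n (-2) k = ex n (-1) k := ex_mul_ex n 1 (-2) k
  have hex : ∀ j : ℤ, ex n (j - n) k = ex n j k := fun j => by
    have := ex_mul_ex n (j - n) n k
    rw [ex_self, mul_one, sub_add_cancel] at this; exact this
  rw [dft_inversion]
  rcases hn with rfl | rfl
  · rw [Fin.sum_univ_five]
    have h4 := hex 4; have h4' := dft_periodic 4 y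
    norm_num at h4 h4'
    have hen : en 5 k = 0 := by simp [en]
    simp [dft_zero hy, hen]
    rw [← h4, ← h4']
    linear_combination -dft 5 2 y * e1 - dft 5 3 y * e2 - dft 5 (-1) y * e3
  · rw [Fin.sum_univ_six]
    have h5 := hex 5; have h5' := dft_periodic 5 y
    norm_num at h5 h5'
    have hen : (en 6 k : ℂ) = ex 6 3 k := by
      have : sn 6 3 k = 0 := by
        have := Real.sin_nat_mul_pi k
        unfold sn; rw [← this]; congr 1; push_cast; ring
      apply Complex.ext <;> simp [en, ex, this]
    have e4 : ex 6 1 k * ex 6 3 k = ex 6 4 k := ex_mul_ex 6 1 3 k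
    simp [dft_zero hy, hen]
    rw [← h5, ← h5']
    linear_combination -dft 6 2 y * e1 - dft 6 3 y * e2 - dft 6 (-1) y * e3 - dft 6 4 y * e4
end

lemma cot_pos {n : ℕ} (hn : 3 ≤ n) : 0 < Real.cos (Real.pi / n) / Real.sin (Real.pi / n) :=
  div_pos (trig_pos hn).2 (trig_pos hn).1

lemma three_le {n : ℕ} (hn : n = 5 ∨ n = 6) : 3 ≤ n := by omega

namespace Cert
set_option maxRecDepth 10000 in
lemma polygon_sines {n : ℕ} (hn : n = 5 ∨ n = 6) :
    (polygon n).s1.val * Real.sin (Real.pi / n) = Real.sin (3 * (Real.pi / n)) ∧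
    (polygon n).s2.val * Real.sin (2 * (Real.pi / n)) = Real.sin (4 * (Real.pi / n)) ∧
    0 < (polygon n).ra2.val ∧ ((polygon n).ec : ℝ) = 9 / 10 := by
  have h5 : (√5 : ℝ) ^ 2 = 5 := Real.sq_sqrt (by norm_num)
  have hp : 1 < √(5:ℝ) := by nlinarith [Real.sqrt_nonneg 5]
  rw [show 4 * (Real.pi / n) = 2 * (2 * (Real.pi / n)) by ring, Real.sin_two_mul (2 * (Real.pi / n)),
    Real.cos_two_mul, Real.sin_three_mul, show Real.sin (Real.pi / n) ^ 3 =
    Real.sin (Real.pi / n) * Real.sin (Real.pi / n) ^ 2 by ring, Real.sin_sq]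
  rcases hn with rfl | rfl
  · push_cast
    rw [Real.cos_pi_div_five]
    simp only [polygon, pentagon, Q5.val, if_true]
    refine ⟨?_, ?_, by push_cast; linarith, by norm_num⟩
    · push_cast; linear_combination (-1 / 4 * Real.sin (Real.pi / 5)) * h5
    · push_cast; linear_combination (-1 / 4 * Real.sin (2 * (Real.pi / 5))) * h5
  · push_cast
    have h3 : (√3 : ℝ) ^ 2 = 3 := Real.sq_sqrt (by norm_num)
    rw [Real.cos_pi_div_six]
    simp only [polygon, hexagon, Q5.val, show (6 = 5) = False by norm_num, if_false]
    refine ⟨?_, ?_, by push_cast; norm_num, by norm_num⟩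
    · push_cast; linear_combination (- Real.sin (Real.pi / 6)) * h3
    · push_cast; linear_combination (- Real.sin (2 * (Real.pi / 6))) * h3

section
variable {n : ℕ}

lemma polygon_tn (hn : n = 5 ∨ n = 6) : tn n 1 * (Real.cos (Real.pi / n) / Real.sin (Real.pi / n)) = 1 ∧
    tn n 2 * (polygon n).ra2.val = Real.cos (Real.pi / n) / Real.sin (Real.pi / n) := by
  have hr := cot_pos (three_le hn)
  have hm := polygon_modes hn
  have ht : ∀ m : ℕ, m = 1 ∨ m = 2 → 0 < tn n m := fun m h => by
    have hpi := Real.pi_pos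
    refine Real.tan_pos_of_pos_of_lt_pi_div_two ?_ ?_ <;> rcases hn with rfl | rfl <;> rcases h with rfl | rfl <;>
      push_cast <;> linarith
  set r := Real.cos (Real.pi / n) / Real.sin (Real.pi / n) with hrd
  have hk : kapN n = r ^ 2 := rfl
  have h1 := hm.t1; have h2 := hm.t2
  rw [hk] at h1 h2
  have p1 := mul_pos (ht 1 (Or.inl rfl)) hr
  have p2 := mul_pos (ht 2 (Or.inr rfl)) (polygon_sines hn).2.2.1
  refine ⟨?_, ?_⟩
  · exact (pow_left_inj₀ p1.le zero_le_one two_ne_zero).1 (by linear_combination h1)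
  · exact (pow_left_inj₀ p2.le hr.le two_ne_zero).1 (by linear_combination h2)
end
end Cert

/-- The tangential part of a deformation with mode amplitudes `d`. -/
noncomputable def tang (n : ℕ) (d : Fin 4 → ℂ) (k : Fin n) : ℂ :=
  d 0 * ex n 1 k + d 1 * ex n 2 k + d 2 * ex n (-2) k + d 3 * en n k

/-- The normal part of a deformation with mode amplitudes `d`. -/
noncomputable def nrml (n : ℕ) (s1 s2 : ℝ) (d : Fin 4 → ℂ) (k : Fin n) : ℂ :=
  -(s1 * (d 0 * ex n 1 k) + s2 * (d 1 * ex n 2 k) + 1 / 2 * (d 3 * en n k))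

/-- The real coordinates of mode amplitudes. -/
noncomputable def coordV (r : ℝ) (d : Fin 4 → ℂ) : Fin 8 → ℝ :=
  ![(d 0).re, (d 0).im, (d 1).re + (d 2).re, (d 1).im - (d 2).im, (d 1).re - (d 2).re, (d 1).im + (d 2).im,
    (d 3).re, r * (d 3).im]

section
variable {n : ℕ}

lemma cs_neg (m : ℤ) (k : Fin n) : cs n (-m) k = cs n m k := by
  unfold cs; rw [← Real.cos_neg]; congr 1; push_cast; ring
lemma sn_neg (m : ℤ) (k : Fin n) : sn n (-m) k = -sn n m k := by
  unfold sn; rw [← Real.sin_neg]; congr 1; push_cast; ring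

lemma tang_re (d : Fin 4 → ℂ) (k : Fin n) : (tang n d k).re = cs n 1 k * (d 0).re + sn n 1 k * (-(d 0).im) +
    cs n 2 k * ((d 1).re + (d 2).re) + sn n 2 k * (-((d 1).im - (d 2).im)) + en n k * (d 3).re := by
  simp [tang, ex, cs_neg, sn_neg]; ring

lemma tang_im (d : Fin 4 → ℂ) (k : Fin n) : (tang n d k).im = cs n 1 k * (d 0).im + sn n 1 k * (d 0).re +
    cs n 2 k * ((d 1).im + (d 2).im) + sn n 2 k * ((d 1).re - (d 2).re) + en n k * (d 3).im := by
  simp [tang, ex, cs_neg, sn_neg]; ring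

lemma nrml_re (s1 s2 : ℝ) (d : Fin 4 → ℂ) (k : Fin n) : (nrml n s1 s2 d k).re = cs n 1 k * (-s1 * (d 0).re) +
    sn n 1 k * (s1 * (d 0).im) + cs n 2 k * (-s2 * (d 1).re) + sn n 2 k * (s2 * (d 1).im) +
    en n k * (-(d 3).re / 2) := by
  simp [nrml, ex]; ring

lemma nrml_im (s1 s2 : ℝ) (d : Fin 4 → ℂ) (k : Fin n) : (nrml n s1 s2 d k).im = cs n 1 k * (-s1 * (d 0).im) +
    sn n 1 k * (-s1 * (d 0).re) + cs n 2 k * (-s2 * (d 1).im) + sn n 2 k * (-s2 * (d 1).re) +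
    en n k * (-(d 3).im / 2) := by
  simp [nrml, ex]; ring

namespace Cert
variable {C : Cert} {κ r : ℝ}

lemma tang_re_eq (r : ℝ) (d : Fin 4 → ℂ) (k : Fin n) : (tang n d k).re = bK n (coordV r d) k := by
  rw [tang_re, bK, fldN_eq]
  simp only [coordV, Matrix.cons_val]
  ring

lemma tang_im_eq (h1 : tn n 1 * r = 1) (h2 : tn n 2 * C.ra2.val = r) (d : Fin 4 → ℂ) (k : Fin n) :
    -2 * r * (tang n d k).im = gK C n (r ^ 2) (coordV r d) k := by
  rw [tang_im, gK, fldN_eq]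
  simp only [coordV, Matrix.cons_val]
  linear_combination (2 * r * (cs n 1 k * (d 0).im + sn n 1 k * (d 0).re)) * h1 +
    2 * (cs n 2 k * ((d 1).im + (d 2).im) + sn n 2 k * ((d 1).re - (d 2).re)) * h2

lemma nrml_re_eq (r : ℝ) (d : Fin 4 → ℂ) (k : Fin n) :
    (nrml n C.s1.val C.s2.val d k).re = -aK C n (coordV r d) k := by
  rw [nrml_re, aK, fldN_eq]
  simp only [coordV, Matrix.cons_val]
  ring

lemma Modes.sum_tang_sq (h : C.Modes n (r ^ 2)) (hr : 0 < r) (h1 : tn n 1 * r = 1) (h2 : tn n 2 * C.ra2.val = r)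
    (d : Fin 4 → ℂ) : ∑ k, ‖tang n d k‖ ^ 2 = sizeV n (coordV r d) := by
  rw [← h.sum_sq]
  refine Finset.sum_congr rfl fun k _ => ?_
  rw [← tang_re_eq, ← tang_im_eq h1 h2, Complex.sq_norm, Complex.normSq_apply]
  field_simp
  ring

lemma Modes.sum_nrml_sq (h : C.Modes n (r ^ 2)) (hr : 0 < r) (d : Fin 4 → ℂ) :
    ∑ k, ‖nrml n C.s1.val C.s2.val d k‖ ^ 2 ≤ 4 * sizeV n (coordV r d) := by
  simp only [Complex.sq_norm, Complex.normSq_apply]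
  rw [Finset.sum_add_distrib]
  simp_rw [nrml_re, nrml_im]
  rw [five_modes_sum h.hn, five_modes_sum h.hn]
  have h3 := h.three
  have e7 : n3 n * (r * (d 3).im) ^ 2 / 3 = n3 n * (d 3).im ^ 2 := by
    field_simp at h3
    linear_combination -(d 3).im ^ 2 / 3 * h3
  have p3 := n3_nonneg n
  have a1 : C.s1.val * C.s1.val ≤ 4 := by nlinarith [h.s1]
  have a2 : C.s2.val * C.s2.val ≤ 1 := by nlinarith [h.s2]
  have b1 := mul_le_mul_of_nonneg_left a1 (add_nonneg (sq_nonneg (d 0).re) (sq_nonneg (d 0).im))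
  have b2 := mul_le_mul_of_nonneg_left a2 (add_nonneg (sq_nonneg (d 1).re) (sq_nonneg (d 1).im))
  have c6 := mul_nonneg p3 (sq_nonneg (d 3).re)
  have c7 := mul_nonneg p3 (sq_nonneg (d 3).im)
  have hn : (0 : ℝ) ≤ n := by positivity
  have key : sizeV n (coordV r d) = n * ((d 0).re ^ 2 + (d 0).im ^ 2 + (d 1).re ^ 2 + (d 1).im ^ 2 +
      (d 2).re ^ 2 + (d 2).im ^ 2) + n3 n * (d 3).re ^ 2 + n3 n * (d 3).im ^ 2 := by
    simp only [sizeV, coordV, Matrix.cons_val]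
    linear_combination e7
  rw [key]
  have m1 := mul_le_mul_of_nonneg_left b1 hn
  have m2 := mul_le_mul_of_nonneg_left b2 hn
  have m3 := mul_nonneg hn (add_nonneg (sq_nonneg (d 1).re) (sq_nonneg (d 1).im))
  have m4 := mul_nonneg hn (add_nonneg (sq_nonneg (d 2).re) (sq_nonneg (d 2).im))
  linarith

lemma Modes.sum_nrml_tang (h : C.Modes n (r ^ 2)) (hr : 0 < r) (d : Fin 4 → ℂ) :
    2 * ∑ k, (nrml n C.s1.val C.s2.val d k * tang n d k).re = -areaV C n (coordV r d) := by
  simp only [Complex.mul_re]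
  rw [Finset.sum_sub_distrib]
  simp_rw [nrml_re, nrml_im, tang_re, tang_im]
  rw [five_modes_sum h.hn, five_modes_sum h.hn]
  have h3 := h.three
  simp only [areaV, coordV, Matrix.cons_val]
  field_simp at h3
  linear_combination (d 3).im ^ 2 / 3 * h3

lemma sum_tang_re (hn : n = 5 ∨ n = 6) (d : Fin 4 → ℂ) : ∑ k, (tang n d k).re = 0 := by
  simp_rw [tang_re_eq 1]; exact fldN_sum_zero hn _ _

lemma sum_nrml_re (hn : n = 5 ∨ n = 6) (d : Fin 4 → ℂ) : ∑ k, (nrml n C.s1.val C.s2.val d k).re = 0 := by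
  simp_rw [nrml_re_eq 1]; rw [Finset.sum_neg_distrib, neg_eq_zero]; exact fldN_sum_zero hn _ _
end Cert

/-- The effect of a single mode on midpoints and half edges. -/
lemma single_mode {θ φ s : ℝ} {b g x z : ℂ} (hφ : Real.sin φ ≠ 0) (hs : s * Real.sin φ = Real.sin (φ + 2 * θ))
    (hg : g * Real.sin φ = -b * circ (-φ) * Real.sin (2 * θ)) :
    (1 / 2 : ℂ) * (z * (g * x) + z * circ (2 * θ) * (g * (x * circ (2 * φ)))) =
      Real.cos θ * (z * circ θ) * (b * x - s * (b * x)) ∧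
    (1 / 2 : ℂ) * (z * circ (2 * θ) * (g * (x * circ (2 * φ))) - z * (g * x)) =
      Complex.I * Real.sin θ * (z * circ θ) * (-(s * (b * x)) - b * x) := by
  have hφ' : (Real.sin φ : ℂ) ≠ 0 := by exact_mod_cast hφ
  have hs' : (s : ℂ) * Real.sin φ = Real.sin (φ + 2 * θ) := by exact_mod_cast hs
  have m1 := mode_mid θ φ
  have m2 := mode_half θ φ
  rw [← hs'] at m1 m2
  constructor <;> refine mul_right_cancel₀ hφ' ?_
  · linear_combination (1 / 2 * z * x * (1 + circ (2 * θ) * circ (2 * φ))) * hg - 1 / 2 * z * x * b * m1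
  · linear_combination (1 / 2 * z * x * (circ (2 * θ) * circ (2 * φ) - 1)) * hg - 1 / 2 * z * x * b * m2

lemma base_mode (θ : ℝ) (z : ℂ) : (1 / 2 : ℂ) * (z + z * circ (2 * θ)) = Real.cos θ * (z * circ θ) ∧
    (1 / 2 : ℂ) * (z * circ (2 * θ) - z) = Complex.I * Real.sin θ * (z * circ θ) := by
  have e : (Real.cos θ : ℂ) ^ 2 + (Real.sin θ : ℂ) ^ 2 = 1 := by exact_mod_cast Real.cos_sq_add_sin_sq θ
  have h : circ θ = Real.cos θ + Real.sin θ * Complex.I := by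
    rw [circ, Complex.exp_mul_I, Complex.ofReal_cos, Complex.ofReal_sin]
  have hI := Complex.I_sq
  rw [two_mul, circ_add, h]
  constructor
  · linear_combination z / 2 * (Real.sin θ : ℂ) ^ 2 * hI - z / 2 * e
  · linear_combination -z / 2 * (Real.sin θ : ℂ) ^ 2 * hI + z / 2 * e
end

section
variable {n : ℕ} [NeZero n]

/-- The normalized amplitude of the `j`-th Fourier mode, of half angle `φ`. -/
noncomputable def modeAmp (n : ℕ) (y : Fin n → ℝ × ℝ) (j : ℤ) (φ : ℝ) : ℂ :=
  -(dft n j y / dft n 1 y * Real.sin φ / Real.sin (2 * (Real.pi / n)) * circ φ)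

/-- The amplitudes of the tangential part of a chain. -/
noncomputable def chainAmp (n : ℕ) (y : Fin n → ℝ × ℝ) : Fin 4 → ℂ :=
  ![modeAmp n y 2 (Real.pi / n), modeAmp n y 3 (2 * (Real.pi / n)), modeAmp n y (-1) (-(2 * (Real.pi / n))),
    modeAmp n y 4 (3 * (Real.pi / n))]

lemma sin_two_pos {n : ℕ} (hn : 3 ≤ n) : 0 < Real.sin (2 * (Real.pi / n)) := by
  rw [Real.sin_two_mul]; have := trig_pos hn; exact mul_pos (mul_pos two_pos this.1) this.2

omit [NeZero n] in
lemma modeAmp_spec (hn : 3 ≤ n) (y : Fin n → ℝ × ℝ) (j : ℤ) (φ : ℝ) :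
    dft n j y / dft n 1 y * Real.sin φ = -modeAmp n y j φ * circ (-φ) * Real.sin (2 * (Real.pi / n)) := by
  have h : (Real.sin (2 * (Real.pi / n)) : ℂ) ≠ 0 := by exact_mod_cast (sin_two_pos hn).ne'
  have h' := circ_ne_zero φ
  rw [modeAmp, circ_neg]
  generalize Real.sin (2 * (Real.pi / n)) = t at *
  generalize dft n j y / dft n 1 y = g
  field_simp

lemma en_circ (hn : n = 5 ∨ n = 6) (k : Fin n) : (en n (k + 1) : ℂ) = en n k * circ (2 * (3 * (Real.pi / n))) := by
  rcases hn with rfl | rfl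
  · simp [en]
  · rw [en_succ, circ_eq, show 2 * (3 * (Real.pi / (6 : ℕ))) = Real.pi by push_cast; ring, Real.cos_pi, Real.sin_pi,
      show (⟨-1, 0⟩ : ℂ) = -1 by apply Complex.ext <;> simp]
    push_cast; ring

lemma ex_circ (m : ℤ) (k : Fin n) : ex n m (k + 1) = ex n m k * circ (2 * (m * (Real.pi / n))) := by
  rw [ex_succ]; congr 2; ring

lemma toC_smul (a : ℝ) (p : ℝ × ℝ) : toC (a • p) = a * toC p := by
  apply Complex.ext <;> simp [toC]

lemma toC_sub (p q : ℝ × ℝ) : toC (p - q) = toC p - toC q := rfl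

/-- Midpoints and half edges of a centred pentagon or hexagon in the frame of its dominating Fourier mode. -/
lemma chain_frame (hn : n = 5 ∨ n = 6) {y : Fin n → ℝ × ℝ} (hy : ∑ k, y k = 0) (hc : dft n 1 y ≠ 0) (k : Fin n) :
    toC (Fan.mid y k) = dft n 1 y * Real.cos (Real.pi / n) * (ex n 1 k * circ (Real.pi / n)) *
      (1 + nrml n (Cert.polygon n).s1.val (Cert.polygon n).s2.val (chainAmp n y) k + tang n (chainAmp n y) k) ∧
    toC (Fan.half y k) = dft n 1 y * (Complex.I * Real.sin (Real.pi / n) * (ex n 1 k * circ (Real.pi / n))) *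
      (1 + nrml n (Cert.polygon n).s1.val (Cert.polygon n).s2.val (chainAmp n y) k - tang n (chainAmp n y) k) := by
  have h3 := three_le hn
  have hs := trig_pos h3
  have hs2 := sin_two_pos h3
  have S := Cert.polygon_sines hn
  set θ := Real.pi / n with hθ
  have E : ∀ k, toC (y k) = dft n 1 y * (ex n 1 k + ex n 1 k * (dft n 2 y / dft n 1 y * ex n 1 k) +
      ex n 1 k * (dft n 3 y / dft n 1 y * ex n 2 k) + ex n 1 k * (dft n (-1) y / dft n 1 y * ex n (-2) k) +
      ex n 1 k * (dft n 4 y / dft n 1 y * en n k)) := fun k => by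
    rw [chain_expansion hn hy]; field_simp
  have x1 : ex n 1 (k + 1) = ex n 1 k * circ (2 * θ) := by rw [ex_circ]; simp [hθ]
  have x2 : ex n 2 (k + 1) = ex n 2 k * circ (2 * (2 * θ)) := by rw [ex_circ]; simp [hθ]
  have x3 : ex n (-2) (k + 1) = ex n (-2) k * circ (2 * -(2 * θ)) := by rw [ex_circ]; simp [hθ]
  have x4 := en_circ hn k
  rw [← hθ] at x4
  obtain ⟨b1, b2⟩ := base_mode θ (ex n 1 k)
  obtain ⟨p1, p2⟩ := single_mode (θ := θ) (φ := θ) (s := (Cert.polygon n).s1.val) (x := ex n 1 k) (z := ex n 1 k) hs.1.ne'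
    (by rw [S.1]; congr 1; ring) (modeAmp_spec h3 y 2 θ)
  obtain ⟨q1, q2⟩ := single_mode (θ := θ) (φ := 2 * θ) (s := (Cert.polygon n).s2.val) (x := ex n 2 k) (z := ex n 1 k) hs2.ne'
    (by rw [S.2.1]; congr 1; ring) (modeAmp_spec h3 y 3 (2 * θ))
  obtain ⟨r1, r2⟩ := single_mode (θ := θ) (φ := -(2 * θ)) (s := 0) (x := ex n (-2) k) (z := ex n 1 k)
    (by rw [Real.sin_neg]; exact neg_ne_zero.2 hs2.ne') (by simp) (modeAmp_spec h3 y (-1) (-(2 * θ)))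
  obtain ⟨t1, t2⟩ : (1 / 2 : ℂ) * (ex n 1 k * (dft n 4 y / dft n 1 y * en n k) +
        ex n 1 k * circ (2 * θ) * (dft n 4 y / dft n 1 y * (en n k * circ (2 * (3 * θ))))) =
      Real.cos θ * (ex n 1 k * circ θ) * (modeAmp n y 4 (3 * θ) * en n k - (1 / 2 : ℝ) * (modeAmp n y 4 (3 * θ) * en n k)) ∧
    (1 / 2 : ℂ) * (ex n 1 k * circ (2 * θ) * (dft n 4 y / dft n 1 y * (en n k * circ (2 * (3 * θ)))) -
        ex n 1 k * (dft n 4 y / dft n 1 y * en n k)) =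
      Complex.I * Real.sin θ * (ex n 1 k * circ θ) *
        (-((1 / 2 : ℝ) * (modeAmp n y 4 (3 * θ) * en n k)) - modeAmp n y 4 (3 * θ) * en n k) := by
    rcases hn with rfl | rfl
    · simp [en]
    · have e : 3 * θ = Real.pi / 2 := by rw [hθ]; push_cast; ring
      have e' : 3 * θ + 2 * θ = Real.pi - Real.pi / 6 := by rw [hθ]; push_cast; ring
      refine single_mode ?_ ?_ (modeAmp_spec h3 y 4 (3 * θ))
      · rw [e, Real.sin_pi_div_two]; exact one_ne_zero
      · rw [e', e, Real.sin_pi_div_two, Real.sin_pi_sub, Real.sin_pi_div_six]; norm_num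
  have n' : nrml n (Cert.polygon n).s1.val (Cert.polygon n).s2.val (chainAmp n y) k =
      -((Cert.polygon n).s1.val * (modeAmp n y 2 θ * ex n 1 k) + (Cert.polygon n).s2.val * (modeAmp n y 3 (2 * θ) * ex n 2 k) +
        1 / 2 * (modeAmp n y 4 (3 * θ) * en n k)) := rfl
  have t' : tang n (chainAmp n y) k = modeAmp n y 2 θ * ex n 1 k + modeAmp n y 3 (2 * θ) * ex n 2 k +
      modeAmp n y (-1) (-(2 * θ)) * ex n (-2) k + modeAmp n y 4 (3 * θ) * en n k := rfl
  rw [n', t', Fan.mid, Fan.half, toC_smul, toC_smul, toC_add, toC_sub, E, E, x1, x2, x3, x4]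
  push_cast at b1 b2 p1 p2 q1 q2 r1 r2 t1 t2 ⊢
  constructor
  · linear_combination dft n 1 y * (b1 + p1 + q1 + r1 + t1)
  · linear_combination dft n 1 y * (b2 + p2 + q2 + r2 + t2)

lemma not_dvd_of_mode (hn : n = 5 ∨ n = 6) {j : ℤ} (hj : j = 2 ∨ j = 3 ∨ j = -1 ∨ j = 4) : ¬ (n : ℤ) ∣ 1 - j := by
  rcases hn with rfl | rfl <;> rcases hj with rfl | rfl | rfl | rfl <;> decide

/-- The size of the tangential part tends to zero at the regular polygon. -/
lemma tendsto_size (hn : n = 5 ∨ n = 6) (r : ℝ) :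
    Filter.Tendsto (fun y => sizeV n (coordV r (chainAmp n y))) (nhds (regY n)) (nhds 0) := by
  have hm : ∀ j φ, (j = 2 ∨ j = 3 ∨ j = -1 ∨ j = 4) →
      Filter.Tendsto (fun y => modeAmp n y j φ) (nhds (regY n)) (nhds 0) := fun j φ hj => by
    have h1 := (continuous_dft (n := n) j).tendsto (regY n)
    have h2 := (continuous_dft (n := n) 1).tendsto (regY n)
    rw [dft_regY j (not_dvd_of_mode hn hj)] at h1
    rw [dft_one_regY] at h2
    have := ((((h1.div h2 one_ne_zero).mul_const (Real.sin φ : ℂ)).div_const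
      (Real.sin (2 * (Real.pi / n)) : ℂ)).mul_const (circ φ)).neg
    simpa [modeAmp] using this
  have h0 : Filter.Tendsto (chainAmp n) (nhds (regY n)) (nhds 0) := by
    rw [tendsto_pi_nhds]
    intro i
    fin_cases i
    · exact hm _ _ (by simp)
    · exact hm _ _ (by simp)
    · exact hm _ _ (by simp)
    · exact hm _ _ (by simp)
  have hc : Continuous fun d => sizeV n (coordV r d) := by
    unfold sizeV coordV; simp only [Matrix.cons_val]; fun_prop
  have := (hc.tendsto 0).comp h0
  simpa [sizeV, coordV, Function.comp_def] using this
end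

/-- Metric quantities of a midpoint and a half edge written in a common complex frame. -/
lemma frame_metric {m h : ℝ × ℝ} {q w : ℂ} {ρ σ : ℝ} (hm : toC m = ρ * (q * (1 + w)))
    (hh : toC h = σ * (Complex.I * (q * (1 - w)))) :
    cross m h = ρ * σ * ‖q‖ ^ 2 * (1 - ‖w‖ ^ 2) ∧
    h.1 ^ 2 + h.2 ^ 2 = σ ^ 2 * ‖q‖ ^ 2 * (1 + ‖w‖ ^ 2 - 2 * w.re) ∧
    m.1 ^ 2 + m.2 ^ 2 = ρ ^ 2 * ‖q‖ ^ 2 * (1 + ‖w‖ ^ 2 + 2 * w.re) ∧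
    h.1 * m.1 + h.2 * m.2 = 2 * (ρ * σ * ‖q‖ ^ 2 * w.im) := by
  have m1 := congrArg Complex.re hm
  have m2 := congrArg Complex.im hm
  have h1 := congrArg Complex.re hh
  have h2 := congrArg Complex.im hh
  simp [toC] at m1 m2 h1 h2
  simp only [cross, m1, m2, h1, h2, Complex.sq_norm, Complex.normSq_apply]
  refine ⟨?_, ?_, ?_, ?_⟩ <;> ring

section
variable {n : ℕ} [NeZero n]

lemma frm_combination (y : Fin n → ℝ × ℝ) (r s : ℝ) (W : Tup n) :
    frm (r • Fan.dirK y + s • Fan.masK y) W W = r * frm (Fan.dirK y) W W + s * frm (Fan.masK y) W W := by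
  rw [frm_add, frm_smul, frm_smul]; simp

/-- Nonnegativity of the rescaled difference of the energy and mass forms bounds the eigenvalue from below. -/
lemma Fan.eig_of_form_nonneg {y : Fin n → ℝ × ℝ} (F : Fan n y) {r l : ℝ} (hr : 0 < r)
    (H : ∀ W : Tup n, 0 ≤ frm (r • dirK y + (-(l * n / ∑ k, jac y k)) • masK y) W W) :
    l * n / r ≤ dirEig (region y) * ∑ k, jac y k := by
  have hJ : 0 < ∑ k, jac y k := Finset.sum_pos (fun k _ => F.jac_pos k) Finset.univ_nonempty
  rw [← div_le_iff₀ hJ]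
  refine le_dirEig (isOpen_region y) ⟨0, zero_mem_region y⟩ fun u hu => ?_
  have := H (F.pull hu)
  rw [frm_combination, ← F.mass_eq hu, ← F.energy_eq hu] at this
  refine le_of_mul_le_mul_left ?_ hr
  have e : r * (l * n / r / (∑ k, jac y k) * mass u) = l * n / (∑ k, jac y k) * mass u := by field_simp
  rw [e]; linarith

/-- The value of `dirEig * area` at a centred polygon near the regular one. -/
theorem eventually_le_dirEig (hn : n = 5 ∨ n = 6) :
    ∀ᶠ y in nhds (regY n), Fan n y → dirEig (Fan.region (regY n)) * ∑ k, Fan.jac (regY n) k ≤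
      dirEig (Fan.region y) * ∑ k, Fan.jac y k := by
  have h3 := three_le hn
  obtain ⟨hσ, hρ⟩ := trig_pos h3
  have hr := cot_pos h3
  have hκ : kapN n = (Real.cos (Real.pi / n) / Real.sin (Real.pi / n)) ^ 2 := rfl
  obtain ⟨L, hL, SG⟩ := polygon_specGap hn
  have hN := Cert.polygon_nice hn
  have hM := Cert.polygon_modes hn
  obtain ⟨t1, t2⟩ := Cert.polygon_tn hn
  rw [hκ] at SG hN hM
  set r := Real.cos (Real.pi / n) / Real.sin (Real.pi / n) with hrd
  set Λ := dirEig (Fan.region (regY n)) with hΛ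
  have hl : 0 ≤ Λ * Real.cos (Real.pi / n) ^ 2 := mul_nonneg (dirEig_nonneg _) (sq_nonneg _)
  set l := Λ * Real.cos (Real.pi / n) ^ 2 with hld
  obtain ⟨K, hK⟩ := coeff_estimates h3 hr hl
  obtain ⟨δ, hδ, hloc⟩ := hN.local_nonneg hM (Cert.polygon_sines hn).2.2.2 SG hL K
  obtain ⟨η, hη, hest⟩ := hK δ hδ
  have hd1 := (continuous_dft (n := n) 1).tendsto (regY n)
  rw [dft_one_regY] at hd1
  filter_upwards [hd1.eventually_ne one_ne_zero, (tendsto_size hn r).eventually (gt_mem_nhds hη),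
    (tendsto_size hn r).eventually (gt_mem_nhds hδ),
    (tendsto_size hn r).eventually (gt_mem_nhds (show (0 : ℝ) < 1 / 4 by norm_num))] with y hc hsη hsδ hsq F
  set d := chainAmp n y with hd
  set a := nrml n (Cert.polygon n).s1.val (Cert.polygon n).s2.val d with ha
  set b := tang n d with hb
  set ρ := Real.cos (Real.pi / n) with hρd
  set σ := Real.sin (Real.pi / n) with hσd
  have hfr := chain_frame hn F.sum_zero hc
  have sb : ∑ k, ‖b k‖ ^ 2 = sizeV n (coordV r d) := hM.sum_tang_sq hr t1 t2 d
  have sa : ∑ k, ‖a k‖ ^ 2 ≤ 4 * sizeV n (coordV r d) := hM.sum_nrml_sq hr d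
  have sab : 2 * ∑ k, (a k * b k).re = -(Cert.polygon n).areaV n (coordV r d) := hM.sum_nrml_tang hr d
  have hab : ∀ k, Fan.jac y k = ρ * σ * ‖dft n 1 y‖ ^ 2 * (‖1 + a k‖ ^ 2 - ‖b k‖ ^ 2) ∧
      r * Fan.dirK y k 0 = (1 + ‖b k / (1 + a k)‖ ^ 2 - 2 * (b k / (1 + a k)).re) / (1 - ‖b k / (1 + a k)‖ ^ 2) ∧
      r * Fan.dirK y k 1 = r * (-2 * (b k / (1 + a k)).im / (1 - ‖b k / (1 + a k)‖ ^ 2)) ∧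
      r * Fan.dirK y k 2 = r ^ 2 * ((1 + ‖b k / (1 + a k)‖ ^ 2 + 2 * (b k / (1 + a k)).re) /
        (1 - ‖b k / (1 + a k)‖ ^ 2)) := fun k => by
    have h1 : 1 + a k ≠ 0 := fun h0 => by
      have e : ‖a k‖ = 1 := by rw [eq_neg_of_add_eq_zero_right h0, norm_neg, norm_one]
      have := Finset.single_le_sum (f := fun k => ‖a k‖ ^ 2) (fun _ _ => by positivity) (Finset.mem_univ k)
      simp only [e] at this
      linarith
    obtain ⟨f1, f2⟩ := hfr k
    set w := b k / (1 + a k) with hw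
    have hbw : b k = w * (1 + a k) := by rw [hw]; field_simp
    have hnq : ‖dft n 1 y * (ex n 1 k * circ (Real.pi / n)) * (1 + a k)‖ = ‖dft n 1 y‖ * ‖1 + a k‖ := by
      rw [norm_mul, norm_mul, norm_mul, norm_ex, norm_circ, one_mul, mul_one]
    obtain ⟨g1, g2, g3, g4⟩ := frame_metric (ρ := ρ) (σ := σ) (w := w)
      (q := dft n 1 y * (ex n 1 k * circ (Real.pi / n)) * (1 + a k)) (m := Fan.mid y k) (h := Fan.half y k)
      (by rw [f1]; linear_combination (dft n 1 y * ρ * (ex n 1 k * circ (Real.pi / n))) * hbw)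
      (by rw [f2]; linear_combination (-(dft n 1 y * (Complex.I * σ * (ex n 1 k * circ (Real.pi / n))))) * hbw)
    rw [hnq] at g1 g2 g3 g4
    have hj := F.jac_pos k
    rw [Fan.jac_eq, g1] at hj
    have hN0 : 0 < ‖dft n 1 y‖ * ‖1 + a k‖ := mul_pos (norm_pos_iff.2 hc) (norm_pos_iff.2 h1)
    have hw1 : 0 < 1 - ‖w‖ ^ 2 := (pos_iff_pos_of_mul_pos hj).1 (by positivity)
    refine ⟨?_, ?_, ?_, ?_⟩
    · rw [Fan.jac_eq, g1, hbw, norm_mul]; ring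
    · simp only [Fan.dirK, Matrix.cons_val]
      rw [Fan.jac_eq, g1, g2, hrd]
      generalize ‖dft n 1 y‖ * ‖1 + a k‖ = N at *
      field_simp
    · simp only [Fan.dirK, Matrix.cons_val]
      rw [Fan.jac_eq, g1, g4, hrd]
      generalize ‖dft n 1 y‖ * ‖1 + a k‖ = N at *
      field_simp
    · simp only [Fan.dirK, Matrix.cons_val]
      rw [Fan.jac_eq, g1, g3, hrd]
      generalize ‖dft n 1 y‖ * ‖1 + a k‖ = N at *
      field_simp
  set s := -(l * n / ∑ k, Fan.jac y k) with hsd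
  have hJ : ∑ k, Fan.jac y k = ρ * σ * ‖dft n 1 y‖ ^ 2 * ∑ k, (‖1 + a k‖ ^ 2 - ‖b k‖ ^ 2) := by
    rw [Finset.mul_sum]; exact Finset.sum_congr rfl fun k _ => (hab k).1
  have hJ0 : 0 < ∑ k, Fan.jac y k := Finset.sum_pos (fun k _ => F.jac_pos k) Finset.univ_nonempty
  have hc0 : 0 < ‖dft n 1 y‖ := norm_pos_iff.2 hc
  have hS0 : 0 < ∑ k, (‖1 + a k‖ ^ 2 - ‖b k‖ ^ 2) := by
    rw [hJ] at hJ0; exact (pos_iff_pos_of_mul_pos hJ0).1 (by positivity)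
  obtain ⟨e1, e2, e3, e4, e5⟩ := hest (sizeV n (coordV r d)) a b (r • Fan.dirK y + s • Fan.masK y) hsη sb sa
    (Cert.sum_tang_re hn d) (Cert.sum_nrml_re hn d)
    (fun k => by rw [← (hab k).2.1]; simp [Fan.masK])
    (fun k => by rw [← (hab k).2.2.1]; simp [Fan.masK])
    (fun k => by rw [← (hab k).2.2.2]; simp [Fan.masK])
    (fun k => by
      simp only [Fan.masK, Fan.dirK, Pi.add_apply, Pi.smul_apply, smul_eq_mul, Matrix.cons_val, mul_zero, zero_add]
      rw [hsd, hJ, (hab k).1]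
      field_simp)
  have key : ∀ W : Tup n, 0 ≤ frm (r • Fan.dirK y + s • Fan.masK y) W W := by
    refine hloc (coordV r d) _ hsδ e1 (fun k i => ?_) (by linarith) (by linarith) e5
    have e : Cert.linC (Cert.polygon n) n (r ^ 2) l (coordV r d) k =
        ![-2 * (b k).re, -2 * r * (b k).im, 2 * r ^ 2 * (b k).re, -2 * l * (a k).re] := by
      rw [hb, ha, Cert.tang_re_eq r, Cert.tang_im_eq t1 t2, Cert.nrml_re_eq r, Cert.linC]
      ring_nf
    rw [e]; exact e2 k i
  have := F.eig_of_form_nonneg hr key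
  have e : Λ * ∑ k, Fan.jac (regY n) k = l * n / r := by
    simp_rw [jac_regY]
    rw [Finset.sum_const, Finset.card_univ, Fintype.card_fin, nsmul_eq_mul, hld, hrd]
    field_simp
    rfl
  rw [e]; exact this
end

section
variable {n : ℕ} [NeZero n]

/-- A plane chain translated to have its centroid at the origin. -/
noncomputable def centred (y : Fin n → ℝ × ℝ) (k : Fin n) : ℝ × ℝ := y k - (n : ℝ)⁻¹ • ∑ j, y j

lemma sum_centred (y : Fin n → ℝ × ℝ) : ∑ k, centred y k = 0 := by
  have hn : (n : ℝ) ≠ 0 := by exact_mod_cast NeZero.ne n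
  simp only [centred, Finset.sum_sub_distrib, Finset.sum_const, Finset.card_univ, Fintype.card_fin]
  rw [← Nat.cast_smul_eq_nsmul ℝ, smul_smul, mul_inv_cancel₀ hn, one_smul, sub_self]

omit [NeZero n] in
lemma centred_of_sum_zero {y : Fin n → ℝ × ℝ} (hy : ∑ k, y k = 0) : centred y = y := by
  ext1 k; simp [centred, hy]

/-- Centred chains close to a fan are fans. -/
lemma Fan.eventually {y₀ : Fin n → ℝ × ℝ} (F : Fan n y₀) : ∀ᶠ y in nhds y₀, ∑ k, y k = 0 → Fan n y := by
  have hc : ∀ i j k : Fin n, Continuous fun y : Fin n → ℝ × ℝ => cross (y i) (y j - y k) := fun i j k => by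
    unfold cross; fun_prop
  have hc' : ∀ i j : Fin n, Continuous fun y : Fin n → ℝ × ℝ => cross (y i) (y j) := fun i j => by
    unfold cross; fun_prop
  have h1 : ∀ᶠ y in nhds y₀, ∀ k, 0 < cross (y k) (y (k + 1)) :=
    Filter.eventually_all.2 fun k => (hc' _ _).continuousAt.eventually (lt_mem_nhds (F.pos k))
  have h2 : ∀ᶠ y in nhds y₀, ∀ k j, j ≠ k → j ≠ k + 1 → cross (y j) (y (k + 1) - y k) < cross (y k) (y (k + 1)) := by
    refine Filter.eventually_all.2 fun k => Filter.eventually_all.2 fun j => ?_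
    by_cases hj : j = k
    · exact Filter.Eventually.of_forall fun y h => absurd hj h
    by_cases hj' : j = k + 1
    · exact Filter.Eventually.of_forall fun y _ h => absurd hj' h
    filter_upwards [(hc j (k + 1) k).continuousAt.eventually_lt (hc' k (k + 1)).continuousAt (F.supp k j hj hj')]
      with y hy _ _ using hy
  filter_upwards [h1, h2] with y p q hs using ⟨F.three, hs, p, q⟩
end

/-- The regular `n`-gon is a local minimizer of `λ₁ · area` among `n`-gons for
`n ∈ {5, 6}`: the vertex vector `a*` of the regular `n`-gon inscribed in the unit circle
is a local minimum of the Pólya–Szegő functional seen as a function of the vertices. -/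
theorem regular_ngon_local_minimizer (n : ℕ) (hn : n = 5 ∨ n = 6)
    (astar : Fin n → EuclideanSpace ℝ (Fin 2))
    (hastar : ∀ k : Fin n,
      astar k = ![Real.cos (2 * Real.pi * k / n), Real.sin (2 * Real.pi * k / n)]) :
    ∃ ε > 0, ∀ x : Fin n → EuclideanSpace ℝ (Fin 2),
      ‖x - astar‖ < ε → polyaFunctional astar ≤ polyaFunctional x := by
  have : NeZero n := ⟨by omega⟩
  have F₀ := fan_regY (three_le hn)
  set π : (Fin n → EuclideanSpace ℝ (Fin 2)) → Fin n → ℝ × ℝ := fun x k => (x k 0, x k 1) with hπ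
  have hreg : π astar = regY n := by
    ext1 k
    have h0 := congrFun (hastar k) 0
    have h1 := congrFun (hastar k) 1
    simp only [Matrix.cons_val_zero, Matrix.cons_val_one] at h0 h1
    simp [hπ, regY, h0, h1, cs, sn]
  have hcont : Continuous fun x => centred (π x) := by
    rw [continuous_pi_iff]; intro k
    simp only [centred, hπ]
    fun_prop
  have hc : centred (π astar) = regY n := by rw [hreg, centred_of_sum_zero F₀.sum_zero]
  have ht : Filter.Tendsto (fun x => centred (π x)) (nhds astar) (nhds (regY n)) := hc ▸ hcont.tendsto astar
  have value : ∀ x, Fan n (centred (π x)) →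
      polyaFunctional x = dirEig (Fan.region (centred (π x))) * ∑ k, Fan.jac (centred (π x)) k := fun x hx =>
    polyaFunctional_eq x ((n : ℝ)⁻¹ • ∑ j, π x j) hx
  obtain ⟨ε, hε, H⟩ := Metric.eventually_nhds_iff.1 (ht.eventually (F₀.eventually.and (eventually_le_dirEig hn)))
  refine ⟨ε, hε, fun x hx => ?_⟩
  obtain ⟨h1, h2⟩ := H (y := x) (by rwa [dist_eq_norm])
  have hx := h1 (sum_centred _)
  rw [value x hx, value astar (by rw [hc]; exact F₀), hc]
  exact h2 hx
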